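/- Let F be a totally real number field, n ≥ 2 an integer, and L a positive definite integral O_F-lattice of rank n+1. Then L is globally n-ADC if and only if L is O_F-maximal and has class number one. -/

import Mathlib

/-
Quadratic lattices over (local and global) fields, following
"On n-ADC integral quadratic lattices over totally real number fields".

A non-archimedean local field of characteristic ≠ 2 is formalized as a field `K`
together with a valuation subring `O` of `K` which is a complete discrete valuation
ring with finite residue field (completeness is expressed as adic completeness with
respect to the maximal ideal); `K` is automatically the fraction field of `O`.
-/

noncomputable section

namespace QLat

variable {K : Type} [Field K]

/-- The bilinear form associated to a quadratic form `Q`, i.e. `B x y = (Q(x+y)-Q(x)-Q(y))/2`,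
so that `B x x = Q x`. -/
def bil {V : Type} [AddCommGroup V] [Module K V] (Q : QuadraticForm K V) (x y : V) : K :=
  (2 : K)⁻¹ * QuadraticMap.polar (⇑Q) x y

/-- A quadratic form (space) is nondegenerate. -/
def Nondeg {V : Type} [AddCommGroup V] [Module K V] (Q : QuadraticForm K V) : Prop :=
  ∀ x : V, (∀ y : V, QuadraticMap.polar (⇑Q) x y = 0) → x = 0

/-- The `O`-span of a subset `t` of a `K`-vector space: all finite `O`-linear
combinations of elements of `t`. -/
def ospan (O : Subring K) {V : Type} [AddCommGroup V] [Module K V] (t : Set V) : Set V :=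
  {x | ∃ (m : ℕ) (c : Fin m → K) (g : Fin m → V),
    (∀ i, c i ∈ O) ∧ (∀ i, g i ∈ t) ∧ x = ∑ i, c i • g i}

/-- An `O`-lattice in `V`: a finitely generated `O`-submodule of `V`. -/
def IsLattice (O : Subring K) {V : Type} [AddCommGroup V] [Module K V] (L : Set V) : Prop :=
  ∃ t : Finset V, L = ospan O (t : Set V)

/-- An `O`-lattice on `V`: a finitely generated `O`-submodule of `V` spanning `V` over `K`. -/
def IsLatticeOn (O : Subring K) {V : Type} [AddCommGroup V] [Module K V] (L : Set V) : Prop :=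
  IsLattice O L ∧ Submodule.span K L = ⊤

/-- The lattice `L` is integral: `𝔫(L) ⊆ O`, i.e. all values of `Q` on `L` lie in `O`. -/
def IsIntegral (O : Subring K) {V : Type} [AddCommGroup V] [Module K V]
    (Q : QuadraticForm K V) (L : Set V) : Prop :=
  ∀ x ∈ L, Q x ∈ O

/-- The quadratic space `(V,Q)` represents the quadratic space `(W,Q')`. -/
def SpaceRep {W V : Type} [AddCommGroup W] [Module K W] [AddCommGroup V] [Module K V]
    (Q' : QuadraticForm K W) (Q : QuadraticForm K V) : Prop :=
  ∃ σ : W →ₗ[K] V, Function.Injective σ ∧ ∀ x, Q (σ x) = Q' x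

/-- The quadratic spaces `(W,Q')` and `(V,Q)` are isometric. -/
def SpaceIsom {W V : Type} [AddCommGroup W] [Module K W] [AddCommGroup V] [Module K V]
    (Q' : QuadraticForm K W) (Q : QuadraticForm K V) : Prop :=
  ∃ σ : W ≃ₗ[K] V, ∀ x, Q (σ x) = Q' x

/-- The lattice `M` (in `(V,Q)`) represents the lattice `N` (a full lattice in `(W,Q')`):
there is an injective form-preserving `K`-linear map carrying `N` into `M`.  (For a full
lattice `N` this is equivalent to the existence of an injective form-preserving
`O`-linear map `N → M`, since `K` is the fraction field of `O`.) -/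
def LatRep {W V : Type} [AddCommGroup W] [Module K W] [AddCommGroup V] [Module K V]
    (Q' : QuadraticForm K W) (Q : QuadraticForm K V) (N : Set W) (M : Set V) : Prop :=
  ∃ σ : W →ₗ[K] V, Function.Injective σ ∧ (∀ x, Q (σ x) = Q' x) ∧ σ '' N ⊆ M

/-- The lattices `N` (full in `(W,Q')`) and `M` (in `(V,Q)`) are isometric. -/
def LatIsom {W V : Type} [AddCommGroup W] [Module K W] [AddCommGroup V] [Module K V]
    (Q' : QuadraticForm K W) (Q : QuadraticForm K V) (N : Set W) (M : Set V) : Prop :=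
  ∃ σ : W →ₗ[K] V, Function.Injective σ ∧ (∀ x, Q (σ x) = Q' x) ∧ σ '' N = M

/-- The lattice `L` is `O`-maximal: it is integral and is not properly contained in any
(finitely generated) lattice on the same subspace with integral norm. -/
def IsMaximal (O : Subring K) {V : Type} [AddCommGroup V] [Module K V]
    (Q : QuadraticForm K V) (L : Set V) : Prop :=
  IsIntegral O Q L ∧
    ∀ L' : Set V, IsLattice O L' → Submodule.span K L' = Submodule.span K L →
      L ⊆ L' → IsIntegral O Q L' → L' = L

/-- The lattice `L` is `n`-ADC: every integral `O`-lattice `N` of rank `n` (on a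
nondegenerate quadratic space `W` of dimension `n`) whose ambient space is represented by
the space `(V,Q) = K·L` is represented by `L`. -/
def IsADC (O : Subring K) {V : Type} [AddCommGroup V] [Module K V]
    (Q : QuadraticForm K V) (L : Set V) (n : ℕ) : Prop :=
  ∀ (W : Type) [AddCommGroup W] [Module K W] (Q' : QuadraticForm K W),
    Nondeg Q' → Module.finrank K W = n →
    ∀ N : Set W, IsLatticeOn O N → IsIntegral O Q' N →
      SpaceRep Q' Q → LatRep Q' Q N L

/-- The lattice `L` is `n`-universal: it represents every integral `O`-lattice of rank `n`. -/
def IsUniversal (O : Subring K) {V : Type} [AddCommGroup V] [Module K V]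
    (Q : QuadraticForm K V) (L : Set V) (n : ℕ) : Prop :=
  ∀ (W : Type) [AddCommGroup W] [Module K W] (Q' : QuadraticForm K W),
    Nondeg Q' → Module.finrank K W = n →
    ∀ N : Set W, IsLatticeOn O N → IsIntegral O Q' N → LatRep Q' Q N L

end QLat

open scoped TensorProduct
open IsDedekindDomain

namespace QGlob

/-- Scalar-commutation instance for the completed field, registered to help instance
search for modules over `F_v`. -/
noncomputable instance (F : Type) [Field F] [NumberField F]
    (v : HeightOneSpectrum (NumberField.RingOfIntegers F)) :
    SMulCommClass F (v.adicCompletion F) (v.adicCompletion F) :=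
  Algebra.to_smulCommClass


variable (F : Type) [Field F] [NumberField F]

/-- `F` is totally real: every infinite place of `F` is real. -/
def TotallyReal : Prop := ∀ v : NumberField.InfinitePlace F, v.IsReal

/-- The ring of integers `O_F` of `F`, as a subring of `F`. -/
def OF : Subring F := (integralClosure ℤ F).toSubring

/-- A quadratic form over the totally real field `F` is positive definite if its values
at nonzero vectors are positive under every real embedding of `F`. -/
def PosDef {V : Type} [AddCommGroup V] [Module F V] (Q : QuadraticForm F V) : Prop :=
  ∀ (φ : F →+* ℝ) (x : V), x ≠ 0 → 0 < φ (Q x)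

/-- The completion `F_v` of `F` at a finite place `v`. -/
abbrev Fv (v : HeightOneSpectrum (NumberField.RingOfIntegers F)) : Type :=
  v.adicCompletion F

/-- The ring of integers of `F_v`, as a subring of `F_v`. -/
def Ov (v : HeightOneSpectrum (NumberField.RingOfIntegers F)) : Subring (Fv F v) :=
  (v.adicCompletionIntegers F).toSubring

/-- The completion `V_v = F_v ⊗_F V` of a quadratic space `V` over `F` at `v`. -/
abbrev Vv (V : Type) [AddCommGroup V] [Module F V]
    (v : HeightOneSpectrum (NumberField.RingOfIntegers F)) : Type :=
  (Fv F v) ⊗[F] V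

/-- The extension of a quadratic form `Q` on `V` to `V_v`. -/
noncomputable def Qv {V : Type} [AddCommGroup V] [Module F V] (Q : QuadraticForm F V)
    (v : HeightOneSpectrum (NumberField.RingOfIntegers F)) :
    QuadraticForm (Fv F v) (Vv F V v) :=
  letI : Invertible (2 : F) := invertibleOfNonzero two_ne_zero
  Q.baseChange (Fv F v)

/-- The canonical map `V → V_v`. -/
noncomputable def toVv {V : Type} [AddCommGroup V] [Module F V]
    (v : HeightOneSpectrum (NumberField.RingOfIntegers F)) : V → Vv F V v :=
  fun x => (1 : Fv F v) ⊗ₜ[F] x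

/-- The completion `L_v = O_{F_v} ⊗ L` of a lattice `L ⊆ V` at `v`, i.e. the
`O_{F_v}`-span of the image of `L` in `V_v`. -/
noncomputable def Lv {V : Type} [AddCommGroup V] [Module F V] (L : Set V)
    (v : HeightOneSpectrum (NumberField.RingOfIntegers F)) : Set (Vv F V v) :=
  QLat.ospan (Ov F v) (toVv F v '' L)

variable {V : Type} [AddCommGroup V] [Module F V]

/-- `L` is globally `n`-ADC: every positive definite integral `O_F`-lattice `N` of rank
`n` whose ambient space `F·N` is represented by `F·L` is represented by `L`. -/
def IsGlobADC (Q : QuadraticForm F V) (L : Set V) (n : ℕ) : Prop :=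
  ∀ (W : Type) [AddCommGroup W] [Module F W] (Q' : QuadraticForm F W),
    QLat.Nondeg Q' → PosDef F Q' → Module.finrank F W = n →
    ∀ N : Set W, QLat.IsLatticeOn (OF F) N → QLat.IsIntegral (OF F) Q' N →
      QLat.SpaceRep Q' Q → QLat.LatRep Q' Q N L

/-- `L` is globally `n`-universal: it represents every positive definite integral
`O_F`-lattice of rank `n`. -/
def IsGlobUniversal (Q : QuadraticForm F V) (L : Set V) (n : ℕ) : Prop :=
  ∀ (W : Type) [AddCommGroup W] [Module F W] (Q' : QuadraticForm F W),
    QLat.Nondeg Q' → PosDef F Q' → Module.finrank F W = n →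
    ∀ N : Set W, QLat.IsLatticeOn (OF F) N → QLat.IsIntegral (OF F) Q' N →
      QLat.LatRep Q' Q N L

/-- `L` is `n`-regular: it represents every positive definite integral `O_F`-lattice `N`
of rank `n` which is represented by `L` locally at every finite place. -/
def IsNRegular (Q : QuadraticForm F V) (L : Set V) (n : ℕ) : Prop :=
  ∀ (W : Type) [AddCommGroup W] [Module F W] (Q' : QuadraticForm F W),
    QLat.Nondeg Q' → PosDef F Q' → Module.finrank F W = n →
    ∀ N : Set W, QLat.IsLatticeOn (OF F) N → QLat.IsIntegral (OF F) Q' N →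
      (∀ v : HeightOneSpectrum (NumberField.RingOfIntegers F),
        QLat.LatRep (Qv F Q' v) (Qv F Q v) (Lv F N v) (Lv F L v)) →
      QLat.LatRep Q' Q N L

/-- `L` is locally `n`-ADC: `L_v` is `n`-ADC for every finite place `v`. -/
def IsLocADC (Q : QuadraticForm F V) (L : Set V) (n : ℕ) : Prop :=
  ∀ v : HeightOneSpectrum (NumberField.RingOfIntegers F),
    QLat.IsADC (Ov F v) (Qv F Q v) (Lv F L v) n

/-- `L` is locally `n`-universal: `L_v` is `n`-universal for every finite place `v`. -/
def IsLocUniversal (Q : QuadraticForm F V) (L : Set V) (n : ℕ) : Prop :=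
  ∀ v : HeightOneSpectrum (NumberField.RingOfIntegers F),
    QLat.IsUniversal (Ov F v) (Qv F Q v) (Lv F L v) n

/-- `L` has class number one: every `O_F`-lattice in the genus of `L` (i.e. every lattice
on a space isometric to `F·L` which is isometric to `L` at every finite place) is
isometric to `L`. -/
def ClassNumberOne (Q : QuadraticForm F V) (L : Set V) : Prop :=
  ∀ (W : Type) [AddCommGroup W] [Module F W] (Q' : QuadraticForm F W),
    QLat.Nondeg Q' →
    ∀ N : Set W, QLat.IsLatticeOn (OF F) N →
      QLat.SpaceIsom Q' Q →
      (∀ v : HeightOneSpectrum (NumberField.RingOfIntegers F),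
        QLat.LatIsom (Qv F Q' v) (Qv F Q v) (Lv F N v) (Lv F L v)) →
      QLat.LatIsom Q' Q N L

end QGlob

open QLat QGlob

/-! ### Helper material, part A1 -/

/-! ## Part A1: arithmetic functions attached to a normed factorial monoid -/
namespace PT

section arith
open Classical

/-- A monoid of ideals with a norm. -/
structure NormMon (I : Type) [CommMonoidWithZero I] [UniqueFactorizationMonoid I] where
  N : I →*₀ ℕ
  N0 : ∀ x, N x = 0 → x = 0
  N1 : ∀ x, N x = 1 → x = 1
  fin : ∀ n, {x | N x = n}.Finite

variable {I : Type} [CommMonoidWithZero I] [UniqueFactorizationMonoid I] (D : NormMon I)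

def NormMon.fib (n : ℕ) : Finset I := (D.fin n).toFinset

lemma NormMon.mem_fib {n : ℕ} {x : I} : x ∈ D.fib n ↔ D.N x = n := by
  simp [NormMon.fib]

lemma NormMon.N_one : D.N 1 = 1 := map_one _

/-- sum over fibres -/
def NormMon.S {R : Type} [CommRing R] (g : I → R) : ArithmeticFunction R :=
  ⟨fun n => if n = 0 then 0 else ∑ x ∈ D.fib n, g x, by simp⟩

lemma NormMon.S_apply {R : Type} [CommRing R] (g : I → R) {n : ℕ} (hn : n ≠ 0) :
    D.S g n = ∑ x ∈ D.fib n, g x := by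
  show (if n = 0 then 0 else ∑ x ∈ D.fib n, g x) = _
  simp [hn]

lemma NormMon.eq_one_of_mul (D : NormMon I) {x y : I} (h : x * y = 1) : x = 1 := by
  apply D.N1
  have := congrArg D.N h
  rw [map_mul, map_one] at this
  exact Nat.eq_one_of_mul_eq_one_right this

lemma NormMon.eq_of_associated (D : NormMon I) {x y : I} (h : Associated x y) : x = y := by
  obtain ⟨u, rfl⟩ := h
  rw [D.eq_one_of_mul u.mul_inv, mul_one]

/-- divisors of a nonzero element -/
def NormMon.dv (x : I) : Finset I :=
  ((Finset.range (D.N x + 1)).biUnion D.fib).filter (fun y => y ∣ x)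

lemma NormMon.mem_dv {x y : I} (hx : x ≠ 0) : y ∈ D.dv x ↔ y ∣ x := by
  simp only [NormMon.dv, Finset.mem_filter, Finset.mem_biUnion, D.mem_fib, Finset.mem_range]
  constructor
  · exact fun h => h.2
  · intro h
    refine ⟨⟨_, ?_, rfl⟩, h⟩
    have h2 : D.N y ∣ D.N x := map_dvd _ h
    have h3 : D.N x ≠ 0 := fun h => hx (D.N0 _ h)
    exact Nat.lt_succ_of_le (Nat.le_of_dvd (Nat.pos_of_ne_zero h3) h2)

/-- von Mangoldt function -/
def NormMon.lam (x : I) : ℝ :=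
  if h : IsPrimePow x then Real.log (D.N h.choose) else 0

lemma NormMon.lam_pow {p : I} (hp : Prime p) {k : ℕ} (hk : 0 < k) :
    D.lam (p ^ k) = Real.log (D.N p) := by
  have h : IsPrimePow (p ^ k) := ⟨p, k, hp, hk, rfl⟩
  rw [NormMon.lam, dif_pos h]
  obtain ⟨l, hq, hl, he⟩ := h.choose_spec
  have : p ∣ h.choose := by
    apply hp.dvd_of_dvd_pow (n := l)
    rw [he]
    exact dvd_pow_self _ hk.ne'
  exact congrArg (fun y => Real.log (D.N y))
    (D.eq_of_associated (hp.associated_of_dvd hq this)).symm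

lemma NormMon.lam_zero {x : I} (h : ¬ IsPrimePow x) : D.lam x = 0 := by
  rw [NormMon.lam, dif_neg h]

lemma NormMon.two_le {p : I} (hp : Prime p) : 2 ≤ D.N p := by
  have h0 : D.N p ≠ 0 := fun h => hp.ne_zero (D.N0 _ h)
  have h1 : D.N p ≠ 1 := fun h => hp.ne_one (D.N1 _ h)
  omega

lemma NormMon.lam_nonneg (x : I) : 0 ≤ D.lam x := by
  unfold NormMon.lam
  split_ifs
  · exact Real.log_natCast_nonneg _
  · exact le_rfl

lemma NormMon.sum_lam_step {p x : I} (hp : Prime p) (hx : x ≠ 0) :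
    ∑ y ∈ D.dv (p * x), D.lam y = ∑ y ∈ D.dv x, D.lam y + Real.log (D.N p) := by
  have hpx : p * x ≠ 0 := mul_ne_zero hp.ne_zero hx
  -- multiplicity
  have hex : ∃ e, ¬ p ^ (e + 1) ∣ x := by
    refine ⟨D.N x, fun h => ?_⟩
    have h2 : D.N p ^ (D.N x + 1) ∣ D.N x := by
      rw [← map_pow]; exact map_dvd _ h
    have h3 : D.N x ≠ 0 := fun h => hx (D.N0 _ h)
    have h4 := Nat.le_of_dvd (Nat.pos_of_ne_zero h3) h2
    have h5 : D.N x + 1 < D.N p ^ (D.N x + 1) := Nat.lt_pow_self (D.two_le hp)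
    omega
  set e := Nat.find hex with he
  have he1 : ¬ p ^ (e + 1) ∣ x := Nat.find_spec hex
  have he2 : p ^ e ∣ x := by
    rcases Nat.eq_zero_or_pos e with h | h
    · rw [h]; simp
    · have := Nat.find_min hex (m := e - 1) (by omega)
      rwa [not_not, Nat.sub_add_cancel h] at this
  have hsub : insert (p ^ (e + 1)) (D.dv x) ⊆ D.dv (p * x) := by
    intro y hy
    rw [Finset.mem_insert, D.mem_dv hx] at hy
    rw [D.mem_dv hpx]
    rcases hy with rfl | hy
    · rw [pow_succ']; exact mul_dvd_mul_left _ he2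
    · exact hy.mul_left _
  have hni : p ^ (e + 1) ∉ D.dv x := by rwa [D.mem_dv hx]
  rw [← Finset.sum_subset hsub, Finset.sum_insert hni, D.lam_pow hp (Nat.succ_pos e), add_comm]
  intro y hy hy'
  rw [Finset.mem_insert, D.mem_dv hx, not_or] at hy'
  rw [D.mem_dv hpx] at hy
  apply D.lam_zero
  rintro ⟨q, k, hq, hk, rfl⟩
  by_cases hqp : q = p
  · subst hqp
    obtain ⟨k, rfl⟩ : ∃ j, k = j + 1 := ⟨k - 1, by omega⟩
    rw [pow_succ', mul_dvd_mul_iff_left hq.ne_zero] at hy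
    have h1 : e < k + 1 := by
      by_contra h
      exact hy'.2 ((pow_dvd_pow _ (by omega)).trans he2)
    have h2 : k < e + 1 := by
      by_contra h
      exact he1 ((pow_dvd_pow _ (by omega)).trans hy)
    exact hy'.1 (by rw [show k = e by omega])
  · apply hy'.2
    apply hq.pow_dvd_of_dvd_mul_left k _ hy
    intro h
    exact hqp (D.eq_of_associated (hq.associated_of_dvd hp h))

lemma NormMon.sum_lam {x : I} (hx : x ≠ 0) :
    ∑ y ∈ D.dv x, D.lam y = Real.log (D.N x) := by
  revert hx
  refine UniqueFactorizationMonoid.induction_on_prime x (fun h => (h rfl).elim) ?_ ?_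
  · intro u hu hu0
    have : u = 1 := by
      obtain ⟨v, rfl⟩ := hu
      exact D.eq_one_of_mul v.mul_inv
    subst this
    rw [map_one, Nat.cast_one, Real.log_one]
    apply Finset.sum_eq_zero
    intro y hy
    rw [D.mem_dv hu0] at hy
    obtain ⟨z, hz⟩ := hy
    rw [D.eq_one_of_mul hz.symm]
    exact D.lam_zero not_isPrimePow_one
  · intro a p ha hp ih _
    rw [D.sum_lam_step hp ha, ih ha, map_mul, Nat.cast_mul, Real.log_mul, add_comm]
    · exact_mod_cast fun h => hp.ne_zero (D.N0 _ h)
    · exact_mod_cast fun h => ha (D.N0 _ h)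

/-- Convolution identity. -/
lemma NormMon.S_mul {R : Type} [CommRing R] (g h : I → R) :
    D.S g * D.S h = D.S (fun x => ∑ y ∈ D.dv x, if hy : y ∣ x then g hy.choose * h y else 0) := by
  ext n
  rcases eq_or_ne n 0 with rfl | hn
  · simp
  rw [ArithmeticFunction.mul_apply, D.S_apply _ hn]
  have h1 : ∀ ab ∈ n.divisorsAntidiagonal, D.S g ab.1 * D.S h ab.2 =
      ∑ xy ∈ D.fib ab.1 ×ˢ D.fib ab.2, g xy.1 * h xy.2 := by
    intro ab hab
    rw [Nat.mem_divisorsAntidiagonal] at hab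
    rw [D.S_apply g (fun h => hab.2 (by rw [← hab.1, h, zero_mul])),
      D.S_apply h (fun h => hab.2 (by rw [← hab.1, h, mul_zero])), Finset.sum_mul_sum,
      Finset.sum_product]
  rw [Finset.sum_congr rfl h1, Finset.sum_sigma', Finset.sum_sigma']
  have hfne : ∀ x ∈ D.fib n, x ≠ 0 := by
    intro x hx h0
    rw [D.mem_fib, h0, _root_.map_zero] at hx
    exact hn hx.symm
  have hcan : ∀ x y z : I, x ≠ 0 → x = y * z → ∀ hy : y ∣ x, hy.choose = z := by
    intro x y z hx he hy
    have h2 := hy.choose_spec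
    have hy0 : y ≠ 0 := by rintro rfl; rw [zero_mul] at he; exact hx he
    exact mul_left_cancel₀ hy0 (h2.symm.trans he)
  refine Finset.sum_bij' (fun s _ => ⟨s.2.1 * s.2.2, s.2.2⟩)
    (fun t _ => if hy : t.2 ∣ t.1 then ⟨(D.N hy.choose, D.N t.2), (hy.choose, t.2)⟩ else
      ⟨(0, 0), (0, 0)⟩) ?_ ?_ ?_ ?_ ?_
  · rintro ⟨⟨a, b⟩, ⟨x, y⟩⟩ hs
    simp only [Finset.mem_sigma, Nat.mem_divisorsAntidiagonal, Finset.mem_product, D.mem_fib] at hs ⊢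
    have hxy : D.N (x * y) = n := by rw [map_mul, hs.2.1, hs.2.2, hs.1.1]
    refine ⟨hxy, ?_⟩
    rw [D.mem_dv (hfne _ (D.mem_fib.2 hxy))]
    exact dvd_mul_left _ _
  · rintro ⟨x, y⟩ hs
    simp only [Finset.mem_sigma] at hs
    have hx := hfne _ hs.1
    rw [D.mem_dv hx] at hs
    simp only [hs.2, dif_pos, Finset.mem_sigma, Nat.mem_divisorsAntidiagonal, Finset.mem_product,
      D.mem_fib, and_self, and_true]
    refine ⟨?_, hn⟩
    rw [← map_mul, mul_comm, ← hs.2.choose_spec]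
    exact D.mem_fib.1 hs.1
  · rintro ⟨⟨a, b⟩, ⟨x, y⟩⟩ hs
    simp only [Finset.mem_sigma, Nat.mem_divisorsAntidiagonal, Finset.mem_product, D.mem_fib] at hs
    have hxy : D.N (x * y) = n := by rw [map_mul, hs.2.1, hs.2.2, hs.1.1]
    have hd : y ∣ x * y := dvd_mul_left _ _
    simp only [hd, dif_pos]
    rw [hcan (x * y) y x (hfne _ (D.mem_fib.2 hxy)) (mul_comm _ _) hd, hs.2.1, hs.2.2]
  · rintro ⟨x, y⟩ hs
    simp only [Finset.mem_sigma] at hs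
    have hx := hfne _ hs.1
    rw [D.mem_dv hx] at hs
    simp only [hs.2, dif_pos]
    congr 1
    rw [mul_comm, ← hs.2.choose_spec]
  · rintro ⟨⟨a, b⟩, ⟨x, y⟩⟩ hs
    simp only [Finset.mem_sigma, Nat.mem_divisorsAntidiagonal, Finset.mem_product, D.mem_fib] at hs
    have hxy : D.N (x * y) = n := by rw [map_mul, hs.2.1, hs.2.2, hs.1.1]
    have hd : y ∣ x * y := dvd_mul_left _ _
    simp only [hd, dif_pos]
    rw [hcan (x * y) y x (hfne _ (D.mem_fib.2 hxy)) (mul_comm _ _) hd]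

/-- log as derivation -/
def mlog (f : ArithmeticFunction ℂ) : ArithmeticFunction ℂ :=
  ⟨fun n => f n * (Real.log n : ℂ), by simp⟩

lemma mlog_apply (f : ArithmeticFunction ℂ) (n : ℕ) : mlog f n = f n * (Real.log n : ℂ) := rfl

lemma mlog_mul (f g : ArithmeticFunction ℂ) : mlog (f * g) = mlog f * g + f * mlog g := by
  ext n
  rw [mlog_apply, ArithmeticFunction.add_apply, ArithmeticFunction.mul_apply,
    ArithmeticFunction.mul_apply, ArithmeticFunction.mul_apply, Finset.sum_mul,
    ← Finset.sum_add_distrib]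
  refine Finset.sum_congr rfl fun ab hab => ?_
  rw [Nat.mem_divisorsAntidiagonal] at hab
  have h1 : ab.1 ≠ 0 := (fun h => hab.2 (by rw [← hab.1, h, zero_mul]))
  have h2 : ab.2 ≠ 0 := (fun h => hab.2 (by rw [← hab.1, h, mul_zero]))
  rw [mlog_apply, mlog_apply, ← hab.1, Nat.cast_mul, Real.log_mul (by exact_mod_cast h1)
    (by exact_mod_cast h2)]
  push_cast
  ring

/-- The coefficient functions of the `L`-series of `ψ`. -/
def NormMon.a (ψ : I →*₀ ℂ) : ArithmeticFunction ℂ := D.S ψ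

def NormMon.Lam (ψ : I →*₀ ℂ) : ArithmeticFunction ℂ := D.S (fun x => ψ x * (D.lam x : ℂ))

lemma NormMon.mlog_a (ψ : I →*₀ ℂ) :
    mlog (D.a ψ) = D.a ψ * D.Lam ψ := by
  rw [NormMon.a, NormMon.Lam, D.S_mul]
  ext n
  rcases eq_or_ne n 0 with rfl | hn
  · simp
  rw [mlog_apply, D.S_apply _ hn, D.S_apply _ hn, Finset.sum_mul]
  refine Finset.sum_congr rfl fun x hx => ?_
  rw [D.mem_fib] at hx
  have hx0 : x ≠ 0 := by rintro rfl; rw [_root_.map_zero] at hx; exact hn hx.symm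
  rw [← hx, ← D.sum_lam hx0, Complex.ofReal_sum, Finset.mul_sum]
  refine Finset.sum_congr rfl fun y hy => ?_
  rw [D.mem_dv hx0] at hy
  rw [dif_pos hy, ← mul_assoc, ← map_mul, mul_comm _ y, ← hy.choose_spec]

end arith
end PT

/-! ### Helper material, part A2 -/

/-! ## Part A2: smoothed sums and their convolutions -/
namespace PT

section smooth
open Classical MeasureTheory

structure Wt (V : ℝ → ℝ) (c : ℝ) : Prop where
  cont : Continuous V
  nonneg : ∀ t, 0 ≤ V t
  supp : ∀ t, V t ≠ 0 → 0 ≤ t ∧ t ≤ c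
  pos : 0 < V (c / 2)

lemma Wt.zero_lt {V : ℝ → ℝ} {c : ℝ} (h : Wt V c) {t : ℝ} (ht : t < 0) : V t = 0 := by
  by_contra h0
  exact absurd (h.supp t h0).1 (not_le.2 ht)

lemma Wt.zero_gt {V : ℝ → ℝ} {c : ℝ} (h : Wt V c) {t : ℝ} (ht : c < t) : V t = 0 := by
  by_contra h0
  exact absurd (h.supp t h0).2 (not_le.2 ht)

lemma Wt.hcs {V : ℝ → ℝ} {c : ℝ} (h : Wt V c) : HasCompactSupport V :=
  HasCompactSupport.intro (isCompact_Icc (a := 0) (b := c)) fun t ht => by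
    by_contra h0
    exact ht (h.supp t h0)

/-- smoothed sum -/
def al (V : ℝ → ℝ) (a : ℕ → ℂ) (x : ℝ) : ℂ := ∑' n : ℕ, a n * (V (Real.log n - x) : ℂ)

lemma Wt.term_zero {V : ℝ → ℝ} {c : ℝ} (h : Wt V c) {x : ℝ} {n : ℕ}
    (hn : Real.exp (x + c) < n) : V (Real.log n - x) = 0 := by
  apply h.zero_gt
  have h1 : (0 : ℝ) < n := (Real.exp_pos _).trans hn
  have := (Real.lt_log_iff_exp_lt h1).2 hn
  linarith

lemma al_eq {V : ℝ → ℝ} {c : ℝ} (h : Wt V c) (a : ℕ → ℂ) {x : ℝ} {M : ℕ}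
    (hM : Real.exp (x + c) < M) : al V a x = ∑ n ∈ Finset.range M, a n * (V (Real.log n - x) : ℂ) := by
  apply tsum_eq_sum
  intro n hn
  rw [Finset.mem_range, not_lt] at hn
  rw [h.term_zero (hM.trans_le (by exact_mod_cast hn))]
  simp

lemma al_zero {V : ℝ → ℝ} {c : ℝ} (h : Wt V c) (a : ℕ → ℂ) (h0 : a 0 = 0) {x : ℝ} (hx : x < -c) :
    al V a x = 0 := by
  unfold al
  convert tsum_zero with n
  rcases Nat.eq_zero_or_pos n with rfl | hn
  · simp [h0]
  · rw [h.zero_gt]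
    · simp
    · have : 0 ≤ Real.log n := Real.log_natCast_nonneg n
      linarith

lemma al_cont {V : ℝ → ℝ} {c : ℝ} (h : Wt V c) (a : ℕ → ℂ) : Continuous (al V a) := by
  rw [continuous_iff_continuousAt]
  intro x
  obtain ⟨M, hM⟩ := exists_nat_gt (Real.exp (x + 1 + c))
  have : (fun y => ∑ n ∈ Finset.range M, a n * (V (Real.log n - y) : ℂ)) =ᶠ[nhds x] al V a := by
    filter_upwards [Iio_mem_nhds (show x < x + 1 by linarith)] with y hy
    refine (al_eq h a (lt_trans (Real.exp_lt_exp.2 ?_) hM)).symm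
    have : y < x + 1 := hy
    linarith
  refine ContinuousAt.congr ?_ this
  have hc := h.cont
  apply Continuous.continuousAt
  fun_prop

/-- convolution of weights -/
def cw (V : ℝ → ℝ) (t : ℝ) : ℝ := ∫ s, V s * V (t - s)

lemma Wt.cw {V : ℝ → ℝ} {c : ℝ} (h : Wt V c) : Wt (cw V) (2 * c) where
  cont := by
    have := HasCompactSupport.continuous_convolution_right (μ := volume)
      (ContinuousLinearMap.mul ℝ ℝ) (f := V) h.hcs
      (h.cont.locallyIntegrable) h.cont
    exact this
  nonneg t := integral_nonneg fun s => mul_nonneg (h.nonneg _) (h.nonneg _)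
  supp t ht := by
    by_contra hcon
    apply ht
    unfold PT.cw
    convert integral_zero ℝ ℝ with s
    by_contra h0
    rw [mul_eq_zero, not_or] at h0
    have h1 := h.supp _ h0.1
    have h2 := h.supp _ h0.2
    exact hcon ⟨by linarith [h1.1, h2.1], by linarith [h1.2, h2.2]⟩
  pos := by
    have hc := h.cont
    have := Continuous.integral_pos_of_hasCompactSupport_nonneg_nonzero (μ := volume)
      (f := fun s => V s * V (2 * c / 2 - s)) (x := c / 2) (by fun_prop)
      (h.hcs.mul_right) (fun s => mul_nonneg (h.nonneg _) (h.nonneg _))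
      (by
        have : (2 * c / 2 - c / 2) = c / 2 := by ring
        rw [this]
        exact (mul_pos h.pos h.pos).ne')
    exact this

lemma Wt.cw_shift {V : ℝ → ℝ} (p q x : ℝ) :
    ∫ s, V (p - s) * V (q - (x - s)) = PT.cw V (p + q - x) := by
  unfold PT.cw
  rw [← integral_sub_left_eq_self (fun s => V s * V (p + q - x - s)) volume p]
  congr 1
  ext s
  congr 2
  ring

lemma sum_conv (f g : ArithmeticFunction ℂ) (F : ℕ → ℂ) (M : ℕ) (hF : ∀ k, M ≤ k → F k = 0) :
    ∑ n ∈ Finset.range M, ∑ m ∈ Finset.range M, f n * g m * F (n * m) =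
      ∑ k ∈ Finset.range M, (f * g) k * F k := by
  have h1 : ∀ k ∈ Finset.range M, (f * g) k * F k =
      ∑ p ∈ k.divisorsAntidiagonal, f p.1 * g p.2 * F (p.1 * p.2) := by
    intro k _
    rw [ArithmeticFunction.mul_apply, Finset.sum_mul]
    refine Finset.sum_congr rfl fun p hp => ?_
    rw [(Nat.mem_divisorsAntidiagonal.1 hp).1]
  rw [Finset.sum_congr rfl h1, ← Finset.sum_product', Finset.sum_sigma']
  symm
  refine Finset.sum_bij_ne_zero (fun s _ _ => s.2) ?_ ?_ ?_ ?_
  · rintro ⟨k, n, m⟩ hs _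
    simp only [Finset.mem_sigma, Finset.mem_range, Nat.mem_divisorsAntidiagonal] at hs
    simp only [Finset.mem_product, Finset.mem_range]
    obtain ⟨h1, h2, h3⟩ := hs
    subst h2
    have hn : n ≠ 0 := fun h => h3 (by rw [h, zero_mul])
    have hm : m ≠ 0 := fun h => h3 (by rw [h, mul_zero])
    exact ⟨(Nat.le_mul_of_pos_right n (Nat.pos_of_ne_zero hm)).trans_lt h1,
      (Nat.le_mul_of_pos_left m (Nat.pos_of_ne_zero hn)).trans_lt h1⟩
  · rintro ⟨k, n, m⟩ hs _ ⟨k', n', m'⟩ hs' _ he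
    simp only [Finset.mem_sigma, Finset.mem_range, Nat.mem_divisorsAntidiagonal] at hs hs'
    simp only [Prod.mk.injEq] at he
    obtain ⟨rfl, rfl⟩ := he
    rw [← hs.2.1, ← hs'.2.1]
  · rintro ⟨n, m⟩ hs h0
    refine ⟨⟨n * m, n, m⟩, ?_, h0, rfl⟩
    simp only [Finset.mem_sigma, Finset.mem_range, Nat.mem_divisorsAntidiagonal, true_and]
    constructor
    · by_contra h
      exact h0 (by simp only [hF _ (not_lt.1 h), mul_zero])
    · intro h
      rcases mul_eq_zero.1 h with h | h <;> exact h0 (by simp [h])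
  · intros; rfl

lemma al_conv {V : ℝ → ℝ} {c : ℝ} (h : Wt V c) (f g : ArithmeticFunction ℂ) (x : ℝ) :
    ∫ s, al V f s * al V g (x - s) = al (cw V) (⇑(f * g)) x := by
  obtain ⟨M, hM⟩ := exists_nat_gt (Real.exp (x + 2 * c))
  have hMp : ∀ k : ℕ, M ≤ k → cw V (Real.log k - x) = 0 := fun k hk =>
    h.cw.term_zero (hM.trans_le (by exact_mod_cast hk))
  rw [al_eq h.cw _ hM, ← sum_conv f g (fun k => (cw V (Real.log k - x) : ℂ)) M
    (fun k hk => by simp [hMp k hk])]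
  have h1 : ∀ s, al V f s * al V g (x - s) =
      ∑ n ∈ Finset.range M, ∑ m ∈ Finset.range M, (f n * g m) *
        ((V (Real.log n - s) * V (Real.log m - (x - s)) : ℝ) : ℂ) := by
    intro s
    have key : ∀ s, (al V f s * al V g (x - s) ≠ 0 → s ≤ x + c ∧ -c ≤ s) := by
      intro s hs
      rw [mul_ne_zero_iff] at hs
      constructor
      · by_contra hcon
        exact hs.2 (al_zero h _ (by simp) (by linarith))
      · by_contra hcon
        exact hs.1 (al_zero h _ (by simp) (by linarith))
    have hr : ∑ n ∈ Finset.range M, ∑ m ∈ Finset.range M, (f n * g m) *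
        ((V (Real.log n - s) * V (Real.log m - (x - s)) : ℝ) : ℂ) =
        (∑ n ∈ Finset.range M, f n * (V (Real.log n - s) : ℂ)) *
        (∑ m ∈ Finset.range M, g m * (V (Real.log m - (x - s)) : ℂ)) := by
      rw [Finset.sum_mul_sum]
      refine Finset.sum_congr rfl fun n _ => Finset.sum_congr rfl fun m _ => ?_
      push_cast
      ring
    rw [hr]
    by_cases hs : s ≤ x + c ∧ -c ≤ s
    · rw [al_eq h f (M := M), al_eq h g (M := M)]
      · exact lt_of_le_of_lt (Real.exp_le_exp.2 (by linarith [hs.2])) hM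
      · exact lt_of_le_of_lt (Real.exp_le_exp.2 (by linarith [hs.1])) hM
    · rw [not_and_or] at hs
      have h0 := (not_imp_comm.1 (key s)) (by tauto)
      rw [h0]
      symm
      rw [mul_eq_zero]
      rcases hs with hs | hs
      · right
        apply Finset.sum_eq_zero
        intro m _
        rcases Nat.eq_zero_or_pos m with rfl | hm
        · simp
        · rw [h.zero_gt]
          · simp
          · have : 0 ≤ Real.log m := Real.log_natCast_nonneg m
            linarith
      · left
        apply Finset.sum_eq_zero
        intro m _
        rcases Nat.eq_zero_or_pos m with rfl | hm
        · simp
        · rw [h.zero_gt]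
          · simp
          · have : 0 ≤ Real.log m := Real.log_natCast_nonneg m
            linarith
  simp_rw [h1]
  have hcV := h.cont
  have hintg : ∀ n m : ℕ, Integrable (fun s => (f n * g m) *
        ((V (Real.log n - s) * V (Real.log m - (x - s)) : ℝ) : ℂ)) := by
    intro n m
    apply Integrable.const_mul
    have h2 : Integrable (fun s => V (Real.log n - s) * V (Real.log m - (x - s))) := by
      refine Continuous.integrable_of_hasCompactSupport (by fun_prop) ?_
      apply HasCompactSupport.mul_right
      exact h.hcs.comp_homeomorph (Homeomorph.subLeft (Real.log n))
    exact h2.ofReal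
  rw [integral_finsetSum _ (fun n _ => integrable_finsetSum _ fun m _ => hintg n m)]
  refine Finset.sum_congr rfl fun n _ => ?_
  rw [integral_finsetSum _ (fun m _ => hintg n m)]
  refine Finset.sum_congr rfl fun m _ => ?_
  rw [integral_const_mul, integral_complex_ofReal, Wt.cw_shift]
  rcases Nat.eq_zero_or_pos n with rfl | hn
  · simp
  rcases Nat.eq_zero_or_pos m with rfl | hm
  · simp
  rw [Nat.cast_mul, Real.log_mul (by positivity) (by positivity)]

lemma integrable_exp_abs {c : ℝ} (hc : 0 < c) : Integrable (fun s : ℝ => Real.exp (-c * |s|)) := by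
  rw [← integrableOn_univ, ← Set.Iic_union_Ioi (a := (0 : ℝ)), integrableOn_union]
  constructor
  · refine (integrableOn_exp_mul_Iic hc 0).congr_fun ?_ measurableSet_Iic
    intro s hs
    simp only [abs_of_nonpos (show s ≤ 0 from hs)]
    ring_nf
  · refine (integrableOn_exp_mul_Ioi (neg_lt_zero.2 hc) 0).congr_fun ?_ measurableSet_Ioi
    intro s hs
    simp only [abs_of_pos (show 0 < s from hs)]

lemma conv_decay {f g : ℝ → ℂ} {A B c : ℝ} (hc : 0 < c)
    (hf : ∀ s, ‖f s‖ ≤ A * Real.exp (-c * |s|)) (hg : ∀ s, ‖g s‖ ≤ B * Real.exp (-c * |s|)) :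
    ∃ C, ∀ x, ‖∫ s, f s * g (x - s)‖ ≤ C * Real.exp (-(c / 2) * |x|) := by
  have hA : 0 ≤ A := by
    have := (norm_nonneg _).trans (hf 0)
    simpa using this
  have hB : 0 ≤ B := by
    have := (norm_nonneg _).trans (hg 0)
    simpa using this
  refine ⟨A * B * ∫ s : ℝ, Real.exp (-(c / 2) * |s|), fun x => ?_⟩
  have : ‖∫ s, f s * g (x - s)‖ ≤
      ∫ s : ℝ, A * B * Real.exp (-(c / 2) * |x|) * Real.exp (-(c / 2) * |s|) := by
    apply norm_integral_le_of_norm_le ((integrable_exp_abs (half_pos hc)).const_mul _)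
    refine Filter.Eventually.of_forall fun s => ?_
    rw [norm_mul]
    calc ‖f s‖ * ‖g (x - s)‖ ≤ (A * Real.exp (-c * |s|)) * (B * Real.exp (-c * |x - s|)) :=
          mul_le_mul (hf s) (hg _) (norm_nonneg _) (mul_nonneg hA (Real.exp_pos _).le)
      _ = A * B * Real.exp (-c * |s| + -c * |x - s|) := by rw [Real.exp_add]; ring
      _ ≤ A * B * Real.exp (-(c / 2) * |x| + -(c / 2) * |s|) := by
          apply mul_le_mul_of_nonneg_left _ (mul_nonneg hA hB)
          apply Real.exp_le_exp.2
          have h1 : |x| ≤ |s| + |x - s| := by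
            have := abs_add_le s (x - s)
            rwa [add_sub_cancel] at this
          have h2 := abs_nonneg (x - s)
          nlinarith
      _ = _ := by rw [Real.exp_add]; ring
  rw [integral_const_mul] at this
  linarith

end smooth
end PT

/-! ### Helper material, part A3 -/

/-! ## Part A3: non-vanishing at `1` -/
namespace PT

section nonvan
open Classical MeasureTheory
open scoped ComplexOrder

variable {I : Type} [CommMonoidWithZero I] [UniqueFactorizationMonoid I] (D : NormMon I)

/-- complex conjugate character -/
def cj (ψ : I →*₀ ℂ) : I →*₀ ℂ := (RingHom.toMonoidWithZeroHom (starRingEnd ℂ)).comp ψ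

lemma cj_apply (ψ : I →*₀ ℂ) (x : I) : cj ψ x = (starRingEnd ℂ) (ψ x) := rfl

lemma a_cj (ψ : I →*₀ ℂ) (n : ℕ) : D.a (cj ψ) n = (starRingEnd ℂ) (D.a ψ n) := by
  rcases eq_or_ne n 0 with rfl | hn
  · simp
  · rw [NormMon.a, NormMon.a, D.S_apply _ hn, D.S_apply _ hn, map_sum]
    rfl

lemma al_cj {V : ℝ → ℝ} {c : ℝ} (hV : Wt V c) (ψ : I →*₀ ℂ) (x : ℝ) :
    al V (D.a (cj ψ)) x = (starRingEnd ℂ) (al V (D.a ψ) x) := by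
  obtain ⟨M, hM⟩ := exists_nat_gt (Real.exp (x + c))
  rw [al_eq hV _ hM, al_eq hV _ hM, map_sum]
  refine Finset.sum_congr rfl fun n _ => ?_
  rw [a_cj, map_mul, Complex.conj_ofReal]

lemma exp_bound {g : ℝ → ℂ} (hg : Continuous g) {C c : ℝ}
    (h1 : ∀ x, 0 ≤ x → ‖g x‖ ≤ C * Real.exp (-x)) (h2 : ∀ x, x < -c → ‖g x‖ ≤ C * Real.exp x) :
    ∃ C', ∀ x, ‖g x‖ ≤ C' * Real.exp (-1 * |x|) := by
  have hcont : Continuous (fun x => ‖g x‖ * Real.exp |x|) := by fun_prop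
  obtain ⟨B, hB⟩ := (isCompact_Icc (a := -c) (b := 0)).exists_bound_of_continuousOn
    hcont.continuousOn
  refine ⟨max B C, fun x => ?_⟩
  rcases le_or_gt 0 x with hx | hx
  · rw [abs_of_nonneg hx, neg_one_mul]
    exact (h1 x hx).trans (mul_le_mul_of_nonneg_right (le_max_right _ _) (Real.exp_pos _).le)
  rcases lt_or_ge x (-c) with hx' | hx'
  · rw [abs_of_neg hx, neg_one_mul, neg_neg]
    exact (h2 x hx').trans (mul_le_mul_of_nonneg_right (le_max_right _ _) (Real.exp_pos _).le)
  · have := hB x ⟨hx', hx.le⟩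
    rw [Real.norm_of_nonneg (by positivity)] at this
    have h3 : ‖g x‖ = ‖g x‖ * Real.exp |x| * Real.exp (-1 * |x|) := by
      rw [mul_assoc, ← Real.exp_add]; simp
    rw [h3]
    exact mul_le_mul_of_nonneg_right (this.trans (le_max_left _ _)) (Real.exp_pos _).le

/-- The nonnegative function -/
def NormMon.ff (ψ0 ψ : I →*₀ ℂ) : ArithmeticFunction ℂ :=
  (D.a ψ0 * D.a ψ) * (D.a ψ0 * D.a (cj ψ))

def NormMon.gg (ψ0 ψ : I →*₀ ℂ) : ArithmeticFunction ℂ :=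
  (D.Lam ψ0 + D.Lam ψ) + (D.Lam ψ0 + D.Lam (cj ψ))

lemma NormMon.mlog_ff (ψ0 ψ : I →*₀ ℂ) : mlog (D.ff ψ0 ψ) = D.ff ψ0 ψ * D.gg ψ0 ψ := by
  rw [NormMon.ff, NormMon.gg, mlog_mul, mlog_mul, mlog_mul, D.mlog_a, D.mlog_a, D.mlog_a]
  ring

lemma NormMon.a_one (ψ : I →*₀ ℂ) : D.a ψ 1 = 1 := by
  rw [NormMon.a, D.S_apply _ one_ne_zero]
  have : D.fib 1 = {1} := by
    ext x
    rw [D.mem_fib, Finset.mem_singleton]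
    exact ⟨D.N1 x, fun h => by rw [h, map_one]⟩
  rw [this, Finset.sum_singleton, map_one]

lemma NormMon.gg_apply (ψ0 ψ : I →*₀ ℂ) {n : ℕ} (hn : n ≠ 0) : D.gg ψ0 ψ n =
    ∑ x ∈ D.fib n, (((2 * (ψ0 x) + (ψ x + cj ψ x))) * (D.lam x : ℂ)) := by
  simp only [NormMon.gg, ArithmeticFunction.add_apply, NormMon.Lam]
  rw [D.S_apply _ hn, D.S_apply _ hn, D.S_apply _ hn, ← Finset.sum_add_distrib,
    ← Finset.sum_add_distrib, ← Finset.sum_add_distrib]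
  refine Finset.sum_congr rfl fun x _ => ?_
  ring

lemma gg_term (ψ0 ψ : I →*₀ ℂ) (h0 : ∀ x, ψ0 x = 0 ∨ ψ0 x = 1) (hψ : ∀ x, ‖ψ x‖ = ‖ψ0 x‖) (x : I) :
    0 ≤ ((2 * (ψ0 x) + (ψ x + cj ψ x))) * (D.lam x : ℂ) := by
  apply mul_nonneg
  · rw [cj_apply, Complex.add_conj]
    have h1 := hψ x
    rcases h0 x with h | h
    · rw [h, norm_zero, norm_eq_zero] at h1
      rw [h1, h]; simp
    · rw [h, norm_one] at h1
      rw [h]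
      have h2 := Complex.abs_re_le_norm (ψ x)
      rw [h1, abs_le] at h2
      have : (2 * 1 + ((2 * (ψ x).re : ℝ) : ℂ)) = ((2 + 2 * (ψ x).re : ℝ) : ℂ) := by
        push_cast; ring
      rw [this]
      exact Complex.zero_le_real.2 (by linarith [h2.1])
  · exact Complex.zero_le_real.2 (D.lam_nonneg x)

lemma gg_nonneg (ψ0 ψ : I →*₀ ℂ) (h0 : ∀ x, ψ0 x = 0 ∨ ψ0 x = 1) (hψ : ∀ x, ‖ψ x‖ = ‖ψ0 x‖) (n : ℕ) :
    0 ≤ D.gg ψ0 ψ n := by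
  rcases eq_or_ne n 0 with rfl | hn
  · simp
  rw [D.gg_apply _ _ hn]
  exact Finset.sum_nonneg fun x _ => gg_term D ψ0 ψ h0 hψ x

lemma ff_one (ψ0 ψ : I →*₀ ℂ) : D.ff ψ0 ψ 1 = 1 := by
  simp [NormMon.ff, D.a_one]

lemma ff_nonneg (ψ0 ψ : I →*₀ ℂ) (h0 : ∀ x, ψ0 x = 0 ∨ ψ0 x = 1) (hψ : ∀ x, ‖ψ x‖ = ‖ψ0 x‖) (n : ℕ) :
    0 ≤ D.ff ψ0 ψ n := by
  induction n using Nat.strong_induction_on with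
  | _ n ih =>
    rcases eq_or_ne n 0 with rfl | hn
    · simp
    rcases eq_or_ne n 1 with rfl | hn1
    · rw [ff_one]; exact zero_le_one
    have hlog : 0 < Real.log n := Real.log_pos (by exact_mod_cast (show 1 < n by omega))
    have h1 : D.ff ψ0 ψ n * (Real.log n : ℂ) =
        ∑ p ∈ n.divisorsAntidiagonal, D.ff ψ0 ψ p.1 * D.gg ψ0 ψ p.2 := by
      rw [← mlog_apply, D.mlog_ff, ArithmeticFunction.mul_apply]
    have h2 : 0 ≤ ∑ p ∈ n.divisorsAntidiagonal, D.ff ψ0 ψ p.1 * D.gg ψ0 ψ p.2 := by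
      apply Finset.sum_nonneg
      intro p hp
      rw [Nat.mem_divisorsAntidiagonal] at hp
      rcases eq_or_ne p.2 1 with h | h
      · have : D.gg ψ0 ψ 1 = 0 := by
          rw [D.gg_apply _ _ one_ne_zero]
          apply Finset.sum_eq_zero
          intro x hx
          rw [D.mem_fib] at hx
          rw [D.N1 x hx, D.lam_zero not_isPrimePow_one]; simp
        rw [h, this, mul_zero]
      · apply mul_nonneg _ (gg_nonneg D ψ0 ψ h0 hψ _)
        apply ih
        have hp2 : p.2 ≠ 0 := (fun h => hp.2 (by rw [← hp.1, h, mul_zero]))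
        have hp1 : p.1 ≠ 0 := (fun h => hp.2 (by rw [← hp.1, h, zero_mul]))
        rw [← hp.1]
        exact (Nat.lt_mul_iff_one_lt_right (Nat.pos_of_ne_zero hp1)).2 (by omega)
    rw [← h1] at h2
    have h3 : D.ff ψ0 ψ n = (D.ff ψ0 ψ n * (Real.log n : ℂ)) * ((Real.log n)⁻¹ : ℝ) := by
      rw [mul_assoc, ← Complex.ofReal_mul, mul_inv_cancel₀ hlog.ne', Complex.ofReal_one, mul_one]
    rw [h3]
    exact mul_nonneg h2 (Complex.zero_le_real.2 (inv_nonneg.2 hlog.le))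

lemma ff_pow (ψ0 ψ : I →*₀ ℂ) (h0 : ∀ x, ψ0 x = 0 ∨ ψ0 x = 1) (hψ : ∀ x, ‖ψ x‖ = ‖ψ0 x‖)
    {h : ℕ} (hh : 0 < h) {p : I} (hp : Prime p) (hp0 : ψ0 p = 1) (hp1 : ψ p ^ h = 1) :
    ((4 / h : ℝ) : ℂ) ≤ D.ff ψ0 ψ (D.N p ^ h) := by
  have h2 := D.two_le hp
  set n := D.N p ^ h with hn
  have hn1 : 1 < n := Nat.one_lt_pow hh.ne' (by omega)
  have hlogp : 0 < Real.log (D.N p) := Real.log_pos (by exact_mod_cast (by omega))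
  have hlog : Real.log n = h * Real.log (D.N p) := by
    rw [hn, Nat.cast_pow, Real.log_pow]
  have h1 : D.ff ψ0 ψ n * (Real.log n : ℂ) =
        ∑ p ∈ n.divisorsAntidiagonal, D.ff ψ0 ψ p.1 * D.gg ψ0 ψ p.2 := by
      rw [← mlog_apply, D.mlog_ff, ArithmeticFunction.mul_apply]
  have h3 : D.ff ψ0 ψ 1 * D.gg ψ0 ψ n ≤
      ∑ p ∈ n.divisorsAntidiagonal, D.ff ψ0 ψ p.1 * D.gg ψ0 ψ p.2 := by
    refine Finset.single_le_sum (f := fun p : ℕ × ℕ => D.ff ψ0 ψ p.1 * D.gg ψ0 ψ p.2)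
      (fun q _ => mul_nonneg (ff_nonneg D ψ0 ψ h0 hψ _) (gg_nonneg D ψ0 ψ h0 hψ _)) (a := (1, n)) ?_
    rw [Nat.mem_divisorsAntidiagonal]
    exact ⟨one_mul _, by omega⟩
  have h4 : ((4 * Real.log (D.N p) : ℝ) : ℂ) ≤ D.gg ψ0 ψ n := by
    rw [D.gg_apply _ _ (by omega)]
    have := Finset.single_le_sum (f := fun x => ((2 * (ψ0 x) + (ψ x + cj ψ x))) * (D.lam x : ℂ))
      (fun q _ => gg_term D ψ0 ψ h0 hψ q) (a := p ^ h) (s := D.fib n)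
      (by rw [D.mem_fib, map_pow])
    refine le_trans (le_of_eq ?_) this
    rw [cj_apply, map_pow, map_pow, hp0, hp1, D.lam_pow hp hh, one_pow, map_one]
    push_cast
    ring
  rw [ff_one, one_mul] at h3
  have h5 := h4.trans h3
  rw [← h1, hlog] at h5
  have hpos : (0 : ℝ) < h * Real.log (D.N p) := by positivity
  have h6 : D.ff ψ0 ψ n = (D.ff ψ0 ψ n * ((h * Real.log (D.N p) : ℝ) : ℂ)) *
      (((h * Real.log (D.N p))⁻¹ : ℝ) : ℂ) := by
    rw [mul_assoc, ← Complex.ofReal_mul, mul_inv_cancel₀ hpos.ne', Complex.ofReal_one, mul_one]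
  rw [h6]
  refine le_trans (le_of_eq ?_) (mul_le_mul_of_nonneg_right h5
    (Complex.zero_le_real.2 (inv_nonneg.2 hpos.le)))
  rw [← Complex.ofReal_mul]
  congr 1
  have : (h : ℝ) ≠ 0 := by positivity
  field_simp

/-- `R` decays if the `L`-value vanishes. -/
lemma R_decay {V : ℝ → ℝ} {c : ℝ} (hV : Wt V c) (ψ0 ψ : I →*₀ ℂ) {κ C : ℝ}
    (H1 : ∀ x, 0 ≤ x → ‖al V (D.a ψ0) x - ((κ * Real.exp x : ℝ) : ℂ)‖ ≤ C * Real.exp (-x))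
    (H2 : ∀ x, 0 ≤ x → ‖al V (D.a ψ) x‖ ≤ C * Real.exp (-x))
    (hz : ∫ x, al V (D.a ψ) x * ((Real.exp (-x) : ℝ) : ℂ) = 0) :
    ∃ B, ∀ x, ‖al (cw V) (⇑(D.a ψ0 * D.a ψ)) x‖ ≤ B * Real.exp (-(1 / 2) * |x|) := by
  have hcz := al_cont hV (D.a ψ)
  have hc0 := al_cont hV (D.a ψ0)
  have hC : 0 ≤ C := by simpa using (norm_nonneg _).trans (H2 0 le_rfl)
  have hzero : ∀ (φ : I →*₀ ℂ) x, x < -c → al V (D.a φ) x = 0 := fun φ x hx =>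
    al_zero hV _ (by simp) hx
  obtain ⟨A1, hA1⟩ := exp_bound (c := c) hcz H2 (fun x hx => by
    rw [hzero _ _ hx, norm_zero]; positivity)
  obtain ⟨A2, hA2⟩ := exp_bound (g := fun x => al V (D.a ψ0) x - ((κ * Real.exp x : ℝ) : ℂ))
    (C := max C |κ|) (c := c)
    (by fun_prop) (fun x hx => (H1 x hx).trans (mul_le_mul_of_nonneg_right (le_max_left _ _)
      (Real.exp_pos _).le)) (fun x hx => by
      rw [hzero _ _ hx, zero_sub, norm_neg, Complex.norm_real, norm_mul, Real.norm_eq_abs,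
        Real.norm_eq_abs, abs_of_pos (Real.exp_pos x)]
      exact mul_le_mul_of_nonneg_right (le_max_right _ _) (Real.exp_pos _).le)
  obtain ⟨B, hB⟩ := conv_decay one_pos hA2 hA1
  refine ⟨B, fun x => ?_⟩
  refine le_trans (le_of_eq ?_) (hB x)
  congr 1
  rw [← al_conv hV]
  have h1 : ∀ s, al V (D.a ψ0) s * al V (D.a ψ) (x - s) =
      (al V (D.a ψ0) s - ((κ * Real.exp s : ℝ) : ℂ)) * al V (D.a ψ) (x - s) +
      (κ * Real.exp x : ℝ) * (al V (D.a ψ) (x - s) * ((Real.exp (-(x - s)) : ℝ) : ℂ)) := by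
    intro s
    have : Real.exp s = Real.exp x * Real.exp (-(x - s)) := by
      rw [← Real.exp_add]; ring_nf
    rw [this]
    push_cast
    ring
  simp_rw [h1]
  have hA1n : 0 ≤ A1 := by simpa using (norm_nonneg _).trans (hA1 0)
  have hA2n : 0 ≤ A2 := by simpa using (norm_nonneg _).trans (hA2 0)
  have hI1 : Integrable (fun s => (al V (D.a ψ0) s - ((κ * Real.exp s : ℝ) : ℂ)) *
      al V (D.a ψ) (x - s)) := by
    refine Integrable.mono' ((integrable_exp_abs one_pos).const_mul (A2 * A1))
      (Continuous.aestronglyMeasurable (by fun_prop)) (Filter.Eventually.of_forall fun s => ?_)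
    rw [norm_mul, mul_right_comm]
    refine mul_le_mul (hA2 s) ((hA1 _).trans ?_) (norm_nonneg _) (by positivity)
    have : Real.exp (-1 * |x - s|) ≤ 1 := Real.exp_le_one_iff.2 (by
      have := abs_nonneg (x - s); linarith)
    nlinarith
  have hI2 : Integrable (fun s => al V (D.a ψ) s * ((Real.exp (-s) : ℝ) : ℂ)) := by
    refine Integrable.mono' ((integrable_exp_abs one_pos).const_mul (A1 * Real.exp c))
      (Continuous.aestronglyMeasurable (by fun_prop)) (Filter.Eventually.of_forall fun s => ?_)
    rw [norm_mul, Complex.norm_real, Real.norm_of_nonneg (Real.exp_pos _).le]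
    rcases lt_or_ge s (-c) with hs | hs
    · rw [hzero _ _ hs, norm_zero, zero_mul]; positivity
    · rw [mul_right_comm]
      exact mul_le_mul (hA1 s) (Real.exp_le_exp.2 (by linarith)) (Real.exp_pos _).le (by positivity)
  have hI3 : Integrable (fun s => al V (D.a ψ) (x - s) * ((Real.exp (-(x - s)) : ℝ) : ℂ)) :=
    hI2.comp_sub_left x
  rw [integral_add hI1 (hI3.const_mul _), integral_const_mul,
    integral_sub_left_eq_self (fun s => al V (D.a ψ) s * ((Real.exp (-s) : ℝ) : ℂ)) volume x, hz,
    mul_zero, add_zero]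

theorem nonvan {V : ℝ → ℝ} {c : ℝ} (hV : Wt V c) (ψ0 ψ : I →*₀ ℂ) {κ C : ℝ}
    (h0 : ∀ x, ψ0 x = 0 ∨ ψ0 x = 1) (hψ : ∀ x, ‖ψ x‖ = ‖ψ0 x‖)
    {h : ℕ} (hh : 0 < h) (hroot : ∀ x, ψ0 x = 1 → ψ x ^ h = 1)
    (hprimes : ∀ B : ℕ, ∃ p, Prime p ∧ B < D.N p ∧ ψ0 p = 1)
    (H1 : ∀ x, 0 ≤ x → ‖al V (D.a ψ0) x - ((κ * Real.exp x : ℝ) : ℂ)‖ ≤ C * Real.exp (-x))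
    (H2 : ∀ x, 0 ≤ x → ‖al V (D.a ψ) x‖ ≤ C * Real.exp (-x)) :
    ∫ x, al V (D.a ψ) x * ((Real.exp (-x) : ℝ) : ℂ) ≠ 0 := by
  intro hz
  have hz' : ∫ x, al V (D.a (cj ψ)) x * ((Real.exp (-x) : ℝ) : ℂ) = 0 := by
    have : ∀ x, al V (D.a (cj ψ)) x * ((Real.exp (-x) : ℝ) : ℂ) =
        (starRingEnd ℂ) (al V (D.a ψ) x * ((Real.exp (-x) : ℝ) : ℂ)) := by
      intro x
      rw [al_cj D hV, map_mul, Complex.conj_ofReal]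
    simp_rw [this]
    rw [integral_conj, hz, map_zero]
  obtain ⟨B1, hB1⟩ := R_decay D hV ψ0 ψ H1 H2 hz
  obtain ⟨B2, hB2⟩ := R_decay D hV ψ0 (cj ψ) H1 (fun x hx => by
    rw [al_cj D hV, RCLike.norm_conj]; exact H2 x hx) hz'
  obtain ⟨B, hB⟩ := conv_decay (by norm_num : (0 : ℝ) < 1 / 2) hB1 hB2
  simp_rw [al_conv hV.cw] at hB
  have hW := hV.cw.cw
  set W := cw (cw V) with hWdef
  set t := 2 * (2 * c) / 2 with ht
  have hWt : 0 < W t := hW.pos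
  have hlow : ∀ p, Prime p → ψ0 p = 1 →
      4 / h * W t ≤ ‖al W (D.ff ψ0 ψ) (Real.log ((D.N p ^ h : ℕ) : ℝ) - t)‖ := by
    intro p hp hp0
    set x := Real.log ((D.N p ^ h : ℕ) : ℝ) - t with hx
    obtain ⟨M, hM⟩ := exists_nat_gt (Real.exp (x + 2 * (2 * c)))
    have hM2 : Real.exp (x + 2 * (2 * c)) < ((max M (D.N p ^ h + 1) : ℕ) : ℝ) :=
      hM.trans_le (by exact_mod_cast le_max_left _ _)
    rw [al_eq hW _ hM2]
    have h1 := Finset.single_le_sum (f := fun n => D.ff ψ0 ψ n * (W (Real.log n - x) : ℂ))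
      (fun q _ => mul_nonneg (ff_nonneg D ψ0 ψ h0 hψ _) (Complex.zero_le_real.2 (hW.nonneg _)))
      (a := D.N p ^ h) (s := Finset.range (max M (D.N p ^ h + 1)))
      (by rw [Finset.mem_range]; exact lt_of_lt_of_le (Nat.lt_succ_self _) (le_max_right _ _))
    have h2 := ff_pow D ψ0 ψ h0 hψ hh hp hp0 (hroot p hp0)
    have h3 : ((4 / h * W t : ℝ) : ℂ) ≤ D.ff ψ0 ψ (D.N p ^ h) *
        (W (Real.log ((D.N p ^ h : ℕ) : ℝ) - x) : ℂ) := by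
      have : Real.log ((D.N p ^ h : ℕ) : ℝ) - x = t := by rw [hx]; ring
      rw [this, Complex.ofReal_mul]
      exact mul_le_mul_of_nonneg_right h2 (Complex.zero_le_real.2 hWt.le)
    have h4 := (Complex.le_def.1 (h3.trans h1)).1
    rw [Complex.ofReal_re] at h4
    exact h4.trans (Complex.re_le_norm _)
  have hhr : (0 : ℝ) < h := by exact_mod_cast hh
  have hlim : Filter.Tendsto (fun x : ℝ => B * Real.exp (-(1 / 2 / 2) * |x|)) Filter.atTop (nhds 0) := by
    have h1 : Filter.Tendsto (fun x : ℝ => (1 / 2 / 2) * |x|) Filter.atTop Filter.atTop :=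
      Filter.Tendsto.const_mul_atTop (by norm_num) Filter.tendsto_abs_atTop_atTop
    have h2 := (Real.tendsto_exp_neg_atTop_nhds_zero.comp h1).const_mul B
    rw [mul_zero] at h2
    refine h2.congr fun x => ?_
    simp only [Function.comp_apply, neg_mul]
  have hev := (hlim.eventually (gt_mem_nhds (show (0 : ℝ) < 4 / h * W t by positivity)))
  obtain ⟨X, hX⟩ := Filter.eventually_atTop.1 hev
  obtain ⟨n, hn⟩ := exists_nat_gt (Real.exp (X + t))
  obtain ⟨p, hp, hpn, hp0⟩ := hprimes n
  have h1 := hlow p hp hp0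
  set x := Real.log ((D.N p ^ h : ℕ) : ℝ) - t with hx
  have hxX : X ≤ x := by
    have h5 : D.N p ≤ D.N p ^ h := Nat.le_self_pow hh.ne' _
    have h6 : Real.exp (X + t) < ((D.N p ^ h : ℕ) : ℝ) :=
      hn.trans (by exact_mod_cast hpn.trans_le h5)
    have := (Real.lt_log_iff_exp_lt ((Real.exp_pos _).trans h6)).2 h6
    rw [hx]; linarith
  have h2 := hX x hxX
  have h3 := hB x
  have h4 : D.ff ψ0 ψ = (D.a ψ0 * D.a ψ) * (D.a ψ0 * D.a (cj ψ)) := rfl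
  rw [← h4] at h3
  linarith

end nonvan
end PT

/-! ### Helper material, part A4 -/

/-! ## Part A4: Dirichlet series near `1` -/
namespace PT

section dser
open Classical MeasureTheory

def EE (s : ℝ) (n : ℕ) : ℝ := Real.exp (-s * Real.log n)

lemma EE_pos (s : ℝ) (n : ℕ) : 0 < EE s n := Real.exp_pos _

lemma log_nat_nonneg (n : ℕ) : 0 ≤ Real.log (n : ℝ) := Real.log_natCast_nonneg n

lemma EE_le {s t : ℝ} (h : s ≤ t) (n : ℕ) : EE t n ≤ EE s n := by
  apply Real.exp_le_exp.2
  have := mul_le_mul_of_nonneg_right h (log_nat_nonneg n)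
  linarith

/-- Dirichlet series -/
def Dz (a : ℕ → ℂ) (s : ℝ) : ℂ := ∑' n, a n * (EE s n : ℂ)

lemma term_EE (a : ℕ → ℂ) (h0 : a 0 = 0) (s : ℝ) : LSeries.term a (s : ℂ) = fun n => a n * (EE s n : ℂ) := by
  funext n
  rcases eq_or_ne n 0 with rfl | hn
  · simp [h0]
  · rw [LSeries.term_of_ne_zero hn, EE, div_eq_mul_inv]
    congr 1
    have hn' : (0 : ℝ) < n := by positivity
    rw [← Complex.cpow_neg, neg_mul, mul_comm, ← mul_neg, Complex.ofReal_exp, ← Complex.ofReal_natCast,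
      Complex.cpow_def_of_ne_zero (by exact_mod_cast hn), Complex.ofReal_mul, Complex.ofReal_log hn'.le,
      Complex.ofReal_neg]

lemma Dz_mul {f g : ArithmeticFunction ℂ} {s : ℝ} (hf : Summable fun n => f n * (EE s n : ℂ))
    (hg : Summable fun n => g n * (EE s n : ℂ)) : Dz (⇑(f * g)) s = Dz f s * Dz g s := by
  have h := ArithmeticFunction.LSeries_mul' (f := f) (g := g) (s := (s : ℂ))
    (by rw [LSeriesSummable, term_EE _ (by simp)]; exact hf)
    (by rw [LSeriesSummable, term_EE _ (by simp)]; exact hg)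
  simpa only [Dz, LSeries, term_EE _ (f.map_zero), term_EE _ (g.map_zero), term_EE _ ((f * g).map_zero)] using h

lemma summable_log {a : ℕ → ℂ} {s t : ℝ} (hst : s < t)
    (h : Summable fun n => ‖a n‖ * EE s n) : Summable fun n => ‖a n‖ * Real.log n * EE t n := by
  refine Summable.of_nonneg_of_le (fun n => ?_) (fun n => ?_) (h.mul_left (1 / (t - s)))
  · exact mul_nonneg (mul_nonneg (norm_nonneg _) (log_nat_nonneg n)) (EE_pos _ _).le
  · have h1 : Real.log n * EE t n ≤ 1 / (t - s) * EE s n := by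
      have h2 : (t - s) * Real.log n ≤ Real.exp ((t - s) * Real.log n) := by
        have := Real.add_one_le_exp ((t - s) * Real.log n); linarith
      have h3 : EE s n = EE t n * Real.exp ((t - s) * Real.log n) := by
        rw [EE, EE, ← Real.exp_add]; congr 1; ring
      rw [h3, div_mul_eq_mul_div, le_div_iff₀ (by linarith)]
      nlinarith [EE_pos t n]
    calc _ = ‖a n‖ * (Real.log n * EE t n) := by ring
      _ ≤ ‖a n‖ * (1 / (t - s) * EE s n) := mul_le_mul_of_nonneg_left h1 (norm_nonneg _)
      _ = _ := by ring

def tv (V : ℝ → ℝ) (s : ℝ) : ℝ := ∫ t, V t * Real.exp (s * t)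
def tv1 (V : ℝ → ℝ) (s : ℝ) : ℝ := ∫ t, V t * (t * Real.exp (s * t))

variable {V : ℝ → ℝ} {c : ℝ}

lemma Wt.int (h : Wt V c) {g : ℝ → ℝ} (hg : Continuous g) : Integrable fun t => V t * g t :=
  (h.cont.mul hg).integrable_of_hasCompactSupport (h.hcs.mul_right)

lemma Wt.int' (h : Wt V c) {g : ℝ → ℝ} (hg : Continuous g) (L : ℝ) :
    Integrable fun x => V (L - x) * g x := by
  have := (h.int (g := fun t => g (L - t)) (by fun_prop)).comp_sub_left L
  simpa using this

lemma int_shift (s L : ℝ) : ∫ x, V (L - x) * Real.exp (-s * x) = Real.exp (-s * L) * tv V s := by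
  rw [tv, ← integral_const_mul, ← integral_sub_left_eq_self _ volume L]
  congr 1; funext x
  rw [show L - (L - x) = x by ring, show -s * (L - x) = -s * L + s * x by ring, Real.exp_add]; ring

lemma int_shift1 (h : Wt V c) (s L : ℝ) : ∫ x, V (L - x) * (x * Real.exp (-s * x)) =
    Real.exp (-s * L) * (L * tv V s - tv1 V s) := by
  rw [tv, tv1, ← integral_const_mul, ← integral_sub (by
      have := (h.int (g := fun t => Real.exp (s * t)) (by fun_prop)).const_mul L
      exact this) (h.int (by fun_prop)), ← integral_const_mul, ← integral_sub_left_eq_self _ volume L]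
  congr 1; funext x
  rw [show L - (L - x) = x by ring, show -s * (L - x) = -s * L + s * x by ring, Real.exp_add]; ring

lemma tv_pos (h : Wt V c) (s : ℝ) : 0 < tv V s := by
  have hc : Continuous fun t => V t * Real.exp (s * t) := by
    have := h.cont; fun_prop
  refine hc.integral_pos_of_hasCompactSupport_nonneg_nonzero h.hcs.mul_right
    (fun t => mul_nonneg (h.nonneg t) (Real.exp_pos _).le) (x := c / 2) ?_
  exact (mul_pos h.pos (Real.exp_pos _)).ne'

lemma tv1_le (h : Wt V c) (s : ℝ) : |tv1 V s| ≤ c * tv V s := by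
  have h0 : 0 ≤ tv1 V s := integral_nonneg fun t => by
    rcases eq_or_ne (V t) 0 with h1 | h1
    · simp [h1]
    · exact mul_nonneg (h.nonneg t) (mul_nonneg (h.supp t h1).1 (Real.exp_pos _).le)
  rw [abs_of_nonneg h0, tv, tv1, ← integral_const_mul]
  refine integral_mono (h.int (by fun_prop)) ((h.int (by fun_prop)).const_mul c) fun t => ?_
  rcases eq_or_ne (V t) 0 with h1 | h1
  · simp [h1]
  · show V t * (t * Real.exp (s * t)) ≤ c * (V t * Real.exp (s * t))
    have := mul_le_mul_of_nonneg_right (h.supp t h1).2 (mul_nonneg (h.nonneg t) (Real.exp_pos (s * t)).le)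
    linarith

lemma tv_le (h : Wt V c) {s t : ℝ} (hst : s ≤ t) : tv V s ≤ tv V t := by
  refine integral_mono (h.int (by fun_prop)) (h.int (by fun_prop)) fun x => ?_
  rcases eq_or_ne (V x) 0 with h1 | h1
  · simp [h1]
  · exact mul_le_mul_of_nonneg_left (Real.exp_le_exp.2
      (mul_le_mul_of_nonneg_right hst (h.supp x h1).1)) (h.nonneg x)

lemma al_int (h : Wt V c) (a : ℕ → ℂ) {g : ℝ → ℝ} (hg : Continuous g)
    (hs : Summable fun n : ℕ => ‖a n‖ * ∫ x, V (Real.log n - x) * |g x|) :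
    ∫ x, al V a x * (g x : ℂ) = ∑' n : ℕ, a n * ((∫ x, V (Real.log n - x) * g x : ℝ) : ℂ) := by
  have h1 := integral_tsum_of_summable_integral_norm (μ := volume)
    (F := fun (n : ℕ) (x : ℝ) => a n * ((V (Real.log n - x) * g x : ℝ) : ℂ))
    (fun n => ((h.int' hg _).ofReal).const_mul _) (by
      refine hs.congr fun n => ?_
      rw [← integral_const_mul]
      congr 1; funext x
      rw [norm_mul, Complex.norm_real, Real.norm_eq_abs, abs_mul, abs_of_nonneg (h.nonneg _)])
  simp_rw [integral_const_mul, integral_complex_ofReal] at h1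
  rw [h1]
  congr 1; funext x
  rw [al, ← tsum_mul_right]
  congr 1; funext n
  push_cast; ring

lemma al_int0 (h : Wt V c) (a : ℕ → ℂ) {s : ℝ} (hs : Summable fun n => ‖a n‖ * EE s n) :
    ∫ x, al V a x * ((Real.exp (-s * x) : ℝ) : ℂ) = Dz a s * (tv V s : ℂ) := by
  rw [al_int h a (by fun_prop), Dz, ← tsum_mul_right]
  · congr 1; funext n
    rw [int_shift, EE]; push_cast; ring
  · refine (hs.mul_right (tv V s)).congr fun n => ?_
    simp_rw [Real.abs_exp]
    rw [int_shift, EE]; ring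

lemma al_int1 (h : Wt V c) (a : ArithmeticFunction ℂ) {s t : ℝ} (hst : t < s)
    (hs : Summable fun n => ‖a n‖ * EE t n) :
    ∫ x, al V a x * ((x * Real.exp (-s * x) : ℝ) : ℂ) =
      Dz (mlog a) s * (tv V s : ℂ) - Dz a s * (tv1 V s : ℂ) := by
  have hl := summable_log hst hs
  have hs' : Summable fun n => ‖a n‖ * EE s n := Summable.of_nonneg_of_le
    (fun n => mul_nonneg (norm_nonneg _) (EE_pos _ _).le)
    (fun n => mul_le_mul_of_nonneg_left (EE_le hst.le n) (norm_nonneg _)) hs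
  have e1 : Summable fun n => mlog a n * (EE s n : ℂ) := by
    refine Summable.of_norm (hl.congr fun n => ?_)
    rw [mlog_apply, norm_mul, norm_mul, Complex.norm_real, Complex.norm_real, Real.norm_eq_abs, Real.norm_eq_abs,
      abs_of_nonneg (log_nat_nonneg n), abs_of_pos (EE_pos _ _)]
  have e2 : Summable fun n => a n * (EE s n : ℂ) := by
    refine Summable.of_norm (hs'.congr fun n => ?_)
    rw [norm_mul, Complex.norm_real, Real.norm_eq_abs, abs_of_pos (EE_pos _ _)]
  rw [al_int h a (by fun_prop), Dz, Dz, ← tsum_mul_right, ← tsum_mul_right,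
    ← (e1.mul_right _).tsum_sub (e2.mul_right _)]
  · congr 1; funext n
    rw [int_shift1 h, mlog_apply, EE]; push_cast; ring
  · refine Summable.of_nonneg_of_le (fun n => mul_nonneg (norm_nonneg _)
      (integral_nonneg fun x => mul_nonneg (h.nonneg _) (abs_nonneg _))) (fun n => ?_)
      ((hl.mul_right (tv V s)).add ((hs'.mul_right (tv V s)).mul_left |c|))
    have : ∫ x, V (Real.log n - x) * |x * Real.exp (-s * x)| ≤
        ∫ x, (Real.log n + |c|) * (V (Real.log n - x) * Real.exp (-s * x)) := by
      refine integral_mono (h.int' (by fun_prop) _) ((h.int' (by fun_prop) _).const_mul _) fun x => ?_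
      show V (Real.log n - x) * |x * Real.exp (-s * x)| ≤
        (Real.log n + |c|) * (V (Real.log n - x) * Real.exp (-s * x))
      rcases eq_or_ne (V (Real.log n - x)) 0 with h1 | h1
      · simp [h1]
      · have h2 := h.supp _ h1
        have h3 : |x| ≤ Real.log n + |c| := by
          have := log_nat_nonneg n
          have := le_abs_self c
          rw [abs_le]; constructor <;> linarith
        rw [abs_mul, Real.abs_exp]
        have := mul_le_mul_of_nonneg_right h3 (mul_nonneg (h.nonneg (Real.log n - x)) (Real.exp_pos (-s * x)).le)
        linarith
    rw [integral_const_mul, int_shift] at this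
    refine (mul_le_mul_of_nonneg_left this (norm_nonneg (a n))).trans (le_of_eq ?_)
    rw [EE]; ring

/-- summability from growth of the smoothed sum. -/
lemma summable_of_al (h : Wt V c) (a : ℕ → ℝ) (ha : ∀ n, 0 ≤ a n) (a0 : a 0 = 0) {κ C : ℝ}
    (H1 : ∀ x, 0 ≤ x → ‖al V (fun n => (a n : ℂ)) x - ((κ * Real.exp x : ℝ) : ℂ)‖ ≤ C * Real.exp (-x))
    {s : ℝ} (hs : 1 < s) : Summable fun n => a n * EE s n := by
  have hcont := al_cont h (fun n => (a n : ℂ))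
  have hg : Continuous fun x => ‖al V (fun n => (a n : ℂ)) x‖ * Real.exp (-s * x) := by fun_prop
  have hintg : Integrable fun x => ‖al V (fun n => (a n : ℂ)) x‖ * Real.exp (-s * x) := by
    rw [← integrableOn_univ, ← Set.Iio_union_Ici (a := -c), integrableOn_union]
    constructor
    · refine (integrableOn_zero).congr_fun (fun x hx => ?_) measurableSet_Iio
      simp [al_zero h (fun n => (a n : ℂ)) (by simp [a0]) hx]
    · rw [← Set.Icc_union_Ioi_eq_Ici (a := -c) (b := max (-c) 0) (le_max_left _ _), integrableOn_union]
      refine ⟨hg.continuousOn.integrableOn_compact isCompact_Icc, ?_⟩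
      have i1 : IntegrableOn (fun x => |κ| * Real.exp ((1 - s) * x) + |C| * Real.exp ((-1 - s) * x))
          (Set.Ioi (max (-c) 0)) :=
        ((integrableOn_exp_mul_Ioi (by linarith) _).const_mul _).add
          ((integrableOn_exp_mul_Ioi (by linarith) _).const_mul _)
      refine i1.mono' hg.aestronglyMeasurable ((ae_restrict_iff' measurableSet_Ioi).2
        (Filter.Eventually.of_forall fun x hx => ?_))
      have hx0 : 0 ≤ x := (le_max_right _ _).trans (le_of_lt hx)
      have h2 : ‖al V (fun n => (a n : ℂ)) x‖ ≤ |κ| * Real.exp x + |C| * Real.exp (-x) := by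
        have h3 := norm_le_norm_add_norm_sub' (al V (fun n => (a n : ℂ)) x) ((κ * Real.exp x : ℝ) : ℂ)
        rw [Complex.norm_real, Real.norm_eq_abs, abs_mul, Real.abs_exp] at h3
        have h4 := mul_le_mul_of_nonneg_right (le_abs_self C) (Real.exp_pos (-x)).le
        linarith [H1 x hx0]
      rw [norm_mul, norm_norm, Real.norm_eq_abs, Real.abs_exp]
      refine (mul_le_mul_of_nonneg_right h2 (Real.exp_pos (-s * x)).le).trans (le_of_eq ?_)
      rw [show (1 - s) * x = x + -s * x by ring, show (-1 - s) * x = -x + -s * x by ring,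
        Real.exp_add, Real.exp_add]; ring
  have key : ∀ M, ∑ n ∈ Finset.range M, a n * EE s n ≤
      (∫ x, ‖al V (fun n => (a n : ℂ)) x‖ * Real.exp (-s * x)) / tv V s := by
    intro M
    rw [le_div_iff₀ (tv_pos h s), Finset.sum_mul]
    have : ∀ n ∈ Finset.range M, a n * EE s n * tv V s =
        ∫ x, a n * (V (Real.log n - x) * Real.exp (-s * x)) := fun n _ => by
      rw [integral_const_mul, int_shift, EE]; ring
    rw [Finset.sum_congr rfl this, ← integral_finsetSum _ fun n _ => (h.int' (by fun_prop) _).const_mul _]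
    refine integral_mono (integrable_finsetSum _ fun n _ => (h.int' (by fun_prop) _).const_mul _) hintg fun x => ?_
    show ∑ n ∈ Finset.range M, a n * (V (Real.log n - x) * Real.exp (-s * x)) ≤ _
    obtain ⟨M', hM'⟩ := exists_nat_gt (Real.exp (x + c))
    have hM2 : Real.exp (x + c) < ((max M M' : ℕ) : ℝ) := hM'.trans_le (by exact_mod_cast le_max_right _ _)
    rw [al_eq h _ hM2]
    have : ∑ n ∈ Finset.range (max M M'), ((a n : ℂ)) * (V (Real.log n - x) : ℂ) =
      ((∑ n ∈ Finset.range (max M M'), a n * V (Real.log n - x) : ℝ) : ℂ) := by push_cast; rfl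
    rw [this, Complex.norm_real, Real.norm_eq_abs, abs_of_nonneg
      (Finset.sum_nonneg fun n _ => mul_nonneg (ha n) (h.nonneg _)), Finset.sum_mul]
    refine le_trans (le_of_eq (Finset.sum_congr rfl fun n _ => ?_)) (Finset.sum_le_sum_of_subset_of_nonneg
      (Finset.range_subset_range.2 (le_max_left M M')) fun n _ _ =>
        mul_nonneg (mul_nonneg (ha n) (h.nonneg _)) (Real.exp_pos _).le)
    ring
  exact summable_of_sum_range_le (fun n => mul_nonneg (ha n) (EE_pos _ _).le) key

/-- divergence at `1` -/
lemma Dz_large (h : Wt V c) (a : ℕ → ℝ) (ha : ∀ n, 0 ≤ a n) (a0 : a 0 = 0) {κ C : ℝ} (hκ : 0 < κ)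
    (H1 : ∀ x, 0 ≤ x → ‖al V (fun n => (a n : ℂ)) x - ((κ * Real.exp x : ℝ) : ℂ)‖ ≤ C * Real.exp (-x))
    (K : ℝ) : ∃ δ > 0, ∀ s, 1 < s → s < 1 + δ → K ≤ ∑' n, a n * EE s n := by
  have hC : 0 ≤ C := by simpa using (norm_nonneg _).trans (H1 0 le_rfl)
  have htv := tv_pos h 2
  refine ⟨min 1 (κ / (|K| * tv V 2 + C + 1)), by positivity, fun s hs hs2 => ?_⟩
  have hs3 : s < 2 := by linarith [min_le_left 1 (κ / (|K| * tv V 2 + C + 1))]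
  have hs4 : s - 1 < κ / (|K| * tv V 2 + C + 1) := by
    linarith [min_le_right 1 (κ / (|K| * tv V 2 + C + 1))]
  have hsum := summable_of_al h a ha a0 H1 hs
  have hsumn : Summable fun n => ‖(a n : ℂ)‖ * EE s n := by
    refine hsum.congr fun n => ?_
    rw [Complex.norm_real, Real.norm_eq_abs, abs_of_nonneg (ha n)]
  have h0 := al_int0 h (fun n => (a n : ℂ)) hsumn
  have hre : ∀ x, al V (fun n => (a n : ℂ)) x = ((∑' n : ℕ, a n * V (Real.log n - x) : ℝ) : ℂ) := by
    intro x; rw [al]; push_cast; rfl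
  set α : ℝ → ℝ := fun x => ∑' n : ℕ, a n * V (Real.log n - x) with hα
  have hα0 : ∀ x, 0 ≤ α x := fun x => tsum_nonneg fun n => mul_nonneg (ha n) (h.nonneg _)
  have h1 : ∫ x, α x * Real.exp (-s * x) = (∑' n, a n * EE s n) * tv V s := by
    have : Dz (fun n => (a n : ℂ)) s = ((∑' n, a n * EE s n : ℝ) : ℂ) := by
      rw [Dz]; push_cast; rfl
    rw [this] at h0
    simp_rw [hre, ← Complex.ofReal_mul] at h0
    rw [integral_complex_ofReal] at h0
    exact_mod_cast h0
  have hαc : Continuous α := by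
    have := al_cont h (fun n => (a n : ℂ))
    have h2 := Complex.continuous_re.comp this
    refine h2.congr fun x => ?_
    simp [hre, hα]
  have hintg : Integrable fun x => α x * Real.exp (-s * x) := by
    by_contra hi
    have h2 := integral_undef hi
    -- then the sum vanishes, so all coefficients vanish
    rw [h1] at h2
    have h3 := (mul_eq_zero.1 h2).resolve_right (tv_pos h s).ne'
    have h4 : ∀ n, a n = 0 := fun n => by
      have := (hasSum_zero_iff_of_nonneg (fun n => mul_nonneg (ha n) (EE_pos s n).le)).1
        (h3 ▸ hsum.hasSum)
      have := congrFun this n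
      exact (mul_eq_zero.1 this).resolve_right (EE_pos _ _).ne'
    apply hi
    have : α = 0 := by funext x; simp [hα, h4]
    simp [this]
  have h2 : ∫ x in Set.Ioi (0 : ℝ), (κ * Real.exp ((1 - s) * x) - C * Real.exp (-1 * x)) ≤
      ∫ x, α x * Real.exp (-s * x) := by
    have i1 : IntegrableOn (fun x => κ * Real.exp ((1 - s) * x) - C * Real.exp (-1 * x))
        (Set.Ioi (0 : ℝ)) :=
      ((integrableOn_exp_mul_Ioi (by linarith) _).const_mul _).sub
          ((integrableOn_exp_mul_Ioi (by norm_num) _).const_mul _)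
    refine (setIntegral_mono_on i1 hintg.integrableOn measurableSet_Ioi fun x hx => ?_).trans
      (setIntegral_le_integral hintg (Filter.Eventually.of_forall fun x => mul_nonneg (hα0 x) (Real.exp_pos _).le))
    have hx0 : 0 < x := hx
    have h5 := H1 x hx0.le
    rw [hre x, ← Complex.ofReal_sub, Complex.norm_real, Real.norm_eq_abs] at h5
    have h6 := (abs_le.1 h5).1
    have h7 : κ * Real.exp x - C * Real.exp (-x) ≤ α x := by
      simp only [hα]; linarith
    have h8 := mul_le_mul_of_nonneg_right h7 (Real.exp_pos (-s * x)).le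
    refine le_trans ?_ h8
    have h9 : Real.exp (-s * x) ≤ 1 := Real.exp_le_one_iff.2 (by nlinarith)
    have h10 : C * Real.exp (-x) * Real.exp (-s * x) ≤ C * Real.exp (-1 * x) := by
      rw [neg_one_mul]
      exact mul_le_of_le_one_right (mul_nonneg hC (Real.exp_pos _).le) h9
    rw [show (1 - s) * x = x + -s * x by ring, Real.exp_add]
    linarith
  rw [integral_sub ((integrableOn_exp_mul_Ioi (by linarith) _).const_mul _)
          ((integrableOn_exp_mul_Ioi (by norm_num) _).const_mul _), integral_const_mul, integral_const_mul,
    integral_exp_mul_Ioi (by linarith), integral_exp_mul_Ioi (by norm_num), h1] at h2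
  simp only [mul_zero, Real.exp_zero] at h2
  have hK : |K| * tv V 2 ≤ κ * (-1 / (1 - s)) - C * (-1 / -1) := by
    rw [lt_div_iff₀ (by positivity)] at hs4
    have : κ * (-1 / (1 - s)) = κ / (s - 1) := by
      rw [← neg_sub s 1, neg_div_neg_eq]; ring
    rw [this]
    have : |K| * tv V 2 + C + 1 ≤ κ / (s - 1) := by
      rw [le_div_iff₀ (by linarith)]; linarith
    linarith
  have h3 : |K| * tv V s ≤ (∑' n, a n * EE s n) * tv V s :=
    (mul_le_mul_of_nonneg_left (tv_le h hs3.le) (abs_nonneg K)).trans (hK.trans h2)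
  exact (le_abs_self K).trans (le_of_mul_le_mul_right h3 (tv_pos h s))

end dser
end PT

/-! ### Helper material, part A5 -/

/-! ## Part A5: primes in classes -/
namespace PT

section fin
open Classical MeasureTheory

variable {V : ℝ → ℝ} {c : ℝ}

lemma D_bdd (hV : Wt V c) (a l : ArithmeticFunction ℂ) (h : mlog a = a * l)
    (hs : ∀ s, 1 < s → Summable fun n => ‖a n‖ * EE s n)
    (hl : ∀ s, 1 < s → Summable fun n => ‖l n‖ * EE s n) {C : ℝ}
    (H2 : ∀ x, 0 ≤ x → ‖al V a x‖ ≤ C * Real.exp (-x))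
    (hnv : ∫ x, al V a x * ((Real.exp (-x) : ℝ) : ℂ) ≠ 0) :
    ∃ δ > 0, ∃ K, ∀ s, 1 < s → s < 1 + δ → ‖Dz l s‖ ≤ K := by
  have hC : 0 ≤ C := by simpa using (norm_nonneg _).trans (H2 0 le_rfl)
  have hcont := al_cont hV a
  have hzero : ∀ x, x < -c → al V a x = 0 := fun x hx => al_zero hV _ (by simp) hx
  obtain ⟨C', hC'⟩ := exp_bound (c := c) hcont H2 (fun x hx => by
    rw [hzero _ hx, norm_zero]; positivity)
  have hC'0 : 0 ≤ C' := by
    have := (norm_nonneg _).trans (hC' 0); simpa using this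
  have hb : ∀ s, 0 ≤ s → s ≤ 2 → ∀ x, ‖al V a x‖ * Real.exp (-s * x) ≤
      C' * Real.exp (2 * |c|) * Real.exp (-1 * |x|) := by
    intro s h0 h2 x
    by_cases hx : x < -c
    · rw [hzero _ hx, norm_zero, zero_mul]; positivity
    · have h3 : Real.exp (-s * x) ≤ Real.exp (2 * |c|) := by
        apply Real.exp_le_exp.2
        have h4 : -x ≤ |c| := by linarith [le_abs_self c]
        nlinarith [abs_nonneg c]
      calc _ ≤ C' * Real.exp (-1 * |x|) * Real.exp (2 * |c|) :=
            mul_le_mul (hC' x) h3 (Real.exp_pos _).le (by positivity)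
        _ = _ := by ring
  set I0 : ℝ → ℂ := fun s => ∫ x, al V a x * ((Real.exp (-s * x) : ℝ) : ℂ) with hI0
  have hI0c : ContinuousAt I0 1 := by
    refine continuousAt_of_dominated (bound := fun x => C' * Real.exp (2 * |c|) * Real.exp (-1 * |x|))
      (Filter.Eventually.of_forall fun s => ?_) ?_ ((integrable_exp_abs one_pos).const_mul _) ?_
    · exact Continuous.aestronglyMeasurable (by fun_prop)
    · filter_upwards [Icc_mem_nhds (show (0 : ℝ) < 1 by norm_num) (show (1 : ℝ) < 2 by norm_num)] with s hs
      refine Filter.Eventually.of_forall fun x => ?_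
      rw [norm_mul, Complex.norm_real, Real.norm_eq_abs, Real.abs_exp]
      exact hb s hs.1 hs.2 x
    · refine Filter.Eventually.of_forall fun x => ?_
      exact Continuous.continuousAt (by fun_prop)
  have hI1 : I0 1 ≠ 0 := by simpa [hI0] using hnv
  have hev := hI0c.norm.eventually (lt_mem_nhds (show ‖I0 1‖ / 2 < ‖I0 1‖ by
    have := norm_pos_iff.2 hI1; linarith))
  obtain ⟨δ, hδ, hball⟩ := Metric.eventually_nhds_iff.1 hev
  set K1 := ∫ x, C' * Real.exp (2 * |c|) * 2 * Real.exp (-(1 / 2) * |x|) with hK1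
  refine ⟨min δ 1, by positivity, K1 / (‖I0 1‖ / 2) + |c|, fun s h1 h2 => ?_⟩
  have hsδ : s - 1 < δ := by linarith [min_le_left δ 1]
  have hs2 : s ≤ 2 := by linarith [min_le_right δ 1]
  have hlow : ‖I0 1‖ / 2 < ‖I0 s‖ := hball (by rw [Real.dist_eq, abs_of_pos (by linarith)]; exact hsδ)
  have hI0pos : 0 < ‖I0 1‖ / 2 := by have := norm_pos_iff.2 hI1; linarith
  have hI0s : I0 s ≠ 0 := norm_pos_iff.1 (hI0pos.trans hlow)
  have e0 : I0 s = Dz a s * (tv V s : ℂ) := al_int0 hV a (hs s h1)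
  have e1 := al_int1 hV a (s := s) (t := (1 + s) / 2) (by linarith) (hs _ (by linarith))
  have htv : (tv V s : ℂ) ≠ 0 := by exact_mod_cast (tv_pos hV s).ne'
  have hsc : ∀ f : ArithmeticFunction ℂ, (Summable fun n => ‖f n‖ * EE s n) →
      Summable fun n => f n * (EE s n : ℂ) := fun f hf => by
    refine Summable.of_norm (hf.congr fun n => ?_)
    rw [norm_mul, Complex.norm_real, Real.norm_eq_abs, abs_of_pos (EE_pos _ _)]
  have e2 : Dz (mlog a) s = Dz a s * Dz l s := by
    rw [h, Dz_mul (hsc a (hs s h1)) (hsc l (hl s h1))]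
  rw [e2] at e1
  set I1 := ∫ x, al V a x * ((x * Real.exp (-s * x) : ℝ) : ℂ) with hI1d
  have hDa : Dz a s ≠ 0 := fun h0 => hI0s (by rw [e0, h0, zero_mul])
  have e3 : Dz l s = I1 / I0 s + (tv1 V s : ℂ) / (tv V s : ℂ) := by
    rw [e1, e0]; field_simp; ring
  have b1 : ‖I1‖ ≤ K1 := by
    refine norm_integral_le_of_norm_le ((integrable_exp_abs (by norm_num)).const_mul _)
      (Filter.Eventually.of_forall fun x => ?_)
    rw [norm_mul, Complex.norm_real, Real.norm_eq_abs, abs_mul, Real.abs_exp]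
    have h3 := hb s (by linarith) hs2 x
    have h4 : |x| ≤ 2 * Real.exp (1 / 2 * |x|) := by
      have := Real.add_one_le_exp (1 / 2 * |x|); linarith
    calc _ = (‖al V a x‖ * Real.exp (-s * x)) * |x| := by ring
      _ ≤ (C' * Real.exp (2 * |c|) * Real.exp (-1 * |x|)) * (2 * Real.exp (1 / 2 * |x|)) :=
        mul_le_mul h3 h4 (abs_nonneg _) (by positivity)
      _ = C' * Real.exp (2 * |c|) * 2 * (Real.exp (-1 * |x|) * Real.exp (1 / 2 * |x|)) := by ring
      _ = _ := by rw [← Real.exp_add]; congr 2; ring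
  rw [e3]
  refine (norm_add_le _ _).trans (add_le_add ?_ ?_)
  · rw [norm_div]
    exact div_le_div₀ ((norm_nonneg _).trans b1) b1 hI0pos hlow.le
  · rw [norm_div, Complex.norm_real, Complex.norm_real, Real.norm_eq_abs, Real.norm_eq_abs,
      abs_of_pos (tv_pos hV s), div_le_iff₀ (tv_pos hV s)]
    exact (tv1_le hV s).trans (mul_le_mul_of_nonneg_right (le_abs_self c) (tv_pos hV s).le)

lemma D_large (a l : ℕ → ℝ) (ha : ∀ n, 0 ≤ a n)
    (h : ∀ s, 1 < s → ∑' n, a n * Real.log n * EE s n = (∑' n, a n * EE s n) * ∑' n, l n * EE s n)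
    (hs : ∀ s, 1 < s → Summable fun n => a n * EE s n)
    (hs' : ∀ s, 1 < s → Summable fun n => a n * Real.log n * EE s n)
    (hA : ∀ K : ℝ, ∃ δ > 0, ∀ s, 1 < s → s < 1 + δ → K ≤ ∑' n, a n * EE s n) (K : ℝ) :
    ∃ δ > 0, ∀ s, 1 < s → s < 1 + δ → K ≤ ∑' n, l n * EE s n := by
  obtain ⟨M, hM⟩ := exists_nat_gt (Real.exp (2 * |K|))
  set CY := ∑ n ∈ Finset.range M, a n with hCY
  have hCY0 : 0 ≤ CY := Finset.sum_nonneg fun n _ => ha n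
  obtain ⟨δ, hδ, hδ2⟩ := hA (2 * CY + 1)
  refine ⟨δ, hδ, fun s h1 h2 => ?_⟩
  have hA1 := hδ2 s h1 h2
  set A := ∑' n, a n * EE s n with hAdef
  have key : 2 * |K| * (A - CY) ≤ ∑' n, a n * Real.log n * EE s n := by
    have t1 : Summable fun n => if n ∈ Finset.range M then a n else 0 :=
      summable_of_ne_finset_zero (s := Finset.range M) fun n hn => if_neg hn
    have t2 : ∑' n, (if n ∈ Finset.range M then a n else 0) = CY := by
      rw [tsum_eq_sum (s := Finset.range M) fun n hn => if_neg hn]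
      exact Finset.sum_congr rfl fun n hn => if_pos hn
    rw [← t2, hAdef, ← (hs s h1).tsum_sub t1, ← tsum_mul_left]
    refine Summable.tsum_le_tsum (fun n => ?_) (((hs s h1).sub t1).mul_left _) (hs' s h1)
    have hE1 : EE s n ≤ 1 := Real.exp_le_one_iff.2 (by nlinarith [log_nat_nonneg n])
    have hE0 := (EE_pos s n).le
    have hlog := log_nat_nonneg n
    by_cases hn : n ∈ Finset.range M
    · rw [if_pos hn]
      have h3 : a n * EE s n - a n ≤ 0 := by nlinarith [ha n]
      have h4 : 0 ≤ a n * Real.log n * EE s n := mul_nonneg (mul_nonneg (ha n) hlog) hE0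
      nlinarith [abs_nonneg K]
    · rw [if_neg hn, sub_zero]
      rw [Finset.mem_range, not_lt] at hn
      have h5 : Real.exp (2 * |K|) < (n : ℝ) := hM.trans_le (by exact_mod_cast hn)
      have h6 := ((Real.lt_log_iff_exp_lt ((Real.exp_pos _).trans h5)).2 h5).le
      have := mul_le_mul_of_nonneg_right h6 (mul_nonneg (ha n) hE0)
      linarith
  rw [h s h1] at key
  have hApos : 0 < A := by linarith
  have h7 : A * |K| ≤ A * ∑' n, l n * EE s n := by
    have : |K| * A ≤ 2 * |K| * (A - CY) := by nlinarith [abs_nonneg K]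
    linarith
  exact (le_abs_self K).trans (le_of_mul_le_mul_left h7 hApos)

variable {I : Type} [CommMonoidWithZero I] [UniqueFactorizationMonoid I] (D : NormMon I)

lemma NormMon.lam_le {x : I} (hx : x ≠ 0) : D.lam x ≤ Real.log (D.N x) := by
  rw [← D.sum_lam hx]
  exact Finset.single_le_sum (f := D.lam) (fun y _ => D.lam_nonneg y) ((D.mem_dv hx).2 dvd_rfl)

variable {A : Type} [AddCommGroup A] [Fintype A] (cl : I →*₀ WithZero (Multiplicative A))

/-- character of the class group, as a function on ideals -/
def psi (χ : AddChar A ℂ) : I →*₀ ℂ := (WithZero.lift' χ.toMonoidHom).comp cl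

lemma psi_zero (χ : AddChar A ℂ) {x : I} (h : cl x = 0) : psi cl χ x = 0 := by
  rw [psi, MonoidWithZeroHom.comp_apply, h, map_zero]

lemma psi_coe (χ : AddChar A ℂ) {x : I} {g : A} (h : cl x = ((Multiplicative.ofAdd g : Multiplicative A) : WithZero (Multiplicative A))) :
    psi cl χ x = χ g := by
  rw [psi, MonoidWithZeroHom.comp_apply, h, WithZero.lift'_coe]; rfl

/-- indicator of a class -/
def ind (g : A) (x : I) : ℂ := if cl x = ((Multiplicative.ofAdd g : Multiplicative A) : WithZero (Multiplicative A)) then 1 else 0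

lemma cl_cases (x : I) : cl x = 0 ∨ ∃ g : A, cl x = ((Multiplicative.ofAdd g : Multiplicative A) : WithZero (Multiplicative A)) := by
  rcases eq_or_ne (cl x) 0 with h | h
  · exact Or.inl h
  · obtain ⟨g, hg⟩ := WithZero.ne_zero_iff_exists.1 h
    exact Or.inr ⟨Multiplicative.toAdd g, hg.symm⟩

lemma ind_coe {x : I} {g : A} (h : cl x = ((Multiplicative.ofAdd g : Multiplicative A) : WithZero (Multiplicative A))) (k : A) :
    ind cl k x = if g = k then 1 else 0 := by
  rw [ind, h]
  congr 1
  rw [WithZero.coe_inj]; simp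

lemma psi_ind (χ : AddChar A ℂ) (x : I) : psi cl χ x = ∑ g, χ g * ind cl g x := by
  rcases cl_cases cl x with h | ⟨g, h⟩
  · rw [psi_zero cl χ h, Finset.sum_eq_zero]
    intro g _
    rw [ind, h, if_neg WithZero.zero_ne_coe, mul_zero]
  · rw [psi_coe cl χ h]
    simp [ind_coe cl h]

lemma ind_psi (g : A) (x : I) : ∑ χ : AddChar A ℂ, χ (-g) * psi cl χ x = Fintype.card A * ind cl g x := by
  rcases cl_cases cl x with h | ⟨k, h⟩
  · rw [ind, h, if_neg WithZero.zero_ne_coe, mul_zero, Finset.sum_eq_zero]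
    intro χ _
    rw [psi_zero cl χ h, mul_zero]
  · rw [ind_coe cl h]
    have : ∀ χ : AddChar A ℂ, χ (-g) * psi cl χ x = χ (k - g) := fun χ => by
      rw [psi_coe cl χ h, ← AddChar.map_add_eq_mul]; congr 1; abel
    simp_rw [this, AddChar.sum_apply_eq_ite, sub_eq_zero]
    split_ifs <;> simp

lemma al_sum (hV : Wt V c) {ι : Type} (s : Finset ι) (w : ι → ℂ) (f : ι → ℕ → ℂ) (x : ℝ) :
    al V (fun n => ∑ i ∈ s, w i * f i n) x = ∑ i ∈ s, w i * al V (f i) x := by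
  obtain ⟨M, hM⟩ := exists_nat_gt (Real.exp (x + c))
  simp_rw [al_eq hV _ hM, Finset.mul_sum, Finset.sum_mul]
  rw [Finset.sum_comm]
  refine Finset.sum_congr rfl fun i _ => Finset.sum_congr rfl fun n _ => by ring

lemma a_psi (χ : AddChar A ℂ) : ⇑(D.a (psi cl χ)) = fun n => ∑ g, χ g * D.S (ind cl g) n := by
  funext n
  rcases eq_or_ne n 0 with rfl | hn
  · simp
  · rw [NormMon.a, D.S_apply _ hn]
    simp_rw [D.S_apply _ hn, psi_ind cl χ, Finset.mul_sum]
    rw [Finset.sum_comm]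

theorem primes_in_class (hV : Wt V c) {κ C : ℝ} (hκ : 0 < κ)
    (HB : ∀ g : A, ∀ x, 0 ≤ x →
      ‖al V (D.S (ind cl g)) x - ((κ * Real.exp x : ℝ) : ℂ)‖ ≤ C * Real.exp (-x))
    (hprimes : ∀ B : ℕ, ∃ p, Prime p ∧ B < D.N p ∧ cl p ≠ 0)
    {d : ℝ} (hd : ∀ n, n ≠ 0 → ∑ y ∈ D.fib n, D.lam y ≤ d * ArithmeticFunction.vonMangoldt n)
    (g : A) (B : ℕ) :
    ∃ x, cl x = ((Multiplicative.ofAdd g : Multiplicative A) : WithZero (Multiplicative A)) ∧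
      (D.N x).Prime ∧ B < D.N x := by
  by_contra hcon
  push Not at hcon
  set m : ℝ := (Fintype.card A : ℝ) with hm
  have hm0 : 0 < m := by rw [hm]; exact_mod_cast Fintype.card_pos
  have hχ1 : ∀ (χ : AddChar A ℂ) g, ‖χ g‖ = 1 := fun χ g => χ.norm_apply g
  -- norms
  have hψ0 : ∀ x, psi cl 0 x = 0 ∨ psi cl 0 x = 1 := fun x => by
    rcases cl_cases cl x with h | ⟨k, h⟩
    · exact Or.inl (psi_zero cl _ h)
    · exact Or.inr (by rw [psi_coe cl _ h]; rfl)
  have hψn : ∀ χ x, ‖psi cl χ x‖ = ‖psi cl 0 x‖ := fun χ x => by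
    rcases cl_cases cl x with h | ⟨k, h⟩
    · rw [psi_zero cl _ h, psi_zero cl _ h]
    · rw [psi_coe cl _ h, psi_coe cl _ h, hχ1, hχ1]
  -- real coefficients
  set ar : ArithmeticFunction ℝ := D.S (fun y => if cl y = 0 then 0 else 1) with har
  set lr : ArithmeticFunction ℝ := D.S (fun y => if cl y = 0 then 0 else D.lam y) with hlr
  have hψ0r : ∀ x, psi cl 0 x = ((if cl x = 0 then 0 else 1 : ℝ) : ℂ) := fun x => by
    rcases cl_cases cl x with h | ⟨k, h⟩
    · rw [psi_zero cl _ h, if_pos h]; simp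
    · rw [psi_coe cl _ h, h, if_neg WithZero.coe_ne_zero]; simp
  have ha_r : ∀ n, D.a (psi cl 0) n = (ar n : ℂ) := fun n => by
    rcases eq_or_ne n 0 with rfl | hn
    · simp
    · rw [NormMon.a, har, D.S_apply _ hn, D.S_apply _ hn, Complex.ofReal_sum]
      exact Finset.sum_congr rfl fun x _ => hψ0r x
  have hl_r : ∀ n, D.Lam (psi cl 0) n = (lr n : ℂ) := fun n => by
    rcases eq_or_ne n 0 with rfl | hn
    · simp
    · rw [NormMon.Lam, hlr, D.S_apply _ hn, D.S_apply _ hn, Complex.ofReal_sum]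
      refine Finset.sum_congr rfl fun x _ => ?_
      rw [hψ0r]; split_ifs <;> simp
  have har0 : ∀ n, 0 ≤ ar n := fun n => by
    rcases eq_or_ne n 0 with rfl | hn
    · simp
    · rw [har, D.S_apply _ hn]
      exact Finset.sum_nonneg fun x _ => by split_ifs <;> norm_num
  have hlr0 : ∀ n, 0 ≤ lr n := fun n => by
    rcases eq_or_ne n 0 with rfl | hn
    · simp
    · rw [hlr, D.S_apply _ hn]
      exact Finset.sum_nonneg fun x _ => by split_ifs; exacts [le_rfl, D.lam_nonneg _]
  have hnr : ∀ x, ‖psi cl 0 x‖ = if cl x = 0 then 0 else 1 := fun x => by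
    rw [hψ0r, Complex.norm_real, Real.norm_eq_abs]; split_ifs <;> simp
  have ha_le : ∀ χ n, ‖D.a (psi cl χ) n‖ ≤ ar n := fun χ n => by
    rcases eq_or_ne n 0 with rfl | hn
    · simp
    · rw [NormMon.a, har, D.S_apply _ hn, D.S_apply _ hn]
      refine (norm_sum_le _ _).trans (Finset.sum_le_sum fun x _ => ?_)
      rw [hψn, hnr]
  have hl_le : ∀ χ n, ‖D.Lam (psi cl χ) n‖ ≤ lr n := fun χ n => by
    rcases eq_or_ne n 0 with rfl | hn
    · simp
    · rw [NormMon.Lam, hlr, D.S_apply _ hn, D.S_apply _ hn]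
      refine (norm_sum_le _ _).trans (Finset.sum_le_sum fun x _ => ?_)
      rw [norm_mul, hψn, hnr, Complex.norm_real, Real.norm_eq_abs, abs_of_nonneg (D.lam_nonneg _)]
      split_ifs <;> simp
  have hlr_le : ∀ n, lr n ≤ ar n * Real.log n := fun n => by
    rcases eq_or_ne n 0 with rfl | hn
    · simp
    · rw [hlr, har, D.S_apply _ hn, D.S_apply _ hn, Finset.sum_mul]
      refine Finset.sum_le_sum fun x hx => ?_
      split_ifs with h
      · simp
      · rw [one_mul, ← (D.mem_fib.1 hx)]
        refine D.lam_le fun h0 => h (by rw [h0, map_zero])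
  -- asymptotics
  have hC : 0 ≤ C := by simpa using (norm_nonneg _).trans (HB 0 0 le_rfl)
  have H1 : ∀ x, 0 ≤ x → ‖al V (D.a (psi cl 0)) x - ((m * κ * Real.exp x : ℝ) : ℂ)‖ ≤
      m * C * Real.exp (-x) := by
    intro x hx
    rw [a_psi D cl, al_sum hV]
    have : ((m * κ * Real.exp x : ℝ) : ℂ) = ∑ g : A, ((κ * Real.exp x : ℝ) : ℂ) := by
      rw [Finset.sum_const, Finset.card_univ, nsmul_eq_mul, hm]; push_cast; ring
    rw [this, ← Finset.sum_sub_distrib]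
    refine (norm_sum_le _ _).trans ?_
    have h2 : ∀ k ∈ Finset.univ, ‖(0 : AddChar A ℂ) k * al V (D.S (ind cl k)) x - ((κ * Real.exp x : ℝ) : ℂ)‖ ≤
        C * Real.exp (-x) := fun k _ => by
      rw [AddChar.zero_apply, one_mul]; exact HB k x hx
    refine (Finset.sum_le_sum h2).trans (le_of_eq ?_)
    rw [Finset.sum_const, Finset.card_univ, nsmul_eq_mul, hm]; ring
  have H2 : ∀ χ : AddChar A ℂ, χ ≠ 0 → ∀ x, 0 ≤ x → ‖al V (D.a (psi cl χ)) x‖ ≤ m * C * Real.exp (-x) := by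
    intro χ hχ x hx
    rw [a_psi D cl, al_sum hV]
    have h0 : ∑ g, χ g * ((κ * Real.exp x : ℝ) : ℂ) = 0 := by
      rw [← Finset.sum_mul, (AddChar.sum_eq_zero_iff_ne_zero).2 hχ, zero_mul]
    rw [← sub_zero (∑ i, _), ← h0, ← Finset.sum_sub_distrib]
    refine (norm_sum_le _ _).trans ?_
    have h2 : ∀ k ∈ Finset.univ, ‖χ k * al V (D.S (ind cl k)) x - χ k * ((κ * Real.exp x : ℝ) : ℂ)‖ ≤
        C * Real.exp (-x) := fun k _ => by
      rw [← mul_sub, norm_mul, hχ1, one_mul]; exact HB k x hx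
    refine (Finset.sum_le_sum h2).trans (le_of_eq ?_)
    rw [Finset.sum_const, Finset.card_univ, nsmul_eq_mul, hm]; ring
  have H1' : ∀ x, 0 ≤ x → ‖al V (fun n => (ar n : ℂ)) x - ((m * κ * Real.exp x : ℝ) : ℂ)‖ ≤
      m * C * Real.exp (-x) := by
    have : (fun n => (ar n : ℂ)) = ⇑(D.a (psi cl 0)) := funext fun n => (ha_r n).symm
    rw [this]; exact H1
  -- summability
  have s1 : ∀ s, 1 < s → Summable fun n => ar n * EE s n := fun s hs =>
    summable_of_al hV ar har0 (by simp) H1' hs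
  have s2 : ∀ s, 1 < s → Summable fun n => ar n * Real.log n * EE s n := fun s hs => by
    have := summable_log (a := fun n => (ar n : ℂ)) (s := (1 + s) / 2) (t := s) (by linarith)
      ((s1 ((1 + s) / 2) (by linarith)).congr fun n => by
        rw [Complex.norm_real, Real.norm_eq_abs, abs_of_nonneg (har0 n)])
    refine this.congr fun n => ?_
    rw [Complex.norm_real, Real.norm_eq_abs, abs_of_nonneg (har0 n)]
  have s3 : ∀ s, 1 < s → Summable fun n => lr n * EE s n := fun s hs =>
    Summable.of_nonneg_of_le (fun n => mul_nonneg (hlr0 n) (EE_pos _ _).le)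
      (fun n => mul_le_mul_of_nonneg_right (hlr_le n) (EE_pos _ _).le) (s2 s hs)
  have s4 : ∀ χ s, 1 < s → Summable fun n => ‖D.a (psi cl χ) n‖ * EE s n := fun χ s hs =>
    Summable.of_nonneg_of_le (fun n => mul_nonneg (norm_nonneg _) (EE_pos _ _).le)
      (fun n => mul_le_mul_of_nonneg_right (ha_le χ n) (EE_pos _ _).le) (s1 s hs)
  have s5 : ∀ χ s, 1 < s → Summable fun n => ‖D.Lam (psi cl χ) n‖ * EE s n := fun χ s hs =>
    Summable.of_nonneg_of_le (fun n => mul_nonneg (norm_nonneg _) (EE_pos _ _).le)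
      (fun n => mul_le_mul_of_nonneg_right (hl_le χ n) (EE_pos _ _).le) (s3 s hs)
  have s6 : ∀ χ s, 1 < s → Summable fun n => D.Lam (psi cl χ) n * (EE s n : ℂ) := fun χ s hs => by
    refine Summable.of_norm ((s5 χ s hs).congr fun n => ?_)
    rw [norm_mul, Complex.norm_real, Real.norm_eq_abs, abs_of_pos (EE_pos _ _)]
  have s7 : ∀ χ s, 1 < s → Summable fun n => D.a (psi cl χ) n * (EE s n : ℂ) := fun χ s hs => by
    refine Summable.of_norm ((s4 χ s hs).congr fun n => ?_)
    rw [norm_mul, Complex.norm_real, Real.norm_eq_abs, abs_of_pos (EE_pos _ _)]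
  -- trivial character
  have hlarge : ∀ K : ℝ, ∃ δ > 0, ∀ s, 1 < s → s < 1 + δ → K ≤ ∑' n, lr n * EE s n := by
    refine D_large ar lr har0 (fun s hs => ?_) s1 s2
      (fun K => Dz_large hV ar har0 (by simp) (mul_pos hm0 hκ) H1' K)
    have h3 := Dz_mul (s7 0 s hs) (s6 0 s hs)
    rw [← D.mlog_a] at h3
    simp only [Dz, mlog_apply, ha_r, hl_r] at h3
    exact_mod_cast h3
  -- other characters
  have hbd : ∀ χ : AddChar A ℂ, χ ≠ 0 → ∃ δ > 0, ∃ K, ∀ s, 1 < s → s < 1 + δ →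
      ‖Dz (D.Lam (psi cl χ)) s‖ ≤ K := by
    intro χ hχ
    refine D_bdd hV _ _ (D.mlog_a _) (s4 χ) (s5 χ) (H2 χ hχ) ?_
    refine nonvan D hV (psi cl 0) (psi cl χ) hψ0 (hψn χ) (h := Fintype.card A) Fintype.card_pos ?_ ?_ H1
      (H2 χ hχ)
    · intro x hx
      rcases cl_cases cl x with h | ⟨k, h⟩
      · rw [psi_zero cl _ h] at hx; exact absurd hx zero_ne_one
      · rw [psi_coe cl _ h, ← AddChar.map_nsmul_eq_pow, card_nsmul_eq_zero, AddChar.map_zero_eq_one]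
    · intro N
      obtain ⟨p, h1, h2, h3⟩ := hprimes N
      refine ⟨p, h1, h2, ?_⟩
      rw [hψ0r, if_neg h3]; simp
  -- the class g
  set lg : ArithmeticFunction ℝ := D.S (fun y => if cl y = ((Multiplicative.ofAdd g : Multiplicative A) :
    WithZero (Multiplicative A)) then D.lam y else 0) with hlg
  have hid : ∀ s, 1 < s → ∑ χ : AddChar A ℂ, χ (-g) * Dz (D.Lam (psi cl χ)) s =
      ((m * ∑' n, lg n * EE s n : ℝ) : ℂ) := by
    intro s hs
    simp_rw [Dz, ← tsum_mul_left]
    rw [← Summable.tsum_finsetSum fun χ _ => (s6 χ s hs).mul_left _, Complex.ofReal_tsum]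
    congr 1; funext n
    rcases eq_or_ne n 0 with rfl | hn
    · simp
    · simp_rw [NormMon.Lam, hlg, D.S_apply _ hn]
      have : ∀ χ : AddChar A ℂ, χ (-g) * ((∑ x ∈ D.fib n, psi cl χ x * (D.lam x : ℂ)) * (EE s n : ℂ)) =
          ∑ x ∈ D.fib n, (χ (-g) * psi cl χ x) * ((D.lam x : ℂ) * (EE s n : ℂ)) := fun χ => by
        rw [Finset.sum_mul, Finset.mul_sum]
        exact Finset.sum_congr rfl fun x _ => by ring
      simp_rw [this]
      rw [Finset.sum_comm]
      simp_rw [← Finset.sum_mul, ind_psi cl g]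
      rw [Complex.ofReal_mul, Complex.ofReal_mul, Complex.ofReal_sum, Finset.sum_mul, Finset.mul_sum]
      refine Finset.sum_congr rfl fun x _ => ?_
      rw [ind, hm]
      split_ifs <;> simp
  -- upper bound for the class g
  set R : ℕ → ℝ := fun n => (if n.Prime then 0 else ArithmeticFunction.vonMangoldt.residueClass (q := 1) 0 n) / n
    with hR
  have hRs : Summable R := ArithmeticFunction.vonMangoldt.summable_residueClass_non_primes_div (q := 1) 0
  have hres : ∀ n, ArithmeticFunction.vonMangoldt.residueClass (q := 1) 0 n = ArithmeticFunction.vonMangoldt n := fun n =>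
    Set.indicator_of_mem (by simp only [Set.mem_ofPred_eq]; exact Subsingleton.elim _ _) _
  have hlg_le : ∀ n, n ≠ 0 → lg n ≤ |d| * ArithmeticFunction.vonMangoldt n := fun n hn => by
    rw [hlg, D.S_apply _ hn]
    refine (Finset.sum_le_sum fun x _ => ?_).trans ((hd n hn).trans
      (mul_le_mul_of_nonneg_right (le_abs_self d) ArithmeticFunction.vonMangoldt_nonneg))
    split_ifs; exacts [le_rfl, D.lam_nonneg x]
  have hlg_zero : ∀ n, n.Prime → B < n → lg n = 0 := fun n hn hB => by
    rw [hlg, D.S_apply _ hn.ne_zero]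
    refine Finset.sum_eq_zero fun x hx => if_neg fun h => ?_
    have h1 := D.mem_fib.1 hx
    exact absurd (hcon x h (h1 ▸ hn)) (by rw [h1]; exact not_le.2 hB)
  set T : ℕ → ℝ := fun n => if n ∈ Finset.range (B + 1) then |d| * ArithmeticFunction.vonMangoldt n else 0 with hT
  have hTs : Summable T := summable_of_ne_finset_zero (s := Finset.range (B + 1)) fun n hn => if_neg hn
  have hup : ∀ s, 1 < s → ∑' n, lg n * EE s n ≤ ∑' n, (|d| * R n + T n) := by
    intro s hs
    have hS2 : Summable fun n => |d| * R n + T n := (hRs.mul_left _).add hTs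
    have hle : ∀ n, lg n * EE s n ≤ |d| * R n + T n := by
      intro n
      have hR0 : 0 ≤ R n := by
        simp only [hR, hres]
        refine div_nonneg ?_ (Nat.cast_nonneg n)
        split_ifs; exacts [le_rfl, ArithmeticFunction.vonMangoldt_nonneg]
      have hT0 : 0 ≤ T n := by
        simp only [hT]
        split_ifs; exacts [mul_nonneg (abs_nonneg _) ArithmeticFunction.vonMangoldt_nonneg, le_rfl]
      have hdR := mul_nonneg (abs_nonneg d) hR0
      rcases eq_or_ne n 0 with rfl | hn
      · rw [lg.map_zero, zero_mul]; linarith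
      have hE1 : EE s n ≤ 1 := Real.exp_le_one_iff.2 (by nlinarith [log_nat_nonneg n])
      have hnp : (0 : ℝ) < n := by positivity
      have hE2 : EE s n ≤ 1 / n := by
        refine (EE_le hs.le n).trans (le_of_eq ?_)
        rw [EE, neg_one_mul, Real.exp_neg, Real.exp_log hnp, one_div]
      have hvm : 0 ≤ |d| * ArithmeticFunction.vonMangoldt n :=
        mul_nonneg (abs_nonneg _) ArithmeticFunction.vonMangoldt_nonneg
      by_cases hnB : n ∈ Finset.range (B + 1)
      · have : T n = |d| * ArithmeticFunction.vonMangoldt n := if_pos hnB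
        have h4 := mul_le_mul (hlg_le n hn) hE1 (EE_pos _ _).le hvm
        linarith
      · rw [Finset.mem_range, not_lt] at hnB
        by_cases hp : n.Prime
        · rw [hlg_zero n hp (by omega), zero_mul]; linarith
        · have : R n = ArithmeticFunction.vonMangoldt n / n := by
            simp only [hR, hres, if_neg hp]
          have h4 := mul_le_mul (hlg_le n hn) hE2 (EE_pos _ _).le hvm
          rw [this]
          have h5 : |d| * ArithmeticFunction.vonMangoldt n * (1 / n) =
            |d| * (ArithmeticFunction.vonMangoldt n / n) := by ring
          linarith
    by_cases hS1 : Summable fun n => lg n * EE s n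
    · exact Summable.tsum_le_tsum hle hS1 hS2
    · exfalso
      apply hS1
      refine Summable.of_nonneg_of_le (fun n => mul_nonneg ?_ (EE_pos _ _).le) hle hS2
      rcases eq_or_ne n 0 with rfl | hn
      · simp
      · rw [hlg, D.S_apply _ hn]
        exact Finset.sum_nonneg fun x _ => by split_ifs; exacts [D.lam_nonneg x, le_rfl]
  -- combine
  have hbd' : ∀ χ : AddChar A ℂ, ∃ δ > 0, ∃ K, χ ≠ 0 → ∀ s, 1 < s → s < 1 + δ →
      ‖Dz (D.Lam (psi cl χ)) s‖ ≤ K := fun χ => by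
    by_cases hχ : χ = 0
    · exact ⟨1, one_pos, 0, fun h => absurd hχ h⟩
    · obtain ⟨δ, h1, K, h2⟩ := hbd χ hχ
      exact ⟨δ, h1, K, fun _ => h2⟩
  choose δ hδ K hK using hbd'
  set U := m * ∑' n, (|d| * R n + T n) with hU
  obtain ⟨δ0, hδ0, hδ1⟩ := hlarge (U + ∑ χ, |K χ| + 1)
  obtain ⟨ε, hε, hε0, hεχ⟩ : ∃ ε > 0, ε < δ0 ∧ ∀ χ, ε < δ χ := by
    refine ⟨(min δ0 (Finset.univ.inf' Finset.univ_nonempty δ)) / 2, ?_, ?_, ?_⟩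
    · have : 0 < Finset.univ.inf' Finset.univ_nonempty δ := (Finset.lt_inf'_iff _).2 fun χ _ => hδ χ
      positivity
    · have := min_le_left δ0 (Finset.univ.inf' Finset.univ_nonempty δ); linarith
    · intro χ
      have h1 := min_le_right δ0 (Finset.univ.inf' Finset.univ_nonempty δ)
      have h2 := Finset.inf'_le δ (Finset.mem_univ χ)
      have := hδ χ
      linarith
  have hs1 : (1 : ℝ) < 1 + ε := by linarith
  have h1 := hid (1 + ε) hs1
  rw [← Finset.add_sum_erase _ _ (Finset.mem_univ (0 : AddChar A ℂ))] at h1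
  have h2 : Dz (D.Lam (psi cl 0)) (1 + ε) = ((∑' n, lr n * EE (1 + ε) n : ℝ) : ℂ) := by
    simp only [Dz, hl_r]; push_cast; rfl
  rw [h2, AddChar.zero_apply, one_mul] at h1
  have h3 : ‖∑ χ ∈ Finset.univ.erase (0 : AddChar A ℂ), χ (-g) * Dz (D.Lam (psi cl χ)) (1 + ε)‖ ≤ ∑ χ, |K χ| := by
    refine (norm_sum_le _ _).trans ((Finset.sum_le_sum fun χ hχ => ?_).trans
      (Finset.sum_le_sum_of_subset_of_nonneg (Finset.erase_subset _ _) fun χ _ _ => abs_nonneg _))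
    rw [norm_mul, hχ1, one_mul]
    exact (hK χ (Finset.ne_of_mem_erase hχ) _ hs1 (by linarith [hεχ χ])).trans (le_abs_self _)
  have h4 := congrArg Complex.re h1
  rw [Complex.add_re, Complex.ofReal_re, Complex.ofReal_re] at h4
  have h5 := hδ1 (1 + ε) hs1 (by linarith)
  have h6 := (abs_le.1 ((Complex.abs_re_le_norm _).trans h3)).1
  have h7 := mul_le_mul_of_nonneg_left (hup (1 + ε) hs1) hm0.le
  rw [← hU] at h7
  linarith

end fin
end PT

/-! ### Helper material, part B1 -/

/-! ## Part B1: smooth lattice sums -/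
namespace LSum

section
open MeasureTheory Module

variable {E : Type} [NormedAddCommGroup E] [NormedSpace ℝ E] {ι : Type} [Fintype ι] (b : Basis ι ℝ E)

def pt (k : ι → ℤ) : E := ∑ i, (k i : ℝ) • b i

structure CC (f : E → ℝ) (r : ℝ) : Prop where
  smooth : ContDiff ℝ (⊤ : ℕ∞) f
  supp : ∀ x, r < ‖x‖ → f x = 0

def LS (f : E → ℝ) (T : ℝ) (y : E) : ℝ := ∑' k : ι → ℤ, f (T⁻¹ • (y + pt b k))

lemma pt_repr (k : ι → ℤ) (i : ι) : b.repr (pt b k) i = k i := by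
  unfold pt
  rw [Basis.repr_sum_self]

lemma pt_add (k l : ι → ℤ) : pt b (k + l) = pt b k + pt b l := by
  simp [pt, add_smul, Finset.sum_add_distrib]

lemma box (r R : ℝ) (hr : 0 ≤ r) (hR : 0 ≤ R) : ∃ C : ℝ, 0 ≤ C ∧ ∀ T : ℝ, 1 ≤ T → ∃ s : Finset (ι → ℤ),
    (s.card : ℝ) ≤ C * T ^ Fintype.card ι ∧
    ∀ y : E, ‖y‖ ≤ R → ∀ k ∉ s, r < ‖T⁻¹ • (y + pt b k)‖ := by
  classical
  have : FiniteDimensional ℝ E := b.finiteDimensional_of_finite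
  set A : ℝ := ∑ i, ‖(b.coord i).toContinuousLinearMap‖ with hA
  have hA0 : 0 ≤ A := Finset.sum_nonneg fun i _ => norm_nonneg _
  have hb : ∀ x i, |b.repr x i| ≤ A * ‖x‖ := by
    intro x i
    refine ((b.coord i).toContinuousLinearMap.le_opNorm x).trans ?_
    exact mul_le_mul_of_nonneg_right (Finset.single_le_sum (f := fun i => ‖(b.coord i).toContinuousLinearMap‖)
      (fun i _ => norm_nonneg _) (Finset.mem_univ i)) (norm_nonneg _)
  refine ⟨(2 * (A * (r + R)) + 1) ^ Fintype.card ι, by positivity, fun T hT => ?_⟩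
  set N := ⌊A * ((r + R) * T)⌋₊ with hN
  refine ⟨Fintype.piFinset fun _ => Finset.Icc (-(N : ℤ)) N, ?_, ?_⟩
  · rw [Fintype.card_piFinset]
    simp only [Int.card_Icc, Finset.prod_const, Finset.card_univ]
    have : ((N : ℤ) + 1 - -(N : ℤ)).toNat = 2 * N + 1 := by omega
    rw [this, ← mul_pow]
    push_cast
    have h1 : (N : ℝ) ≤ A * ((r + R) * T) := Nat.floor_le (by positivity)
    gcongr
    nlinarith
  · intro y hy k hk
    by_contra hcon
    rw [not_lt] at hcon
    apply hk
    rw [Fintype.mem_piFinset]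
    intro i
    have hT0 : 0 < T := by linarith
    rw [norm_smul, norm_inv, Real.norm_eq_abs, abs_of_pos hT0, inv_mul_le_iff₀ hT0] at hcon
    have h1 : ‖pt b k‖ ≤ (r + R) * T := by
      have : ‖pt b k‖ ≤ ‖y + pt b k‖ + ‖y‖ := by
        have := norm_sub_le (y + pt b k) y
        simpa using this
      nlinarith
    have h2 := hb (pt b k) i
    rw [pt_repr] at h2
    have h3 : |(k i : ℝ)| ≤ A * ((r + R) * T) := h2.trans (mul_le_mul_of_nonneg_left h1 hA0)
    have h4 : (k i).natAbs ≤ N := by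
      apply Nat.le_floor
      rw [Nat.cast_natAbs]
      push_cast
      exact h3
    rw [Finset.mem_Icc]
    omega

variable {b}

lemma LS_eq {f : E → ℝ} {r : ℝ} (hf : CC f r) {T : ℝ} {s : Finset (ι → ℤ)} {y : E}
    (h : ∀ k ∉ s, r < ‖T⁻¹ • (y + pt b k)‖) : LS b f T y = ∑ k ∈ s, f (T⁻¹ • (y + pt b k)) :=
  tsum_eq_sum fun k hk => hf.supp _ (h k hk)

lemma LS_periodic (f : E → ℝ) (T : ℝ) (y : E) (l : ι → ℤ) : LS b f T (y + pt b l) = LS b f T y := by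
  unfold LS
  rw [← (Equiv.addLeft l).tsum_eq (fun k => f (T⁻¹ • (y + pt b k)))]
  refine tsum_congr fun k => ?_
  simp [pt_add, add_assoc]

lemma CC.deriv {f : E → ℝ} {r : ℝ} (hf : CC f r) (w : E) : CC (fun x => fderiv ℝ f x w) r where
  smooth := by
    have := hf.smooth.fderiv_right (m := (⊤ : ℕ∞)) (by simp)
    exact this.clm_apply contDiff_const
  supp := by
    intro x hx
    have : f =ᶠ[nhds x] fun _ => 0 := by
      have ho : IsOpen {x : E | r < ‖x‖} := isOpen_lt continuous_const continuous_norm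
      filter_upwards [ho.mem_nhds hx] with z hz using hf.supp z hz
    rw [this.fderiv_eq]
    simp

lemma LS_hasDeriv {f : E → ℝ} {r : ℝ} (hr : 0 ≤ r) (hf : CC f r) {T : ℝ} (hT : 1 ≤ T) (y w : E) (t : ℝ) :
    HasDerivAt (fun t : ℝ => LS b f T (y + t • w))
      (T⁻¹ * LS b (fun x => fderiv ℝ f x w) T (y + t • w)) t := by
  obtain ⟨C, -, hC⟩ := box b r (‖y‖ + (|t| + 1) * ‖w‖) hr (by positivity)
  obtain ⟨s, -, hs⟩ := hC T hT
  have hbd : ∀ t' : ℝ, |t' - t| < 1 → ‖y + t' • w‖ ≤ ‖y‖ + (|t| + 1) * ‖w‖ := by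
    intro t' ht'
    refine (norm_add_le _ _).trans ?_
    rw [norm_smul, Real.norm_eq_abs]
    have : |t'| ≤ |t| + 1 := by
      have := abs_add_le (t' - t) t
      rw [sub_add_cancel] at this
      linarith
    gcongr
  rw [LS_eq (hf.deriv w) (hs _ (hbd t (by simp)))]
  have hev : (fun t : ℝ => LS b f T (y + t • w)) =ᶠ[nhds t]
      fun t => ∑ k ∈ s, f (T⁻¹ • (y + t • w + pt b k)) := by
    have ho : {t' : ℝ | |t' - t| < 1} ∈ nhds t := by
      simpa [Metric.ball, Real.dist_eq] using Metric.ball_mem_nhds t one_pos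
    filter_upwards [ho] with t' ht'
    exact LS_eq hf (hs _ (hbd t' ht'))
  refine HasDerivAt.congr_of_eventuallyEq ?_ hev
  rw [Finset.mul_sum]
  refine HasDerivAt.fun_sum fun k _ => ?_
  have h1 : HasDerivAt (fun t : ℝ => T⁻¹ • (y + t • w + pt b k)) (T⁻¹ • w) t := by
    have h2 : HasDerivAt (fun t : ℝ => t • w) w t := by
      simpa using (hasDerivAt_id t).smul_const w
    exact ((h2.const_add y).add_const (pt b k)).const_smul T⁻¹
  have h2 := (hf.smooth.differentiable (by simp) (T⁻¹ • (y + t • w + pt b k))).hasFDerivAt.comp_hasDerivAt t h1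
  convert! h2 using 1
  simp

lemma LS_lin {f : E → ℝ} {r : ℝ} (hr : 0 ≤ r) (hf : CC f r) {T : ℝ} (hT : 1 ≤ T) (y w : E) :
    LS b (fun x => fderiv ℝ f x w) T y =
      ∑ i, b.repr w i * LS b (fun x => fderiv ℝ f x (b i)) T y := by
  obtain ⟨C, -, hC⟩ := box b r ‖y‖ hr (norm_nonneg _)
  obtain ⟨s, -, hs⟩ := hC T hT
  rw [LS_eq (hf.deriv w) (hs _ le_rfl)]
  simp_rw [LS_eq (hf.deriv (b _)) (hs _ le_rfl), Finset.mul_sum]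
  rw [Finset.sum_comm]
  refine Finset.sum_congr rfl fun k _ => ?_
  have h1 : w = ∑ i, b.repr w i • b i := (b.sum_repr w).symm
  calc _ = fderiv ℝ f (T⁻¹ • (y + pt b k)) (∑ i, b.repr w i • b i) := congrArg _ h1
    _ = _ := by simp only [map_sum, map_smul, smul_eq_mul]

lemma LS_fract (f : E → ℝ) (T : ℝ) (y : E) : LS b f T (ZSpan.fract b y) = LS b f T y := by
  rw [← LS_periodic f T (ZSpan.fract b y) (fun i => ⌊b.repr y i⌋)]
  congr 1
  apply b.repr.injective
  ext i
  simp [pt_repr]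

lemma CC.bound {f : E → ℝ} {r : ℝ} (hf : CC f r) [FiniteDimensional ℝ E] :
    ∃ M, 0 ≤ M ∧ ∀ x, |f x| ≤ M := by
  have : HasCompactSupport f := HasCompactSupport.intro (isCompact_closedBall (0 : E) r) fun x hx => by
    apply hf.supp
    simpa using hx
  obtain ⟨M, hM⟩ := this.exists_bound_of_continuous hf.smooth.continuous
  exact ⟨M, (norm_nonneg _).trans (hM 0), hM⟩

lemma osc (r : ℝ) (hr : 0 ≤ r) (K : ℕ) : ∀ f : E → ℝ, CC f r → ∃ C : ℝ, 0 ≤ C ∧ ∀ T : ℝ, 1 ≤ T → ∀ y y' : E,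
    |LS b f T y - LS b f T y'| ≤ C * T ^ Fintype.card ι / T ^ K := by
  have : FiniteDimensional ℝ E := b.finiteDimensional_of_finite
  induction K with
  | zero =>
    intro f hf
    obtain ⟨M, hM0, hM⟩ := hf.bound
    obtain ⟨C, hC0, hC⟩ := box b r (∑ i, ‖b i‖) hr (by positivity)
    refine ⟨2 * (C * M), by positivity, fun T hT y y' => ?_⟩
    obtain ⟨s, hsc, hs⟩ := hC T hT
    have hb : ∀ y, |LS b f T y| ≤ C * M * T ^ Fintype.card ι := by
      intro y
      rw [← LS_fract, LS_eq hf (hs _ (ZSpan.norm_fract_le b y))]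
      refine (Finset.abs_sum_le_sum_abs _ _).trans ?_
      refine (Finset.sum_le_sum fun k _ => hM _).trans ?_
      rw [Finset.sum_const, nsmul_eq_mul]
      nlinarith
    have := abs_sub (LS b f T y) (LS b f T y')
    have h1 := hb y
    have h2 := hb y'
    rw [pow_zero, div_one]
    linarith
  | succ K ih =>
    intro f hf
    choose Ci hCi0 hCi using fun i => ih _ (hf.deriv (b i))
    refine ⟨∑ i, Ci i, Finset.sum_nonneg fun i _ => hCi0 i, fun T hT => ?_⟩
    have hT0 : 0 < T := by linarith
    have hbd : ∀ i y, |LS b (fun x => fderiv ℝ f x (b i)) T y| ≤ Ci i * T ^ Fintype.card ι / T ^ K := by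
      intro i y
      have hd := fun t => LS_hasDeriv (b := b) hr hf hT y (b i) t
      have hper : LS b f T (y + (0 : ℝ) • b i) = LS b f T (y + (1 : ℝ) • b i) := by
        classical
        rw [zero_smul, add_zero, one_smul, ← LS_periodic f T y (Pi.single i 1)]
        congr 2
        simp [pt, Pi.single_apply]
      obtain ⟨c, -, hc⟩ := exists_hasDerivAt_eq_zero (zero_lt_one' ℝ)
        (fun t _ => (hd t).continuousAt.continuousWithinAt) hper (fun t _ => hd t)
      have h0 : LS b (fun x => fderiv ℝ f x (b i)) T (y + c • b i) = 0 := by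
        rcases mul_eq_zero.1 hc with h | h
        · exact absurd h (by positivity)
        · exact h
      have := hCi i T hT y (y + c • b i)
      rwa [h0, sub_zero] at this
    intro y y'
    rw [← LS_fract f T y, ← LS_fract f T y']
    set z := ZSpan.fract b y
    set z' := ZSpan.fract b y'
    have hd := fun t => LS_hasDeriv (b := b) hr hf hT z' (z - z') t
    obtain ⟨c, -, hc⟩ := exists_hasDerivAt_eq_slope _ _ (zero_lt_one' ℝ)
        (fun t _ => (hd t).continuousAt.continuousWithinAt) (fun t _ => hd t)
    simp only [one_smul, add_sub_cancel, zero_smul, add_zero, sub_zero, div_one] at hc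
    rw [← hc, abs_mul, abs_inv, abs_of_pos hT0, LS_lin hr hf hT, pow_succ, ← div_div, inv_mul_eq_div]
    gcongr
    refine (Finset.abs_sum_le_sum_abs _ _).trans ?_
    rw [Finset.sum_mul, Finset.sum_div]
    refine Finset.sum_le_sum fun i _ => ?_
    rw [abs_mul]
    have hw : |b.repr (z - z') i| ≤ 1 := by
      rw [map_sub, Finsupp.sub_apply, ZSpan.repr_fract_apply, ZSpan.repr_fract_apply, abs_le]
      have := Int.fract_nonneg (b.repr y i)
      have := Int.fract_nonneg (b.repr y' i)
      have := Int.fract_lt_one (b.repr y i)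
      have := Int.fract_lt_one (b.repr y' i)
      constructor <;> linarith
    refine (mul_le_of_le_one_left (abs_nonneg _) hw).trans (hbd i _)

lemma CC.hcs {f : E → ℝ} {r : ℝ} (hf : CC f r) [FiniteDimensional ℝ E] : HasCompactSupport f :=
  HasCompactSupport.intro (isCompact_closedBall (0 : E) r) fun x hx => by
    apply hf.supp
    simpa using hx

variable [MeasurableSpace E] [BorelSpace E] (μ : Measure E) [μ.IsAddHaarMeasure]

lemma LS_mean {f : E → ℝ} {r : ℝ} (hr : 0 ≤ r) (hf : CC f r) {T : ℝ} (hT : 1 ≤ T) :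
    IntegrableOn (LS b f T) (ZSpan.fundamentalDomain b) μ ∧
    ∫ y in ZSpan.fundamentalDomain b, LS b f T y ∂μ = T ^ Fintype.card ι * ∫ x, f x ∂μ := by
  have : FiniteDimensional ℝ E := b.finiteDimensional_of_finite
  have hT0 : 0 < T := by linarith
  obtain ⟨C, -, hC⟩ := box b r (∑ i, ‖b i‖) hr (by positivity)
  obtain ⟨s, -, hs⟩ := hC T hT
  have hfi : ∀ k : ι → ℤ, Integrable (fun x => f (T⁻¹ • (x + pt b k))) μ := by
    intro k
    have h1 : Integrable f μ := hf.smooth.continuous.integrable_of_hasCompactSupport hf.hcs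
    have h2 : Integrable (fun x => f (T⁻¹ • x)) μ := h1.comp_smul (inv_ne_zero hT0.ne')
    exact h2.comp_add_right (pt b k)
  have hz : ∀ y ∈ ZSpan.fundamentalDomain b, ∀ k ∉ s, r < ‖T⁻¹ • (y + pt b k)‖ := by
    intro y hy
    apply hs
    rw [← ZSpan.fract_eq_self.2 hy]
    exact ZSpan.norm_fract_le b y
  have hfin : ∀ y ∈ ZSpan.fundamentalDomain b,
      LS b f T y = ∑ k ∈ s, f (T⁻¹ • (y + pt b k)) := fun y hy => LS_eq hf (hz y hy)
  have hms := ZSpan.fundamentalDomain_measurableSet b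
  constructor
  · refine (integrableOn_congr_fun hfin hms).2 ?_
    exact integrable_finsetSum _ fun k _ => (hfi k).integrableOn
  rw [setIntegral_congr_fun hms hfin, integral_finsetSum _ fun k _ => (hfi k).integrableOn]
  have h1 : T ^ Fintype.card ι * ∫ x, f x ∂μ = ∫ x, f (T⁻¹ • x) ∂μ := by
    rw [Measure.integral_comp_inv_smul, smul_eq_mul, finrank_eq_card_basis b, abs_of_pos (by positivity)]
  have hi0 : Integrable (fun x => f (T⁻¹ • x)) μ := by simpa [pt] using hfi 0
  have : VAddInvariantMeasure (Submodule.span ℤ (Set.range b)) E μ :=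
    inferInstanceAs <| VAddInvariantMeasure (Submodule.span ℤ (Set.range b)).toAddSubgroup E μ
  rw [h1, (ZSpan.isAddFundamentalDomain b μ).integral_eq_tsum'' _ hi0]
  let e : (ι → ℤ) ≃ Submodule.span ℤ (Set.range b) := (b.restrictScalars ℤ).equivFun.symm.toEquiv
  have he : ∀ k, ((e k : Submodule.span ℤ (Set.range b)) : E) = pt b k := by
    intro k
    simp only [e, LinearEquiv.coe_toEquiv, Basis.equivFun_symm_apply, pt]
    rw [AddSubmonoidClass.coe_finsetSum]
    refine Finset.sum_congr rfl fun i _ => ?_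
    simp [← Int.cast_smul_eq_zsmul ℝ]
  rw [← e.tsum_eq]
  rw [tsum_eq_sum (s := s)]
  · refine Finset.sum_congr rfl fun k _ => ?_
    refine setIntegral_congr_fun hms fun y _ => ?_
    simp only [Submodule.vadd_def, he, vadd_eq_add]
    rw [add_comm]
  · intro k hk
    rw [setIntegral_congr_fun (g := fun _ => 0) hms, integral_zero]
    intro y hy
    simp only [Submodule.vadd_def, he, vadd_eq_add]
    rw [add_comm]
    exact hf.supp _ (hz y hy k hk)

theorem LS_asymp {f : E → ℝ} {r : ℝ} (hr : 0 ≤ r) (hf : CC f r) (K : ℕ) : ∃ C : ℝ, ∀ T : ℝ, 1 ≤ T → ∀ y : E,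
    |LS b f T y - (∫ x, f x ∂μ) / μ.real (ZSpan.fundamentalDomain b) * T ^ Fintype.card ι| ≤ C / T ^ K := by
  have : FiniteDimensional ℝ E := b.finiteDimensional_of_finite
  obtain ⟨C, hC0, hC⟩ := osc (b := b) r hr (Fintype.card ι + K) f hf
  refine ⟨C, fun T hT y => ?_⟩
  have hT0 : 0 < T := by linarith
  have hfin : μ (ZSpan.fundamentalDomain b) ≠ ⊤ :=
    ((ZSpan.fundamentalDomain_isBounded b).measure_lt_top).ne
  have hpos : 0 < μ.real (ZSpan.fundamentalDomain b) :=
    ENNReal.toReal_pos (ZSpan.measure_fundamentalDomain_ne_zero b) hfin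
  have hC' : ∀ y', |LS b f T y - LS b f T y'| ≤ C / T ^ K := by
    intro y'
    refine (hC T hT y y').trans (le_of_eq ?_)
    rw [pow_add]
    field_simp
  obtain ⟨hintg, hmean⟩ := LS_mean (b := b) μ hr hf hT
  have h1 : ∫ y' in ZSpan.fundamentalDomain b, (LS b f T y - LS b f T y') ∂μ =
      μ.real (ZSpan.fundamentalDomain b) * LS b f T y - T ^ Fintype.card ι * ∫ x, f x ∂μ := by
    rw [integral_sub (integrableOn_const (C := LS b f T y) hfin) hintg, hmean, setIntegral_const, smul_eq_mul]
  have h2 := norm_setIntegral_le_of_norm_le_const (μ := μ) (s := ZSpan.fundamentalDomain b)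
    (f := fun y' => LS b f T y - LS b f T y') (C := C / T ^ K) hfin.lt_top (fun y' _ => hC' y')
  rw [h1, Real.norm_eq_abs] at h2
  have h3 : LS b f T y - (∫ x, f x ∂μ) / μ.real (ZSpan.fundamentalDomain b) * T ^ Fintype.card ι =
    (μ.real (ZSpan.fundamentalDomain b) * LS b f T y - T ^ Fintype.card ι * ∫ x, f x ∂μ) /
      μ.real (ZSpan.fundamentalDomain b) := by
    field_simp
  rw [h3, abs_div, abs_of_pos hpos, div_le_iff₀ hpos]
  exact h2

end
end LSum

/-! ### Helper material, part B2 -/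

/-! ## Part B2: a smooth weight on the mixed space -/
namespace UW
open NumberField NumberField.mixedEmbedding NumberField.Units NumberField.Units.dirichletUnitTheorem
open MeasureTheory Module
open scoped Classical

def phi (c : ℝ) : ℝ := Real.smoothTransition (c + 1) - Real.smoothTransition c

lemma phi_contDiff : ContDiff ℝ (⊤ : ℕ∞) phi :=
  (Real.smoothTransition.contDiff.comp (contDiff_id.add contDiff_const)).sub Real.smoothTransition.contDiff

lemma phi_nonneg (c : ℝ) : 0 ≤ phi c := sub_nonneg.2 (Real.smoothTransition.monotone (by linarith))

lemma phi_zero : phi 0 = 1 := by simp [phi]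

lemma phi_le {c : ℝ} (h : c ≤ -1) : phi c = 0 := by
  rw [phi, Real.smoothTransition.zero_of_nonpos (by linarith), Real.smoothTransition.zero_of_nonpos (by linarith),
    sub_zero]

lemma phi_ge {c : ℝ} (h : 1 ≤ c) : phi c = 0 := by
  rw [phi, Real.smoothTransition.one_of_one_le (by linarith), Real.smoothTransition.one_of_one_le (by linarith),
    sub_self]

lemma phi_abs {c : ℝ} (h : phi c ≠ 0) : |c| ≤ 1 := by
  rw [abs_le]
  constructor
  · by_contra h1
    exact h (phi_le (by linarith))
  · by_contra h1
    exact h (phi_ge (by linarith))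

lemma phi_fin (c : ℝ) : ∃ s : Finset ℤ, (∀ k ∉ s, phi (c + k) = 0) ∧ ∑ k ∈ s, phi (c + k) = 1 := by
  refine ⟨{-⌊c⌋, -⌊c⌋ - 1}, ?_, ?_⟩
  · intro k hk
    rw [Finset.mem_insert, Finset.mem_singleton, not_or] at hk
    have h1 := Int.floor_le c
    have h2 := Int.lt_floor_add_one c
    rcases lt_or_ge k (-⌊c⌋ - 1) with h | h
    · apply phi_le
      have : (k : ℝ) ≤ -⌊c⌋ - 1 - 1 := by exact_mod_cast (by omega : k ≤ -⌊c⌋ - 1 - 1)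
      linarith
    · apply phi_ge
      have : (-⌊c⌋ + 1 : ℝ) ≤ k := by exact_mod_cast (by omega : -⌊c⌋ + 1 ≤ k)
      linarith
  · rw [Finset.sum_pair (by omega)]
    have h1 := Int.floor_le c
    have h2 := Int.lt_floor_add_one c
    push_cast
    have e : c + (-(⌊c⌋ : ℝ) - 1) + 1 = c + -⌊c⌋ := by ring
    rw [phi, phi, e, Real.smoothTransition.one_of_one_le (by linarith),
      Real.smoothTransition.zero_of_nonpos (x := c + (-(⌊c⌋ : ℝ) - 1)) (by linarith)]
    ring

lemma phi_hasSum {r : ℕ} (c : Fin r → ℝ) : HasSum (fun k : Fin r → ℤ => ∏ i, phi (c i + k i)) 1 := by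
  classical
  choose s hs1 hs2 using fun i => phi_fin (c i)
  have h := Finset.prod_univ_sum s (fun i k => phi (c i + (k : ℤ)))
  simp only [hs2, Finset.prod_const_one] at h
  rw [h]
  refine hasSum_sum_of_ne_finset_zero fun k hk => ?_
  rw [Fintype.mem_piFinset, not_forall] at hk
  obtain ⟨i, hi⟩ := hk
  exact Finset.prod_eq_zero (Finset.mem_univ i) (hs1 i _ hi)

variable (K : Type) [Field K] [NumberField K]

def cb : Basis (Fin (rank K)) ℝ (logSpace K) := (basisUnitLattice K).ofZLatticeBasis ℝ (unitLattice K)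

variable {K} in
def fW (V : ℝ → ℝ) (x : mixedSpace K) : ℝ :=
  V (Real.log (mixedEmbedding.norm x)) * ∏ i, phi ((cb K).repr (mixedEmbedding.logMap x) i)

lemma cb_repr (ζ : torsion K) (k : Fin (rank K) → ℤ) (i : Fin (rank K)) :
    (cb K).repr (logEmbedding K (Additive.ofMul ((ζ : (𝓞 K)ˣ) * ∏ i, fundSystem K i ^ k i))) i = k i := by
  rw [ofMul_mul, map_add, logEmbedding_eq_zero_iff.2 ζ.2, zero_add, ofMul_prod, map_sum]
  have : ∀ j, logEmbedding K (Additive.ofMul (fundSystem K j ^ k j)) = (k j : ℝ) • cb K j := by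
    intro j
    rw [ofMul_zpow, map_zsmul, logEmbedding_fundSystem, cb, Basis.ofZLatticeBasis_apply,
      Int.cast_smul_eq_zsmul]
  simp only [this]
  rw [Basis.repr_sum_self]

def uequiv : torsion K × (Fin (rank K) → ℤ) ≃ (𝓞 K)ˣ :=
  Equiv.ofBijective (fun p => (p.1 : (𝓞 K)ˣ) * ∏ i, fundSystem K i ^ p.2 i) (by
    constructor
    · intro p q h
      obtain ⟨z, -, hz⟩ := exist_unique_eq_mul_prod K ((p.1 : (𝓞 K)ˣ) * ∏ i, fundSystem K i ^ p.2 i)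
      rw [hz p rfl, hz q h]
    · intro u
      obtain ⟨z, hz, -⟩ := exist_unique_eq_mul_prod K u
      exact ⟨z, hz.symm⟩)

variable {K}

lemma fW_hasSum {V : ℝ → ℝ} {x : mixedSpace K} (hx : mixedEmbedding.norm x ≠ 0) :
    HasSum (fun u : (𝓞 K)ˣ => fW V (u • x))
      (Nat.card (torsion K) * V (Real.log (mixedEmbedding.norm x))) := by
  have h1 : ∀ u : (𝓞 K)ˣ, fW V (u • x) = V (Real.log (mixedEmbedding.norm x)) *
      ∏ i, phi ((cb K).repr (mixedEmbedding.logMap x) i + (cb K).repr (logEmbedding K (Additive.ofMul u)) i) := by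
    intro u
    unfold fW
    rw [norm_unit_smul, logMap_unit_smul u hx]
    congr 1
    refine Finset.prod_congr rfl fun i _ => ?_
    rw [map_add, Finsupp.add_apply, add_comm]
  simp only [h1]
  rw [mul_comm]
  have : Fintype (torsion K) := Fintype.ofFinite _
  refine HasSum.mul_left _ ?_
  rw [← (uequiv K).hasSum_iff]
  have h2 : ∀ z : torsion K, HasSum (fun k : Fin (rank K) → ℤ => ((fun u : (𝓞 K)ˣ => ∏ i, phi ((cb K).repr (mixedEmbedding.logMap x) i +
      (cb K).repr (logEmbedding K (Additive.ofMul u)) i)) ∘ uequiv K) (z, k)) 1 := by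
    intro z
    convert! phi_hasSum (fun i => (cb K).repr (mixedEmbedding.logMap x) i) using 2 with k
    refine Finset.prod_congr rfl fun i _ => ?_
    rw [← cb_repr K z k i]
    rfl
  have h3 : HasSum (fun _ : torsion K => (1 : ℝ)) (Nat.card (torsion K)) := by
    rw [Nat.card_eq_fintype_card]
    simpa using hasSum_fintype (fun _ : torsion K => (1 : ℝ))
  have hs : Summable ((fun u : (𝓞 K)ˣ => ∏ i, phi ((cb K).repr (mixedEmbedding.logMap x) i +
      (cb K).repr (logEmbedding K (Additive.ofMul u)) i)) ∘ uequiv K) := by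
    refine (summable_prod_of_nonneg fun p => ?_).2 ⟨fun z => (h2 z).summable, ?_⟩
    · exact Finset.prod_nonneg fun _ _ => phi_nonneg _
    · exact (hasSum_fintype _).summable
  have h4 := hs.hasSum.prod_fiberwise h2
  rw [← h4.unique h3]
  exact hs.hasSum

lemma fW_smul {V : ℝ → ℝ} {T : ℝ} (hT : 0 < T) (x : mixedSpace K) :
    fW V (T⁻¹ • x) = fW (fun t => V (t - finrank ℚ K * Real.log T)) x ∨ mixedEmbedding.norm x = 0 := by
  by_cases hx : mixedEmbedding.norm x = 0
  · exact Or.inr hx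
  left
  unfold fW
  rw [logMap_real_smul hx (inv_ne_zero hT.ne'), mixedEmbedding.norm_smul, Real.log_mul (by positivity) hx, Real.log_pow,
    abs_of_pos (inv_pos.2 hT), Real.log_inv]
  congr 2
  ring

lemma normAtPlace_contDiffAt {x : mixedSpace K} (w : InfinitePlace K) (h : normAtPlace w x ≠ 0) :
    ContDiffAt ℝ (⊤ : ℕ∞) (normAtPlace w : mixedSpace K → ℝ) x := by
  rcases w.isReal_or_isComplex with hw | hw
  · have e : (normAtPlace w : mixedSpace K → ℝ) = fun x => ‖x.1 ⟨w, hw⟩‖ := by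
      ext x
      exact normAtPlace_apply_of_isReal hw x
    rw [e]
    rw [normAtPlace_apply_of_isReal hw x] at h
    refine ContDiffAt.norm ℝ ?_ (norm_ne_zero_iff.1 h)
    fun_prop
  · have e : (normAtPlace w : mixedSpace K → ℝ) = fun x => ‖x.2 ⟨w, hw⟩‖ := by
      ext x
      exact normAtPlace_apply_of_isComplex hw x
    rw [e]
    rw [normAtPlace_apply_of_isComplex hw x] at h
    refine ContDiffAt.norm ℝ ?_ (norm_ne_zero_iff.1 h)
    fun_prop

lemma norm_contDiffAt {x : mixedSpace K} (h : mixedEmbedding.norm x ≠ 0) :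
    ContDiffAt ℝ (⊤ : ℕ∞) (mixedEmbedding.norm : mixedSpace K → ℝ) x := by
  have e : (mixedEmbedding.norm : mixedSpace K → ℝ) = fun x => ∏ w, normAtPlace w x ^ w.mult := by
    ext x
    exact mixedEmbedding.norm_apply x
  rw [e]
  refine contDiffAt_prod fun w _ => ?_
  exact (normAtPlace_contDiffAt w (mixedEmbedding.norm_ne_zero_iff.1 h w)).pow _

lemma fW_contDiff {V : ℝ → ℝ} {c : ℝ} (hV : PT.Wt V c) (hVs : ContDiff ℝ (⊤ : ℕ∞) V) :
    ContDiff ℝ (⊤ : ℕ∞) (fW V : mixedSpace K → ℝ) := by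
  rw [contDiff_iff_contDiffAt]
  intro x
  by_cases h : mixedEmbedding.norm x = 0
  · have : (fW V : mixedSpace K → ℝ) =ᶠ[nhds x] fun _ => 0 := by
      have ho : IsOpen {y : mixedSpace K | mixedEmbedding.norm y < 1} :=
        isOpen_lt (mixedEmbedding.continuous_norm K) continuous_const
      filter_upwards [ho.mem_nhds (by simp [h])] with y hy
      have hV0 : ∀ t, t ≤ 0 → V t = 0 := by
        intro t ht
        have hcl : IsClosed {t | V t = 0} := isClosed_eq hV.cont continuous_const
        have hsub : Set.Iio (0 : ℝ) ⊆ {t | V t = 0} := fun t ht => hV.zero_lt ht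
        have := closure_minimal hsub hcl
        rw [closure_Iio] at this
        exact this ht
      have h2 : Real.log (mixedEmbedding.norm y) ≤ 0 :=
        Real.log_nonpos (mixedEmbedding.norm_nonneg y) (le_of_lt hy)
      simp only [fW, hV0 _ h2, zero_mul]
    exact contDiffAt_const.congr_of_eventuallyEq this
  · have hl : ContDiffAt ℝ (⊤ : ℕ∞) (fun y : mixedSpace K => Real.log (mixedEmbedding.norm y)) x :=
      (norm_contDiffAt h).log h
    have hm : ContDiffAt ℝ (⊤ : ℕ∞) (mixedEmbedding.logMap : mixedSpace K → logSpace K) x := by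
      rw [contDiffAt_pi]
      intro w
      simp only [logMap_apply]
      refine contDiffAt_const.mul (ContDiffAt.sub ?_ (hl.mul contDiffAt_const))
      exact (normAtPlace_contDiffAt _ (mixedEmbedding.norm_ne_zero_iff.1 h w)).log
        (mixedEmbedding.norm_ne_zero_iff.1 h w)
    refine ContDiffAt.mul (hVs.contDiffAt.comp x hl) ?_
    refine contDiffAt_prod fun i _ => ?_
    refine phi_contDiff.contDiffAt.comp x ?_
    exact ((cb K).coord i).toContinuousLinearMap.contDiff.contDiffAt.comp x hm

lemma fW_nonneg {V : ℝ → ℝ} {c : ℝ} (hV : PT.Wt V c) (x : mixedSpace K) : 0 ≤ fW V x :=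
  mul_nonneg (hV.nonneg _) (Finset.prod_nonneg fun i _ => phi_nonneg _)

lemma fW_pos {V : ℝ → ℝ} {c : ℝ} (hV : PT.Wt V c) : ∃ x : mixedSpace K, fW V x ≠ 0 := by
  have hd : (finrank ℚ K : ℝ) ≠ 0 := Nat.cast_ne_zero.2 finrank_pos.ne'
  refine ⟨Real.exp (c / 2 / finrank ℚ K) • (1 : mixedSpace K), ?_⟩
  unfold fW
  rw [logMap_real, mixedEmbedding.norm_smul, map_one, mul_one, Real.log_pow, abs_of_pos (Real.exp_pos _), Real.log_exp,
    mul_div_cancel₀ _ hd]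
  simp [phi_zero, hV.pos.ne']

lemma fW_supp {V : ℝ → ℝ} {c : ℝ} (hV : PT.Wt V c) (hV0 : V 0 = 0) :
    ∃ r : ℝ, 0 ≤ r ∧ ∀ x : mixedSpace K, r < ‖x‖ → fW V x = 0 := by
  classical
  set B : ℝ := ∑ i, ‖cb K i‖ with hB
  have hB0 : 0 ≤ B := Finset.sum_nonneg fun i _ => norm_nonneg _
  have hc0 : 0 ≤ c := by
    have := hV.supp _ hV.pos.ne'
    linarith
  have hd1 : (1 : ℝ) ≤ finrank ℚ K := by exact_mod_cast (finrank_pos : 0 < finrank ℚ K)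
  have hmain : ∀ x : mixedSpace K, fW V x ≠ 0 → ∀ w : InfinitePlace K,
      normAtPlace w x ≤ Real.exp (c + Fintype.card (InfinitePlace K) * (2 * (B + c))) := by
    intro x hx
    have hV1 : V (Real.log (mixedEmbedding.norm x)) ≠ 0 := fun h => hx (by simp [fW, h])
    have hp : ∀ i, phi ((cb K).repr (mixedEmbedding.logMap x) i) ≠ 0 := fun i h =>
      hx (by rw [fW, Finset.prod_eq_zero (Finset.mem_univ i) h, mul_zero])
    have hn : mixedEmbedding.norm x ≠ 0 := by
      intro h
      rw [h, Real.log_zero] at hV1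
      exact hV1 hV0
    obtain ⟨hN0, hN1⟩ := hV.supp _ hV1
    have hl : ‖mixedEmbedding.logMap x‖ ≤ B := by
      rw [← (cb K).sum_repr (mixedEmbedding.logMap x)]
      refine (norm_sum_le _ _).trans (Finset.sum_le_sum fun i _ => ?_)
      rw [_root_.norm_smul, Real.norm_eq_abs]
      exact mul_le_of_le_one_left (norm_nonneg _) (phi_abs (hp i))
    have hpos : ∀ w, 0 < normAtPlace w x := fun w =>
      lt_of_le_of_ne (normAtPlace_nonneg w x) (Ne.symm (mixedEmbedding.norm_ne_zero_iff.1 hn w))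
    have hm1 : ∀ w : InfinitePlace K, (1 : ℝ) ≤ w.mult := fun w => by exact_mod_cast w.mult_pos
    have hm2 : ∀ w : InfinitePlace K, (w.mult : ℝ) ≤ 2 := fun w => by
      have : w.mult ≤ 2 := by unfold InfinitePlace.mult; split_ifs <;> omega
      exact_mod_cast this
    -- bound away from the distinguished place
    have hb : ∀ w : InfinitePlace K, w ≠ w₀ → |Real.log (normAtPlace w x)| ≤ B + c := by
      intro w hw
      have h1 : |mixedEmbedding.logMap x ⟨w, hw⟩| ≤ B := (norm_le_pi_norm (mixedEmbedding.logMap x) ⟨w, hw⟩).trans hl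
      rw [logMap_apply, abs_mul, abs_of_pos (by linarith [hm1 w])] at h1
      simp only at h1
      have h2 : |Real.log (normAtPlace w x) - Real.log (mixedEmbedding.norm x) * (finrank ℚ K : ℝ)⁻¹| ≤ B := by
        refine le_trans ?_ h1
        exact le_mul_of_one_le_left (abs_nonneg _) (hm1 w)
      have h3 : |Real.log (mixedEmbedding.norm x) * (finrank ℚ K : ℝ)⁻¹| ≤ c := by
        rw [abs_of_nonneg (by positivity)]
        exact (mul_le_of_le_one_right hN0 (inv_le_one_of_one_le₀ hd1)).trans hN1
      have := abs_add_le (Real.log (normAtPlace w x) - Real.log (mixedEmbedding.norm x) * (finrank ℚ K : ℝ)⁻¹)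
        (Real.log (mixedEmbedding.norm x) * (finrank ℚ K : ℝ)⁻¹)
      rw [sub_add_cancel] at this
      linarith
    have hsum : Real.log (mixedEmbedding.norm x) = ∑ w, (w.mult : ℝ) * Real.log (normAtPlace w x) := by
      rw [mixedEmbedding.norm_apply, Real.log_prod (fun w _ => (pow_pos (hpos w) _).ne')]
      simp only [Real.log_pow]
    have hcard : (1 : ℝ) ≤ Fintype.card (InfinitePlace K) := by
      exact_mod_cast Fintype.card_pos
    intro w
    have hD : B + c ≤ Fintype.card (InfinitePlace K) * (2 * (B + c)) := by
      have h1 : 2 * (B + c) ≤ Fintype.card (InfinitePlace K) * (2 * (B + c)) :=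
        le_mul_of_one_le_left (by linarith) hcard
      linarith
    rw [← Real.log_le_iff_le_exp (hpos w)]
    by_cases hw : w = w₀
    · rw [← Finset.add_sum_erase _ _ (Finset.mem_univ w)] at hsum
      have h1 : -(∑ w ∈ Finset.univ.erase w, (w.mult : ℝ) * Real.log (normAtPlace w x)) ≤
          Fintype.card (InfinitePlace K) * (2 * (B + c)) := by
        rw [← Finset.sum_neg_distrib]
        refine (Finset.sum_le_card_nsmul _ _ (2 * (B + c)) fun w' hw' => ?_).trans ?_
        · have h2 := hb w' (by rw [← hw]; exact Finset.ne_of_mem_erase hw')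
          have h3 := (abs_le.1 h2).1
          have h4 := mul_le_mul_of_nonneg_left h3 (by linarith [hm1 w'] : (0 : ℝ) ≤ w'.mult)
          have h5 := mul_le_mul_of_nonneg_right (hm2 w') (by linarith : 0 ≤ B + c)
          linarith
        · rw [nsmul_eq_mul]
          have : ((Finset.univ.erase w).card : ℝ) ≤ Fintype.card (InfinitePlace K) := by
            exact_mod_cast Finset.card_le_card (Finset.erase_subset _ _)
          gcongr
      have h4 : (w.mult : ℝ) * Real.log (normAtPlace w x) ≤ c + Fintype.card (InfinitePlace K) * (2 * (B + c)) := by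
        linarith
      rcases le_or_gt (Real.log (normAtPlace w x)) 0 with h | h
      · linarith
      · have := le_mul_of_one_le_left h.le (hm1 w)
        linarith
    · have h2 := (abs_le.1 (hb w hw)).2
      linarith
  refine ⟨_, (Real.exp_pos (c + Fintype.card (InfinitePlace K) * (2 * (B + c)))).le, fun x hx => ?_⟩
  by_contra h0
  refine absurd hx (not_lt.2 ?_)
  rw [norm_eq_sup'_normAtPlace]
  exact Finset.sup'_le _ _ fun w _ => hmain x h0 w

lemma fW_CC {V : ℝ → ℝ} {c : ℝ} (hV : PT.Wt V c) (hV0 : V 0 = 0) (hVs : ContDiff ℝ (⊤ : ℕ∞) V) :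
    ∃ r : ℝ, 0 ≤ r ∧ LSum.CC (fW V : mixedSpace K → ℝ) r := by
  obtain ⟨r, hr, h⟩ := fW_supp (K := K) hV hV0
  exact ⟨r, hr, fW_contDiff hV hVs, h⟩

lemma fW_int_pos {V : ℝ → ℝ} {c : ℝ} (hV : PT.Wt V c) (hV0 : V 0 = 0) (hVs : ContDiff ℝ (⊤ : ℕ∞) V) :
    0 < ∫ x : mixedSpace K, fW V x := by
  obtain ⟨r, hr, h⟩ := fW_CC (K := K) hV hV0 hVs
  obtain ⟨x, hx⟩ := fW_pos (K := K) hV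
  exact h.smooth.continuous.integral_pos_of_hasCompactSupport_nonneg_nonzero h.hcs
    (fW_nonneg hV) hx

end UW

/-! ### Helper material, part C1 -/

/-! ## Part C1: ray class groups -/
namespace Ray
open NumberField
open scoped Classical

variable {K : Type} [Field K] [NumberField K] (m : Ideal (𝓞 K))

/-- ideals coprime to the modulus -/
def Cop : Submonoid (Ideal (𝓞 K)) where
  carrier := {J | IsCoprime J m}
  one_mem' := isCoprime_one_left
  mul_mem' := fun h1 h2 => IsCoprime.mul_left h1 h2

variable {m}
lemma mem_cop {J : Ideal (𝓞 K)} : J ∈ Cop m ↔ IsCoprime J m := Iff.rfl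

variable (m) in
abbrev q : 𝓞 K →+* 𝓞 K ⧸ m := Ideal.Quotient.mk m

/-- ray equivalence -/
def rcon : Con (Cop m) where
  r J J' := ∃ a b : 𝓞 K, q m a = 1 ∧ q m b = 1 ∧ Ideal.span {a} * J.1 = Ideal.span {b} * J'.1
  iseqv := by
    refine ⟨fun J => ⟨1, 1, by simp, by simp, rfl⟩, ?_, ?_⟩
    · rintro J J' ⟨a, b, ha, hb, h⟩
      exact ⟨b, a, hb, ha, h.symm⟩
    · rintro J J' J'' ⟨a, b, ha, hb, h⟩ ⟨c, d, hc, hd, h'⟩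
      refine ⟨a * c, b * d, by rw [map_mul, ha, hc, one_mul], by rw [map_mul, hb, hd, one_mul], ?_⟩
      rw [← Ideal.span_singleton_mul_span_singleton, ← Ideal.span_singleton_mul_span_singleton,
        mul_right_comm, h, mul_right_comm, mul_assoc, h', mul_assoc]
  mul' := by
    rintro J J' I I' ⟨a, b, ha, hb, h⟩ ⟨c, d, hc, hd, h'⟩
    refine ⟨a * c, b * d, by rw [map_mul, ha, hc, one_mul], by rw [map_mul, hb, hd, one_mul], ?_⟩
    rw [← Ideal.span_singleton_mul_span_singleton, ← Ideal.span_singleton_mul_span_singleton,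
      Submonoid.coe_mul, Submonoid.coe_mul, mul_mul_mul_comm, h, h', mul_mul_mul_comm]

lemma ne_zero_of_q (hm : m ≠ ⊤) {a : 𝓞 K} (ha : q m a = 1) : a ≠ 0 := by
  rintro rfl
  rw [map_zero] at ha
  have := Ideal.Quotient.nontrivial_iff.2 hm
  exact zero_ne_one ha

lemma ne_bot_of_cop (hm : m ≠ ⊤) {J : Ideal (𝓞 K)} (hJ : IsCoprime J m) : J ≠ ⊥ := by
  rintro rfl
  rw [Ideal.isCoprime_iff_sup_eq, bot_sup_eq] at hJ
  exact hm hJ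

lemma unit_of_cop {x : 𝓞 K} (hx : IsCoprime (Ideal.span {x}) m) : ∃ y, q m x * q m y = 1 := by
  rw [Ideal.isCoprime_iff_exists] at hx
  obtain ⟨i, hi, j, hj, h⟩ := hx
  obtain ⟨y, rfl⟩ := Ideal.mem_span_singleton'.1 hi
  refine ⟨y, ?_⟩
  have := congrArg (q m) h
  rw [map_add, map_mul, map_one, Ideal.Quotient.eq_zero_iff_mem.2 hj, add_zero, mul_comm] at this
  exact this

variable (K) in
abbrev hK : ℕ := Fintype.card (ClassGroup (𝓞 K))

lemma principal_aux (I I' : nonZeroDivisors (Ideal (𝓞 K))) (h : ClassGroup.mk0 I = ClassGroup.mk0 I') :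
    ∃ x, I.1 * I'.1 ^ (hK K - 1) = Ideal.span {x} := by
  have h1 : ClassGroup.mk0 (I * I' ^ (hK K - 1)) = 1 := by
    rw [map_mul, map_pow, h, ← pow_succ', Nat.sub_add_cancel Fintype.card_pos]
    exact pow_card_eq_one
  generalize hP : I * I' ^ (hK K - 1) = P at h1
  obtain ⟨P, hPm⟩ := P
  have h2 := (ClassGroup.mk0_eq_one_iff hPm).1 h1
  obtain ⟨x, hx⟩ := h2.principal
  refine ⟨x, ?_⟩
  have := congrArg Subtype.val hP
  rw [Submonoid.coe_mul, SubmonoidClass.coe_pow] at this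
  rw [this]
  exact hx

lemma mem_nzd {J : Ideal (𝓞 K)} (hJ : J ≠ ⊥) : J ∈ nonZeroDivisors (Ideal (𝓞 K)) := by
  rw [← Ideal.zero_eq_bot] at hJ
  exact mem_nonZeroDivisors_of_ne_zero hJ

lemma pow_principal {J : Ideal (𝓞 K)} (hJ : J ≠ ⊥) : ∃ x, J ^ (hK K) = Ideal.span {x} := by
  obtain ⟨x, hx⟩ := principal_aux (⟨J, mem_nzd hJ⟩) (⟨J, mem_nzd hJ⟩) rfl
  refine ⟨x, ?_⟩
  rw [← hx, ← pow_succ', Nat.sub_add_cancel Fintype.card_pos]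

variable (m) in
abbrev G := (rcon (m := m)).Quotient

variable (m) in
/-- standing assumptions -/
structure Good : Prop where
  top : m ≠ ⊤
  bot : m ≠ ⊥

lemma Good.fin (h : Good m) : Finite (𝓞 K ⧸ m) := Ideal.finiteQuotientOfFreeOfNeBot m h.bot

lemma isUnit_G (h : Good m) (g : G m) : IsUnit g := by
  induction g using Con.induction_on with
  | H J =>
  have := h.fin
  have hJ : J.1 ≠ ⊥ := ne_bot_of_cop h.top J.2
  obtain ⟨x, hx⟩ := pow_principal hJ
  have hxc : IsCoprime (Ideal.span {x}) m := by
    rw [← hx]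
    exact IsCoprime.pow_left J.2
  obtain ⟨y, hy⟩ := unit_of_cop hxc
  obtain ⟨u, hu⟩ := IsUnit.of_mul_eq_one _ hy
  have hp : (u ^ Nat.card (𝓞 K ⧸ m)ˣ) = 1 := pow_card_eq_one'
  have hpos : 0 < Nat.card (𝓞 K ⧸ m)ˣ := Nat.card_pos
  refine IsUnit.of_pow_eq_one (n := hK K * Nat.card (𝓞 K ⧸ m)ˣ) ?_ (by
    have : 0 < hK K := Fintype.card_pos
    positivity)
  have hq := map_pow (rcon (m := m)).mk' J (hK K * Nat.card (𝓞 K ⧸ m)ˣ)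
  rw [Con.coe_mk'] at hq
  rw [← hq, ← Con.coe_one]
  refine (Con.eq _).2 ⟨1, x ^ Nat.card (𝓞 K ⧸ m)ˣ, by simp, ?_, ?_⟩
  · rw [map_pow, ← hu]
    have := congrArg Units.val hp
    rwa [Units.val_pow_eq_pow_val, Units.val_one] at this
  · rw [SubmonoidClass.coe_pow, pow_mul, hx, Ideal.span_singleton_pow]
    simp

lemma finite_G (h : Good m) : Finite (G m) := by
  have := h.fin
  -- representatives
  let cls : Cop m → ClassGroup (𝓞 K) := fun J =>
    ClassGroup.mk0 ⟨J.1, mem_nzd (ne_bot_of_cop h.top J.2)⟩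
  have hrep : ∀ c : ClassGroup (𝓞 K), ∃ I : Cop m, ∀ J : Cop m, cls J = c → ∃ x, J.1 * I.1 = Ideal.span {x} := by
    intro c
    by_cases hc : ∃ J0, cls J0 = c
    · obtain ⟨J0, rfl⟩ := hc
      refine ⟨J0 ^ (hK K - 1), fun J hJ => ?_⟩
      obtain ⟨x, hx⟩ := principal_aux _ _ hJ
      refine ⟨x, ?_⟩
      rw [SubmonoidClass.coe_pow]
      exact hx
    · exact ⟨1, fun J hJ => absurd ⟨J, hJ⟩ hc⟩
  choose R hR using hrep
  have hx : ∀ J : Cop m, ∃ x, J.1 * (R (cls J)).1 = Ideal.span {x} := fun J => hR _ J rfl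
  choose xx hxx using hx
  refine Finite.of_injective (β := ClassGroup (𝓞 K) × (𝓞 K ⧸ m))
    (fun g => (cls (Quotient.out g), q m (xx (Quotient.out g)))) ?_
  intro g g' hg
  rw [← Quotient.out_eq g, ← Quotient.out_eq g']
  set J := Quotient.out g
  set J' := Quotient.out g'
  rw [Prod.mk.injEq] at hg
  have hJ := hxx J
  have hJ' := hxx J'
  rw [← hg.1] at hJ'
  set I := R (cls J)
  have hI : I.1 ≠ ⊥ := ne_bot_of_cop h.top I.2
  obtain ⟨y, hy⟩ := unit_of_cop (m := m) (x := xx J) (by rw [← hJ]; exact IsCoprime.mul_left J.2 I.2)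
  refine Quotient.sound ⟨xx J' * y, xx J * y, ?_, ?_, ?_⟩
  · rw [map_mul, ← hy, hg.2]
  · rw [map_mul, hy]
  · apply mul_right_cancel₀ hI
    rw [mul_assoc, hJ, mul_assoc, hJ', Ideal.span_singleton_mul_span_singleton,
      Ideal.span_singleton_mul_span_singleton]
    congr 2
    ring

variable (m) in
abbrev A := Additive (G m)ˣ

variable (K) in
def NM : PT.NormMon (Ideal (𝓞 K)) where
  N := Ideal.absNorm
  N0 := fun _ h => Ideal.absNorm_eq_zero_iff.1 h
  N1 := fun _ h => (Ideal.absNorm_eq_one_iff.1 h).trans Ideal.one_eq_top.symm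
  fin := fun n => Ideal.finite_setOfPred_absNorm_eq n

lemma NM_N (J : Ideal (𝓞 K)) : (NM K).N J = Ideal.absNorm J := rfl

lemma A_ext {x y : Multiplicative (A m)}
    (h : (Additive.toMul (Multiplicative.toAdd x)).1 = (Additive.toMul (Multiplicative.toAdd y)).1) : x = y :=
  Multiplicative.toAdd.injective (Additive.toMul.injective (Units.ext h))

def cls (h : Good m) (J : Cop m) : Multiplicative (A m) :=
  Multiplicative.ofAdd (Additive.ofMul (isUnit_G h (J : G m)).unit)

lemma cls_val (h : Good m) (J : Cop m) :
    (Additive.toMul (Multiplicative.toAdd (cls h J))).1 = (J : G m) := rfl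

lemma one_val : (Additive.toMul (Multiplicative.toAdd (1 : Multiplicative (A m)))).1 = ((1 : Cop m) : G m) := rfl

lemma mul_val (x y : Multiplicative (A m)) : (Additive.toMul (Multiplicative.toAdd (x * y))).1 =
   (Additive.toMul (Multiplicative.toAdd x)).1 * (Additive.toMul (Multiplicative.toAdd y)).1 := rfl

lemma cls_one (h : Good m) : cls h 1 = 1 := A_ext (by rw [cls_val, one_val])

lemma cls_mul (h : Good m) (J J' : Cop m) : cls h (J * J') = cls h J * cls h J' :=
  A_ext (by rw [mul_val, cls_val, cls_val, cls_val, Con.coe_mul])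

lemma cls_eq_one (h : Good m) (J : Cop m) : cls h J = 1 ↔ ∃ a b : 𝓞 K, q m a = 1 ∧ q m b = 1 ∧
    Ideal.span {a} * J.1 = Ideal.span {b} := by
  constructor
  · intro hJ
    have h2 := congrArg (fun z => (Additive.toMul (Multiplicative.toAdd z)).1) hJ
    beta_reduce at h2
    rw [cls_val, one_val, Con.eq] at h2
    obtain ⟨a, b, ha, hb, hab⟩ := h2
    refine ⟨a, b, ha, hb, ?_⟩
    rw [hab, OneMemClass.coe_one, mul_one]
  · rintro ⟨a, b, ha, hb, hab⟩
    apply A_ext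
    rw [cls_val, one_val, Con.eq]
    refine ⟨a, b, ha, hb, ?_⟩
    rw [hab, OneMemClass.coe_one, mul_one]

/-- the ray class map -/
def cl (h : Good m) : Ideal (𝓞 K) →*₀ WithZero (Multiplicative (A m)) where
  toFun J := if hJ : J ∈ Cop m then (cls h ⟨J, hJ⟩ : WithZero (Multiplicative (A m))) else 0
  map_zero' := by
    rw [dif_neg]
    intro hJ
    exact ne_bot_of_cop h.top hJ rfl
  map_one' := by
    rw [dif_pos (Cop m).one_mem, ← WithZero.coe_one]
    exact congrArg _ (cls_one h)
  map_mul' := by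
    intro J J'
    by_cases hJ : J ∈ Cop m
    · by_cases hJ' : J' ∈ Cop m
      · rw [dif_pos hJ, dif_pos hJ', dif_pos ((Cop m).mul_mem hJ hJ'), ← WithZero.coe_mul]
        exact congrArg _ (cls_mul h ⟨J, hJ⟩ ⟨J', hJ'⟩)
      · rw [dif_neg hJ', dif_neg, mul_zero]
        exact fun hh => hJ' (IsCoprime.of_mul_left_right hh)
    · rw [dif_neg hJ, dif_neg, zero_mul]
      exact fun hh => hJ (IsCoprime.of_mul_left_left hh)

lemma cl_cop (h : Good m) {J : Ideal (𝓞 K)} : cl h J ≠ 0 ↔ IsCoprime J m := by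
  by_cases hJ : J ∈ Cop m
  · simp only [cl, MonoidWithZeroHom.coe_mk, ZeroHom.coe_mk, dif_pos hJ]
    exact ⟨fun _ => hJ, fun _ => WithZero.coe_ne_zero⟩
  · simp only [cl, MonoidWithZeroHom.coe_mk, ZeroHom.coe_mk, dif_neg hJ]
    exact ⟨fun h => absurd rfl h, fun h => absurd h hJ⟩

lemma cl_surj (h : Good m) (g : A m) : ∃ J, IsCoprime J m ∧
    cl h J = ((Multiplicative.ofAdd g : Multiplicative (A m)) : WithZero (Multiplicative (A m))) := by
  obtain ⟨J, hJ⟩ := Quotient.exists_rep (Additive.toMul g).1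
  refine ⟨J.1, J.2, ?_⟩
  simp only [cl, MonoidWithZeroHom.coe_mk, ZeroHom.coe_mk, dif_pos J.2]
  refine congrArg _ (A_ext ?_)
  rw [cls_val]
  exact hJ

lemma cancel_span {a x : 𝓞 K} (ha : a ≠ 0) {J : Ideal (𝓞 K)}
    (h : Ideal.span {a} * J = Ideal.span {a * x}) : J = Ideal.span {x} := by
  have ha0 : Ideal.span {a} ≠ (0 : Ideal (𝓞 K)) := by
    rw [Ne, Ideal.zero_eq_bot, Ideal.span_singleton_eq_bot]
    exact ha
  apply mul_left_cancel₀ ha0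
  rw [h, Ideal.span_singleton_mul_span_singleton]

lemma cl_one (h : Good m) {J : Ideal (𝓞 K)} :
    cl h J = 1 ↔ IsCoprime J m ∧ ∃ x, q m x = 1 ∧ J = Ideal.span {x} := by
  constructor
  · intro hJ
    have hc : IsCoprime J m := (cl_cop h).1 (by rw [hJ]; exact one_ne_zero)
    refine ⟨hc, ?_⟩
    have hJ' : J ∈ Cop m := hc
    simp only [cl, MonoidWithZeroHom.coe_mk, ZeroHom.coe_mk, dif_pos hJ'] at hJ
    rw [← WithZero.coe_one, WithZero.coe_inj] at hJ
    obtain ⟨a, b, ha, hb, hab⟩ := (cls_eq_one h _).1 hJ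
    change Ideal.span {a} * J = Ideal.span {b} at hab
    have hle : Ideal.span {b} ≤ Ideal.span {a} := by rw [← hab]; exact Ideal.mul_le_left
    obtain ⟨x, rfl⟩ := Ideal.span_singleton_le_span_singleton.1 hle
    have hqx : q m x = 1 := by
      rw [map_mul, ha, one_mul] at hb
      exact hb
    exact ⟨x, hqx, cancel_span (ne_zero_of_q h.top ha) hab⟩
  · rintro ⟨hc, x, hx, rfl⟩
    have hJ' : Ideal.span {x} ∈ Cop m := hc
    simp only [cl, MonoidWithZeroHom.coe_mk, ZeroHom.coe_mk, dif_pos hJ']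
    rw [← WithZero.coe_one, WithZero.coe_inj, cls_eq_one]
    exact ⟨1, x, map_one _, hx, by simp⟩

lemma cop_of_q {x : 𝓞 K} (hx : q m x = 1) : IsCoprime (Ideal.span {x}) m := by
  rw [Ideal.isCoprime_iff_exists]
  refine ⟨x, Ideal.mem_span_singleton_self x, 1 - x, ?_, by ring⟩
  rw [← Ideal.Quotient.eq_zero_iff_mem, map_sub, map_one]
  rw [sub_eq_zero]
  exact hx.symm

end Ray

/-! ### Helper material, part C2 -/

/-! ## Part C2: counting ideals in ray classes -/
namespace Ray
open NumberField NumberField.mixedEmbedding NumberField.Units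
open MeasureTheory Module
open scoped Classical

variable {K : Type} [Field K] [NumberField K]

variable (K) in
def cov0 : ℝ := volume.real (ZSpan.fundamentalDomain (latticeBasis K))

lemma cov0_pos : 0 < cov0 K := by
  unfold cov0
  rw [Measure.real, ENNReal.toReal_pos_iff]
  refine ⟨?_, (ZSpan.fundamentalDomain_isBounded _).measure_lt_top⟩
  exact pos_iff_ne_zero.2 (ZSpan.measure_fundamentalDomain_ne_zero _)

lemma ideal_basis {J : Ideal (𝓞 K)} (hJ : J ≠ ⊥) : ∃ (ι : Type) (_ : Fintype ι) (b : Basis ι ℝ (mixedSpace K)),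
    Fintype.card ι = finrank ℚ K ∧ volume.real (ZSpan.fundamentalDomain b) = Ideal.absNorm J * cov0 K ∧
    ∃ e : (ι → ℤ) ≃ J, ∀ k, LSum.pt b k = mixedEmbedding K (algebraMap (𝓞 K) K (e k).1) := by
  have hJ0 : (J : FractionalIdeal (nonZeroDivisors (𝓞 K)) K) ≠ 0 := by
    rw [Ne, FractionalIdeal.coeIdeal_eq_zero]
    exact hJ
  set I : (FractionalIdeal (nonZeroDivisors (𝓞 K)) K)ˣ := Units.mk0 _ hJ0 with hI
  refine ⟨_, inferInstance, fractionalIdealLatticeBasis K I, ?_, ?_, ?_⟩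
  · rw [← finrank_eq_card_chooseBasisIndex, fractionalIdeal_rank, RingOfIntegers.rank]
  · rw [Measure.real, volume_fundamentalDomain_fractionalIdealLatticeBasis, ENNReal.toReal_mul]
    congr 1
    rw [ENNReal.toReal_ofReal (by exact_mod_cast FractionalIdeal.absNorm_nonneg _), hI, Units.val_mk0,
      FractionalIdeal.coeIdeal_absNorm]
    simp
  · have hmem : ∀ k, ∃ x : J, LSum.pt (fractionalIdealLatticeBasis K I) k = mixedEmbedding K (algebraMap (𝓞 K) K x.1) := by
      intro k
      have h1 : LSum.pt (fractionalIdealLatticeBasis K I) k ∈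
          Submodule.span ℤ (Set.range (fractionalIdealLatticeBasis K I)) := by
        unfold LSum.pt
        refine Submodule.sum_mem _ fun i _ => ?_
        rw [Int.cast_smul_eq_zsmul]
        exact Submodule.smul_mem _ _ (Submodule.subset_span ⟨i, rfl⟩)
      rw [mem_span_fractionalIdealLatticeBasis] at h1
      obtain ⟨y, hy, hxy⟩ := h1
      rw [SetLike.mem_coe, hI, Units.val_mk0, FractionalIdeal.mem_coeIdeal] at hy
      obtain ⟨x, hx, rfl⟩ := hy
      exact ⟨⟨x, hx⟩, hxy.symm⟩
    choose e he using hmem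
    refine ⟨Equiv.ofBijective e ⟨?_, ?_⟩, he⟩
    · intro k k' hk
      have h2 := (he k).trans ((congrArg (fun z : J => mixedEmbedding K (algebraMap (𝓞 K) K z.1)) hk).trans (he k').symm)
      ext i
      have := congrArg (fun z => (fractionalIdealLatticeBasis K I).repr z i) h2
      beta_reduce at this
      rw [LSum.pt_repr, LSum.pt_repr] at this
      exact_mod_cast this
    · rintro ⟨x, hx⟩
      have h1 : mixedEmbedding K (algebraMap (𝓞 K) K x) ∈
          Submodule.span ℤ (Set.range (fractionalIdealLatticeBasis K I)) := by
        rw [mem_span_fractionalIdealLatticeBasis]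
        refine ⟨algebraMap (𝓞 K) K x, ?_, rfl⟩
        rw [SetLike.mem_coe, hI, Units.val_mk0, FractionalIdeal.mem_coeIdeal]
        exact ⟨x, hx, rfl⟩
      rw [Submodule.mem_span_range_iff_exists_fun] at h1
      obtain ⟨k, hk⟩ := h1
      refine ⟨k, ?_⟩
      apply Subtype.ext
      apply RingOfIntegers.coe_injective
      apply mixedEmbedding_injective K
      refine (he k).symm.trans ?_
      rw [← hk]
      unfold LSum.pt
      exact Finset.sum_congr rfl fun i _ => Int.cast_smul_eq_zsmul ℝ _ _

lemma coset_asymp {V : ℝ → ℝ} {c : ℝ} (hV : PT.Wt V c) (hV0 : V 0 = 0) (hVs : ContDiff ℝ (⊤ : ℕ∞) V)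
    {J : Ideal (𝓞 K)} (hJ : J ≠ ⊥) (N : ℕ) : ∃ C : ℝ, ∀ T : ℝ, 1 ≤ T → ∀ y : 𝓞 K, ∃ s : ℝ,
      HasSum (fun x : {x : 𝓞 K // x - y ∈ J} =>
        UW.fW V (T⁻¹ • mixedEmbedding K (algebraMap (𝓞 K) K x.1))) s ∧
      |s - (∫ x : mixedSpace K, UW.fW V x) / (Ideal.absNorm J * cov0 K) * T ^ (finrank ℚ K)| ≤ C / T ^ N := by
  obtain ⟨r, hr, hf⟩ := UW.fW_CC (K := K) hV hV0 hVs
  obtain ⟨ι, _, b, hcard, hvol, e, he⟩ := ideal_basis hJ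
  obtain ⟨C, hC⟩ := LSum.LS_asymp (b := b) volume hr hf N
  refine ⟨C, fun T hT y => ?_⟩
  have h1 := hC T hT (mixedEmbedding K (algebraMap (𝓞 K) K y))
  rw [hvol, hcard] at h1
  refine ⟨_, ?_, h1⟩
  unfold LSum.LS
  let E : (ι → ℤ) ≃ {x : 𝓞 K // x - y ∈ J} := e.trans
    { toFun := fun z => ⟨y + z.1, by simp⟩
      invFun := fun x => ⟨x.1 - y, x.2⟩
      left_inv := fun z => by simp
      right_inv := fun x => by simp }
  have hE : ∀ k, UW.fW V (T⁻¹ • (mixedEmbedding K (algebraMap (𝓞 K) K y) + LSum.pt b k)) =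
      UW.fW V (T⁻¹ • mixedEmbedding K (algebraMap (𝓞 K) K (E k).1)) := by
    intro k
    have : (E k).1 = y + (e k).1 := rfl
    rw [this, map_add, map_add, he]
  have hsum : Summable (fun k => UW.fW V (T⁻¹ • (mixedEmbedding K (algebraMap (𝓞 K) K y) + LSum.pt b k))) := by
    obtain ⟨C', _, h2⟩ := LSum.box b r (‖mixedEmbedding K (algebraMap (𝓞 K) K y)‖) hr (norm_nonneg _)
    obtain ⟨s, _, hs⟩ := h2 T hT
    refine summable_of_ne_finset_zero (s := s) fun k hk => ?_
    exact hf.supp _ (hs _ le_rfl k hk)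
  have h3 := hsum.hasSum
  simp only [hE] at h3 ⊢
  exact (E.hasSum_iff (f := fun x : {x : 𝓞 K // x - y ∈ J} =>
        UW.fW V (T⁻¹ • mixedEmbedding K (algebraMap (𝓞 K) K x.1)))).1 h3

end Ray

/-! ### Helper material, part C3 -/

namespace Ray
open NumberField NumberField.mixedEmbedding NumberField.Units
open MeasureTheory Module
open scoped Classical

variable {K : Type} [Field K] [NumberField K] {m : Ideal (𝓞 K)}

variable (m) in
def XX (I0 : Ideal (𝓞 K)) : Set (𝓞 K) := {x | x ∈ I0 ∧ ∃ u : (𝓞 K)ˣ, q m x = q m u}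

variable (m) in
def UU : Set (𝓞 K ⧸ m) := Set.range fun u : (𝓞 K)ˣ => q m u

lemma XX_cl (h : Good m) {I0 J : Ideal (𝓞 K)} {x : 𝓞 K}
    (hx : Ideal.span {x} = J * I0) : x ∈ XX m I0 ↔ cl h (J * I0) = 1 := by
  rw [cl_one]
  constructor
  · rintro ⟨h1, u, hu⟩
    have h2 : q m (↑u⁻¹ * x) = 1 := by
      rw [map_mul, hu, ← map_mul, Units.inv_mul, map_one]
    have h3 : J * I0 = Ideal.span {↑u⁻¹ * x} := by
      rw [← hx, Ideal.span_singleton_mul_left_unit (Units.isUnit _)]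
    exact ⟨by rw [h3]; exact cop_of_q h2, _, h2, h3⟩
  · rintro ⟨_, y, hy, hy'⟩
    have hxI : x ∈ I0 := by
      have : x ∈ J * I0 := hx ▸ Ideal.mem_span_singleton_self x
      exact Ideal.mul_le_right this
    refine ⟨hxI, ?_⟩
    rw [hy', Ideal.span_singleton_eq_span_singleton] at hx
    obtain ⟨u, hu⟩ := hx.symm
    exact ⟨u, by rw [← hu, map_mul, hy, one_mul]⟩

lemma norm_mE (x : 𝓞 K) : mixedEmbedding.norm (mixedEmbedding K (algebraMap (𝓞 K) K x)) =
    (Ideal.absNorm (Ideal.span {x}) : ℝ) := by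
  rw [mixedEmbedding.norm_eq_norm, Ideal.absNorm_span_singleton, ← Algebra.coe_norm_int, Nat.cast_natAbs]
  push_cast
  rfl

lemma XX_zero (h : Good m) {I0 : Ideal (𝓞 K)} {x : 𝓞 K} (hx : x ∈ XX m I0) : x ≠ 0 := by
  rintro rfl
  obtain ⟨_, u, hu⟩ := hx
  have := Ideal.Quotient.nontrivial_iff.2 h.top
  have h2 : IsUnit (q m u) := u.isUnit.map _
  rw [← hu, map_zero] at h2
  exact not_isUnit_zero h2

/-- the sum over `XX` by residue classes -/
lemma XX_asymp (h : Good m) {V : ℝ → ℝ} {c : ℝ} (hV : PT.Wt V c) (hV0 : V 0 = 0) (hVs : ContDiff ℝ (⊤ : ℕ∞) V)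
    {I0 : Ideal (𝓞 K)} (hI0 : IsCoprime I0 m) (N : ℕ) : ∃ C : ℝ, ∀ T : ℝ, 1 ≤ T → ∃ s : ℝ,
      HasSum ((XX m I0).indicator fun x : 𝓞 K =>
        UW.fW V (T⁻¹ • mixedEmbedding K (algebraMap (𝓞 K) K x))) s ∧
      |s - (UU m).ncard * ((∫ x : mixedSpace K, UW.fW V x) / (Ideal.absNorm (I0 * m) * cov0 K) * T ^ (finrank ℚ K))| ≤
        C / T ^ N := by
  have := h.fin
  have hI0' : I0 ≠ ⊥ := ne_bot_of_cop h.top hI0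
  obtain ⟨C, hC⟩ := coset_asymp (K := K) hV hV0 hVs (J := I0 * m) (mul_ne_zero hI0' h.bot) N
  have hy : ∀ r : 𝓞 K ⧸ m, ∃ y ∈ I0, q m y = r := by
    intro r
    obtain ⟨z, rfl⟩ := Ideal.Quotient.mk_surjective r
    rw [Ideal.isCoprime_iff_exists] at hI0
    obtain ⟨i, hi, j, hj, hij⟩ := hI0
    refine ⟨i * z, Ideal.mul_mem_right _ _ hi, ?_⟩
    have h1 : q m i = 1 := by
      have := congrArg (q m) hij
      rwa [map_add, map_one, Ideal.Quotient.eq_zero_iff_mem.2 hj, add_zero] at this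
    rw [map_mul, h1, one_mul]
  choose y hyI hyq using hy
  have hcos : ∀ r x, x - y r ∈ I0 * m ↔ x ∈ I0 ∧ q m x = r := by
    intro r x
    rw [Ideal.mul_eq_inf_of_coprime (Ideal.isCoprime_iff_sup_eq.1 hI0), Ideal.mem_inf]
    refine and_congr (Submodule.sub_mem_iff_left _ (hyI r)) ?_
    rw [← Ideal.Quotient.eq_zero_iff_mem, map_sub, sub_eq_zero]
    exact ⟨fun hh => hh.trans (hyq r), fun hh => hh.trans (hyq r).symm⟩
  set Uf : Finset (𝓞 K ⧸ m) := (UU m).toFinite.toFinset with hUf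
  have hUm : ∀ r, r ∈ Uf ↔ r ∈ UU m := fun r => Set.Finite.mem_toFinset _
  refine ⟨(UU m).ncard * C, fun T hT => ?_⟩
  choose s hs1 hs2 using fun r => hC T hT (y r)
  refine ⟨∑ r ∈ Uf, s r, ?_, ?_⟩
  · set g : 𝓞 K → ℝ := fun x => UW.fW V (T⁻¹ • mixedEmbedding K (algebraMap (𝓞 K) K x)) with hg
    have h3 : ∀ r ∈ Uf, HasSum (Set.indicator {x | x - y r ∈ I0 * m} g) (s r) := by
      intro r _
      rw [← hasSum_subtype_iff_indicator]
      exact hs1 r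
    have h4 := hasSum_sum h3
    convert! h4 using 1
    ext x
    by_cases hx : x ∈ XX m I0
    · rw [Set.indicator_of_mem hx, Finset.sum_eq_single (q m x)]
      · rw [Set.indicator_of_mem]
        exact (hcos _ x).2 ⟨hx.1, rfl⟩
      · intro r _ hr
        rw [Set.indicator_of_notMem]
        exact fun hh => hr ((hcos r x).1 hh).2.symm
      · intro hh
        exact absurd ((hUm _).2 (by obtain ⟨_, u, hu⟩ := hx; exact ⟨u, hu.symm⟩)) hh
    · rw [Set.indicator_of_notMem hx, Finset.sum_eq_zero]
      intro r hr
      rw [Set.indicator_of_notMem]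
      intro hh
      have h5 := (hcos r x).1 hh
      obtain ⟨u, hu⟩ := (hUm r).1 hr
      exact hx ⟨h5.1, u, h5.2.trans hu.symm⟩
  · have hcard : ((UU m).ncard : ℝ) = Uf.card := by
      rw [Set.ncard_eq_toFinset_card _ (UU m).toFinite]
    set W := (∫ x : mixedSpace K, UW.fW V x) / (Ideal.absNorm (I0 * m) * cov0 K) * T ^ (finrank ℚ K)
    rw [hcard, ← nsmul_eq_mul, ← Finset.sum_const, ← Finset.sum_sub_distrib]
    refine (Finset.abs_sum_le_sum_abs _ _).trans ?_
    rw [mul_div_assoc, ← nsmul_eq_mul]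
    exact Finset.sum_le_card_nsmul _ _ _ fun r _ => hs2 r

/-- the sum over `XX` by ideals -/
lemma XX_ideals (h : Good m) {V : ℝ → ℝ}
    {I0 : Ideal (𝓞 K)} (hI0 : IsCoprime I0 m) {T : ℝ} (hT : 0 < T) {s : ℝ}
    (hs : HasSum ((XX m I0).indicator fun x : 𝓞 K =>
        UW.fW V (T⁻¹ • mixedEmbedding K (algebraMap (𝓞 K) K x))) s) :
    HasSum (fun J : Ideal (𝓞 K) => if cl h (J * I0) = 1 then (Nat.card (torsion K) : ℝ) *
      V (Real.log (Ideal.absNorm J) + Real.log (Ideal.absNorm I0) - finrank ℚ K * Real.log T) else 0) s := by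
  have hI0' : I0 ≠ ⊥ := ne_bot_of_cop h.top hI0
  have h1 := hs.tsum_fiberwise (fun x => Ideal.span {x})
  have hinj : Function.Injective fun J : Ideal (𝓞 K) => J * I0 := fun J J' hJ => mul_right_cancel₀ hI0' hJ
  rw [← hinj.hasSum_iff] at h1
  · convert! h1 using 1
    ext J
    simp only [Function.comp]
    by_cases hc : cl h (J * I0) = 1
    · rw [if_pos hc]
      obtain ⟨hcop, x, hx, hxJ⟩ := (cl_one h).1 hc
      have hxX : x ∈ XX m I0 := (XX_cl h hxJ.symm).2 hc
      have hx0 := XX_zero h hxX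
      symm
      apply HasSum.tsum_eq
      let e : (𝓞 K)ˣ ≃ ((fun x : 𝓞 K => Ideal.span {x}) ⁻¹' {J * I0} : Set (𝓞 K)) :=
        Equiv.ofBijective (fun u => ⟨u * x, by
          rw [Set.mem_preimage, Set.mem_singleton_iff, Ideal.span_singleton_mul_left_unit u.isUnit, hxJ]⟩)
          ⟨by
            intro u v huv
            have := congrArg Subtype.val huv
            exact Units.ext (mul_right_cancel₀ hx0 this), by
            rintro ⟨z, hz⟩
            rw [Set.mem_preimage, Set.mem_singleton_iff, hxJ, Ideal.span_singleton_eq_span_singleton] at hz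
            obtain ⟨u, hu⟩ := hz.symm
            exact ⟨u, Subtype.ext ((mul_comm _ _).trans hu)⟩⟩
      rw [← e.hasSum_iff]
      have hn : mixedEmbedding.norm (mixedEmbedding K (algebraMap (𝓞 K) K x)) ≠ 0 := by
        rw [norm_mE, Nat.cast_ne_zero, Ne, Ideal.absNorm_eq_zero_iff, Ideal.span_singleton_eq_bot]
        exact hx0
      have h2 := UW.fW_hasSum (V := fun t => V (t - finrank ℚ K * Real.log T)) hn
      convert! h2 using 1
      · ext u
        have hu : (e u).1 = u * x := rfl
        have huX : (u * x : 𝓞 K) ∈ XX m I0 := (XX_cl h (by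
          rw [Ideal.span_singleton_mul_left_unit u.isUnit, hxJ])).2 hc
        rw [Function.comp, hu, Set.indicator_of_mem huX, unitSMul_smul, map_mul, map_mul]
        rcases UW.fW_smul (V := V) hT (mixedEmbedding K (algebraMap (𝓞 K) K u) * mixedEmbedding K (algebraMap (𝓞 K) K x))
          with h5 | h5
        · exact h5
        · exfalso
          rw [← unitSMul_smul, norm_unit_smul] at h5
          exact hn h5
      · rw [norm_mE, ← hxJ, map_mul, Nat.cast_mul, Real.log_mul]
        · rw [Nat.cast_ne_zero, Ne, Ideal.absNorm_eq_zero_iff]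
          rintro rfl
          exact ne_bot_of_cop h.top hcop (by simp)
        · rw [Nat.cast_ne_zero, Ne, Ideal.absNorm_eq_zero_iff]
          exact hI0'
    · rw [if_neg hc]
      symm
      convert! tsum_zero with x
      rw [Set.indicator_of_notMem]
      intro hx
      exact hc ((XX_cl h x.2).1 hx)
  · intro P hP
    convert! tsum_zero with x
    rw [Set.indicator_of_notMem]
    intro hx
    apply hP
    have h2 : I0 ∣ Ideal.span {x.1} := by
      rw [Ideal.dvd_iff_le, Ideal.span_singleton_le_iff_mem]
      exact hx.1
    obtain ⟨J, hJ⟩ := h2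
    have h3 : Ideal.span {x.1} = P := x.2
    exact ⟨J, by rw [← h3, hJ, mul_comm]⟩

end Ray

/-! ### Helper material, part C4 -/

namespace Ray
open NumberField NumberField.mixedEmbedding NumberField.Units
open MeasureTheory Module
open scoped Classical

/-- the weight -/
def VV (t : ℝ) : ℝ := Real.smoothTransition t * Real.smoothTransition (1 - t)

lemma VV_wt : PT.Wt VV 1 where
  cont := Real.smoothTransition.continuous.mul (Real.smoothTransition.continuous.comp (continuous_const.sub continuous_id))
  nonneg t := mul_nonneg (Real.smoothTransition.nonneg _) (Real.smoothTransition.nonneg _)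
  supp t ht := by
    constructor
    · by_contra h
      exact ht (by rw [VV, Real.smoothTransition.zero_of_nonpos (not_le.1 h).le, zero_mul])
    · by_contra h
      exact ht (by rw [VV, Real.smoothTransition.zero_of_nonpos (x := 1 - t) (by linarith), mul_zero])
  pos := mul_pos (Real.smoothTransition.pos_of_pos (by norm_num)) (Real.smoothTransition.pos_of_pos (by norm_num))

lemma VV_zero : VV 0 = 0 := by simp [VV]

lemma VV_smooth : ContDiff ℝ (⊤ : ℕ∞) VV :=
  Real.smoothTransition.contDiff.mul (Real.smoothTransition.contDiff.comp (contDiff_const.sub contDiff_id))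

variable {K : Type} [Field K] [NumberField K] {m : Ideal (𝓞 K)}

/-- passing from a sum over ideals to a Dirichlet series sum -/
lemma al_of_hasSum (h : Good m) (g : A m) {V : ℝ → ℝ} {x s w : ℝ}
    (hs : HasSum (fun J : Ideal (𝓞 K) => if cl h J = ((Multiplicative.ofAdd g : Multiplicative (A m)) :
      WithZero (Multiplicative (A m))) then w * V (Real.log (Ideal.absNorm J) - x) else 0) s) :
    (w : ℂ) * PT.al V ((NM K).S (PT.ind (cl h) g)) x = s := by
  have h1 := hs.mapL Complex.ofRealCLM
  have h2 := h1.tsum_fiberwise (fun J => Ideal.absNorm J)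
  unfold PT.al
  rw [← tsum_mul_left]
  refine Eq.trans ?_ h2.tsum_eq
  refine tsum_congr fun n => ?_
  rcases eq_or_ne n 0 with rfl | hn
  · rw [ArithmeticFunction.map_zero, zero_mul, mul_zero]
    symm
    convert! tsum_zero with J
    have hJ : J.1 = ⊥ := Ideal.absNorm_eq_zero_iff.1 J.2
    rw [if_neg, map_zero]
    rw [hJ, ← Ideal.zero_eq_bot, map_zero]
    exact WithZero.zero_ne_coe
  · rw [(NM K).S_apply _ hn]
    have h3 : ((fun J : Ideal (𝓞 K) => Ideal.absNorm J) ⁻¹' {n} : Set (Ideal (𝓞 K))) = ↑((NM K).fib n) := by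
      ext J
      rw [Finset.mem_coe, (NM K).mem_fib]
      rfl
    rw [h3, Finset.tsum_subtype' _ (fun J => Complex.ofRealCLM (if cl h J = ((Multiplicative.ofAdd g : Multiplicative (A m)) :
      WithZero (Multiplicative (A m))) then w * V (Real.log (Ideal.absNorm J) - x) else 0)),
      Finset.sum_mul, Finset.mul_sum]
    refine Finset.sum_congr rfl fun J hJ => ?_
    have hJ' : Ideal.absNorm J = n := (NM K).mem_fib.1 hJ
    unfold PT.ind
    split_ifs
    · rw [hJ', Complex.ofRealCLM_apply]
      push_cast
      ring
    · simp

variable (m) in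
def kap : ℝ := (UU m).ncard * (∫ x : mixedSpace K, UW.fW VV x) / (Ideal.absNorm m * cov0 K) / Nat.card (torsion K)

lemma kap_pos (h : Good m) : 0 < kap m := by
  have := h.fin
  have h1 : 0 < (UU m).ncard := by
    rw [Set.ncard_pos]
    exact ⟨_, 1, rfl⟩
  have h2 : 0 < Ideal.absNorm m := Nat.pos_of_ne_zero (fun h0 => h.bot (Ideal.absNorm_eq_zero_iff.1 h0))
  have h3 := cov0_pos (K := K)
  have h4 := UW.fW_int_pos (K := K) VV_wt VV_zero VV_smooth
  have h5 : 0 < Nat.card (torsion K) := Nat.card_pos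
  unfold kap
  positivity

lemma HB_one (h : Good m) (g : A m) : ∃ C : ℝ, ∀ x : ℝ, 0 ≤ x →
    ‖PT.al VV ((NM K).S (PT.ind (cl h) g)) x - ((kap m * Real.exp x : ℝ) : ℂ)‖ ≤ C * Real.exp (-x) := by
  obtain ⟨I0, hI0, hclI⟩ := cl_surj h (-g)
  obtain ⟨C, hC⟩ := XX_asymp h VV_wt VV_zero VV_smooth hI0 (finrank ℚ K)
  have hcl : ∀ J, cl h (J * I0) = 1 ↔ cl h J = ((Multiplicative.ofAdd g : Multiplicative (A m)) :
      WithZero (Multiplicative (A m))) := by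
    intro J
    have hne : cl h I0 ≠ 0 := (cl_cop h).2 hI0
    have h1 : ((Multiplicative.ofAdd g : Multiplicative (A m)) : WithZero (Multiplicative (A m))) * cl h I0 = 1 := by
      rw [hclI, ← WithZero.coe_mul, ← ofAdd_add, add_neg_cancel, ofAdd_zero, WithZero.coe_one]
    rw [map_mul, ← h1]
    exact ⟨fun hh => mul_right_cancel₀ hne hh, fun hh => by rw [hh]⟩
  have hN : 0 < Ideal.absNorm I0 := Nat.pos_of_ne_zero fun h0 => ne_bot_of_cop h.top hI0 (Ideal.absNorm_eq_zero_iff.1 h0)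
  have hNr : (1 : ℝ) ≤ Ideal.absNorm I0 := by exact_mod_cast hN
  have hD : 0 < finrank ℚ K := finrank_pos
  have hDr : (0 : ℝ) < finrank ℚ K := by exact_mod_cast hD
  have hw : 0 < Nat.card (torsion K) := Nat.card_pos
  have hwr : (0 : ℝ) < Nat.card (torsion K) := by exact_mod_cast hw
  have hm0 : 0 < Ideal.absNorm m := Nat.pos_of_ne_zero (fun h0 => h.bot (Ideal.absNorm_eq_zero_iff.1 h0))
  have hmr : (0 : ℝ) < Ideal.absNorm m := by exact_mod_cast hm0
  have hcov := cov0_pos (K := K)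
  refine ⟨|C| / Nat.card (torsion K), fun x hx => ?_⟩
  set T := Real.exp ((x + Real.log (Ideal.absNorm I0)) / finrank ℚ K) with hT
  have hlog : 0 ≤ Real.log (Ideal.absNorm I0) := Real.log_nonneg hNr
  have hT1 : 1 ≤ T := Real.one_le_exp (by positivity)
  have hlT : finrank ℚ K * Real.log T = x + Real.log (Ideal.absNorm I0) := by
    rw [hT, Real.log_exp, mul_div_cancel₀ _ hDr.ne']
  have hTD : T ^ (finrank ℚ K) = Real.exp x * Ideal.absNorm I0 := by
    rw [hT, ← Real.exp_nat_mul, mul_div_cancel₀ _ hDr.ne', Real.exp_add, Real.exp_log (by linarith)]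
  obtain ⟨s, hs, hsb⟩ := hC T hT1
  have h1 := XX_ideals h hI0 (by linarith) hs
  simp only [hlT, hcl, add_sub_add_right_eq_sub] at h1
  have h2 := al_of_hasSum h g h1
  have h3 : PT.al VV ((NM K).S (PT.ind (cl h) g)) x = ((s / Nat.card (torsion K) : ℝ) : ℂ) := by
    rw [Complex.ofReal_div, ← h2, mul_div_cancel_left₀]
    exact_mod_cast hw.ne'
  rw [h3, ← Complex.ofReal_sub, Complex.norm_real, Real.norm_eq_abs]
  have h4 : s / Nat.card (torsion K) - kap m * Real.exp x = (s - (UU m).ncard *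
    ((∫ x : mixedSpace K, UW.fW VV x) / (Ideal.absNorm (I0 * m) * cov0 K) * T ^ (finrank ℚ K))) / Nat.card (torsion K) := by
    rw [hTD, map_mul, kap, Nat.cast_mul]
    have : (Ideal.absNorm I0 : ℝ) ≠ 0 := by linarith
    field_simp
  rw [h4, abs_div, abs_of_pos hwr, div_mul_eq_mul_div |C|]
  refine div_le_div_of_nonneg_right ?_ hwr.le
  refine hsb.trans ?_
  rw [hTD, Real.exp_neg, ← div_eq_mul_inv]
  refine (div_le_div_of_nonneg_right (le_abs_self C) (by positivity)).trans ?_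
  refine div_le_div_of_nonneg_left (abs_nonneg _) (Real.exp_pos _) ?_
  exact le_mul_of_one_le_right (Real.exp_pos _).le hNr

lemma HB_all (h : Good m) : ∃ C : ℝ, ∀ g : A m, ∀ x : ℝ, 0 ≤ x →
    ‖PT.al VV ((NM K).S (PT.ind (cl h) g)) x - ((kap m * Real.exp x : ℝ) : ℂ)‖ ≤ C * Real.exp (-x) := by
  have := finite_G h
  have : Finite (A m) := inferInstanceAs (Finite (Additive (G m)ˣ))
  choose C hC using fun g : A m => HB_one h g
  obtain ⟨M, hM⟩ := (Set.finite_range C).bddAbove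
  refine ⟨M, fun g x hx => (hC g x hx).trans ?_⟩
  exact mul_le_mul_of_nonneg_right (hM ⟨g, rfl⟩) (Real.exp_pos _).le

lemma absNorm_pp {P : Ideal (𝓞 K)} (hP : Prime P) : ∃ p k : ℕ, p.Prime ∧ 0 < k ∧ Ideal.absNorm P = p ^ k ∧
    P ∣ Ideal.span {(p : 𝓞 K)} := by
  have hP' := Ideal.isPrime_of_prime hP
  have : P.IsMaximal := hP'.isMaximal hP.ne_zero
  let _ := Ideal.Quotient.field P
  have : Finite (𝓞 K ⧸ P) := Ideal.finiteQuotientOfFreeOfNeBot P hP.ne_zero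
  have h1 : IsPrimePow (Nat.card (𝓞 K ⧸ P)) := by
    have := Fintype.ofFinite (𝓞 K ⧸ P)
    rw [Nat.card_eq_fintype_card]
    exact FiniteField.isPrimePow_card _
  rw [isPrimePow_nat_iff] at h1
  obtain ⟨p, k, hp, hk, hpk⟩ := h1
  have h2 : Ideal.absNorm P = p ^ k := by
    rw [hpk, Ideal.absNorm_apply]
    rfl
  refine ⟨p, k, hp, hk, h2, ?_⟩
  rw [Ideal.dvd_span_singleton]
  have h3 := Ideal.absNorm_mem P
  rw [h2, Nat.cast_pow] at h3
  exact hP'.mem_of_pow_mem _ h3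

lemma hprimes (h : Good m) (B : ℕ) : ∃ P, Prime P ∧ B < (NM K).N P ∧ cl h P ≠ 0 := by
  obtain ⟨l, hl, hlp⟩ := Nat.exists_infinite_primes (B + Ideal.absNorm m + 1)
  have hl0 : (l : 𝓞 K) ≠ 0 := by exact_mod_cast hlp.ne_zero
  have hnl : Ideal.absNorm (Ideal.span {(l : 𝓞 K)}) = l ^ finrank ℚ K := by
    rw [Ideal.absNorm_span_natCast, RingOfIntegers.rank]
  have hne : Ideal.span {(l : 𝓞 K)} ≠ ⊤ := by
    intro h0
    rw [h0, Ideal.absNorm_top] at hnl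
    have : 1 < l ^ finrank ℚ K := Nat.one_lt_pow finrank_pos.ne' hlp.one_lt
    omega
  obtain ⟨P, hP, hle⟩ := Ideal.exists_le_maximal _ hne
  have hP0 : P ≠ ⊥ := by
    rintro rfl
    rw [le_bot_iff, Ideal.span_singleton_eq_bot] at hle
    exact hl0 hle
  have hdvd : Ideal.absNorm P ∣ l ^ finrank ℚ K := by
    rw [← hnl]
    exact map_dvd _ (Ideal.dvd_iff_le.2 hle)
  obtain ⟨i, _, hi⟩ := (Nat.dvd_prime_pow hlp).1 hdvd
  have hi0 : i ≠ 0 := by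
    rintro rfl
    rw [pow_zero, Ideal.absNorm_eq_one_iff] at hi
    exact hP.ne_top hi
  have hge : l ≤ Ideal.absNorm P := by
    rw [hi]
    exact Nat.le_self_pow hi0 l
  have hm0 : 0 < Ideal.absNorm m := Nat.pos_of_ne_zero (fun h0 => h.bot (Ideal.absNorm_eq_zero_iff.1 h0))
  refine ⟨P, Ideal.prime_of_isPrime hP0 hP.isPrime, ?_, ?_⟩
  · rw [NM_N]
    omega
  · rw [cl_cop, Ideal.isCoprime_iff_sup_eq]
    by_contra hc
    have h2 : m ≤ P := by
      have := hP.eq_of_le hc (le_sup_left)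
      rw [this]
      exact le_sup_right
    have h3 : Ideal.absNorm P ∣ Ideal.absNorm m := map_dvd _ (Ideal.dvd_iff_le.2 h2)
    have := Nat.le_of_dvd hm0 h3
    omega

lemma hd_bound (n : ℕ) (_ : n ≠ 0) : ∑ y ∈ (NM K).fib n, (NM K).lam y ≤
    (finrank ℚ K : ℝ) * ArithmeticFunction.vonMangoldt n := by
  set S := ((NM K).fib n).filter fun y => IsPrimePow y with hS
  have h1 : ∑ y ∈ (NM K).fib n, (NM K).lam y = ∑ y ∈ S, (NM K).lam y := by
    symm
    apply Finset.sum_subset (Finset.filter_subset _ _)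
    intro y hy hyS
    apply (NM K).lam_zero
    intro h
    exact hyS (Finset.mem_filter.2 ⟨hy, h⟩)
  rw [h1]
  rcases S.eq_empty_or_nonempty with h0 | ⟨y0, hy0⟩
  · rw [h0, Finset.sum_empty]
    exact mul_nonneg (Nat.cast_nonneg _) ArithmeticFunction.vonMangoldt_nonneg
  have hstr : ∀ y : Ideal (𝓞 K), ∃ P : Ideal (𝓞 K), ∃ k : ℕ, y ∈ S → Prime P ∧ 0 < k ∧ P ^ k = y := by
    intro y
    by_cases hy : y ∈ S
    · obtain ⟨P, k, hP, hk, hh⟩ := (Finset.mem_filter.1 hy).2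
      exact ⟨P, k, fun _ => ⟨hP, hk, hh⟩⟩
    · exact ⟨⊥, 0, fun h => absurd h hy⟩
  choose P k hPk using hstr
  have hnorm : ∀ y ∈ S, Ideal.absNorm (P y) ^ (k y) = n := by
    intro y hy
    rw [← map_pow, (hPk y hy).2.2]
    exact (NM K).mem_fib.1 (Finset.mem_filter.1 hy).1
  obtain ⟨p, j, hp, hj, hpj, -⟩ := absNorm_pp (hPk y0 hy0).1
  have hnp : n = p ^ (j * k y0) := by rw [← hnorm y0 hy0, hpj, ← pow_mul]
  have hjk : j * k y0 ≠ 0 := (Nat.mul_pos hj (hPk y0 hy0).2.1).ne'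
  have hΛ : ArithmeticFunction.vonMangoldt n = Real.log p := by
    rw [hnp, ArithmeticFunction.vonMangoldt_apply_pow hjk, ArithmeticFunction.vonMangoldt_apply_prime hp]
  have hdvd : ∀ y ∈ S, P y ∣ Ideal.span {(p : 𝓞 K)} := by
    intro y hy
    obtain ⟨p', j', hp', hj', hpj', hd'⟩ := absNorm_pp (hPk y hy).1
    have : p' = p := by
      have h5 : p' ∣ p ^ (j * k y0) := by
        rw [← hnp, ← hnorm y hy, hpj', ← pow_mul]
        exact dvd_pow_self _ (Nat.mul_pos hj' (hPk y hy).2.1).ne'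
      exact (Nat.prime_dvd_prime_iff_eq hp' hp).1 (hp'.dvd_of_dvd_pow h5)
    rw [← this]
    exact hd'
  have hp0 : Ideal.span {(p : 𝓞 K)} ≠ 0 := by
    rw [Ne, Ideal.zero_eq_bot, Ideal.span_singleton_eq_bot]
    exact_mod_cast hp.ne_zero
  have h2 : ∑ y ∈ S, (NM K).lam y = ∑ z ∈ S.image P, (NM K).lam z := by
    rw [Finset.sum_image]
    · refine Finset.sum_congr rfl fun y hy => ?_
      have h6 := (NM K).lam_pow (hPk y hy).1 one_pos
      rw [pow_one] at h6
      rw [h6]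
      conv_lhs => rw [← (hPk y hy).2.2]
      exact (NM K).lam_pow (hPk y hy).1 (hPk y hy).2.1
    · intro y hy y' hy' hyy
      rw [← (hPk y hy).2.2, ← (hPk y' hy').2.2, hyy]
      congr 1
      have h7 := (hnorm y hy).trans (hnorm y' hy').symm
      rw [hyy] at h7
      obtain ⟨p', j', hp', hj', hpj', -⟩ := absNorm_pp (hPk y' hy').1
      apply Nat.pow_right_injective _ h7
      rw [hpj']
      exact Nat.one_lt_pow hj'.ne' hp'.one_lt
  rw [h2, hΛ]
  have h3 : ∑ z ∈ S.image P, (NM K).lam z ≤ ∑ z ∈ (NM K).dv (Ideal.span {(p : 𝓞 K)}), (NM K).lam z := by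
    apply Finset.sum_le_sum_of_subset_of_nonneg
    · intro z hz
      obtain ⟨y, hy, rfl⟩ := Finset.mem_image.1 hz
      exact ((NM K).mem_dv hp0).2 (hdvd y hy)
    · exact fun z _ _ => (NM K).lam_nonneg z
  refine h3.trans (le_of_eq ?_)
  rw [(NM K).sum_lam hp0, NM_N, Ideal.absNorm_span_natCast, RingOfIntegers.rank, Nat.cast_pow, Real.log_pow]

end Ray

/-! ### Helper material, part C5 -/

namespace Ray
open NumberField NumberField.mixedEmbedding NumberField.Units
open MeasureTheory Module
open scoped Classical
variable {K : Type} [Field K] [NumberField K] {m : Ideal (𝓞 K)}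

theorem primes_ray (h : Good m) (g : A m) (B : ℕ) : ∃ J : Ideal (𝓞 K),
    cl h J = ((Multiplicative.ofAdd g : Multiplicative (A m)) : WithZero (Multiplicative (A m))) ∧
    (Ideal.absNorm J).Prime ∧ B < Ideal.absNorm J := by
  have := finite_G h
  have : Finite (A m) := inferInstanceAs (Finite (Additive (G m)ˣ))
  have := Fintype.ofFinite (A m)
  obtain ⟨C, hC⟩ := HB_all h
  have h1 := kap_pos h
  have h2 := hprimes h
  generalize kap m = κ at hC h1
  have h3 := hd_bound (K := K)
  generalize hc : cl h = c at *
  generalize hD : NM K = D at *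
  have h5 := PT.primes_in_class (V := VV) (c := 1) D (A := A m) c (κ := κ) (C := C)
  have h6 := h5 VV_wt
  have h6 := h6 h1
  have h6 := h6 hC h2 (d := finrank ℚ K) h3 g B
  obtain ⟨J, e1, e2, e3⟩ := h6
  subst hD
  exact ⟨J, e1, e2, e3⟩

lemma Tpp_good (h : Good m) {I : Ideal (𝓞 K)} (hc : IsCoprime I m) (B : ℕ) :
    ∃ x ∈ I, x - 1 ∈ m ∧ ∃ l : ℕ, l.Prime ∧ B < l ∧
      Ideal.absNorm (Ideal.span {x}) = Ideal.absNorm I * l := by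
  have := finite_G h
  have : Finite (A m) := inferInstanceAs (Finite (Additive (G m)ˣ))
  have := Fintype.ofFinite (A m)
  rcases PT.cl_cases (A := A m) (cl h) I with h0 | ⟨g, hg⟩
  · exact absurd h0 ((cl_cop h).2 hc)
  obtain ⟨J, h1, h2, h3⟩ := primes_ray h (-g) B
  have h4 : cl h (J * I) = 1 := by
    rw [map_mul, h1, hg, ← WithZero.coe_mul, ← ofAdd_add, neg_add_cancel, ofAdd_zero, WithZero.coe_one]
  obtain ⟨_, x, hx, hJ⟩ := (cl_one h).1 h4
  refine ⟨x, ?_, ?_, Ideal.absNorm J, h2, h3, ?_⟩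
  · have : x ∈ J * I := hJ ▸ Ideal.mem_span_singleton_self x
    exact Ideal.mul_le_right this
  · rw [← Ideal.Quotient.eq_zero_iff_mem, map_sub, map_one]
    exact sub_eq_zero.2 hx
  · rw [← hJ, map_mul, mul_comm]

lemma Tpp (hm : m ≠ ⊥) {I : Ideal (𝓞 K)} (hI : I ≠ ⊥) (hc : IsCoprime I m) (B : ℕ) :
    ∃ x ∈ I, x - 1 ∈ m ∧ ∃ l : ℕ, l.Prime ∧ B < l ∧
      Ideal.absNorm (Ideal.span {x}) = Ideal.absNorm I * l := by
  by_cases ht : m = ⊤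
  · obtain ⟨r, hr, hrp⟩ := Nat.exists_infinite_primes (Ideal.absNorm I + 1)
    have hI0 : 0 < Ideal.absNorm I := Nat.pos_of_ne_zero (fun h0 => hI (Ideal.absNorm_eq_zero_iff.1 h0))
    have hr0 : (r : 𝓞 K) ≠ 0 := by exact_mod_cast hrp.ne_zero
    have hG : Good (Ideal.span {(r : 𝓞 K)}) := by
      refine ⟨fun h0 => ?_, by rwa [Ne, Ideal.span_singleton_eq_bot]⟩
      have hnl : Ideal.absNorm (Ideal.span {(r : 𝓞 K)}) = r ^ finrank ℚ K := by
        rw [Ideal.absNorm_span_natCast, RingOfIntegers.rank]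
      rw [h0, Ideal.absNorm_top] at hnl
      have : 1 < r ^ finrank ℚ K := Nat.one_lt_pow finrank_pos.ne' hrp.one_lt
      omega
    have hcop : IsCoprime I (Ideal.span {(r : 𝓞 K)}) := by
      have h1 : Nat.Coprime (Ideal.absNorm I) r := by
        rw [Nat.coprime_comm, Nat.Prime.coprime_iff_not_dvd hrp]
        intro h2
        have := Nat.le_of_dvd hI0 h2
        omega
      have h2 := (Nat.isCoprime_iff_coprime.2 h1)
      obtain ⟨a, b, hab⟩ := h2
      rw [Ideal.isCoprime_iff_exists]
      refine ⟨a * (Ideal.absNorm I : 𝓞 K), Ideal.mul_mem_left _ _ (Ideal.absNorm_mem I), b * (r : 𝓞 K),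
        Ideal.mul_mem_left _ _ (Ideal.mem_span_singleton_self _), ?_⟩
      exact_mod_cast congrArg (Int.cast : ℤ → 𝓞 K) hab
    obtain ⟨x, h1, h2, h3⟩ := Tpp_good hG hcop B
    exact ⟨x, h1, ht ▸ Submodule.mem_top, h3⟩
  · exact Tpp_good ⟨ht, hm⟩ hc B

lemma T3_aux {α β : 𝓞 K} (hα : α ≠ 0) (hβ : β ≠ 0) (B : ℕ) : ∃ ξ : 𝓞 K, β ∣ ξ - α ∧ ∃ l : ℕ, l.Prime ∧ B < l ∧
    Ideal.absNorm (Ideal.span {ξ}) = Ideal.absNorm (Ideal.span {α, β}) * l := by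
  set g : Ideal (𝓞 K) := Ideal.span {α, β} with hg
  have hαg : g ∣ Ideal.span {α} := Ideal.dvd_iff_le.2 (Ideal.span_mono (by simp))
  have hβg : g ∣ Ideal.span {β} := Ideal.dvd_iff_le.2 (Ideal.span_mono (by simp))
  obtain ⟨I0, hI0⟩ := hαg
  obtain ⟨M, hM⟩ := hβg
  have hα0 : Ideal.span {α} ≠ (0 : Ideal (𝓞 K)) := by
    rw [Ne, Ideal.zero_eq_bot, Ideal.span_singleton_eq_bot]
    exact hα
  have hβ0 : Ideal.span {β} ≠ (0 : Ideal (𝓞 K)) := by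
    rw [Ne, Ideal.zero_eq_bot, Ideal.span_singleton_eq_bot]
    exact hβ
  have hg0 : g ≠ 0 := fun h => hα0 (by rw [hI0, h, zero_mul])
  have hI00 : I0 ≠ 0 := fun h => hα0 (by rw [hI0, h, mul_zero])
  have hM0 : M ≠ 0 := fun h => hβ0 (by rw [hM, h, mul_zero])
  have hcop : IsCoprime I0 M := by
    rw [Ideal.isCoprime_iff_add]
    apply mul_left_cancel₀ hg0
    rw [mul_add, ← hI0, ← hM, mul_one, hg, Ideal.span_insert]
    rfl
  have hκ : ∃ κ ∈ I0, κ - 1 ∈ M ∧ κ ≠ 0 := by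
    obtain ⟨i, hi, j, hj, hij⟩ := Ideal.isCoprime_iff_exists.1 hcop
    by_cases h0 : i = 0
    · refine ⟨α, ?_, ?_, hα⟩
      · have : α ∈ g * I0 := hI0 ▸ Ideal.mem_span_singleton_self α
        exact Ideal.mul_le_right this
      · have : M = ⊤ := by
          rw [Ideal.eq_top_iff_one]
          rw [h0, zero_add] at hij
          rwa [← hij]
        rw [this]
        exact Submodule.mem_top
    · refine ⟨i, hi, ?_, h0⟩
      have : i - 1 = - j := by rw [← hij]; ring
      rw [this]
      exact M.neg_mem hj
  obtain ⟨κ, hκI, hκM, hκ0⟩ := hκ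
  have hdvd : I0 ∣ Ideal.span {κ} := Ideal.dvd_iff_le.2 ((Ideal.span_singleton_le_iff_mem _).2 hκI)
  obtain ⟨I, hI⟩ := hdvd
  have hκ00 : Ideal.span {κ} ≠ (0 : Ideal (𝓞 K)) := by
    rw [Ne, Ideal.zero_eq_bot, Ideal.span_singleton_eq_bot]
    exact hκ0
  have hIne : I ≠ 0 := fun h => hκ00 (by rw [hI, h, mul_zero])
  have hIM : IsCoprime I M := by
    have h1 : IsCoprime (Ideal.span {κ}) M := by
      apply cop_of_q
      rw [← sub_eq_zero, ← map_one (q M), ← map_sub]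
      exact Ideal.Quotient.eq_zero_iff_mem.2 hκM
    rw [hI] at h1
    exact h1.of_mul_left_right
  obtain ⟨x, hxI, hxM, l, hl, hlB, hN⟩ := Tpp hM0 hIne hIM B
  have hκI' : κ ∈ I := by
    have : κ ∈ I0 * I := hI ▸ Ideal.mem_span_singleton_self κ
    exact Ideal.mul_le_right this
  have h1 : x - κ ∈ I * M := by
    rw [Ideal.mul_eq_inf_of_coprime (Ideal.isCoprime_iff_sup_eq.1 hIM)]
    refine ⟨I.sub_mem hxI hκI', ?_⟩
    have : x - κ = (x - 1) - (κ - 1) := by ring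
    rw [this]
    exact M.sub_mem hxM hκM
  have h2 : α * (x - κ) ∈ Ideal.span {β * κ} := by
    have h3 : α * (x - κ) ∈ (g * I0) * (I * M) := Ideal.mul_mem_mul (hI0 ▸ Ideal.mem_span_singleton_self α) h1
    have h4 : Ideal.span {β * κ} = (g * I0) * (I * M) := by
      rw [← Ideal.span_singleton_mul_span_singleton, hM, hI]
      ring
    rw [h4]
    exact h3
  obtain ⟨s, hs⟩ := Ideal.mem_span_singleton.1 h2
  refine ⟨α + β * s, ⟨s, by ring⟩, l, hl, hlB, ?_⟩
  have h5 : κ * (α + β * s) = α * x := by linear_combination -hs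
  have h6 := congrArg (fun z => Ideal.absNorm (Ideal.span {z})) h5
  beta_reduce at h6
  rw [← Ideal.span_singleton_mul_span_singleton, ← Ideal.span_singleton_mul_span_singleton, map_mul, map_mul, hN, hI,
    hI0, map_mul, map_mul] at h6
  have hn1 : Ideal.absNorm I0 ≠ 0 := fun h0 => hI00 (Ideal.absNorm_eq_zero_iff.1 h0)
  have hn2 : Ideal.absNorm I ≠ 0 := fun h0 => hIne (Ideal.absNorm_eq_zero_iff.1 h0)
  apply Nat.eq_of_mul_eq_mul_left (Nat.pos_of_ne_zero (mul_ne_zero hn1 hn2))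
  rw [h6]
  ring

/-- main arithmetic input -/
theorem T3 (α : 𝓞 K) {β : 𝓞 K} (hβ : β ≠ 0) (B : ℕ) : ∃ ξ : 𝓞 K, β ∣ ξ - α ∧ ∃ l : ℕ, l.Prime ∧ B < l ∧
    Ideal.absNorm (Ideal.span {ξ}) = Ideal.absNorm (Ideal.span {α, β}) * l := by
  by_cases hα : α = 0
  · obtain ⟨ξ, h1, l, h2, h3, h4⟩ := T3_aux hβ hβ B
    refine ⟨ξ, ?_, l, h2, h3, ?_⟩
    · rw [hα, sub_zero]
      exact (dvd_iff_dvd_of_dvd_sub h1).2 dvd_rfl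
    · rw [h4, hα, Ideal.span_insert, Ideal.span_insert]
      simp
  · exact T3_aux hα hβ B

end Ray

/-! ### Helper material, part D0 -/

namespace QL
variable {K : Type} [Field K] {V : Type} [AddCommGroup V] [Module K V]

/-- the polar form -/
abbrev P (Q : QuadraticForm K V) (x y : V) : K := QuadraticMap.polar (⇑Q) x y

section polar
variable (Q : QuadraticForm K V)
lemma Q_add (x y : V) : Q (x + y) = Q x + Q y + P Q x y := by simp [P, QuadraticMap.polar]
lemma Q_smul (a : K) (x : V) : Q (a • x) = a * a * Q x := by rw [QuadraticMap.map_smul, smul_eq_mul]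
lemma P_add_left (x y z : V) : P Q (x + y) z = P Q x z + P Q y z := QuadraticMap.polar_add_left Q x y z
lemma P_add_right (x y z : V) : P Q x (y + z) = P Q x y + P Q x z := QuadraticMap.polar_add_right Q x y z
lemma P_sub_left (x y z : V) : P Q (x - y) z = P Q x z - P Q y z := QuadraticMap.polar_sub_left Q x y z
lemma P_sub_right (x y z : V) : P Q x (y - z) = P Q x y - P Q x z := QuadraticMap.polar_sub_right Q x y z
lemma P_smul_left (a : K) (x y : V) : P Q (a • x) y = a * P Q x y := QuadraticMap.polar_smul_left Q a x y
lemma P_smul_right (a : K) (x y : V) : P Q x (a • y) = a * P Q x y := QuadraticMap.polar_smul_right Q a x y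
lemma P_comm (x y : V) : P Q x y = P Q y x := QuadraticMap.polar_comm Q x y
lemma P_self (x : V) : P Q x x = 2 * Q x := by simp [P]
lemma P_zero_left (x : V) : P Q 0 x = 0 := QuadraticMap.polar_zero_left Q x
lemma P_zero_right (x : V) : P Q x 0 = 0 := QuadraticMap.polar_zero_right Q x
lemma Q_sub (x y : V) : Q (x - y) = Q x + Q y - P Q x y := by
  have := Q_add Q x ((-1 : K) • y)
  rw [P_smul_right, Q_smul] at this
  rw [show x - y = x + (-1 : K) • y by module, this]; ring
/-- polar as linear functional -/
def PL (x : V) : V →ₗ[K] K := QuadraticMap.polarBilin Q x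
@[simp] lemma PL_apply (x y : V) : PL Q x y = P Q x y := rfl
end polar

lemma isom_P {V' : Type} [AddCommGroup V'] [Module K V'] {Q : QuadraticForm K V} {Q' : QuadraticForm K V'}
    (σ : V →ₗ[K] V') (h : ∀ x, Q' (σ x) = Q x) (x y : V) : P Q' (σ x) (σ y) = P Q x y := by
  simp only [P, QuadraticMap.polar, ← map_add, h]

lemma isom_inj {V' : Type} [AddCommGroup V'] [Module K V'] {Q : QuadraticForm K V} {Q' : QuadraticForm K V'}
    (hQ : Nondeg Q) (σ : V →ₗ[K] V') (h : ∀ x, Q' (σ x) = Q x) : Function.Injective σ := by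
  rw [← LinearMap.ker_eq_bot, LinearMap.ker_eq_bot']
  intro x hx
  refine hQ x fun y => ?_
  change P Q x y = 0
  rw [← isom_P σ h, hx, P_zero_left]

/-- `M` is integral and maximal (elementwise form). -/
def Mx (O : Subring K) (Q : QuadraticForm K V) (M : Submodule O V) : Prop :=
  (∀ x ∈ M, Q x ∈ O) ∧ ∀ x, Q x ∈ O → (∀ m ∈ M, P Q x m ∈ O) → x ∈ M

lemma P_mem {O : Subring K} {Q : QuadraticForm K V} {M : Submodule O V} (hM : ∀ x ∈ M, Q x ∈ O)
    {x y : V} (hx : x ∈ M) (hy : y ∈ M) : P Q x y ∈ O :=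
  O.sub_mem (O.sub_mem (hM _ (M.add_mem hx hy)) (hM _ hx)) (hM _ hy)

lemma smul_memK {O : Subring K} (M : Submodule O V) {a : K} (ha : a ∈ O) {x : V} (hx : x ∈ M) : a • x ∈ M :=
  M.smul_mem (⟨a, ha⟩ : O) hx

lemma Mx.eq_of_le {O : Subring K} {Q : QuadraticForm K V} {M M' : Submodule O V} (h : Mx O Q M)
    (h' : ∀ x ∈ M', Q x ∈ O) (hle : M ≤ M') : M' = M :=
  le_antisymm (fun x hx => h.2 x (h' x hx) fun _ hm => P_mem h' hx (hle hm)) hle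

/-- discrete valuation subring with uniformizer `p` -/
structure DV (O : Subring K) (p : K) : Prop where
  mem : p ∈ O
  ne : p ≠ 0
  inv : p⁻¹ ∉ O
  dec : ∀ x : K, x ≠ 0 → ∃ (k : ℤ) (u : K), u ∈ O ∧ u⁻¹ ∈ O ∧ u ≠ 0 ∧ x = p ^ k * u

namespace DV
variable {O : Subring K} {p : K}

/-- trichotomy -/
lemma tri (h : DV O p) (x : K) : p⁻¹ * x ∈ O ∨ (x ∈ O ∧ x⁻¹ ∈ O ∧ x ≠ 0) ∨ (x ≠ 0 ∧ p⁻¹ * x⁻¹ ∈ O) := by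
  by_cases hx : x = 0
  · left; simp [hx, O.zero_mem]
  obtain ⟨k, u, h1, h2, h3, h4⟩ := h.dec x hx
  rcases lt_trichotomy k 0 with hk | hk | hk
  · right; right
    refine ⟨hx, ?_⟩
    obtain ⟨j, rfl⟩ : ∃ j : ℕ, k = -((j : ℤ) + 1) := ⟨(-k - 1).toNat, by omega⟩
    have : p⁻¹ * x⁻¹ = p ^ j * u⁻¹ := by
      rw [h4, zpow_neg, mul_inv, inv_inv, zpow_add₀ h.ne, zpow_one, zpow_natCast]
      field_simp [h.ne]
    rw [this]; exact O.mul_mem (O.pow_mem h.mem _) h2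
  · right; left
    subst hk; simp only [zpow_zero, one_mul] at h4
    subst h4; exact ⟨h1, h2, hx⟩
  · left
    obtain ⟨j, rfl⟩ : ∃ j : ℕ, k = (j : ℤ) + 1 := ⟨(k - 1).toNat, by omega⟩
    have : p⁻¹ * x = p ^ j * u := by
      rw [h4, zpow_add₀ h.ne, zpow_one, zpow_natCast]
      have := h.ne
      field_simp
    rw [this]; exact O.mul_mem (O.pow_mem h.mem _) h1

lemma of_p (h : DV O p) {x : K} (hx : p⁻¹ * x ∈ O) : x ∈ O := by
  have := O.mul_mem h.mem hx
  rwa [mul_inv_cancel_left₀ h.ne] at this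

lemma unit (h : DV O p) {x : K} (hx : x ∈ O) (hp : p⁻¹ * x ∉ O) : x⁻¹ ∈ O ∧ x ≠ 0 := by
  rcases h.tri x with h1 | h1 | ⟨h1, h2⟩
  · exact absurd h1 hp
  · exact h1.2
  · exfalso
    have := O.mul_mem h2 hx
    rw [mul_assoc, inv_mul_cancel₀ h1, mul_one] at this
    exact h.inv this

lemma not_unit (h : DV O p) {x : K} (hx : x⁻¹ ∈ O) (h0 : x ≠ 0) : p⁻¹ * x ∉ O := fun hp => by
  have := O.mul_mem hp hx
  rw [mul_assoc, mul_inv_cancel₀ h0, mul_one] at this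
  exact h.inv this

lemma nmem (h : DV O p) {x : K} (hx : x ∉ O) : x ≠ 0 ∧ p⁻¹ * x⁻¹ ∈ O := by
  rcases h.tri x with h1 | h1 | h1
  · exact absurd (h.of_p h1) hx
  · exact absurd h1.1 hx
  · exact h1

lemma prime (h : DV O p) {x y : K} (hx : x ∈ O) (hxp : p⁻¹ * x ∉ O) (hxy : p⁻¹ * (x * y) ∈ O) : p⁻¹ * y ∈ O := by
  obtain ⟨h1, h2⟩ := h.unit hx hxp
  have := O.mul_mem h1 hxy
  rwa [show x⁻¹ * (p⁻¹ * (x * y)) = p⁻¹ * y by field_simp] at this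

lemma full_of (h : DV O p) (x : K) : ∃ k : ℕ, p ^ k * x ∈ O := by
  by_cases hx : x = 0
  · exact ⟨0, by simp [hx, O.zero_mem]⟩
  obtain ⟨k, u, h1, h2, h3, h4⟩ := h.dec x hx
  refine ⟨k.natAbs, ?_⟩
  obtain ⟨j, hj⟩ : ∃ j : ℕ, (k.natAbs : ℤ) + k = j := ⟨((k.natAbs : ℤ) + k).toNat, by omega⟩
  rw [h4, ← mul_assoc, ← zpow_natCast, ← zpow_add₀ h.ne, hj, zpow_natCast]
  exact O.mul_mem (O.pow_mem h.mem _) h1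

lemma bdd_of (h : DV O p) {x : K} (hx : x ≠ 0) : ∃ k : ℕ, (p ^ k)⁻¹ * x ∉ O := by
  obtain ⟨k, hk⟩ := h.full_of x⁻¹
  refine ⟨k + 1, fun h1 => h.inv ?_⟩
  have := O.mul_mem hk h1
  have e : p ^ k * x⁻¹ * ((p ^ (k + 1))⁻¹ * x) = p⁻¹ := by
    have := h.ne
    field_simp
    ring
  rwa [e] at this
end DV

/-- full and bounded `O`-submodule -/
structure Lt (O : Subring K) (p : K) (L : Submodule O V) : Prop where
  full : ∀ x : V, ∃ k : ℕ, p ^ k • x ∈ L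
  bdd : ∀ x : V, x ≠ 0 → ∃ k : ℕ, (p ^ k)⁻¹ • x ∉ L

/-- primitive multiple -/
lemma Lt.prim {O : Subring K} {p : K} (h : DV O p) {L : Submodule O V} (hL : Lt O p L) {x : V} (hx : x ≠ 0) :
    ∃ a : K, a ≠ 0 ∧ a • x ∈ L ∧ (p⁻¹ * a) • x ∉ L := by
  obtain ⟨k, hk⟩ := hL.full x
  classical
  have hp := h.ne
  have hy : p ^ k • x ≠ 0 := by simp [hx, hp]
  have hex := hL.bdd _ hy
  set j := Nat.find hex with hj
  have h1 := Nat.find_spec hex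
  have hj0 : j ≠ 0 := by
    intro h0
    rw [← hj, h0] at h1
    simp [hk] at h1
  obtain ⟨i, hi⟩ := Nat.exists_eq_succ_of_ne_zero hj0
  have h2 := Nat.find_min hex (m := i) (by omega)
  rw [not_not, smul_smul] at h2
  rw [← hj, hi, smul_smul] at h1
  refine ⟨_, ?_, h2, ?_⟩
  · positivity
  · rwa [show p⁻¹ * ((p ^ i)⁻¹ * p ^ k) = (p ^ i.succ)⁻¹ * p ^ k by rw [Nat.succ_eq_add_one]; field_simp; ring]
end QL

/-! ### Helper material, part D2 -/

namespace QL
variable {K : Type} [Field K]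

/-- special case of Hensel's lemma -/
def Hens (O : Subring K) (p : K) : Prop := ∀ a ∈ O, ∀ c ∈ O, ∃ u ∈ O, a + u + p * c * u ^ 2 = 0

section
variable {V : Type} [AddCommGroup V] [Module K V] {O : Subring K} {p : K}

lemma isotropic_of (h : DV O p) (hH : Hens O p) {Q : QuadraticForm K V} {x y : V} (hx : Q x ∈ O) (hy : Q y ∈ O)
    (hxy : P Q x y ∉ O) : ∃ w : V, w ≠ 0 ∧ Q w = 0 := by
  obtain ⟨hb, hb2⟩ := h.nmem hxy
  have hp := h.ne
  obtain ⟨u, hu, he⟩ := hH (Q x) hx (p * (p⁻¹ * (P Q x y)⁻¹) ^ 2 * Q y)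
    (O.mul_mem (O.mul_mem h.mem (O.pow_mem hb2 2)) hy)
  refine ⟨x + (u * (P Q x y)⁻¹) • y, fun h0 => hxy ?_, ?_⟩
  · have h1 : P Q (x + (u * (P Q x y)⁻¹) • y) y = 0 := by rw [h0, P_zero_left]
    rw [P_add_left, P_smul_left, P_self] at h1
    have h3 : (P Q x y)⁻¹ ∈ O := h.of_p hb2
    have : P Q x y = - (u * (P Q x y)⁻¹ * ((1 + 1) * Q y)) := by linear_combination h1
    rw [this]
    exact O.neg_mem (O.mul_mem (O.mul_mem hu h3) (O.mul_mem (O.add_mem O.one_mem O.one_mem) hy))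
  · rw [Q_add, Q_smul, P_smul_right]
    rw [← he]
    field_simp
    ring

lemma eq_of_aniso (h : DV O p) (hH : Hens O p) {Q : QuadraticForm K V} (ha : ∀ w, Q w = 0 → w = 0)
    {L : Submodule O V} (hL : Mx O Q L) (x : V) : x ∈ L ↔ Q x ∈ O := by
  refine ⟨hL.1 x, fun hx => hL.2 x hx fun m hm => ?_⟩
  by_contra hc
  obtain ⟨w, h1, h2⟩ := isotropic_of h hH hx (hL.1 m hm) hc
  exact h1 (ha w h2)

lemma hyp_pair (h : DV O p) {Q : QuadraticForm K V} {L : Submodule O V} (hL : Mx O Q L) {e : V}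
    (he : Q e = 0) (heL : e ∈ L) (hpe : p⁻¹ • e ∉ L) : ∃ f ∈ L, Q f = 0 ∧ P Q e f = 1 := by
  have : ∃ m ∈ L, p⁻¹ * P Q e m ∉ O := by
    by_contra hc
    push Not at hc
    refine hpe (hL.2 _ ?_ fun m hm => ?_)
    · rw [Q_smul, he, mul_zero]; exact O.zero_mem
    · rw [P_smul_left]; exact hc m hm
  obtain ⟨m, hm, hc⟩ := this
  obtain ⟨h1, h2⟩ := h.unit (P_mem hL.1 heL hm) hc
  set u := P Q e m
  have hf0 : u⁻¹ • m ∈ L := smul_memK L h1 hm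
  have hq := hL.1 _ hf0
  refine ⟨u⁻¹ • m - Q (u⁻¹ • m) • e, L.sub_mem hf0 (smul_memK L hq heL), ?_, ?_⟩
  · rw [Q_sub, Q_smul Q _ e, he, P_smul_right, P_smul_left, P_comm Q m e]
    change _ + _ - _ * (u⁻¹ * u) = 0
    rw [inv_mul_cancel₀ h2]; ring
  · rw [P_sub_right, P_smul_right, P_smul_right, P_self, he]
    change u⁻¹ * u - _ = 1
    rw [inv_mul_cancel₀ h2]; ring

/-- orthogonal complement of a pair -/
def Orth (Q : QuadraticForm K V) (e f : V) : Submodule K V := (PL Q e).ker ⊓ (PL Q f).ker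
lemma mem_Orth {Q : QuadraticForm K V} {e f x : V} : x ∈ Orth Q e f ↔ P Q e x = 0 ∧ P Q f x = 0 := by
  simp [Orth]

/-- projection -/
def prj (Q : QuadraticForm K V) {e f : V} (he : Q e = 0) (hf : Q f = 0) (hef : P Q e f = 1) : V →ₗ[K] Orth Q e f :=
  LinearMap.codRestrict _ (LinearMap.id - (PL Q f).smulRight e - (PL Q e).smulRight f) (by
    intro x
    rw [mem_Orth]
    simp only [LinearMap.sub_apply, LinearMap.id_apply, LinearMap.smulRight_apply, PL_apply, P_sub_right, P_smul_right,
      P_self, he, hf, hef, P_comm Q f e]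
    constructor <;> ring)
lemma prj_apply (Q : QuadraticForm K V) {e f : V} (he : Q e = 0) (hf : Q f = 0) (hef : P Q e f = 1) (x : V) :
    (prj Q he hf hef x : V) = x - P Q f x • e - P Q e x • f := rfl

lemma Q_hyp (Q : QuadraticForm K V) {e f : V} (he : Q e = 0) (hf : Q f = 0) (hef : P Q e f = 1) (a b : K) {x : V}
    (hx : x ∈ Orth Q e f) : Q (a • e + b • f + x) = a * b + Q x := by
  rw [mem_Orth] at hx
  rw [Q_add, Q_add, P_add_left, P_smul_left, P_smul_left, P_smul_left, P_smul_right, Q_smul, Q_smul, he, hf, hef, hx.1, hx.2]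
  ring

lemma orth_Mx {Q : QuadraticForm K V} {L : Submodule O V} (hL : Mx O Q L) {e f : V}
    (he : Q e = 0) (hf : Q f = 0) (hef : P Q e f = 1) (heL : e ∈ L) (hfL : f ∈ L) :
    Mx O (Q.comp (Orth Q e f).subtype) (L.comap ((Orth Q e f).subtype.restrictScalars O)) := by
  refine ⟨fun x hx => hL.1 _ hx, fun x hx h => hL.2 _ hx fun m hm => ?_⟩
  have h2 := h (prj Q he hf hef m) (by
    change ((prj Q he hf hef m : Orth Q e f) : V) ∈ L
    rw [prj_apply]
    exact L.sub_mem (L.sub_mem hm (smul_memK L (P_mem hL.1 hfL hm) heL)) (smul_memK L (P_mem hL.1 heL hm) hfL))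
  have h3 : P (Q.comp (Orth Q e f).subtype) x (prj Q he hf hef m) = P Q x (prj Q he hf hef m) := rfl
  rw [h3, prj_apply, P_sub_right, P_sub_right, P_smul_right, P_smul_right, P_comm Q x e, P_comm Q x f,
    (mem_Orth.1 x.2).1, (mem_Orth.1 x.2).2] at h2
  simpa using h2

lemma orth_Lt {Q : QuadraticForm K V} {L : Submodule O V} (hL : Lt O p L) (e f : V) :
    Lt O p (L.comap ((Orth Q e f).subtype.restrictScalars O)) := by
  refine ⟨fun x => hL.full x, fun x hx => hL.bdd x (by simpa using hx)⟩

lemma orth_nondeg {Q : QuadraticForm K V} (hQ : Nondeg Q) {e f : V}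
    (he : Q e = 0) (hf : Q f = 0) (hef : P Q e f = 1) : Nondeg (Q.comp (Orth Q e f).subtype) := by
  intro x hx
  have : (x : V) = 0 := hQ _ fun y => by
    have h3 : P (Q.comp (Orth Q e f).subtype) x (prj Q he hf hef y) = P Q x (prj Q he hf hef y) := rfl
    have h2 := hx (prj Q he hf hef y)
    change P _ _ _ = 0 at h2
    rw [h3, prj_apply, P_sub_right, P_sub_right, P_smul_right, P_smul_right, P_comm Q x e, P_comm Q x f,
      (mem_Orth.1 x.2).1, (mem_Orth.1 x.2).2] at h2
    change P Q x y = 0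
    simpa using h2
  exact Subtype.ext this

lemma orth_finrank [FiniteDimensional K V] (Q : QuadraticForm K V) {e f : V} (he : Q e = 0)
    (hef : P Q e f = 1) : Module.finrank K (Orth Q e f) < Module.finrank K V := by
  refine Submodule.finrank_lt fun h => ?_
  have h1 : f ∈ Orth Q e f := by rw [h]; trivial
  rw [mem_Orth, hef] at h1
  exact one_ne_zero h1.1
end

/-- Eichler-type isometry between complements -/
lemma eichler {V : Type} [AddCommGroup V] [Module K V] (Q : QuadraticForm K V) {e f e' f' : V} {a : K}
    (he : Q e = 0) (hea : e' = a • e) (hef : P Q e f = 1) (hef' : P Q e' f' = 1) (hf : Q f = 0) (hf' : Q f' = 0) :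
    ∃ τ : Orth Q e f ≃ₗ[K] Orth Q e' f', ∀ x, Q (τ x) = Q x := by
  have ha : a ≠ 0 := by
    rintro rfl
    rw [hea, zero_smul, P_zero_left] at hef'
    exact zero_ne_one hef'
  have h1 : a * P Q e f' = 1 := by rw [← hef', hea, P_smul_left]
  have h1' : a * P Q f' e = 1 := by rw [P_comm, h1]
  have h2 : P Q f e = 1 := by rw [P_comm, hef]
  have hee : P Q e e = 0 := by rw [P_self, he, mul_zero]
  refine ⟨LinearEquiv.ofLinearMap
    (LinearMap.codRestrict _ (((LinearMap.id - (PL Q f').smulRight e')) ∘ₗ (Orth Q e f).subtype) fun x => ?_)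
    (LinearMap.codRestrict _ (((LinearMap.id - (PL Q f).smulRight e)) ∘ₗ (Orth Q e' f').subtype) fun x => ?_)
    ?_ ?_, fun x => ?_⟩
  · have hx := mem_Orth.1 x.2
    rw [mem_Orth, hea]
    simp only [LinearMap.comp_apply, LinearMap.sub_apply, LinearMap.id_apply, LinearMap.smulRight_apply, PL_apply,
      P_sub_right, P_smul_right, P_smul_left, hee, Submodule.coe_subtype, hx.1, h1']
    constructor <;> ring
  · have hx := mem_Orth.1 x.2
    have hx0 : a * P Q e x = 0 := by rw [← P_smul_left, ← hea]; exact hx.1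
    have hx1 : P Q e x = 0 := (mul_eq_zero.1 hx0).resolve_left ha
    rw [mem_Orth]
    simp only [LinearMap.comp_apply, LinearMap.sub_apply, LinearMap.id_apply, LinearMap.smulRight_apply, PL_apply,
      P_sub_right, P_smul_right, hee, Submodule.coe_subtype, hx1, h2]
    constructor <;> ring
  · ext x
    have hx := mem_Orth.1 x.2
    simp only [LinearMap.comp_apply, LinearMap.sub_apply, LinearMap.id_apply, LinearMap.smulRight_apply, PL_apply,
      P_sub_right, P_smul_right, LinearMap.codRestrict_apply, Submodule.coe_subtype, hx.2, hea]
    rw [smul_smul, show (0 - P Q f x * P Q f' e) * a = - P Q f x by linear_combination (-P Q f x) * h1']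
    module
  · ext x
    have hx := mem_Orth.1 x.2
    simp only [LinearMap.comp_apply, LinearMap.sub_apply, LinearMap.id_apply, LinearMap.smulRight_apply, PL_apply,
      P_sub_right, P_smul_right, LinearMap.codRestrict_apply, Submodule.coe_subtype, hx.2, hea, h2]
    module
  · have hx := mem_Orth.1 x.2
    change Q ((x : V) - P Q f' x • e') = Q x
    rw [hea, Q_sub, Q_smul, Q_smul, he, P_smul_right, P_smul_right, P_comm Q x e, hx.1]
    ring

theorem uniq {O : Subring K} {p : K} (h : DV O p) (hH : Hens O p) (d : ℕ) :
    ∀ (V : Type) [AddCommGroup V] [Module K V] [FiniteDimensional K V] (Q : QuadraticForm K V) (_ : Nondeg Q)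
      (_ : Module.finrank K V ≤ d) (L M : Submodule O V) (_ : Lt O p L) (_ : Lt O p M) (_ : Mx O Q L) (_ : Mx O Q M),
      ∃ σ : V →ₗ[K] V, (∀ x, Q (σ x) = Q x) ∧ ∀ x ∈ L, σ x ∈ M := by
  induction d with
  | zero =>
    intro V _ _ _ Q hQ hd L M _ _ _ _
    refine ⟨LinearMap.id, fun x => rfl, fun x _ => ?_⟩
    have : Subsingleton V := Module.finrank_zero_iff.1 (Nat.le_zero.1 hd)
    rw [Subsingleton.elim (LinearMap.id x) 0]
    exact M.zero_mem
  | succ d ih =>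
    intro V _ _ _ Q hQ hd L M hL hM hLx hMx
    by_cases ha : ∀ w, Q w = 0 → w = 0
    · exact ⟨LinearMap.id, fun x => rfl, fun x hx => (eq_of_aniso h hH ha hMx x).2 ((eq_of_aniso h hH ha hLx x).1 hx)⟩
    push Not at ha
    obtain ⟨w, hw, hw0⟩ := ha
    obtain ⟨a, ha0, haL, hpa⟩ := hL.prim h hw0
    obtain ⟨b, hb0, hbM, hpb⟩ := hM.prim h hw0
    obtain ⟨e, hedef⟩ : ∃ e, e = a • w := ⟨_, rfl⟩
    obtain ⟨e', hedef'⟩ : ∃ e', e' = b • w := ⟨_, rfl⟩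
    have he : Q e = 0 := by rw [hedef, Q_smul, hw, mul_zero]
    have he' : Q e' = 0 := by rw [hedef', Q_smul, hw, mul_zero]
    rw [mul_smul, ← hedef] at hpa
    rw [mul_smul, ← hedef'] at hpb
    rw [← hedef] at haL
    rw [← hedef'] at hbM
    obtain ⟨f, hfL, hf, hef⟩ := hyp_pair h hLx he haL hpa
    obtain ⟨f', hfM, hf', hef'⟩ := hyp_pair h hMx he' hbM hpb
    have hee : e' = (b * a⁻¹) • e := by rw [hedef, hedef', smul_smul]; field_simp
    obtain ⟨τ, hτ⟩ := eichler Q he hee hef hef' hf hf'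
    have hr := orth_finrank Q he hef
    have hM1 := orth_Mx hMx he' hf' hef' hbM hfM
    have hM2 := orth_Lt (Q := Q) hM e' f'
    have hτ' : ∀ x, (Q.comp (Orth Q e' f').subtype) (τ x) = (Q.comp (Orth Q e f).subtype) x := hτ
    obtain ⟨σ0, h1, h2⟩ := ih (Orth Q e f) (Q.comp (Orth Q e f).subtype) (orth_nondeg hQ he hf hef) (by omega)
      (L.comap ((Orth Q e f).subtype.restrictScalars O))
      ((M.comap ((Orth Q e' f').subtype.restrictScalars O)).comap (τ.toLinearMap.restrictScalars O))
      (orth_Lt hL e f)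
      ⟨fun x => by
        obtain ⟨k, hk⟩ := hM2.full (τ x)
        refine ⟨k, ?_⟩
        change τ (p ^ k • x) ∈ M.comap ((Orth Q e' f').subtype.restrictScalars O)
        rwa [map_smul], fun x hx => by
        obtain ⟨k, hk⟩ := hM2.bdd (τ x) (by simpa using hx)
        refine ⟨k, fun hc => hk ?_⟩
        change τ ((p ^ k)⁻¹ • x) ∈ M.comap ((Orth Q e' f').subtype.restrictScalars O) at hc
        rwa [map_smul] at hc⟩
      (orth_Mx hLx he hf hef haL hfL)
      ⟨fun x hx => by rw [← hτ']; exact hM1.1 _ hx, fun x hx hx2 => by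
        refine hM1.2 (τ x) (by rw [hτ']; exact hx) fun m hm => ?_
        have := hx2 (τ.symm m) (by
          change τ (τ.symm m) ∈ M.comap ((Orth Q e' f').subtype.restrictScalars O)
          rwa [τ.apply_symm_apply])
        rw [← isom_P τ.toLinearMap hτ'] at this
        simpa using this⟩
    refine ⟨(PL Q f).smulRight e' + (PL Q e).smulRight f' + (Orth Q e' f').subtype ∘ₗ τ.toLinearMap ∘ₗ σ0 ∘ₗ prj Q he hf hef,
      fun x => ?_, fun x hx => ?_⟩
    · have e1 : x = P Q f x • e + P Q e x • f + (prj Q he hf hef x : V) := by rw [prj_apply]; module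
      change Q (P Q f x • e' + P Q e x • f' + (τ (σ0 (prj Q he hf hef x)) : V)) = Q x
      rw [Q_hyp Q he' hf' hef' _ _ (τ (σ0 (prj Q he hf hef x))).2, hτ]
      have e2 := h1 (prj Q he hf hef x)
      simp only [QuadraticMap.comp_apply, Submodule.coe_subtype] at e2
      rw [e2]
      conv_rhs => rw [e1]
      rw [Q_hyp Q he hf hef _ _ (prj Q he hf hef x).2]
    · change P Q f x • e' + P Q e x • f' + (τ (σ0 (prj Q he hf hef x)) : V) ∈ M
      refine M.add_mem (M.add_mem (smul_memK M (P_mem hLx.1 hfL hx) hbM) (smul_memK M (P_mem hLx.1 haL hx) hfM)) ?_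
      refine h2 (prj Q he hf hef x) ?_
      change ((prj Q he hf hef x : Orth Q e f) : V) ∈ L
      rw [prj_apply]
      exact L.sub_mem (L.sub_mem hx (smul_memK L (P_mem hLx.1 hfL hx) haL)) (smul_memK L (P_mem hLx.1 haL hx) hfL)
end QL

/-! ### Helper material, part D1 -/

namespace QL
variable {K : Type} [Field K]

/-- residue map, as a total function -/
structure Res (O : Subring K) (p : K) (k : Type) [Field k] (rs : K → k) : Prop where
  add : ∀ a ∈ O, ∀ b ∈ O, rs (a + b) = rs a + rs b
  mul : ∀ a ∈ O, ∀ b ∈ O, rs (a * b) = rs a * rs b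
  surj : ∀ c, ∃ a ∈ O, rs a = c
  zero : ∀ a ∈ O, (rs a = 0 ↔ p⁻¹ * a ∈ O)

section
variable {V : Type} [AddCommGroup V] [Module K V] {O : Subring K} {p : K} {k : Type} [Field k] {rs : K → k}

lemma Res.z (h : Res O p k rs) : rs 0 = 0 := (h.zero 0 O.zero_mem).2 (by simp [O.zero_mem])
lemma Res.sum (h : Res O p k rs) {ι : Type} (s : Finset ι) (f : ι → K) (hf : ∀ i ∈ s, f i ∈ O) :
    rs (∑ i ∈ s, f i) = ∑ i ∈ s, rs (f i) := by
  classical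
  induction s using Finset.induction_on with
  | empty => simp [h.z]
  | insert i s hi ih =>
    rw [Finset.sum_insert hi, Finset.sum_insert hi, h.add _ (hf i (Finset.mem_insert_self _ _)) _
      (O.sum_mem fun j hj => hf j (Finset.mem_insert_of_mem hj)), ih fun j hj => hf j (Finset.mem_insert_of_mem hj)]
lemma Res.sub (h : Res O p k rs) {a b : K} (ha : a ∈ O) (hb : b ∈ O) : rs (a - b) = rs a - rs b := by
  have := h.add (a - b) (O.sub_mem ha hb) b hb
  rw [sub_add_cancel] at this
  rw [this, add_sub_cancel_right]

open MvPolynomial in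
lemma chev_poly (k : Type) [Field k] [Finite k] (c0 c1 c2 d0 d1 d2 : k) :
    ∃ a : Fin 3 → k, a ≠ 0 ∧ c0 * a 0 ^ 2 + c1 * a 1 ^ 2 + c2 * a 2 ^ 2 + d0 * (a 1 * a 2) + d1 * (a 0 * a 2)
      + d2 * (a 0 * a 1) = 0 := by
  classical
  have := Fintype.ofFinite k
  obtain ⟨q, hq⟩ := CharP.exists k
  have hqp : q.Prime := CharP.char_is_prime k q
  let f : MvPolynomial (Fin 3) k := C c0 * X 0 ^ 2 + C c1 * X 1 ^ 2 + C c2 * X 2 ^ 2 + C d0 * (X 1 * X 2) +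
    C d1 * (X 0 * X 2) + C d2 * (X 0 * X 1)
  have hA : ∀ (c : k) (i : Fin 3), (C c * X i ^ 2 : MvPolynomial (Fin 3) k).totalDegree ≤ 2 := fun c i => by
    refine (totalDegree_mul _ _).trans ?_
    rw [totalDegree_C, zero_add]
    exact (totalDegree_pow _ _).trans (by rw [totalDegree_X])
  have hB : ∀ (c : k) (i j : Fin 3), (C c * (X i * X j) : MvPolynomial (Fin 3) k).totalDegree ≤ 2 := fun c i j => by
    refine (totalDegree_mul _ _).trans ?_
    rw [totalDegree_C, zero_add]
    exact (totalDegree_mul _ _).trans (by rw [totalDegree_X, totalDegree_X])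
  have hC : ∀ {f g : MvPolynomial (Fin 3) k}, f.totalDegree ≤ 2 → g.totalDegree ≤ 2 → (f + g).totalDegree ≤ 2 :=
    fun hf hg => (totalDegree_add _ _).trans (max_le hf hg)
  have hdeg : f.totalDegree < Fintype.card (Fin 3) := by
    rw [Fintype.card_fin]
    exact Nat.lt_succ_of_le (hC (hC (hC (hC (hC (hA _ _) (hA _ _)) (hA _ _)) (hB _ _ _)) (hB _ _ _)) (hB _ _ _))
  have hdvd := char_dvd_card_solutions q hdeg
  have h0 : eval (0 : Fin 3 → k) f = 0 := by simp [f]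
  have hcard : 1 < Fintype.card { x : Fin 3 → k // eval x f = 0 } :=
    lt_of_lt_of_le hqp.one_lt (Nat.le_of_dvd (Fintype.card_pos_iff.2 ⟨⟨0, h0⟩⟩) hdvd)
  obtain ⟨⟨a, ha⟩, hne⟩ := Fintype.exists_ne_of_one_lt_card hcard ⟨0, h0⟩
  refine ⟨a, fun h => hne (Subtype.ext h), ?_⟩
  simpa [f] using ha

lemma chev [Finite k] (h : DV O p) (hr : Res O p k rs) {Q : QuadraticForm K V} (x : Fin 3 → V)
    (hx : ∀ i, Q (x i) ∈ O) (hxy : ∀ i j, P Q (x i) (x j) ∈ O) :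
    ∃ a : Fin 3 → K, (∀ i, a i ∈ O) ∧ (∃ i, p⁻¹ * a i ∉ O) ∧ p⁻¹ * Q (∑ i, a i • x i) ∈ O := by
  obtain ⟨a, ha, he⟩ := chev_poly k (rs (Q (x 0))) (rs (Q (x 1))) (rs (Q (x 2))) (rs (P Q (x 1) (x 2)))
    (rs (P Q (x 0) (x 2))) (rs (P Q (x 0) (x 1)))
  choose b hb hba using fun i => hr.surj (a i)
  refine ⟨b, hb, ?_, ?_⟩
  · by_contra hc
    push Not at hc
    refine ha (funext fun i => ?_)
    rw [← hba]
    exact (hr.zero _ (hb i)).2 (hc i)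
  · have e : Q (∑ i, b i • x i) = Q (x 0) * (b 0 * b 0) + Q (x 1) * (b 1 * b 1) + Q (x 2) * (b 2 * b 2)
        + P Q (x 1) (x 2) * (b 1 * b 2) + P Q (x 0) (x 2) * (b 0 * b 2) + P Q (x 0) (x 1) * (b 0 * b 1) := by
      rw [Fin.sum_univ_three]
      simp only [Q_add, Q_smul, P_add_left, P_smul_left, P_smul_right]
      ring
    have m1 : ∀ i j, b i * b j ∈ O := fun i j => O.mul_mem (hb i) (hb j)
    have mq : ∀ i, Q (x i) * (b i * b i) ∈ O := fun i => O.mul_mem (hx i) (m1 i i)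
    have mp : ∀ i j, P Q (x i) (x j) * (b i * b j) ∈ O := fun i j => O.mul_mem (hxy i j) (m1 i j)
    have a2 := O.add_mem (mq 0) (mq 1)
    have a3 := O.add_mem a2 (mq 2)
    have a4 := O.add_mem a3 (mp 1 2)
    have a5 := O.add_mem a4 (mp 0 2)
    have a6 := O.add_mem a5 (mp 0 1)
    rw [e, ← hr.zero _ a6, hr.add _ a5 _ (mp 0 1), hr.add _ a4 _ (mp 0 2), hr.add _ a3 _ (mp 1 2),
      hr.add _ a2 _ (mq 2), hr.add _ (mq 0) _ (mq 1)]
    have eq : ∀ i, rs (Q (x i) * (b i * b i)) = rs (Q (x i)) * a i ^ 2 := fun i => by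
      rw [hr.mul _ (hx i) _ (m1 i i), hr.mul _ (hb i) _ (hb i), hba, sq]
    have ep : ∀ i j, rs (P Q (x i) (x j) * (b i * b j)) = rs (P Q (x i) (x j)) * (a i * a j) := fun i j => by
      rw [hr.mul _ (hxy i j) _ (m1 i j), hr.mul _ (hb i) _ (hb j), hba, hba]
    rw [eq, eq, eq, ep, ep, ep, he]

/-- `M` is the `O`-span of the basis `b` -/
def BM {ι : Type} (O : Subring K) (b : Module.Basis ι K V) (M : Submodule O V) : Prop :=
  ∀ x, x ∈ M ↔ ∀ i, b.repr x i ∈ O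

section bas
variable {ι : Type} [Fintype ι] {b : Module.Basis ι K V} {M : Submodule O V}

/-- reduction -/
def rd (rs : K → k) (b : Module.Basis ι K V) (x : V) : ι → k := fun i => rs (b.repr x i)

lemma b_mem (hb : BM O b M) (i : ι) : b i ∈ M := by
  classical
  rw [hb]
  intro j
  rw [Module.Basis.repr_self, Finsupp.single_apply]
  split_ifs
  exacts [O.one_mem, O.zero_mem]

lemma rd_eq (hr : Res O p k rs) (hb : BM O b M) {x y : V} (hx : x ∈ M) (hy : y ∈ M) :
    rd rs b x = rd rs b y ↔ p⁻¹ • (x - y) ∈ M := by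
  rw [hb, funext_iff]
  refine forall_congr' fun i => ?_
  have h1 := (hb x).1 hx i
  have h2 := (hb y).1 hy i
  rw [map_smul, Finsupp.smul_apply, smul_eq_mul, map_sub, Finsupp.sub_apply, ← hr.zero _ (O.sub_mem h1 h2),
    hr.sub h1 h2, sub_eq_zero]
  rfl

lemma rd_surj (hr : Res O p k rs) (hb : BM O b M) (u : ι → k) : ∃ x ∈ M, rd rs b x = u := by
  choose c hc hcu using fun i => hr.surj (u i)
  refine ⟨∑ i, c i • b i, ?_, ?_⟩
  · exact M.sum_mem fun i _ => smul_memK M (hc i) (b_mem hb i)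
  · funext i
    rw [rd, Module.Basis.repr_sum_self, hcu]

/-- reduced functional -/
def fd (rs : K → k) (b : Module.Basis ι K V) (g : V →ₗ[K] K) : (ι → k) →ₗ[k] k :=
  ∑ i, rs (g (b i)) • LinearMap.proj i

lemma fd_rd (hr : Res O p k rs) (hb : BM O b M) {g : V →ₗ[K] K} (hg : ∀ x ∈ M, g x ∈ O) {x : V} (hx : x ∈ M) :
    fd rs b g (rd rs b x) = rs (g x) := by
  have h1 := (hb x).1 hx
  have e : g x = ∑ i, g (b i) * b.repr x i := by
    conv_lhs => rw [← b.sum_repr x]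
    rw [map_sum]
    exact Finset.sum_congr rfl fun i _ => by rw [map_smul, smul_eq_mul, mul_comm]
  rw [e, hr.sum _ _ fun i _ => O.mul_mem (hg _ (b_mem hb i)) (h1 i)]
  simp only [fd, LinearMap.sum_apply, LinearMap.smul_apply, LinearMap.proj_apply, smul_eq_mul]
  exact Finset.sum_congr rfl fun i _ => by rw [hr.mul _ (hg _ (b_mem hb i)) _ (h1 i)]; rfl

lemma sep (h : DV O p) (hr : Res O p k rs) (hb : BM O b M) {Z : Submodule O V} (hZ : Z ≤ M)
    (hpZ : ∀ x ∈ M, p • x ∈ Z) {ρ : V} (hρ : ρ ∈ M) (hρZ : ρ ∉ Z) :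
    ∃ g : V →ₗ[K] K, (∀ x ∈ M, g x ∈ O) ∧ (∀ x ∈ Z, p⁻¹ * g x ∈ O) ∧ p⁻¹ * g ρ ∉ O := by
  have hadd : ∀ x ∈ M, ∀ y ∈ M, rd rs b (x + y) = rd rs b x + rd rs b y := fun x hx y hy => by
    funext i
    simp only [rd, map_add, Finsupp.add_apply, Pi.add_apply]
    exact hr.add _ ((hb x).1 hx i) _ ((hb y).1 hy i)
  let S : Submodule k (ι → k) :=
    { carrier := {u | ∃ x ∈ Z, rd rs b x = u}
      add_mem' := by
        rintro _ _ ⟨x, hx, rfl⟩ ⟨y, hy, rfl⟩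
        exact ⟨x + y, Z.add_mem hx hy, hadd x (hZ hx) y (hZ hy)⟩
      zero_mem' := ⟨0, Z.zero_mem, by funext i; simp [rd, hr.z]⟩
      smul_mem' := by
        rintro c _ ⟨x, hx, rfl⟩
        obtain ⟨a, ha, rfl⟩ := hr.surj c
        refine ⟨a • x, smul_memK Z ha hx, ?_⟩
        funext i
        simp only [rd, map_smul, Finsupp.smul_apply, Pi.smul_apply, smul_eq_mul]
        exact hr.mul _ ha _ ((hb x).1 (hZ hx) i) }
  have hS : rd rs b ρ ∉ S := by
    rintro ⟨x, hx, he⟩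
    have h1 := hpZ _ ((rd_eq hr hb hρ (hZ hx)).1 he.symm)
    rw [smul_smul, mul_inv_cancel₀ h.ne, one_smul] at h1
    exact hρZ (by simpa using Z.add_mem h1 hx)
  obtain ⟨f, hf, hfS⟩ := Submodule.exists_le_ker_of_notMem hS
  classical
  choose c hc hcf using fun i => hr.surj (f (Pi.single i 1))
  let g : V →ₗ[K] K := ∑ i, c i • b.coord i
  have hgb : ∀ i, g (b i) = c i := fun i => by
    classical
    simp [g, Finsupp.single_apply]
  have hg : ∀ x ∈ M, g x ∈ O := fun x hx => by
    simp only [g, LinearMap.sum_apply, LinearMap.smul_apply, Module.Basis.coord_apply, smul_eq_mul]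
    exact O.sum_mem fun i _ => O.mul_mem (hc i) ((hb x).1 hx i)
  have hfg : fd rs b g = f := by
    classical
    refine LinearMap.pi_ext' fun i => LinearMap.ext_ring ?_
    simp only [fd, hgb, hcf, LinearMap.comp_apply, LinearMap.sum_apply, LinearMap.smul_apply, LinearMap.proj_apply]
    simp [Pi.single_apply]
  refine ⟨g, hg, fun x hx => ?_, fun hc => hf ?_⟩
  · rw [← hr.zero _ (hg x (hZ hx)), ← fd_rd hr hb hg (hZ hx), hfg]
    exact hfS ⟨x, hx, rfl⟩
  · rw [← hfg, fd_rd hr hb hg hρ]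
    exact (hr.zero _ (hg ρ hρ)).2 hc

/-- preimage of the kernel of the reduced functional -/
def HH (O : Subring K) (p : K) (M : Submodule O V) (g : V →ₗ[K] K) : Set V := {x | x ∈ M ∧ p⁻¹ * g x ∈ O}

lemma HH_ncard [Finite k] (hr : Res O p k rs) (hb : BM O b M) {g : V →ₗ[K] K} (hg : ∀ x ∈ M, g x ∈ O)
    (hp : ∃ m ∈ M, p⁻¹ * g m ∉ O) : (rd rs b '' HH O p M g).ncard * Nat.card k = Nat.card (ι → k) := by
  have e : rd rs b '' HH O p M g = ((fd rs b g).ker : Set (ι → k)) := by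
    ext u
    constructor
    · rintro ⟨x, ⟨hx, h2⟩, rfl⟩
      change fd rs b g _ = 0
      rw [fd_rd hr hb hg hx]
      exact (hr.zero _ (hg x hx)).2 h2
    · intro hu
      obtain ⟨x, hx, rfl⟩ := rd_surj hr hb u
      refine ⟨x, ⟨hx, ?_⟩, rfl⟩
      rw [← hr.zero _ (hg x hx), ← fd_rd hr hb hg hx]
      exact hu
  obtain ⟨m, hm, hm2⟩ := hp
  have hs : Function.Surjective (fd rs b g) := by
    refine LinearMap.surjective ?_
    intro h0
    apply hm2
    rw [← hr.zero _ (hg m hm), ← fd_rd hr hb hg hm, h0]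
    rfl
  rw [e, ← Nat.card_coe_set_eq]
  have h1 := LinearMap.finrank_range_add_finrank_ker (fd rs b g)
  rw [LinearMap.range_eq_top.2 hs, finrank_top, Module.finrank_self] at h1
  have h2 := Module.natCard_eq_pow_finrank (K := k) (V := (fd rs b g).ker)
  have h3 := Module.natCard_eq_pow_finrank (K := k) (V := (ι → k))
  change Nat.card (fd rs b g).ker * _ = _
  rw [h2, h3, ← h1, pow_add, pow_one, mul_comm]
end bas
end
end QL

/-! ### Helper material, part D3 -/

namespace QL
section
variable {K : Type} [Field K] {V : Type} [AddCommGroup V] [Module K V] {O : Subring K} {p : K}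
  {Q : QuadraticForm K V} {M M' : Submodule O V}

lemma pi_add {a b : K} (ha : p⁻¹ * a ∈ O) (hb : p⁻¹ * b ∈ O) : p⁻¹ * (a + b) ∈ O := by
  rw [mul_add]; exact O.add_mem ha hb
lemma pi_sub {a b : K} (ha : p⁻¹ * a ∈ O) (hb : p⁻¹ * b ∈ O) : p⁻¹ * (a - b) ∈ O := by
  rw [mul_sub]; exact O.sub_mem ha hb
lemma pi_mul {a b : K} (ha : a ∈ O) (hb : p⁻¹ * b ∈ O) : p⁻¹ * (a * b) ∈ O := by
  rw [mul_left_comm]; exact O.mul_mem ha hb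
lemma pi_p (h : DV O p) {a : K} (ha : a ∈ O) : p⁻¹ * (p * a) ∈ O := by
  rwa [inv_mul_cancel_left₀ h.ne]

/-- the radical mod p -/
def ZZ (h : DV O p) (Q : QuadraticForm K V) (M : Submodule O V) (hintg : ∀ x ∈ M, Q x ∈ O) : Submodule O V where
  carrier := {y | y ∈ M ∧ p⁻¹ * Q y ∈ O ∧ ∀ w ∈ M, p⁻¹ * P Q y w ∈ O}
  add_mem' := by
    rintro x y ⟨hx, hx1, hx2⟩ ⟨hy, hy1, hy2⟩
    refine ⟨M.add_mem hx hy, ?_, fun w hw => ?_⟩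
    · rw [Q_add]; exact pi_add (pi_add hx1 hy1) (hx2 y hy)
    · rw [P_add_left]; exact pi_add (hx2 w hw) (hy2 w hw)
  zero_mem' := ⟨M.zero_mem, by simp [O.zero_mem], fun w _ => by rw [P_zero_left]; simp [O.zero_mem]⟩
  smul_mem' := by
    rintro c x ⟨hx, hx1, hx2⟩
    refine ⟨M.smul_mem c hx, ?_, fun w hw => ?_⟩
    · change p⁻¹ * Q ((c : K) • x) ∈ O
      rw [Q_smul]; exact pi_mul (O.mul_mem c.2 c.2) hx1
    · change p⁻¹ * P Q ((c : K) • x) w ∈ O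
      rw [P_smul_left]; exact pi_mul c.2 (hx2 w hw)

lemma mem_ZZ {h : DV O p} {hintg : ∀ x ∈ M, Q x ∈ O} {y : V} :
    y ∈ ZZ h Q M hintg ↔ y ∈ M ∧ p⁻¹ * Q y ∈ O ∧ ∀ w ∈ M, p⁻¹ * P Q y w ∈ O := Iff.rfl

/-- `pM` -/
def pM (p : K) (M : Submodule O V) : Submodule O V where
  carrier := {x | p⁻¹ • x ∈ M}
  add_mem' := fun {x y} hx hy => by
    change p⁻¹ • (x + y) ∈ M
    rw [smul_add]; exact M.add_mem hx hy
  zero_mem' := by simp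
  smul_mem' := fun c x hx => by
    change p⁻¹ • ((c : K) • x) ∈ M
    rw [smul_comm]; exact M.smul_mem c hx

lemma mem_pM {x : V} : x ∈ pM p M ↔ p⁻¹ • x ∈ M := Iff.rfl
lemma pM_le (h : DV O p) : pM p M ≤ M := fun x hx => by
  have := smul_memK M h.mem (mem_pM.1 hx)
  rwa [smul_smul, mul_inv_cancel₀ h.ne, one_smul] at this
lemma pM_p (h : DV O p) {x : V} (hx : x ∈ M) : p • x ∈ pM p M := by
  rw [mem_pM, smul_smul, inv_mul_cancel₀ h.ne, one_smul]; exact hx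

lemma MZ (hM : Mx O Q M) {y : V} (hQ : p⁻¹ * (p⁻¹ * Q y) ∈ O) (hP : ∀ w ∈ M, p⁻¹ * P Q y w ∈ O) :
    p⁻¹ • y ∈ M := by
  refine hM.2 _ ?_ fun w hw => ?_
  · rw [Q_smul, mul_assoc]; exact hQ
  · rw [P_smul_left]; exact hP w hw

/-- type A functional -/
structure TA (O : Subring K) (p : K) (Q : QuadraticForm K V) (M : Submodule O V) (g : V →ₗ[K] K) : Prop where
  int : ∀ x ∈ M, g x ∈ O
  prim : ∃ m ∈ M, p⁻¹ * g m ∉ O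
  ty : ∀ y ∈ M, p⁻¹ * g y ∈ O → p⁻¹ * Q y ∈ O → (∀ w ∈ M, p⁻¹ * g w ∈ O → p⁻¹ * P Q y w ∈ O) →
    ∀ w ∈ M, p⁻¹ * P Q y w ∈ O
  zz : ∀ y ∈ M, p⁻¹ * Q y ∈ O → (∀ w ∈ M, p⁻¹ * P Q y w ∈ O) → p⁻¹ * g y ∈ O

/-- decomposition along a vector with unit value -/
lemma dcm (h : DV O p) {g : V →ₗ[K] K} (hg : ∀ x ∈ M, g x ∈ O) {m : V} (hm : m ∈ M) (hgm : p⁻¹ * g m ∉ O)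
    {w : V} (hw : w ∈ M) : ∃ c ∈ O, ∃ w' ∈ M, g w' = 0 ∧ w = w' + c • m ∧ (p⁻¹ * g w ∈ O → p⁻¹ * c ∈ O) := by
  obtain ⟨h1, h2⟩ := h.unit (hg m hm) hgm
  refine ⟨(g m)⁻¹ * g w, O.mul_mem h1 (hg w hw), w - ((g m)⁻¹ * g w) • m,
    M.sub_mem hw (smul_memK M (O.mul_mem h1 (hg w hw)) hm), ?_, by simp, fun h3 => pi_mul h1 h3⟩
  rw [map_sub, map_smul, smul_eq_mul]
  field_simp
  ring

/-- condition on kernel elements suffices -/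
lemma ker_HH (h : DV O p) (hintg : ∀ x ∈ M, Q x ∈ O) {g : V →ₗ[K] K} (hg : ∀ x ∈ M, g x ∈ O)
    (hp : ∃ m ∈ M, p⁻¹ * g m ∉ O) {y : V} (hy : y ∈ M) (hN : ∀ w ∈ M, g w = 0 → p⁻¹ * P Q y w ∈ O) :
    ∀ w ∈ M, p⁻¹ * g w ∈ O → p⁻¹ * P Q y w ∈ O := by
  obtain ⟨m, hm, hgm⟩ := hp
  intro w hw hgw
  obtain ⟨c, hc, w', hw', h0, rfl, hc2⟩ := dcm h hg hm hgm hw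
  rw [P_add_right, P_smul_right, mul_comm c]
  exact pi_add (hN _ hw' h0) (pi_mul (P_mem hintg hy hm) (hc2 hgw))

/-- with `x0`, `g = P x0`, correct `y` by a multiple of `x0` -/
lemma corr (h : DV O p) (hintg : ∀ x ∈ M, Q x ∈ O) {x0 m : V} (hx0 : x0 ∈ M) (hm : m ∈ M)
    (hgm : p⁻¹ * P Q x0 m ∉ O) {y : V} (hy : y ∈ M) (hN : ∀ w ∈ M, P Q x0 w = 0 → p⁻¹ * P Q y w ∈ O) :
    ∃ c ∈ O, ∀ w ∈ M, p⁻¹ * P Q (y - c • x0) w ∈ O := by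
  have hg : ∀ x ∈ M, PL Q x0 x ∈ O := fun x hx => P_mem hintg hx0 hx
  obtain ⟨h1, h2⟩ := h.unit (P_mem hintg hx0 hm) hgm
  refine ⟨(P Q x0 m)⁻¹ * P Q y m, O.mul_mem h1 (P_mem hintg hy hm), fun w hw => ?_⟩
  obtain ⟨c, hc, w', hw', h0, rfl, hc2⟩ := dcm h hg hm (g := PL Q x0) hgm hw
  rw [PL_apply] at h0
  have e : P Q (y - ((P Q x0 m)⁻¹ * P Q y m) • x0) (w' + c • m) = P Q y w' := by
    rw [P_sub_left, P_smul_left, P_add_right, P_add_right, P_smul_right, P_smul_right, h0]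
    field_simp
    ring
  rw [e]
  exact hN _ hw' h0

lemma badV (h : DV O p) (hM : Mx O Q M) (hM' : Mx O Q M') (hfull : ∀ x : V, ∃ k : ℕ, p ^ k • x ∈ M)
    {g : V →ₗ[K] K} (hg : TA O p Q M g) (hN : ∀ x ∈ M, g x = 0 → x ∈ M') : M' ≤ M := by
  by_contra hcon
  obtain ⟨x, hx, hxM⟩ := SetLike.not_le_iff_exists.1 hcon
  obtain ⟨x, hx, hxM, hpx⟩ : ∃ x ∈ M', x ∉ M ∧ p • x ∈ M := by
    classical
    have hex := hfull x
    have h1 := Nat.find_spec hex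
    have h0 : Nat.find hex ≠ 0 := fun h0 => hxM (by rw [h0] at h1; simpa using h1)
    obtain ⟨i, hi⟩ := Nat.exists_eq_succ_of_ne_zero h0
    refine ⟨p ^ i • x, smul_memK M' (O.pow_mem h.mem _) hx, Nat.find_min hex (by omega), ?_⟩
    rw [hi, pow_succ', mul_smul] at h1
    exact h1
  have hP : ∀ w ∈ M', p⁻¹ * P Q (p • x) w ∈ O := fun w hw => by
    rw [P_smul_left]; exact pi_p h (P_mem hM'.1 hx hw)
  have hQ : p⁻¹ * (p⁻¹ * Q (p • x)) ∈ O := by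
    rw [Q_smul, mul_assoc, inv_mul_cancel_left₀ h.ne, inv_mul_cancel_left₀ h.ne]; exact hM'.1 x hx
  by_cases hgy : p⁻¹ * g (p • x) ∈ O
  · have := hg.ty _ hpx hgy (h.of_p hQ) (ker_HH h hM.1 hg.int hg.prim hpx fun w hw h0 => hP w (hN w hw h0))
    have h2 := MZ hM hQ this
    rw [smul_smul, inv_mul_cancel₀ h.ne, one_smul] at h2
    exact hxM h2
  · refine hcon (le_of_eq (hM.eq_of_le hM'.1 fun w hw => ?_))
    obtain ⟨c, hc, w', hw', h0, rfl, -⟩ := dcm h hg.int hpx hgy hw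
    exact M'.add_mem (hN _ hw' h0) (smul_memK M' hc (smul_memK M' h.mem hx))

variable {k : Type} [Field k] [Finite k] {rs : K → k} {ι : Type} [Fintype ι] {b : Module.Basis ι K V}

/-- Chevalley in a lattice -/
lemma chevM {Q : QuadraticForm K V} (h : DV O p) (hr : Res O p k rs) (hb : BM O b M) (h3 : 3 ≤ Fintype.card ι)
    (hintg : ∀ x ∈ M, Q x ∈ O) : ∃ x ∈ M, p⁻¹ • x ∉ M ∧ p⁻¹ * Q x ∈ O := by
  classical
  obtain ⟨f⟩ : Nonempty (Fin 3 ↪ ι) := Function.Embedding.nonempty_of_card_le (by simpa using h3)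
  obtain ⟨a, ha, ⟨i, hi⟩, hq⟩ := chev h hr (Q := Q) (fun i => b (f i)) (fun i => hintg _ (b_mem hb _))
    fun i j => P_mem hintg (b_mem hb _) (b_mem hb _)
  refine ⟨_, M.sum_mem fun i _ => smul_memK M (ha i) (b_mem hb (f i)), fun hc => hi ?_, hq⟩
  have := (hb _).1 hc (f i)
  rw [map_smul, Finsupp.smul_apply, smul_eq_mul, map_sum, Finsupp.finset_sum_apply] at this
  rw [Finset.sum_eq_single i] at this
  · simpa using this
  · intro j _ hj
    simp [Finsupp.single_apply, hj]
  · simp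

lemma TAex (h : DV O p) (hr : Res O p k rs) (hb : BM O b M) (h3 : 3 ≤ Fintype.card ι) (hM : Mx O Q M) :
    ∃ g, TA O p Q M g := by
  by_cases hc : ∃ ρ ∈ M, (∀ w ∈ M, p⁻¹ * P Q ρ w ∈ O) ∧ p⁻¹ * Q ρ ∉ O
  · obtain ⟨ρ, hρ, hρP, hρQ⟩ := hc
    obtain ⟨g, g1, g2, g3⟩ := sep h hr hb (Z := ZZ h Q M hM.1) (fun x hx => hx.1)
      (fun x hx => ⟨smul_memK M h.mem hx, by
        rw [Q_smul, mul_assoc]; exact pi_p h (O.mul_mem h.mem (hM.1 x hx)), fun w hw => by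
        rw [P_smul_left]; exact pi_p h (P_mem hM.1 hx hw)⟩) hρ (fun hh => hρQ hh.2.1)
    refine ⟨g, g1, ⟨ρ, hρ, g3⟩, fun y hy _ hQ hP w hw => ?_, fun y hy hQ hP => g2 y ⟨hy, hQ, hP⟩⟩
    obtain ⟨c, hcO, w', hw', h0, rfl, -⟩ := dcm h g1 hρ g3 hw
    rw [P_add_right, P_smul_right]
    refine pi_add (hP w' hw' (by rw [h0]; simp [O.zero_mem])) (pi_mul hcO ?_)
    rw [P_comm]; exact hρP y hy
  · push Not at hc
    obtain ⟨y0, hy0, hQ0⟩ : ∃ y0 ∈ M, p⁻¹ * Q y0 ∉ O := by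
      by_contra hcon
      push Not at hcon
      obtain ⟨x, hx, hx1, hx2⟩ := chevM (Q := p⁻¹ • Q) h hr hb h3 (fun x hx => hcon x hx)
      refine hx1 (MZ hM hx2 fun w hw => ?_)
      simp only [P, QuadraticMap.polar, mul_sub]
      exact O.sub_mem (O.sub_mem (hcon _ (M.add_mem hx hw)) (hcon _ hx)) (hcon _ hw)
    obtain ⟨m, hm, hm2⟩ : ∃ m ∈ M, p⁻¹ * P Q y0 m ∉ O := by
      by_contra hcon
      push Not at hcon
      exact hQ0 (hc y0 hy0 hcon)
    refine ⟨PL Q y0, fun x hx => P_mem hM.1 hy0 hx, ⟨m, hm, hm2⟩, fun y hy hgy hQ hP w hw => ?_,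
      fun y hy hQ hP => by rw [PL_apply, P_comm]; exact hP y0 hy0⟩
    obtain ⟨c, hcO, hcw⟩ := corr h hM.1 hy0 hm hm2 hy fun w hw h0 => hP w hw (by rw [PL_apply, h0]; simp [O.zero_mem])
    have h1 := hc _ (M.sub_mem hy (smul_memK M hcO hy0)) hcw
    rw [Q_sub, Q_smul, P_smul_right, P_comm] at h1
    have h2 : p⁻¹ * (c * c * Q y0) ∈ O := by
      have := pi_sub (pi_add h1 (pi_mul hcO hgy)) hQ
      convert this using 2
      simp only [PL_apply]; ring
    have hcp : p⁻¹ * c ∈ O := by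
      by_contra hcc
      rw [mul_assoc] at h2
      exact hQ0 (h.prime hcO hcc (h.prime hcO hcc h2))
    have := pi_add (hcw w hw) (pi_mul (P_mem hM.1 hy0 hw) hcp)
    rw [P_sub_left, P_smul_left] at this
    convert this using 2
    ring
end
end QL

/-! ### Helper material, part D4 -/

namespace QL
lemma ncard_img {α β γ : Type} [Finite β] [Finite γ] (A : Set α) (f : α → β) (g : α → γ)
    (h : ∀ x ∈ A, ∀ y ∈ A, f x = f y ↔ g x = g y) : (f '' A).ncard = (g '' A).ncard := by
  classical
  rcases isEmpty_or_nonempty α with hα | hα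
  · have : A = ∅ := Set.eq_empty_of_isEmpty A
    simp [this]
  have hF : ∀ x ∈ A, g (Function.invFunOn f A (f x)) = g x := fun x hx => by
    have h1 : f x ∈ f '' A := ⟨x, hx, rfl⟩
    exact (h _ (Function.invFunOn_mem h1) _ hx).1 (Function.invFunOn_eq h1)
  have e : g '' A = (fun u => g (Function.invFunOn f A u)) '' (f '' A) := by
    rw [Set.image_image]
    exact Set.image_congr fun x hx => (hF x hx).symm
  rw [e]
  refine (Set.InjOn.ncard_image ?_).symm
  rintro _ ⟨x, hx, rfl⟩ _ ⟨y, hy, rfl⟩ hxy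
  simp only at hxy
  rw [hF x hx, hF y hy] at hxy
  exact (h x hx y hy).2 hxy

section
variable {K : Type} [Field K] {V : Type} [AddCommGroup V] [Module K V] {O : Subring K} {p : K}
  {Q : QuadraticForm K V} {M L : Submodule O V}
  {k : Type} [Field k] [Finite k] {rs : K → k} {ι : Type} [Fintype ι] {b : Module.Basis ι K V}

/-- radical of the hyperplane -/
def SS (p : K) (Q : QuadraticForm K V) (M : Submodule O V) (g : V →ₗ[K] K) : Set V :=
  {x | x ∈ HH O p M g ∧ p⁻¹ * Q x ∈ O ∧ ∀ w ∈ HH O p M g, p⁻¹ * P Q x w ∈ O}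

lemma SS_congr (h : DV O p) (hintg : ∀ x ∈ M, Q x ∈ O) {g : V →ₗ[K] K} (hg : ∀ x ∈ M, g x ∈ O) {x y : V}
    (hx : x ∈ SS p Q M g) (hxy : p⁻¹ • (x - y) ∈ M) : y ∈ SS p Q M g := by
  obtain ⟨⟨h1, h2⟩, h3, h4⟩ := hx
  obtain ⟨t, ht, rfl⟩ : ∃ t ∈ M, y = x - p • t := ⟨_, hxy, by
    rw [smul_smul, mul_inv_cancel₀ h.ne, one_smul, sub_sub_cancel]⟩
  have hpt := smul_memK M h.mem ht
  refine ⟨⟨M.sub_mem h1 hpt, ?_⟩, ?_, fun w hw => ?_⟩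
  · rw [map_sub, map_smul, smul_eq_mul]; exact pi_sub h2 (pi_p h (hg t ht))
  · rw [Q_sub, Q_smul, P_smul_right, mul_assoc]
    exact pi_sub (pi_add h3 (pi_p h (O.mul_mem h.mem (hintg t ht)))) (pi_p h (P_mem hintg h1 ht))
  · rw [P_sub_left, P_smul_left]; exact pi_sub (h4 w hw) (pi_p h (P_mem hintg ht hw.1))

lemma cnt (h : DV O p) (hr : Res O p k rs) (hb : BM O b M) (hintg : ∀ x ∈ M, Q x ∈ O) (hL : L ≤ M)
    {g l : V →ₗ[K] K} (hg : ∀ x ∈ M, g x ∈ O) (hgp : ∃ m ∈ M, p⁻¹ * g m ∉ O)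
    (hl : ∀ x ∈ M, l x ∈ O) (hlp : ∃ m ∈ M, p⁻¹ * l m ∉ O) (hlL : ∀ x ∈ L, p⁻¹ * l x ∈ O)
    (hstar : ∀ x ∈ M, g x = 0 → p⁻¹ * (p⁻¹ * Q x) ∈ O → (∀ w ∈ M, g w = 0 → p⁻¹ * P Q x w ∈ O) → p⁻¹ • x ∈ M)
    (σ : V →ₗ[K] V) (hσ : ∀ x, Q (σ x) = Q x) (hσL : ∀ x ∈ M, g x = 0 → σ x ∈ L) :
    (rd rs b '' SS p Q M g).ncard = (rd rs b '' SS p Q M l).ncard := by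
  obtain ⟨m, hm, hgm⟩ := id hgp
  let N : Set V := {x | x ∈ M ∧ g x = 0}
  have hσM : ∀ x ∈ N, σ x ∈ M := fun x hx => hL (hσL x hx.1 hx.2)
  -- every class of HH has a representative in N
  have hrep : ∀ w ∈ HH O p M g, ∃ w' ∈ N, p⁻¹ • (w - w') ∈ M := fun w hw => by
    obtain ⟨c, hc, w', hw', h0, rfl, hc2⟩ := dcm h hg hm hgm hw.1
    refine ⟨w', ⟨hw', h0⟩, ?_⟩
    rw [add_sub_cancel_left, smul_smul]
    exact smul_memK M (hc2 hw.2) hm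
  have hinj : ∀ x ∈ N, ∀ y ∈ N, rd rs b x = rd rs b y ↔ rd rs b (σ x) = rd rs b (σ y) := fun x hx y hy => by
    rw [rd_eq hr hb hx.1 hy.1, rd_eq hr hb (hσM x hx) (hσM y hy), ← map_sub]
    have hd : x - y ∈ N := ⟨M.sub_mem hx.1 hy.1, by rw [map_sub, hx.2, hy.2, sub_zero]⟩
    constructor
    · intro h1
      rw [← map_smul]
      exact hσM _ ⟨h1, by rw [map_smul, hd.2, smul_zero]⟩
    · intro h1
      refine hstar _ hd.1 hd.2 ?_ fun w hw h0 => ?_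
      · have := hintg _ h1
        rw [Q_smul, hσ] at this
        rwa [← mul_assoc]
      · have := P_mem hintg h1 (hσM w ⟨hw, h0⟩)
        rwa [P_smul_left, isom_P σ hσ] at this
  have hN1 : rd rs b '' HH O p M g = rd rs b '' N := by
    ext u
    constructor
    · rintro ⟨w, hw, rfl⟩
      obtain ⟨w', hw', h1⟩ := hrep w hw
      exact ⟨w', hw', ((rd_eq hr hb hw.1 hw'.1).2 h1).symm⟩
    · rintro ⟨w, hw, rfl⟩
      exact ⟨w, ⟨hw.1, by rw [hw.2]; simp [O.zero_mem]⟩, rfl⟩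
  have hσH : ∀ x ∈ N, σ x ∈ HH O p M l := fun x hx => ⟨hσM x hx, hlL _ (hσL x hx.1 hx.2)⟩
  have hN2 : (fun x => rd rs b (σ x)) '' N = rd rs b '' HH O p M l := by
    refine Set.eq_of_subset_of_ncard_le ?_ ?_
    · rintro _ ⟨x, hx, rfl⟩
      exact ⟨σ x, hσH x hx, rfl⟩
    · have e1 := HH_ncard hr hb hg hgp
      have e2 := HH_ncard hr hb hl hlp
      have hk : 0 < Nat.card k := Nat.card_pos
      rw [← ncard_img N (rd rs b) _ hinj, ← hN1]
      exact le_of_eq (Nat.eq_of_mul_eq_mul_right hk (e2.trans e1.symm))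
  have hrep2 : ∀ w ∈ HH O p M l, ∃ w' ∈ N, p⁻¹ • (w - σ w') ∈ M := fun w hw => by
    have : rd rs b w ∈ (fun x => rd rs b (σ x)) '' N := by rw [hN2]; exact ⟨w, hw, rfl⟩
    obtain ⟨w', hw', h1⟩ := this
    exact ⟨w', hw', (rd_eq hr hb hw.1 (hσM w' hw')).1 h1.symm⟩
  have hPP : ∀ x ∈ M, ∀ w w', p⁻¹ • (w - w') ∈ M → p⁻¹ * P Q x w' ∈ O → p⁻¹ * P Q x w ∈ O :=
    fun x hx w w' h1 h2 => by
      have := O.add_mem (P_mem hintg hx h1) h2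
      rw [P_smul_right, ← mul_add, P_sub_right, sub_add_cancel] at this
      exact this
  have hSS : ∀ x ∈ N, x ∈ SS p Q M g ↔ σ x ∈ SS p Q M l := fun x hx => by
    constructor
    · rintro ⟨h1, h2, h3⟩
      refine ⟨hσH x hx, by rw [hσ]; exact h2, fun w hw => ?_⟩
      obtain ⟨w', hw', hww⟩ := hrep2 w hw
      refine hPP _ (hσM x hx) _ _ hww ?_
      rw [isom_P σ hσ]
      exact h3 w' ⟨hw'.1, by rw [hw'.2]; simp [O.zero_mem]⟩
    · rintro ⟨h1, h2, h3⟩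
      refine ⟨⟨hx.1, by rw [hx.2]; simp [O.zero_mem]⟩, by rw [← hσ]; exact h2, fun w hw => ?_⟩
      obtain ⟨w', hw', hww⟩ := hrep w hw
      refine hPP _ hx.1 _ _ hww ?_
      rw [← isom_P σ hσ]
      exact h3 _ (hσH w' hw')
  have e1 : rd rs b '' SS p Q M g = rd rs b '' (N ∩ SS p Q M g) := by
    ext u
    constructor
    · rintro ⟨w, hw, rfl⟩
      obtain ⟨w', hw', h1⟩ := hrep w hw.1
      exact ⟨w', ⟨hw', SS_congr h hintg hg hw h1⟩, ((rd_eq hr hb hw.1.1 hw'.1).2 h1).symm⟩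
    · rintro ⟨w, hw, rfl⟩
      exact ⟨w, hw.2, rfl⟩
  have e2 : rd rs b '' SS p Q M l = (fun x => rd rs b (σ x)) '' (N ∩ SS p Q M g) := by
    ext u
    constructor
    · rintro ⟨w, hw, rfl⟩
      obtain ⟨w', hw', h1⟩ := hrep2 w hw.1
      exact ⟨w', ⟨hw', (hSS _ hw').2 (SS_congr h hintg hl hw h1)⟩, ((rd_eq hr hb hw.1.1 (hσM w' hw')).2 h1).symm⟩
    · rintro ⟨w, hw, rfl⟩
      exact ⟨σ w, (hSS _ hw.1).1 hw.2, rfl⟩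
  rw [e1, e2]
  exact ncard_img _ _ _ fun x hx y hy => hinj x hx.1 y hy.1

/-- represent a functional by a vector -/
lemma rep_fun [FiniteDimensional K V] (hQ : Nondeg Q) (g : V →ₗ[K] K) : ∃ z, ∀ x, P Q z x = g x := by
  have hinj : Function.Injective (QuadraticMap.polarBilin Q) := by
    rw [← LinearMap.ker_eq_bot, LinearMap.ker_eq_bot']
    intro x hx
    refine hQ x fun y => ?_
    have := LinearMap.congr_fun hx y
    simpa using this
  have hs := (LinearMap.injective_iff_surjective_of_finrank_eq_finrank
    (f := (QuadraticMap.polarBilin Q : V →ₗ[K] (V →ₗ[K] K))) (Subspace.dual_finrank_eq (K := K) (V := V)).symm).1 hinj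
  obtain ⟨z, hz⟩ := hs g
  exact ⟨z, fun x => by rw [← hz]; rfl⟩

/-- separation of a proper sublattice -/
lemma sepL (h : DV O p) (hr : Res O p k rs) (hb : BM O b M) (hL : L ≤ M) (hLne : ¬ M ≤ L)
    (hfull : ∀ x : V, ∃ k : ℕ, p ^ k • x ∈ L) :
    ∃ l : V →ₗ[K] K, (∀ x ∈ M, l x ∈ O) ∧ (∀ x ∈ L, p⁻¹ * l x ∈ O) ∧ ∃ m ∈ M, p⁻¹ * l m ∉ O := by
  have hne : ¬ M ≤ L ⊔ pM p M := by
    intro hle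
    obtain ⟨j, hj⟩ : ∃ j : ℕ, ∀ x ∈ M, p ^ j • x ∈ L := by
      choose f hf using fun i => hfull (b i)
      refine ⟨Finset.univ.sup f, fun x hx => ?_⟩
      rw [← b.sum_repr x, Finset.smul_sum]
      refine L.sum_mem fun i _ => ?_
      have hi : f i ≤ Finset.univ.sup f := Finset.le_sup (Finset.mem_univ i)
      obtain ⟨d, hd⟩ := Nat.exists_eq_add_of_le hi
      rw [hd, smul_comm, pow_add, mul_comm, mul_smul]
      exact smul_memK L ((hb x).1 hx i) (smul_memK L (O.pow_mem h.mem _) (hf i))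
    have hit : ∀ i : ℕ, ∀ x ∈ M, ∃ y ∈ L, ∃ t ∈ M, x = y + p ^ i • t := by
      intro i
      induction i with
      | zero => exact fun x hx => ⟨0, L.zero_mem, x, hx, by simp⟩
      | succ i ih =>
        intro x hx
        obtain ⟨y, hy, t, ht, rfl⟩ := ih x hx
        obtain ⟨y', hy', t', ht', rfl⟩ := Submodule.mem_sup.1 (hle ht)
        refine ⟨y + p ^ i • y', L.add_mem hy (smul_memK L (O.pow_mem h.mem _) hy'), p⁻¹ • t', ht', ?_⟩
        rw [smul_smul, pow_succ, mul_assoc, mul_inv_cancel₀ h.ne, mul_one, smul_add, add_assoc]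
    refine hLne fun x hx => ?_
    obtain ⟨y, hy, t, ht, rfl⟩ := hit j x hx
    exact L.add_mem hy (hj t ht)
  obtain ⟨ρ, hρ, hρ2⟩ := SetLike.not_le_iff_exists.1 hne
  obtain ⟨l, h1, h2, h3⟩ := sep h hr hb (Z := L ⊔ pM p M) (sup_le hL (pM_le h))
    (fun x hx => Submodule.mem_sup_right (pM_p h hx)) hρ hρ2
  exact ⟨l, h1, fun x hx => h2 x (Submodule.mem_sup_left hx), ρ, hρ, h3⟩

theorem S1 [FiniteDimensional K V] (hQ : Nondeg Q) (h : DV O p) (hr : Res O p k rs) (hb : BM O b M) (h3 : 3 ≤ Fintype.card ι)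
    (hM : Mx O Q M) (hL : L ≤ M) (hLne : ¬ M ≤ L) (hfull : ∀ x : V, ∃ k : ℕ, p ^ k • x ∈ L) :
    ∃ z : V, z ≠ 0 ∧ ∀ σ : V →ₗ[K] V, (∀ x, Q (σ x) = Q x) → ¬ ∀ x ∈ M, P Q z x = 0 → σ x ∈ L := by
  obtain ⟨l, l1, l2, l3⟩ := sepL h hr hb hL hLne hfull
  -- main reduction
  have key : ∀ g : V →ₗ[K] K, (∀ x ∈ M, g x ∈ O) → (∃ m ∈ M, p⁻¹ * g m ∉ O) →
      (∀ x ∈ M, g x = 0 → p⁻¹ * (p⁻¹ * Q x) ∈ O → (∀ w ∈ M, g w = 0 → p⁻¹ * P Q x w ∈ O) → p⁻¹ • x ∈ M) →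
      (∃ z : V, z ≠ 0 ∧ ∀ σ : V →ₗ[K] V, (∀ x, Q (σ x) = Q x) → ¬ ∀ x ∈ M, P Q z x = 0 → σ x ∈ L) ∨
      (rd rs b '' SS p Q M g).ncard = (rd rs b '' SS p Q M l).ncard := by
    intro g g1 g2 g3
    by_contra hcon
    rw [not_or] at hcon
    obtain ⟨hc1, hc2⟩ := hcon
    push Not at hc1
    obtain ⟨z, hz⟩ := rep_fun hQ g
    have hz0 : z ≠ 0 := by
      rintro rfl
      obtain ⟨m, hm, hm2⟩ := g2
      rw [← hz, P_zero_left] at hm2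
      simp [O.zero_mem] at hm2
    obtain ⟨σ, s1, s2⟩ := hc1 z hz0
    exact hc2 (cnt h hr hb hM.1 hL g1 g2 l1 l3 l2 g3 σ s1 fun x hx h0 => s2 x hx (by rw [hz, h0]))
  -- type A
  obtain ⟨g, hg⟩ := TAex h hr hb h3 hM
  rcases key g hg.int hg.prim (fun x hx h0 hx2 hN => MZ hM hx2 (hg.ty x hx (by rw [h0]; simp [O.zero_mem]) (h.of_p hx2)
    (ker_HH h hM.1 hg.int hg.prim hx hN))) with h1 | hA
  · exact h1
  have eA : SS p Q M g = (ZZ h Q M hM.1 : Set V) := by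
    ext x
    constructor
    · rintro ⟨⟨a1, a2⟩, a3, a4⟩
      exact ⟨a1, a3, hg.ty x a1 a2 a3 fun w hw hw2 => a4 w ⟨hw, hw2⟩⟩
    · rintro ⟨a1, a2, a3⟩
      exact ⟨⟨a1, hg.zz x a1 a2 a3⟩, a2, fun w hw => a3 w hw.1⟩
  rw [eA] at hA
  have hfin : ∀ s : Set (ι → k), s.Finite := fun s => Set.toFinite s
  by_cases hZ : ∃ ζ ∈ ZZ h Q M hM.1, p⁻¹ • ζ ∉ M
  · obtain ⟨ζ, hζ, hζM⟩ := hZ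
    obtain ⟨g', g1, -, g3⟩ := sep h hr hb (Z := pM p M) (pM_le h) (fun x hx => pM_p h hx) hζ.1 hζM
    have hP : ∀ x ∈ M, (∀ w ∈ M, g' w = 0 → p⁻¹ * P Q x w ∈ O) → ∀ w ∈ M, p⁻¹ * P Q x w ∈ O := fun x hx hN w hw => by
      obtain ⟨c, hc, w', hw', h0, rfl, -⟩ := dcm h g1 hζ.1 g3 hw
      rw [P_add_right, P_smul_right]
      refine pi_add (hN w' hw' h0) (pi_mul hc ?_)
      rw [P_comm]; exact hζ.2.2 x hx
    rcases key g' g1 ⟨ζ, hζ.1, g3⟩ (fun x hx h0 hx2 hN => MZ hM hx2 (hP x hx hN)) with h1 | hB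
    · exact h1
    exfalso
    refine (Set.ncard_lt_ncard (s := rd rs b '' SS p Q M g') (t := rd rs b '' (ZZ h Q M hM.1 : Set V))
      ⟨?_, ?_⟩ (hfin _)).ne (hB.trans hA.symm)
    · refine Set.image_mono ?_
      rintro x ⟨⟨a1, a2⟩, a3, a4⟩
      exact ⟨a1, a3, hP x a1 fun w hw h0 => a4 w ⟨hw, by rw [h0]; simp [O.zero_mem]⟩⟩
    · intro hsub
      obtain ⟨x, hx, hxe⟩ := hsub ⟨ζ, hζ, rfl⟩
      have h1 := (rd_eq hr hb hx.1.1 hζ.1).1 hxe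
      have h2 := g1 _ h1
      rw [map_smul, smul_eq_mul, map_sub] at h2
      have := O.sub_mem hx.1.2 h2
      apply g3
      rwa [← mul_sub, sub_sub_cancel] at this
  · push Not at hZ
    obtain ⟨x0, hx0, hx0M, hx0Q⟩ := chevM h hr hb h3 hM.1
    have hprim : ∀ x ∈ M, p⁻¹ • x ∉ M → p⁻¹ * Q x ∈ O → ∃ m ∈ M, p⁻¹ * P Q x m ∉ O := fun x hx hxM hxQ => by
      by_contra hcon
      push Not at hcon
      exact hxM (hZ x ⟨hx, hxQ, hcon⟩)
    obtain ⟨x0, hx0, hx0M, hx0Q, hx0QQ⟩ : ∃ x ∈ M, p⁻¹ • x ∉ M ∧ p⁻¹ * Q x ∈ O ∧ p⁻¹ * (p⁻¹ * Q x) ∉ O := by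
      by_cases hq : p⁻¹ * (p⁻¹ * Q x0) ∈ O
      · obtain ⟨m, hm, hm2⟩ := hprim x0 hx0 hx0M hx0Q
        have e : p⁻¹ * Q (x0 + p • m) = p⁻¹ * Q x0 + p * Q m + P Q x0 m := by
          rw [Q_add, Q_smul, P_smul_right]
          have := h.ne
          field_simp
        refine ⟨x0 + p • m, M.add_mem hx0 (smul_memK M h.mem hm), fun hc => hx0M ?_, ?_, fun hc => hm2 ?_⟩
        · rw [smul_add, smul_smul, inv_mul_cancel₀ h.ne, one_smul] at hc
          simpa using M.sub_mem hc hm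
        · rw [e]; exact O.add_mem (O.add_mem hx0Q (O.mul_mem h.mem (hM.1 m hm))) (P_mem hM.1 hx0 hm)
        · rw [e] at hc
          have := pi_sub hc (pi_add hq (pi_p h (hM.1 m hm)))
          rwa [add_sub_cancel_left] at this
      · exact ⟨x0, hx0, hx0M, hx0Q, hq⟩
    obtain ⟨m, hm, hm2⟩ := hprim x0 hx0 hx0M hx0Q
    rcases key (PL Q x0) (fun x hx => P_mem hM.1 hx0 hx) ⟨m, hm, hm2⟩ (fun x hx h0 hx2 hN => by
      obtain ⟨c, hc, hcw⟩ := corr h hM.1 hx0 hm hm2 hx hN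
      have e : Q (x - c • x0) = Q x + c * (c * Q x0) := by
        rw [PL_apply] at h0
        rw [Q_sub, Q_smul, P_smul_right, P_comm, h0]; ring
      have hmem : x - c • x0 ∈ M := M.sub_mem hx (smul_memK M hc hx0)
      have h1 := hZ _ ⟨hmem, by
        rw [e]; exact pi_add (h.of_p hx2) (pi_mul hc (pi_mul hc hx0Q)), hcw⟩
      by_cases hcp : p⁻¹ * c ∈ O
      · have := M.add_mem h1 (smul_memK M hcp hx0)
        rwa [smul_sub, smul_smul, sub_add_cancel] at this
      · exfalso
        have h2 := hM.1 _ h1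
        rw [Q_smul, mul_assoc, e] at h2
        have h4 := O.sub_mem h2 hx2
        rw [← mul_sub, ← mul_sub, add_sub_cancel_left,
          show p⁻¹ * (p⁻¹ * (c * (c * Q x0))) = p⁻¹ * (c * (c * (p⁻¹ * Q x0))) by ring] at h4
        exact hx0QQ (h.prime hc hcp (h.prime hc hcp h4))) with h1 | hB
    · exact h1
    exfalso
    have hx0S : x0 ∈ SS p Q M (PL Q x0) := by
      refine ⟨⟨hx0, ?_⟩, hx0Q, fun w hw => hw.2⟩
      rw [PL_apply, P_self, two_mul]
      exact pi_add hx0Q hx0Q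
    refine (Set.ncard_lt_ncard (s := rd rs b '' (ZZ h Q M hM.1 : Set V)) (t := rd rs b '' SS p Q M (PL Q x0))
      ⟨?_, ?_⟩ (hfin _)).ne (hA.trans hB.symm)
    · rintro _ ⟨x, hx, rfl⟩
      refine ⟨0, ⟨⟨M.zero_mem, by simp [O.zero_mem]⟩, by simp [O.zero_mem], fun w _ => ?_⟩, ?_⟩
      · rw [P_zero_left]; simp [O.zero_mem]
      · rw [rd_eq hr hb M.zero_mem hx.1, zero_sub, smul_neg]
        exact M.neg_mem (hZ x hx)
    · intro hsub
      obtain ⟨x, hx, hxe⟩ := hsub ⟨x0, hx0S, rfl⟩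
      have h1 := (rd_eq hr hb hx.1 hx0).1 hxe
      have h2 := M.sub_mem (hZ x hx) h1
      rw [smul_sub, sub_sub_cancel] at h2
      exact hx0M h2
end
end QL

/-! ### Helper material, part E0 -/

namespace QL
section
variable {K : Type} [Field K] {V : Type} [AddCommGroup V] [Module K V] {O : Subring K} {p : K}

lemma DV.pid (h : DV O p) : IsPrincipalIdealRing O := by
  have hd : IsDiscreteValuationRing O := by
    refine IsDiscreteValuationRing.ofHasUnitMulPowIrreducibleFactorization ⟨⟨p, h.mem⟩, ?_, ?_⟩
    · constructor
      · intro hu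
        obtain ⟨y, hy⟩ := hu.exists_right_inv
        have h1 : p * (y : K) = 1 := congrArg Subtype.val hy
        apply h.inv
        rw [inv_eq_of_mul_eq_one_right h1]; exact y.2
      · intro a c hac
        have h1 : p = (a : K) * c := congrArg Subtype.val hac
        have h0 : (c : K) ≠ 0 := fun h0 => h.ne (by rw [h1, h0, mul_zero])
        by_cases ha : p⁻¹ * (a : K) ∈ O
        · right
          refine IsUnit.of_mul_eq_one (⟨_, ha⟩ : O) (Subtype.ext ?_)
          change (c : K) * (p⁻¹ * a) = 1
          have := h.ne
          field_simp
          rw [h1]; ring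
        · left
          obtain ⟨h2, h3⟩ := h.unit a.2 ha
          exact IsUnit.of_mul_eq_one (⟨_, h2⟩ : O) (Subtype.ext (mul_inv_cancel₀ h3))
    · intro x hx
      have hx0 : (x : K) ≠ 0 := fun h0 => hx (Subtype.ext h0)
      obtain ⟨j, u, h1, h2, h3, h4⟩ := h.dec x hx0
      have hj : 0 ≤ j := by
        by_contra hneg
        push Not at hneg
        obtain ⟨i, rfl⟩ : ∃ i : ℕ, j = -((i : ℤ) + 1) := ⟨(-j - 1).toNat, by omega⟩
        apply h.inv
        have e : p⁻¹ = p ^ i * ((x : K) * u⁻¹) := by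
          rw [h4, zpow_neg, zpow_add₀ h.ne, zpow_one, zpow_natCast]
          have := h.ne
          field_simp
        rw [e]
        exact O.mul_mem (O.pow_mem h.mem _) (O.mul_mem x.2 h2)
      obtain ⟨i, rfl⟩ := Int.eq_ofNat_of_zero_le hj
      refine ⟨i, ⟨⟨⟨u, h1⟩, ⟨u⁻¹, h2⟩, Subtype.ext (mul_inv_cancel₀ h3), Subtype.ext (inv_mul_cancel₀ h3)⟩, ?_⟩⟩
      apply Subtype.ext
      change p ^ i * u = x
      rw [h4, zpow_natCast]
  infer_instance

lemma DV.frac (h : DV O p) : IsFractionRing O K := by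
  refine IsFractionRing.of_field O K fun z => ?_
  obtain ⟨k, hk⟩ := h.full_of z
  refine ⟨⟨_, hk⟩, ⟨p ^ k, O.pow_mem h.mem _⟩, ?_⟩
  change z = p ^ k * z / p ^ k
  rw [mul_div_cancel_left₀ _ (pow_ne_zero _ h.ne)]

lemma exBM (h : DV O p) {M : Submodule O V} (hfg : M.FG) (hsp : Submodule.span K (M : Set V) = ⊤) :
    ∃ (d : ℕ) (b : Module.Basis (Fin d) K V), BM O b M := by
  have := h.pid
  have := h.frac
  have : Module.Finite O M := Module.Finite.iff_fg.2 hfg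
  have : Submodule.IsLattice K M := ⟨hfg, hsp⟩
  have : Module.IsTorsionFree O V := Module.IsTorsionFree.trans_faithfulSMul O K V
  have : Module.Free O M := Module.free_of_finite_type_torsion_free'
  let b' := Module.finBasis O M
  refine ⟨_, b'.extendOfIsLattice K, fun x => ⟨fun hx i => ?_, fun hx => ?_⟩⟩
  · obtain ⟨c, e⟩ : ∃ c : Fin _ → O, x = ∑ i, (c i : K) • (b'.extendOfIsLattice K) i := by
      refine ⟨b'.repr ⟨x, hx⟩, ?_⟩
      have := congrArg Subtype.val (b'.sum_repr ⟨x, hx⟩)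
      simp only [Submodule.coe_sum, Submodule.coe_smul] at this
      refine this.symm.trans (Finset.sum_congr rfl fun i _ => ?_)
      rw [Module.Basis.extendOfIsLattice_apply]
      rfl
    rw [e, Module.Basis.repr_sum_self]
    exact (c i).2
  · rw [← (b'.extendOfIsLattice K).sum_repr x]
    refine M.sum_mem fun i _ => smul_memK M (hx i) ?_
    rw [Module.Basis.extendOfIsLattice_apply]
    exact (b' i).2

lemma DV.of_val (w : Valuation K (WithZero (Multiplicative ℤ))) (hO : ∀ x, x ∈ O ↔ w x ≤ 1)
    (hp : w p = WithZero.exp (-1)) : DV O p := by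
  have hp0 : p ≠ 0 := by
    rintro rfl
    rw [map_zero] at hp
    exact WithZero.exp_ne_zero hp.symm
  refine ⟨?_, hp0, ?_, fun x hx => ?_⟩
  · rw [hO, hp, ← WithZero.exp_zero, WithZero.exp_le_exp]; norm_num
  · rw [hO, map_inv₀, hp, ← WithZero.exp_neg, ← WithZero.exp_zero, WithZero.exp_le_exp]; norm_num
  · have hw : w x ≠ 0 := (Valuation.ne_zero_iff w).2 hx
    obtain ⟨j, hj⟩ : ∃ j : ℤ, w x = WithZero.exp j := ⟨_, (WithZero.exp_log hw).symm⟩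
    have hpj : ∀ i : ℤ, w (p ^ i) = WithZero.exp (-i) := fun i => by
      rw [map_zpow₀, hp, ← WithZero.exp_zsmul]; simp
    have hu : w (p ^ j * x) = 1 := by
      rw [map_mul, hpj, hj, ← WithZero.exp_add]; simp
    refine ⟨-j, p ^ j * x, ?_, ?_, ?_, ?_⟩
    · rw [hO, hu]
    · rw [hO, map_inv₀, hu, inv_one]
    · exact mul_ne_zero (zpow_ne_zero _ hp0) hx
    · rw [← mul_assoc, ← zpow_add₀ hp0]; simp
end
end QL

/-! ### Helper material, part E1 -/

namespace QL
lemma BM.lt {K : Type} [Field K] {V : Type} [AddCommGroup V] [Module K V] {O : Subring K} {p : K} {ι : Type} [Fintype ι]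
    {b : Module.Basis ι K V} {M : Submodule O V} (h : DV O p) (hb : BM O b M) : Lt O p M := by
  constructor
  · intro x
    choose f hf using fun i => h.full_of (b.repr x i)
    refine ⟨Finset.univ.sup f, (hb _).2 fun i => ?_⟩
    obtain ⟨d, hd⟩ := Nat.exists_eq_add_of_le (Finset.le_sup (f := f) (Finset.mem_univ i))
    rw [hd, map_smul, Finsupp.smul_apply, smul_eq_mul, pow_add, mul_comm (p ^ f i), mul_assoc]
    exact O.mul_mem (O.pow_mem h.mem _) (hf i)
  · intro x hx
    obtain ⟨i, hi⟩ : ∃ i, b.repr x i ≠ 0 := by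
      by_contra hc
      push Not at hc
      exact hx (b.repr.map_eq_zero_iff.1 (Finsupp.ext hc))
    obtain ⟨k, hk⟩ := h.bdd_of hi
    refine ⟨k, fun hc => hk ?_⟩
    have := (hb _).1 hc i
    rwa [map_smul, Finsupp.smul_apply, smul_eq_mul] at this

section
open NumberField
variable {F : Type} [Field F] [NumberField F] {V : Type} [AddCommGroup V] [Module F V]

lemma mem_OF {x : F} : x ∈ OF F ↔ ∃ r : 𝓞 F, algebraMap (𝓞 F) F r = x :=
  ⟨fun h => ⟨⟨x, h⟩, rfl⟩, fun ⟨r, hr⟩ => hr ▸ r.2⟩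
lemma OF_coe (r : 𝓞 F) : algebraMap (𝓞 F) F r ∈ OF F := r.2

/-- localization inside `F` -/
def OL (v : HeightOneSpectrum (𝓞 F)) : Subring F := (v.valuation F).integer
lemma mem_OL {v : HeightOneSpectrum (𝓞 F)} {x : F} : x ∈ OL v ↔ v.valuation F x ≤ 1 := Iff.rfl

lemma OF_le_OL (v : HeightOneSpectrum (𝓞 F)) {x : F} (hx : x ∈ OF F) : x ∈ OL v := by
  obtain ⟨r, rfl⟩ := mem_OF.1 hx
  exact v.valuation_le_one r

lemma OF_iff {x : F} : x ∈ OF F ↔ ∀ v : HeightOneSpectrum (𝓞 F), x ∈ OL v := by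
  refine ⟨fun h v => OF_le_OL v h, fun h => ?_⟩
  obtain ⟨r, hr⟩ := HeightOneSpectrum.mem_integers_of_valuation_le_one F x h
  exact mem_OF.2 ⟨r, hr⟩

lemma OL_den (v : HeightOneSpectrum (𝓞 F)) {x : F} (hx : x ∈ OL v) :
    ∃ s ∈ OF F, v.valuation F s = 1 ∧ s * x ∈ OF F := by
  obtain ⟨n, d, h⟩ := v.exists_primeCompl_mul_eq_of_integer x hx
  have hd : (d : 𝓞 F) ∉ v.asIdeal := d.2
  refine ⟨_, OF_coe (d : 𝓞 F), v.valuation_eq_one_iff_notMem.2 hd, ?_⟩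
  rw [mul_comm]; erw [h]; exact OF_coe n

lemma OL_cancel {v : HeightOneSpectrum (𝓞 F)} {s x : F} (hs : v.valuation F s = 1) : s * x ∈ OL v ↔ x ∈ OL v := by
  rw [mem_OL, mem_OL, map_mul, hs, one_mul]

/-- localized lattice -/
def lc (v : HeightOneSpectrum (𝓞 F)) (M : Submodule (OF F) V) : Submodule (OL v) V where
  carrier := {x | ∃ s ∈ OF F, v.valuation F s = 1 ∧ s • x ∈ M}
  add_mem' := by
    rintro x y ⟨s, h1, h2, h3⟩ ⟨t, h4, h5, h6⟩
    refine ⟨s * t, (OF F).mul_mem h1 h4, by rw [map_mul, h2, h5, one_mul], ?_⟩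
    rw [smul_add, mul_smul, mul_smul, smul_comm s t x]
    exact M.add_mem (smul_memK M h4 h3) (smul_memK M h1 h6)
  zero_mem' := ⟨1, (OF F).one_mem, map_one _, by simp⟩
  smul_mem' := by
    rintro a x ⟨s, h1, h2, h3⟩
    obtain ⟨t, h4, h5, h6⟩ := OL_den v a.2
    refine ⟨s * t, (OF F).mul_mem h1 h4, by rw [map_mul, h2, h5, one_mul], ?_⟩
    change (s * t) • ((a : F) • x) ∈ M
    rw [smul_smul, mul_assoc, mul_comm, mul_smul]
    exact smul_memK M h6 h3

lemma mem_lc {v : HeightOneSpectrum (𝓞 F)} {M : Submodule (OF F) V} {x : V} :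
    x ∈ lc v M ↔ ∃ s ∈ OF F, v.valuation F s = 1 ∧ s • x ∈ M := Iff.rfl
lemma le_lc (v : HeightOneSpectrum (𝓞 F)) {M : Submodule (OF F) V} {x : V} (hx : x ∈ M) : x ∈ lc v M :=
  ⟨1, (OF F).one_mem, map_one _, by simpa⟩

lemma of_lc {M : Submodule (OF F) V} {x : V} (h : ∀ v, x ∈ lc v M) : x ∈ M := by
  let I : Ideal (𝓞 F) :=
    { carrier := {r | (algebraMap (𝓞 F) F r) • x ∈ M}
      add_mem' := fun {a b} ha hb => by
        change (algebraMap (𝓞 F) F (a + b)) • x ∈ M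
        rw [map_add, add_smul]; exact M.add_mem ha hb
      zero_mem' := by
        change (algebraMap (𝓞 F) F 0) • x ∈ M
        simp
      smul_mem' := fun c a ha => by
        change (algebraMap (𝓞 F) F (c * a)) • x ∈ M
        rw [map_mul, mul_smul]; exact smul_memK M (OF_coe c) ha }
  by_contra hx
  have hI : I ≠ ⊤ := fun ht => hx (by
    have : (1 : 𝓞 F) ∈ I := by rw [ht]; trivial
    change (algebraMap (𝓞 F) F 1) • x ∈ M at this
    simpa using this)
  obtain ⟨m, hm, hIm⟩ := Ideal.exists_le_maximal I hI
  let v : HeightOneSpectrum (𝓞 F) := ⟨m, hm.isPrime,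
    Ring.ne_bot_of_isMaximal_of_not_isField hm (RingOfIntegers.not_isField F)⟩
  obtain ⟨s, h1, h2, h3⟩ := h v
  obtain ⟨r, rfl⟩ := mem_OF.1 h1
  exact v.valuation_eq_one_iff_notMem.1 h2 (hIm h3)

lemma lc_mono (v : HeightOneSpectrum (𝓞 F)) {M N : Submodule (OF F) V} (h : M ≤ N) : lc v M ≤ lc v N :=
  fun _ ⟨s, h1, h2, h3⟩ => ⟨s, h1, h2, h h3⟩

lemma lc_int {v : HeightOneSpectrum (𝓞 F)} {M : Submodule (OF F) V} {Q : QuadraticForm F V}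
    (h : ∀ x ∈ M, Q x ∈ OF F) : ∀ x ∈ lc v M, Q x ∈ OL v := by
  rintro x ⟨s, h1, h2, h3⟩
  have := OF_le_OL v (h _ h3)
  rwa [Q_smul, OL_cancel (by rw [map_mul, h2, one_mul])] at this

lemma lc_den (v : HeightOneSpectrum (𝓞 F)) (f : V → F) (t : Finset V) (h : ∀ m ∈ t, f m ∈ OL v) :
    ∃ s ∈ OF F, v.valuation F s = 1 ∧ ∀ m ∈ t, s * f m ∈ OF F := by
  classical
  induction t using Finset.induction_on with
  | empty => exact ⟨1, (OF F).one_mem, map_one _, by simp⟩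
  | insert a t ha ih =>
    obtain ⟨s, h1, h2, h3⟩ := ih fun m hm => h m (Finset.mem_insert_of_mem hm)
    obtain ⟨u, h4, h5, h6⟩ := OL_den v (h a (Finset.mem_insert_self _ _))
    refine ⟨s * u, (OF F).mul_mem h1 h4, by rw [map_mul, h2, h5, one_mul], fun m hm => ?_⟩
    rcases Finset.mem_insert.1 hm with rfl | hm
    · rw [mul_assoc]; exact (OF F).mul_mem h1 h6
    · rw [mul_comm s, mul_assoc]; exact (OF F).mul_mem h4 (h3 m hm)

lemma span_ind {O : Subring F} {t : Set V} (f : V →ₗ[F] F) (h : ∀ m ∈ t, f m ∈ O) :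
    ∀ m ∈ Submodule.span O t, f m ∈ O := by
  intro m hm
  induction hm using Submodule.span_induction with
  | mem x hx => exact h x hx
  | zero => simp [O.zero_mem]
  | add x y _ _ hx hy => rw [map_add]; exact O.add_mem hx hy
  | smul a x _ hx =>
    change f ((a : F) • x) ∈ O
    rw [map_smul, smul_eq_mul]; exact O.mul_mem a.2 hx

lemma lc_Mx (v : HeightOneSpectrum (𝓞 F)) {M : Submodule (OF F) V} {Q : QuadraticForm F V} (hfg : M.FG)
    (h : Mx (OF F) Q M) : Mx (OL v) Q (lc v M) := by
  refine ⟨lc_int h.1, fun x hx hP => ?_⟩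
  obtain ⟨t, rfl⟩ := hfg
  obtain ⟨s, h1, h2, h3⟩ := lc_den v (fun m => P Q x m) t fun m hm => hP m (le_lc v (Submodule.subset_span hm))
  obtain ⟨u, h4, h5, h6⟩ := OL_den v hx
  refine ⟨s * u, (OF F).mul_mem h1 h4, by rw [map_mul, h2, h5, one_mul], h.2 _ ?_ ?_⟩
  · rw [Q_smul, show s * u * (s * u) * Q x = s * s * u * (u * Q x) by ring]
    exact (OF F).mul_mem ((OF F).mul_mem ((OF F).mul_mem h1 h1) h4) h6
  · refine span_ind (PL Q ((s * u) • x)) fun m hm => ?_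
    rw [PL_apply, P_smul_left, mul_comm s, mul_assoc]
    exact (OF F).mul_mem h4 (h3 m hm)

lemma lc_fg (v : HeightOneSpectrum (𝓞 F)) {M : Submodule (OF F) V} (hfg : M.FG) : (lc v M).FG := by
  obtain ⟨t, rfl⟩ := hfg
  refine ⟨t, le_antisymm (Submodule.span_le.2 fun x hx => le_lc v (Submodule.subset_span hx)) ?_⟩
  rintro x ⟨s, h1, h2, h3⟩
  have h4 : s • x ∈ Submodule.span (OL v) (t : Set V) := by
    refine Submodule.span_induction (p := fun y _ => y ∈ Submodule.span (OL v) (t : Set V))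
      (fun y hy => Submodule.subset_span hy) (Submodule.zero_mem _) (fun _ _ _ _ => Submodule.add_mem _) (fun a y _ hy => ?_) h3
    exact smul_memK _ (OF_le_OL v a.2) hy
  have hs : s ≠ 0 := by
    rintro rfl
    simp at h2
  have h5 : s⁻¹ ∈ OL v := by rw [mem_OL, map_inv₀, h2, inv_one]
  have := smul_memK _ h5 h4
  rwa [smul_smul, inv_mul_cancel₀ hs, one_smul] at this

lemma lc_sp (v : HeightOneSpectrum (𝓞 F)) {M : Submodule (OF F) V} (h : Submodule.span F (M : Set V) = ⊤) :
    Submodule.span F (lc v M : Set V) = ⊤ :=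
  top_le_iff.1 (h ▸ Submodule.span_mono fun _ hx => le_lc v hx)

lemma OL_DV (v : HeightOneSpectrum (𝓞 F)) : ∃ p : F, v.valuation F p = WithZero.exp (-1) ∧ DV (OL v) p := by
  obtain ⟨p, hp⟩ := v.valuation_exists_uniformizer F
  exact ⟨p, hp, DV.of_val (v.valuation F) (fun _ => Iff.rfl) hp⟩

lemma OL_pi {v : HeightOneSpectrum (𝓞 F)} {p : F} (hp : v.valuation F p = WithZero.exp (-1)) (x : F) :
    p⁻¹ * x ∈ OL v ↔ v.valuation F x < 1 := by
  rw [mem_OL, map_mul, map_inv₀, hp]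
  by_cases hx : v.valuation F x = 0
  · simp [hx]
  obtain ⟨j, hj⟩ : ∃ j : ℤ, v.valuation F x = WithZero.exp j := ⟨_, (WithZero.exp_log hx).symm⟩
  rw [hj, ← WithZero.exp_neg, ← WithZero.exp_add, ← WithZero.exp_zero, WithZero.exp_le_exp, WithZero.exp_lt_exp]
  omega

open Classical in
/-- residue function -/
def rsv (v : HeightOneSpectrum (𝓞 F)) (x : F) : 𝓞 F ⧸ v.asIdeal :=
  if h : ∃ r : 𝓞 F, v.valuation F (algebraMap (𝓞 F) F r - x) < 1 then Ideal.Quotient.mk _ h.choose else 0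

lemma rsv_eq (v : HeightOneSpectrum (𝓞 F)) {x : F} {r : 𝓞 F} (h : v.valuation F (algebraMap (𝓞 F) F r - x) < 1) :
    rsv v x = Ideal.Quotient.mk _ r := by
  have hex : ∃ r : 𝓞 F, v.valuation F (algebraMap (𝓞 F) F r - x) < 1 := ⟨r, h⟩
  rw [rsv, dif_pos hex, Ideal.Quotient.eq, ← v.valuation_lt_one_iff_mem (K := F)]
  change v.valuation F (algebraMap (𝓞 F) F _) < 1
  rw [map_sub, ← sub_sub_sub_cancel_right _ _ x]
  exact Valuation.map_sub_lt _ hex.choose_spec h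

lemma OL_Res (v : HeightOneSpectrum (𝓞 F)) {p : F} (hp : v.valuation F p = WithZero.exp (-1)) :
    ∃ (k : Type) (_ : Field k) (_ : Finite k) (rs : F → k), Res (OL v) p k rs := by
  have : v.asIdeal.IsMaximal := v.isMaximal
  letI : Field (𝓞 F ⧸ v.asIdeal) := Ideal.Quotient.field _
  refine ⟨𝓞 F ⧸ v.asIdeal, inferInstance, Ideal.finiteQuotientOfFreeOfNeBot _ v.ne_bot, rsv v, ?_⟩
  have key : ∀ x ∈ OL v, ∃ r : 𝓞 F, v.valuation F (algebraMap (𝓞 F) F r - x) < 1 := fun x hx => by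
    simpa using v.exists_valuation_sub_lt_of_integer hx 1
  refine ⟨fun a ha b hb => ?_, fun a ha b hb => ?_, fun c => ?_, fun a ha => ?_⟩
  · obtain ⟨r, hr⟩ := key a ha
    obtain ⟨s, hs⟩ := key b hb
    rw [rsv_eq v hr, rsv_eq v hs, rsv_eq v (r := r + s), map_add]
    rw [map_add, add_sub_add_comm]
    exact Valuation.map_add_lt _ hr hs
  · obtain ⟨r, hr⟩ := key a ha
    obtain ⟨s, hs⟩ := key b hb
    rw [rsv_eq v hr, rsv_eq v hs, rsv_eq v (r := r * s), map_mul]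
    rw [map_mul, show algebraMap (𝓞 F) F r * algebraMap (𝓞 F) F s - a * b =
      algebraMap (𝓞 F) F r * (algebraMap (𝓞 F) F s - b) + b * (algebraMap (𝓞 F) F r - a) by ring]
    refine Valuation.map_add_lt _ ?_ ?_
    · rw [map_mul]; exact (mul_le_of_le_one_left' (v.valuation_le_one r)).trans_lt hs
    · rw [map_mul]; exact (mul_le_of_le_one_left' hb).trans_lt hr
  · obtain ⟨r, rfl⟩ := Ideal.Quotient.mk_surjective c
    exact ⟨_, OF_le_OL v (OF_coe r), rsv_eq v (by simp)⟩
  · obtain ⟨r, hr⟩ := key a ha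
    rw [rsv_eq v hr, OL_pi hp, Ideal.Quotient.eq_zero_iff_mem, ← v.valuation_lt_one_iff_mem (K := F)]
    change v.valuation F (algebraMap (𝓞 F) F r) < 1 ↔ _
    constructor
    · intro h
      have := Valuation.map_sub_lt _ h hr
      rwa [sub_sub_cancel] at this
    · intro h
      have := Valuation.map_add_lt _ hr h
      rwa [sub_add_cancel] at this

lemma CD (v : HeightOneSpectrum (𝓞 F)) {a : F} (ha : a ∈ OF F) (h0 : a ≠ 0) :
    ∃ c ∈ OF F, v.valuation F c = 1 ∧ ∃ k : ℕ, ∀ r ∈ OF F, v.valuation F r ≤ WithZero.exp (-(k : ℤ)) →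
      ∃ t ∈ OF F, c * r = a * t := by
  obtain ⟨a, rfl⟩ := mem_OF.1 ha
  have ha0 : a ≠ 0 := fun h => h0 (by rw [h, map_zero])
  have hI : Ideal.span {a} ≠ ⊥ := by simpa using ha0
  have hfin : FiniteMultiplicity v.asIdeal (Ideal.span {a}) := FiniteMultiplicity.of_prime_left v.prime hI
  obtain ⟨J, hJ, hJv⟩ := hfin.exists_eq_pow_mul_and_not_dvd
  rw [Ideal.dvd_iff_le] at hJv
  obtain ⟨c, hc, hcv⟩ := SetLike.not_le_iff_exists.1 hJv
  refine ⟨_, OF_coe c, v.valuation_eq_one_iff_notMem.2 hcv, multiplicity v.asIdeal (Ideal.span {a}), fun r hr hrk => ?_⟩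
  obtain ⟨r, rfl⟩ := mem_OF.1 hr
  have h1 := v.valuation_of_algebraMap (K := F) r
  rw [h1, v.intValuation_le_pow_iff_mem] at hrk
  have : r * c ∈ Ideal.span {a} := by rw [hJ]; exact Ideal.mul_mem_mul hrk hc
  obtain ⟨t, ht⟩ := Ideal.mem_span_singleton.1 this
  exact ⟨_, OF_coe t, by rw [← map_mul, ← map_mul, mul_comm, ht]⟩
end
end QL

/-! ### Helper material, part E2 -/

namespace QL
lemma ospan_eq {K : Type} [Field K] {V : Type} [AddCommGroup V] [Module K V] (O : Subring K) (t : Set V) :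
    ospan O t = (Submodule.span O t : Set V) := by
  ext x
  constructor
  · rintro ⟨m, c, g, hc, hg, rfl⟩
    exact Submodule.sum_mem _ fun i _ => smul_memK _ (hc i) (Submodule.subset_span (hg i))
  · intro hx
    rw [SetLike.mem_coe, Submodule.mem_span_set'] at hx
    obtain ⟨m, c, g, rfl⟩ := hx
    exact ⟨m, fun i => c i, fun i => g i, fun i => (c i).2, fun i => (g i).2, rfl⟩

lemma span_ind' {K : Type} [Field K] {V : Type} [AddCommGroup V] [Module K V] {O : Subring K} {t : Set V}
    (f : V →ₗ[K] K) (h : ∀ m ∈ t, f m ∈ O) :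
    ∀ m ∈ Submodule.span O t, f m ∈ O := by
  intro m hm
  induction hm using Submodule.span_induction with
  | mem x hx => exact h x hx
  | zero => simp [O.zero_mem]
  | add x y _ _ hx hy => rw [map_add]; exact O.add_mem hx hy
  | smul a x _ hx =>
    change f ((a : K) • x) ∈ O
    rw [map_smul, smul_eq_mul]; exact O.mul_mem a.2 hx

section
open NumberField
variable {F : Type} [Field F] [NumberField F] {V : Type} [AddCommGroup V] [Module F V]
  (v : HeightOneSpectrum (𝓞 F))

lemma mem_Ov {x : Fv F v} : x ∈ Ov F v ↔ Valued.v x ≤ 1 := Iff.rfl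

lemma v_alg (k : F) : Valued.v (algebraMap F (Fv F v) k) = v.valuation F k :=
  v.valuedAdicCompletion_eq_valuation' k

lemma alg_Ov {k : F} : algebraMap F (Fv F v) k ∈ Ov F v ↔ k ∈ OL v := by
  rw [mem_Ov, v_alg, mem_OL]

lemma Ov_Hens {p : Fv F v} (hp : Valued.v p = WithZero.exp (-1)) : Hens (Ov F v) p := by
  intro a ha c hc
  have hp1 : p ∈ Ov F v := by
    rw [mem_Ov, hp, ← WithZero.exp_zero, WithZero.exp_le_exp]; omega
  let T : Fv F v → Fv F v := fun u => -a - p * c * u ^ 2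
  let u : ℕ → Fv F v := fun k => T^[k] 0
  have hu : ∀ k, u (k + 1) = T (u k) := fun k => Function.iterate_succ_apply' T k 0
  have hO : ∀ k, u k ∈ Ov F v := by
    intro k
    induction k with
    | zero => exact (Ov F v).zero_mem
    | succ k ih =>
      rw [hu]
      exact (Ov F v).sub_mem ((Ov F v).neg_mem ha) ((Ov F v).mul_mem ((Ov F v).mul_mem hp1 hc) ((Ov F v).pow_mem ih 2))
  have hd : ∀ k : ℕ, Valued.v (u (k + 1) - u k) ≤ WithZero.exp (-(k : ℤ)) := by
    intro k
    induction k with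
    | zero => 
      simpa using (mem_Ov v).1 ((Ov F v).sub_mem (hO 1) (hO 0))
    | succ k ih =>
      rw [hu (k + 1)]
      nth_rewrite 2 [hu k]
      rw [show T (u (k + 1)) - T (u k) = (-(c * (u (k + 1) + u k))) * (p * (u (k + 1) - u k)) by simp only [T]; ring, map_mul]
      refine (mul_le_of_le_one_left' ((mem_Ov v).1 ((Ov F v).neg_mem ((Ov F v).mul_mem hc ((Ov F v).add_mem (hO _) (hO _)))))).trans ?_
      rw [map_mul, hp]
      calc _ ≤ WithZero.exp (-1 : ℤ) * WithZero.exp (-(k : ℤ)) := by gcongr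
        _ = _ := by rw [← WithZero.exp_add]; congr 1; push_cast; ring
  have hd2 : ∀ k m : ℕ, Valued.v (u (k + m) - u k) ≤ WithZero.exp (-(k : ℤ)) := by
    intro k m
    induction m with
    | zero => simp
    | succ m ih =>
      rw [← add_assoc, show u (k + m + 1) - u k = (u (k + m + 1) - u (k + m)) + (u (k + m) - u k) by ring]
      refine Valuation.map_add_le _ ((hd (k + m)).trans ?_) ih
      rw [WithZero.exp_le_exp]; push_cast; omega
  have hC : CauchySeq u := by
    rw [CauchySeq, Valued.cauchy_iff]
    refine ⟨inferInstance, fun γ => ?_⟩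
    have hne : MonoidWithZeroHom.ValueGroup₀.embedding γ.1 ≠ 0 := by
      simp
    obtain ⟨j, hj⟩ : ∃ j : ℤ, MonoidWithZeroHom.ValueGroup₀.embedding γ.1 = WithZero.exp j := ⟨_, (WithZero.exp_log hne).symm⟩
    refine ⟨u '' Set.Ici ((-j).toNat + 1), Filter.image_mem_map (Filter.Ici_mem_atTop _), ?_⟩
    rintro _ ⟨i, hi, rfl⟩ _ ⟨l, hl, rfl⟩
    obtain ⟨i, rfl⟩ := Nat.exists_eq_add_of_le hi
    obtain ⟨l, rfl⟩ := Nat.exists_eq_add_of_le hl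
    rw [Valuation.restrict_lt_iff_lt_embedding, hj, ← sub_sub_sub_cancel_right _ _ (u ((-j).toNat + 1))]
    refine (Valuation.map_sub_le _ (hd2 _ l) (hd2 _ i)).trans_lt ?_
    rw [WithZero.exp_lt_exp]; push_cast; omega
  obtain ⟨w, hw⟩ := cauchySeq_tendsto_of_complete hC
  have hcl : IsClosed ((Ov F v : Subring (Fv F v)) : Set (Fv F v)) := Valued.isClosed_integer (Fv F v)
  refine ⟨w, hcl.mem_of_tendsto hw (Filter.Eventually.of_forall hO), ?_⟩
  have h1 : Filter.Tendsto (fun k => T (u k)) Filter.atTop (nhds (T w)) :=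
    ((by fun_prop : Continuous T).tendsto w).comp hw
  have h2 : Filter.Tendsto (fun k => T (u k)) Filter.atTop (nhds w) := by
    simp_rw [← hu]; exact (Filter.tendsto_add_atTop_iff_nat 1).2 hw
  have h3 := tendsto_nhds_unique h1 h2
  simp only [T] at h3
  linear_combination -h3

lemma alg_sm (a : F) (c : Fv F v) : a • c = algebraMap F (Fv F v) a * c := Algebra.smul_def a c

lemma Qv_one (Q : QuadraticForm F V) (x : V) : Qv F Q v (toVv F v x) = algebraMap F (Fv F v) (Q x) := by
  let _ : Invertible (2 : F) := invertibleOfNonzero two_ne_zero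
  have := QuadraticForm.baseChange_tmul (A := Fv F v) Q 1 x
  rw [mul_one, alg_sm, mul_one] at this
  exact this

lemma toVv_add (x y : V) : toVv F v (x + y) = toVv F v x + toVv F v y := TensorProduct.tmul_add _ _ _
lemma toVv_smul (a : F) (x : V) : toVv F v (a • x) = algebraMap F (Fv F v) a • toVv F v x := by
  rw [toVv, toVv, TensorProduct.tmul_smul, TensorProduct.smul_tmul', TensorProduct.smul_tmul', alg_sm, smul_eq_mul]

lemma Pv_one (Q : QuadraticForm F V) (x y : V) :
    P (Qv F Q v) (toVv F v x) (toVv F v y) = algebraMap F (Fv F v) (P Q x y) := by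
  simp only [P, QuadraticMap.polar, ← toVv_add, Qv_one, map_sub]

/-- completed lattice as a submodule -/
def LS (M : Submodule (OF F) V) : Submodule (Ov F v) (Vv F V v) := Submodule.span (Ov F v) (toVv F v '' M)

lemma Lv_eq (M : Submodule (OF F) V) : Lv F (M : Set V) v = LS v M := ospan_eq _ _

lemma LS_int (Q : QuadraticForm F V) (M : Submodule (OF F) V) (h : ∀ x ∈ M, Q x ∈ OF F) :
    ∀ x ∈ LS v M, Qv F Q v x ∈ Ov F v := by
  have hP : ∀ x ∈ LS v M, ∀ y ∈ LS v M, P (Qv F Q v) x y ∈ Ov F v := by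
    intro x hx
    refine span_ind' (PL (Qv F Q v) x) ?_
    rintro _ ⟨m, hm, rfl⟩
    rw [PL_apply, P_comm]
    revert x
    refine span_ind' (PL (Qv F Q v) _) ?_
    rintro _ ⟨m', hm', rfl⟩
    rw [PL_apply, Pv_one, alg_Ov]
    exact OF_le_OL v (P_mem h hm hm')
  intro x hx
  induction hx using Submodule.span_induction with
  | mem x hx =>
    obtain ⟨m, hm, rfl⟩ := hx
    rw [Qv_one, alg_Ov]; exact OF_le_OL v (h m hm)
  | zero => simp [(Ov F v).zero_mem]
  | add x y hx hy h1 h2 => rw [Q_add]; exact (Ov F v).add_mem ((Ov F v).add_mem h1 h2) (hP x hx y hy)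
  | smul a x _ hx =>
    change Qv F Q v ((a : Fv F v) • x) ∈ Ov F v
    rw [Q_smul]; exact (Ov F v).mul_mem ((Ov F v).mul_mem a.2 a.2) hx

variable {v}
lemma LS_BM {d : ℕ} {b : Module.Basis (Fin d) F V} {M : Submodule (OF F) V} (hb : BM (OL v) b (lc v M)) :
    BM (Ov F v) (b.baseChange (Fv F v)) (LS v M) := by
  intro x
  constructor
  · intro hx i
    refine span_ind' ((b.baseChange (Fv F v)).coord i) ?_ x hx
    rintro _ ⟨m, hm, rfl⟩
    rw [Module.Basis.coord_apply, toVv, Module.Basis.baseChange_repr_tmul, alg_sm, mul_one, alg_Ov]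
    exact (hb m).1 (le_lc v hm) i
  · intro hx
    rw [← (b.baseChange (Fv F v)).sum_repr x]
    refine Submodule.sum_mem _ fun i _ => smul_memK _ (hx i) ?_
    rw [Module.Basis.baseChange_apply]
    obtain ⟨s, h1, h2, h3⟩ := b_mem hb i
    have hs : s ≠ 0 := by rintro rfl; simp at h2
    have : toVv F v (b i) = algebraMap F (Fv F v) s⁻¹ • toVv F v (s • b i) := by
      rw [← toVv_smul, smul_smul, inv_mul_cancel₀ hs, one_smul]
    change toVv F v (b i) ∈ _
    rw [this]
    refine smul_memK _ ?_ (Submodule.subset_span ⟨_, h3, rfl⟩)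
    rw [alg_Ov, mem_OL, map_inv₀, h2, inv_one]

lemma LS_inter {d : ℕ} {b : Module.Basis (Fin d) F V} {M : Submodule (OF F) V} (hb : BM (OL v) b (lc v M)) {x : V}
    (hx : toVv F v x ∈ LS v M) : x ∈ lc v M := by
  rw [hb]
  intro i
  have := (LS_BM hb _).1 hx i
  rwa [toVv, Module.Basis.baseChange_repr_tmul, alg_sm, mul_one, alg_Ov] at this

lemma LS_dens {d : ℕ} {b : Module.Basis (Fin d) F V} {M : Submodule (OF F) V} (hb : BM (OL v) b (lc v M)) (y : Vv F V v) :
    ∃ x : V, y - toVv F v x ∈ LS v M := by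
  have key : ∀ c : Fv F v, ∃ r : F, c - algebraMap F _ r ∈ Ov F v := by
    intro c
    have ho : IsOpen {x : Fv F v | c - x ∈ Ov F v} :=
      (Valued.isOpen_integer (Fv F v)).preimage (by fun_prop : Continuous fun x => c - x)
    obtain ⟨r, hr⟩ := (HeightOneSpectrum.denseRange_algebraMap F v).exists_mem_open ho ⟨c, by simp [(Ov F v).zero_mem]⟩
    exact ⟨r, hr⟩
  choose r hr using key
  refine ⟨∑ i, r ((b.baseChange (Fv F v)).repr y i) • b i, ?_⟩
  refine (LS_BM hb _).2 ?_
  intro i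
  rw [map_sub, Finsupp.sub_apply]
  rw [toVv, Module.Basis.baseChange_repr_tmul, alg_sm, mul_one, b.repr_sum_self]
  exact hr _

lemma LS_Mx {d : ℕ} {b : Module.Basis (Fin d) F V} {M : Submodule (OF F) V} (hb : BM (OL v) b (lc v M))
    {Q : QuadraticForm F V} (hfg : M.FG) (h : Mx (OF F) Q M) : Mx (Ov F v) (Qv F Q v) (LS v M) := by
  have hintg := LS_int v Q M h.1
  refine ⟨hintg, fun y hy hP => ?_⟩
  obtain ⟨x, hx⟩ := LS_dens hb y
  have e : toVv F v x = y - (y - toVv F v x) := by abel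
  have h1 : x ∈ lc v M := by
    refine (lc_Mx v hfg h).2 x ?_ ?_
    · rw [← alg_Ov, ← Qv_one, e, Q_sub]
      exact (Ov F v).sub_mem ((Ov F v).add_mem hy (hintg _ hx)) (hP _ hx)
    · rintro m ⟨s, h1, h2, h3⟩
      rw [← OL_cancel (s := s) h2, ← P_smul_right, ← alg_Ov, ← Pv_one]
      have hm : toVv F v (s • m) ∈ LS v M := Submodule.subset_span ⟨_, h3, rfl⟩
      rw [e, P_sub_left]
      exact (Ov F v).sub_mem (hP _ hm) (P_mem hintg hx hm)
  have h2 : toVv F v x ∈ LS v M := by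
    refine (LS_BM hb _).2 ?_
    intro i
    rw [toVv, Module.Basis.baseChange_repr_tmul, alg_sm, mul_one, alg_Ov]
    exact (hb x).1 h1 i
  have := (LS v M).add_mem hx h2
  rwa [sub_add_cancel] at this

lemma Mx_of_LS {M : Submodule (OF F) V} (hb : ∀ v : HeightOneSpectrum (𝓞 F), ∃ (d : ℕ) (b : Module.Basis (Fin d) F V), BM (OL v) b (lc v M))
    {Q : QuadraticForm F V} (h : ∀ v, Mx (Ov F v) (Qv F Q v) (LS v M)) : Mx (OF F) Q M := by
  refine ⟨fun x hx => OF_iff.2 fun v => ?_, fun x hx hP => of_lc fun v => ?_⟩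
  · have := (h v).1 (toVv F v x) (Submodule.subset_span ⟨_, hx, rfl⟩)
    rwa [Qv_one, alg_Ov] at this
  · obtain ⟨d, b, hb⟩ := hb v
    refine LS_inter hb ((h v).2 _ ?_ ?_)
    · rw [Qv_one, alg_Ov]; exact OF_le_OL v hx
    · refine span_ind' (PL (Qv F Q v) _) ?_
      rintro _ ⟨m, hm, rfl⟩
      rw [PL_apply, Pv_one, alg_Ov]
      exact OF_le_OL v (hP m hm)

variable (v)
lemma Qv_nondeg [FiniteDimensional F V] {Q : QuadraticForm F V} (hQ : Nondeg Q) : Nondeg (Qv F Q v) := by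
  intro x hx
  let b := Module.finBasis F V
  refine (b.baseChange (Fv F v)).ext_elem fun i => ?_
  obtain ⟨z, hz⟩ := rep_fun hQ (b.coord i)
  have : PL (Qv F Q v) (toVv F v z) = (b.baseChange (Fv F v)).coord i := by
    refine (b.baseChange (Fv F v)).ext fun j => ?_
    rw [PL_apply, Module.Basis.baseChange_apply]
    change P (Qv F Q v) (toVv F v z) (toVv F v (b j)) = _
    rw [Pv_one, hz, Module.Basis.coord_apply, Module.Basis.coord_apply, Module.Basis.baseChange_repr_tmul, alg_sm, mul_one]
  have h2 := congrArg (fun f => f x) this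
  simp only [PL_apply, Module.Basis.coord_apply] at h2
  rw [← h2, map_zero, Finsupp.zero_apply, P_comm]
  exact hx _

lemma lc_exBM {M : Submodule (OF F) V} (hfg : M.FG) (hsp : Submodule.span F (M : Set V) = ⊤) :
    ∃ (d : ℕ) (b : Module.Basis (Fin d) F V), BM (OL v) b (lc v M) := by
  obtain ⟨p, _, h⟩ := OL_DV v
  exact exBM h (lc_fg v hfg) (lc_sp v hsp)

/-- maximal lattices on the same space are locally isometric -/
theorem loc_isom [FiniteDimensional F V] {Q : QuadraticForm F V} (hQ : Nondeg Q) {L M : Submodule (OF F) V}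
    (hL : L.FG) (hL' : Submodule.span F (L : Set V) = ⊤) (hM : M.FG) (hM' : Submodule.span F (M : Set V) = ⊤)
    (h1 : Mx (OF F) Q L) (h2 : Mx (OF F) Q M) :
    LatIsom (Qv F Q v) (Qv F Q v) (Lv F (L : Set V) v) (Lv F (M : Set V) v) := by
  obtain ⟨p, hp, _⟩ := OL_DV v
  have hp' : Valued.v (algebraMap F (Fv F v) p) = WithZero.exp (-1) := by rw [v_alg, hp]
  have hDV : DV (Ov F v) (algebraMap F (Fv F v) p) := DV.of_val _ (fun _ => Iff.rfl) hp'
  obtain ⟨d, b, hb⟩ := lc_exBM v hL hL'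
  obtain ⟨d', b', hb'⟩ := lc_exBM v hM hM'
  have hN := Qv_nondeg v hQ
  obtain ⟨σ, hσ, hσ'⟩ := uniq hDV (Ov_Hens v hp') _ (Vv F V v) (Qv F Q v) hN le_rfl (LS v L) (LS v M)
    ((LS_BM hb).lt hDV) ((LS_BM hb').lt hDV) (LS_Mx hb hL h1) (LS_Mx hb' hM h2)
  have hinj := isom_inj hN σ hσ
  refine ⟨σ, hinj, hσ, ?_⟩
  rw [Lv_eq, Lv_eq]
  refine Set.Subset.antisymm (by rintro _ ⟨x, hx, rfl⟩; exact hσ' x hx) fun y hy => ?_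
  obtain ⟨x, rfl⟩ := (LinearMap.injective_iff_surjective.1 hinj) y
  refine ⟨x, (LS_Mx hb hL h1).2 x ?_ fun m hm => ?_, rfl⟩
  · rw [← hσ]; exact (LS_Mx hb' hM h2).1 _ hy
  · rw [← isom_P σ hσ]; exact P_mem (LS_Mx hb' hM h2).1 hy (hσ' m hm)
end
end QL

/-! ### Helper material, part P1 -/

namespace PT
open NumberField

lemma split (m : ℕ) (T : ℕ) : T ≠ 0 → ∃ j e : ℕ, T ∣ m ^ j * e ∧ Nat.Coprime e m ∧ e ≠ 0 := by
  induction T using Nat.strong_induction_on with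
  | _ T ih =>
    intro hT
    by_cases h : Nat.Coprime T m
    · exact ⟨0, T, by simp, h, hT⟩
    · obtain ⟨T', hT'⟩ := Nat.gcd_dvd_left T m
      have hg : 1 < Nat.gcd T m := by
        have : Nat.gcd T m ≠ 0 := fun h0 => hT (Nat.gcd_eq_zero_iff.1 h0).1
        have : Nat.gcd T m ≠ 1 := h
        omega
      have hT'0 : T' ≠ 0 := by rintro rfl; rw [mul_zero] at hT'; exact hT hT'
      have hlt : T' < T := by
        rw [hT']; exact lt_mul_of_one_lt_left (Nat.pos_of_ne_zero hT'0) hg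
      obtain ⟨j, e, h1, h2, h3⟩ := ih T' hlt hT'0
      refine ⟨j + 1, e, ?_, h2, h3⟩
      rw [hT', pow_succ, show m ^ j * m * e = m * (m ^ j * e) by ring]
      exact mul_dvd_mul (Nat.gcd_dvd_right T m) h1

lemma den {F : Type} [Field F] [NumberField F] (x : F) : ∃ T : ℕ, T ≠ 0 ∧ ∃ s : 𝓞 F, (T : F) * x = algebraMap (𝓞 F) F s := by
  have halg : IsAlgebraic ℤ x := (IsFractionRing.isAlgebraic_iff ℤ ℚ F).2 (Algebra.IsAlgebraic.isAlgebraic x)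
  obtain ⟨y, hy, h⟩ := halg.exists_integral_multiple
  refine ⟨y.natAbs, Int.natAbs_ne_zero.2 hy, ?_⟩
  rcases Int.natAbs_eq y with hh | hh
  · refine ⟨⟨y • x, h⟩, ?_⟩
    change _ = y • x
    rw [zsmul_eq_mul]
    congr 1
    conv_rhs => rw [hh]
    simp
  · refine ⟨⟨-(y • x), h.neg⟩, ?_⟩
    change _ = -(y • x)
    rw [zsmul_eq_mul, ← neg_mul]
    congr 1
    conv_rhs => rw [hh]
    simp

section
variable {F E : Type} [Field F] [NumberField F] [Field E] [NumberField E] [Algebra F E]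

/-- the structure map -/
abbrev io (F E : Type) [Field F] [Field E] [Algebra F E] : 𝓞 F →+* E := (algebraMap F E).comp (algebraMap (𝓞 F) F)

lemma denE (θ : E) (hs : ∀ e : E, ∃ x y : F, e = algebraMap F E x + algebraMap F E y * θ) :
    ∃ T : ℕ, T ≠ 0 ∧ ∀ y : 𝓞 E, ∃ s t : 𝓞 F, (T : E) * algebraMap (𝓞 E) E y = io F E s + io F E t * θ := by
  classical
  obtain ⟨G, hG⟩ := (inferInstance : Module.Finite ℤ (𝓞 E)).fg_top
  have key : ∀ y : E, ∃ T : ℕ, T ≠ 0 ∧ ∃ s t : 𝓞 F, (T : E) * y = io F E s + io F E t * θ := by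
    intro y
    obtain ⟨x1, x2, rfl⟩ := hs y
    obtain ⟨T1, h1, s1, e1⟩ := den x1
    obtain ⟨T2, h2, s2, e2⟩ := den x2
    refine ⟨T1 * T2, mul_ne_zero h1 h2, T2 * s1, T1 * s2, ?_⟩
    simp only [map_mul, map_natCast, RingHom.comp_apply, ← e1, ← e2, Nat.cast_mul]
    ring
  choose T hT st using fun y : 𝓞 E => key (algebraMap (𝓞 E) E y)
  refine ⟨∏ g ∈ G, T g, Finset.prod_ne_zero_iff.2 fun g _ => hT g, fun y => ?_⟩
  have hy : y ∈ Submodule.span ℤ (G : Set (𝓞 E)) := hG ▸ Submodule.mem_top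
  induction hy using Submodule.span_induction with
  | mem x hx =>
    obtain ⟨s, t, e⟩ := st x
    obtain ⟨k, hk⟩ := Finset.dvd_prod_of_mem T hx
    refine ⟨k * s, k * t, ?_⟩
    rw [hk, map_mul, map_mul, map_natCast, Nat.cast_mul]
    linear_combination (k : E) * e
  | zero => exact ⟨0, 0, by simp⟩
  | add x y _ _ hx hy =>
    obtain ⟨s, t, e⟩ := hx
    obtain ⟨s', t', e'⟩ := hy
    refine ⟨s + s', t + t', ?_⟩
    rw [map_add, map_add, map_add]
    linear_combination e + e'
  | smul a x _ hx =>
    obtain ⟨s, t, e⟩ := hx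
    refine ⟨a * s, a * t, ?_⟩
    rw [zsmul_eq_mul, map_mul, map_mul, map_mul, map_intCast, map_intCast]
    linear_combination (a : E) * e

theorem main {θ : E} {c0 c1 c2 : 𝓞 F} (hc0 : c0 ≠ 0)
    (hN : ∀ x y : F, algebraMap (𝓞 F) F c0 * Algebra.norm F (algebraMap F E x + algebraMap F E y * θ) =
      algebraMap (𝓞 F) F c0 * x ^ 2 + algebraMap (𝓞 F) F c2 * x * y + algebraMap (𝓞 F) F c1 * y ^ 2)
    (hθ : io F E c0 * θ ^ 2 = io F E c2 * θ - io F E c1)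
    (hs : ∀ e : E, ∃ x y : F, e = algebraMap F E x + algebraMap F E y * θ)
    (m : ℕ) (hm : m ≠ 0) (hq : Ideal.absNorm (Ideal.span {c0}) ∣ m) (J : ℕ) :
    ∃ a b : 𝓞 F, (m : 𝓞 F) ^ J ∣ a ∧ (m : 𝓞 F) ^ J ∣ b - 1 ∧ ∃ l : ℕ, ∀ r : ℕ, r.Prime → ¬ r ∣ m →
      r ∣ Ideal.absNorm (Ideal.span {c0 * a ^ 2 + c2 * a * b + c1 * b ^ 2}) →
      r = l ∧ ¬ r ^ 2 ∣ Ideal.absNorm (Ideal.span {c0 * a ^ 2 + c2 * a * b + c1 * b ^ 2}) := by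
  obtain ⟨T, hT, hTy⟩ := denE θ hs
  obtain ⟨j, e, ⟨k, hk⟩, hco, he⟩ := split m T hT
  obtain ⟨q0, hq0⟩ : ∃ q : ℕ, q = Ideal.absNorm (Ideal.span {c0}) := ⟨_, rfl⟩
  have hq00 : q0 ≠ 0 := by
    rw [hq0]; intro h; rw [Ideal.absNorm_eq_zero_iff] at h; simp [hc0] at h
  obtain ⟨c0', hc0'⟩ : ∃ c0' : 𝓞 F, (q0 : 𝓞 F) = c0 * c0' := by
    have := Ideal.absNorm_mem (Ideal.span {c0})
    rw [Ideal.mem_span_singleton, ← hq0] at this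
    exact this
  have hcoq : IsCoprime (e : ℤ) ((m ^ (J + j) : ℕ) : ℤ) := Nat.isCoprime_iff_coprime.2 (hco.pow_right _)
  obtain ⟨u, w, huw⟩ := hcoq
  -- q0 * θ is integral
  obtain ⟨t0, ht0⟩ : ∃ t0 : 𝓞 E, algebraMap (𝓞 E) E t0 = (q0 : E) * θ := by
    suffices hintg : _root_.IsIntegral ℤ ((q0 : E) * θ) from ⟨⟨_, hintg⟩, rfl⟩
    have h1 : _root_.IsIntegral (𝓞 F) (io F E c0 * θ) := by
      refine ⟨Polynomial.X ^ 2 - Polynomial.C c2 * Polynomial.X + Polynomial.C (c0 * c1), by monicity!, ?_⟩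
      simp only [Polynomial.eval₂_add, Polynomial.eval₂_sub, Polynomial.eval₂_pow, Polynomial.eval₂_X, Polynomial.eval₂_mul, Polynomial.eval₂_C,
          IsScalarTower.algebraMap_apply (𝓞 F) F E, map_mul]
      simp only [RingHom.comp_apply] at hθ ⊢
      linear_combination (algebraMap F E (algebraMap (𝓞 F) F c0)) * hθ
    have h2 : _root_.IsIntegral ℤ (io F E c0 * θ) := isIntegral_trans (R := ℤ) (A := 𝓞 F) _ h1
    have h3 : _root_.IsIntegral ℤ (io F E c0') := map_isIntegral_int (io F E) (RingOfIntegers.isIntegral c0')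
    have h4 : (q0 : E) * θ = io F E c0' * (io F E c0 * θ) := by
      have := congrArg (io F E) hc0'
      rw [map_natCast, map_mul] at this
      rw [this]; ring
    rw [h4]
    exact h3.mul h2
  -- the arithmetic input
  let α : 𝓞 E := (w : 𝓞 E) * m ^ (J + j) * q0 + u * e * t0
  let β : 𝓞 E := q0 * m ^ (J + j) * e
  have hβ : β ≠ 0 := by
    refine mul_ne_zero (mul_ne_zero ?_ (pow_ne_zero _ ?_)) ?_ <;> exact_mod_cast (by assumption)
  obtain ⟨η, ⟨y, hy⟩, l, hl, -, hηl⟩ := Ray.T3 α hβ 0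
  obtain ⟨s, t, hst⟩ := hTy y
  refine ⟨m ^ J * (w * m ^ j + k * s), 1 + m ^ J * (k * t - w * m ^ j), dvd_mul_right _ _, by simp, l, ?_⟩
  set a : 𝓞 F := m ^ J * (w * m ^ j + k * s) with ha
  set b : 𝓞 F := 1 + m ^ J * (k * t - w * m ^ j) with hb
  have hkE : (m : E) ^ j * e = T * k := by exact_mod_cast congrArg (Nat.cast : ℕ → E) hk
  have huE : (u : E) * e + w * (m : E) ^ (J + j) = 1 := by exact_mod_cast congrArg (Int.cast : ℤ → E) huw
  -- η in coordinates
  have hη : algebraMap (𝓞 E) E η = (q0 : E) * (io F E a + io F E b * θ) := by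
    have h1 : η = α + β * y := by rw [← hy]; ring
    rw [h1, ha, hb]
    simp only [α, β, map_add, map_sub, map_mul, map_pow, map_natCast, map_intCast, map_one, ht0] at hst ⊢
    rw [pow_add] at huE ⊢
    linear_combination (q0 * m ^ J * algebraMap (𝓞 E) E y) * hkE + q0 * m ^ J * k * hst + q0 * θ * huE
  clear_value a b
  have hfd : FiniteDimensional F E := Module.Finite.of_restrictScalars_finite ℚ F E
  have hrel : Ideal.absNorm (Ideal.span {c0}) * Ideal.absNorm (Ideal.span {η}) =
      (q0 ^ 2) ^ (Module.finrank ℚ F) * Ideal.absNorm (Ideal.span {c0 * a ^ 2 + c2 * a * b + c1 * b ^ 2}) := by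
    have h1 : algebraMap (𝓞 F) F c0 * Algebra.norm F (algebraMap (𝓞 E) E η) =
        (q0 : F) ^ 2 * algebraMap (𝓞 F) F (c0 * a ^ 2 + c2 * a * b + c1 * b ^ 2) := by
      have h2 := hN (q0 * algebraMap (𝓞 F) F a) (q0 * algebraMap (𝓞 F) F b)
      have h3 : algebraMap (𝓞 E) E η = algebraMap F E (q0 * algebraMap (𝓞 F) F a) + algebraMap F E (q0 * algebraMap (𝓞 F) F b) * θ := by
        rw [hη]; simp only [map_mul, map_natCast, RingHom.comp_apply]; ring
      rw [h3, h2]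
      simp only [map_add, map_mul, map_pow]
      ring
    have h4 := congrArg (Algebra.norm ℚ) h1
    rw [map_mul, map_mul, Algebra.norm_norm, map_pow, show ((q0 : ℕ) : F) = algebraMap ℚ F (q0 : ℚ) by simp,
      Algebra.norm_algebraMap, ← Algebra.coe_norm_int, ← Algebra.coe_norm_int, ← Algebra.coe_norm_int, ← pow_mul, mul_comm _ 2, pow_mul] at h4
    rw [Ideal.absNorm_span_singleton, Ideal.absNorm_span_singleton, Ideal.absNorm_span_singleton, ← Int.natAbs_mul]
    have h5 : Algebra.norm ℤ c0 * Algebra.norm ℤ η = ((q0 ^ 2) ^ (Module.finrank ℚ F) : ℕ) *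
        Algebra.norm ℤ (c0 * a ^ 2 + c2 * a * b + c1 * b ^ 2) := by exact_mod_cast h4
    rw [h5, Int.natAbs_mul, Int.natAbs_natCast]
  -- conclusion
  intro r hr hrm hrX
  rw [← hq0, hηl] at hrel
  have hrq : ¬ r ∣ q0 := fun h => hrm (h.trans (hq0 ▸ hq))
  have hW : ((q0 ^ 2 * m ^ (J + j) : ℕ) : 𝓞 E) ∈ Ideal.span {α, β} := by
    rw [Ideal.mem_span_pair]
    refine ⟨q0 * m ^ (J + j), u * q0 - u * t0, ?_⟩
    have huO : (u : 𝓞 E) * e + w * (m : 𝓞 E) ^ (J + j) = 1 := by exact_mod_cast congrArg (Int.cast : ℤ → 𝓞 E) huw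
    simp only [α, β]
    push_cast
    linear_combination (q0 : 𝓞 E) ^ 2 * m ^ (J + j) * huO
  have hrD : ¬ r ∣ Ideal.absNorm (Ideal.span {α, β}) := by
    intro h
    have h1 := h.trans (Ideal.absNorm_dvd_absNorm_of_le ((Ideal.span_singleton_le_iff_mem _).2 hW))
    rw [Ideal.absNorm_span_natCast] at h1
    have h2 := hr.dvd_of_dvd_pow h1
    rcases (hr.dvd_mul).1 h2 with h3 | h3
    · exact hrq (hr.dvd_of_dvd_pow h3)
    · exact hrm (hr.dvd_of_dvd_pow h3)
  have hrqD : ¬ r ∣ q0 * Ideal.absNorm (Ideal.span {α, β}) := fun h =>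
    ((hr.dvd_mul).1 h).elim hrq hrD
  rw [← mul_assoc] at hrel
  have hrl : r = l := by
    have h1 := dvd_mul_of_dvd_right hrX ((q0 ^ 2) ^ Module.finrank ℚ F)
    rw [← hrel] at h1
    exact (Nat.prime_dvd_prime_iff_eq hr hl).1 (((hr.dvd_mul).1 h1).resolve_left hrqD)
  refine ⟨hrl, fun h => ?_⟩
  have h1 := dvd_mul_of_dvd_right h ((q0 ^ 2) ^ Module.finrank ℚ F)
  rw [← hrel, ← hrl, pow_two] at h1
  exact hrqD (Nat.dvd_of_mul_dvd_mul_right hr.pos h1)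

end

/-- prime-type values of binary forms -/
theorem binary {F : Type} [Field F] [NumberField F] {c0 c1 c2 : 𝓞 F} (hc0 : c0 ≠ 0)
    (hsq : ∀ x : F, x ^ 2 ≠ algebraMap (𝓞 F) F (c2 ^ 2 - 4 * c0 * c1))
    (m : ℕ) (hm : m ≠ 0) (hq : Ideal.absNorm (Ideal.span {c0}) ∣ m) (J : ℕ) :
    ∃ a b : 𝓞 F, (m : 𝓞 F) ^ J ∣ a ∧ (m : 𝓞 F) ^ J ∣ b - 1 ∧ ∃ l : ℕ, ∀ r : ℕ, r.Prime → ¬ r ∣ m →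
      r ∣ Ideal.absNorm (Ideal.span {c0 * a ^ 2 + c2 * a * b + c1 * b ^ 2}) →
      r = l ∧ ¬ r ^ 2 ∣ Ideal.absNorm (Ideal.span {c0 * a ^ 2 + c2 * a * b + c1 * b ^ 2}) := by
  obtain ⟨C0, hC0⟩ : ∃ C, C = algebraMap (𝓞 F) F c0 := ⟨_, rfl⟩
  obtain ⟨C1, hC1⟩ : ∃ C, C = algebraMap (𝓞 F) F c1 := ⟨_, rfl⟩
  obtain ⟨C2, hC2⟩ : ∃ C, C = algebraMap (𝓞 F) F c2 := ⟨_, rfl⟩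
  have hC00 : C0 ≠ 0 := by rw [hC0]; simpa using hc0
  have hfact : Fact (∀ r : F, r ^ 2 ≠ -C1 / C0 + C2 / C0 * r) := by
    constructor
    intro r hr
    refine hsq (2 * C0 * r - C2) ?_
    simp only [map_sub, map_mul, map_pow, map_ofNat, ← hC0, ← hC1, ← hC2]
    field_simp at hr
    linear_combination 4 * C0 * hr
  have : NumberField (QuadraticAlgebra F (-C1 / C0) (C2 / C0)) :=
    { to_charZero := inferInstance
      to_finiteDimensional := Module.Finite.trans F _ }
  have hco : ∀ x y : F, algebraMap F (QuadraticAlgebra F (-C1 / C0) (C2 / C0)) x + algebraMap F _ y * QuadraticAlgebra.omega = ⟨x, y⟩ := by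
    intro x y
    ext <;> simp
  refine main (E := QuadraticAlgebra F (-C1 / C0) (C2 / C0)) (θ := QuadraticAlgebra.omega) hc0 ?_ ?_ ?_ m hm hq J
  · intro x y
    have h1 : Algebra.norm F (⟨x, y⟩ : QuadraticAlgebra F (-C1 / C0) (C2 / C0)) =
        QuadraticAlgebra.norm (⟨x, y⟩ : QuadraticAlgebra F (-C1 / C0) (C2 / C0)) := by
      rw [← QuadraticAlgebra.det_toLinearMap_eq_norm]; rfl
    rw [hco, h1, QuadraticAlgebra.norm_def, ← hC0, ← hC1, ← hC2]
    field_simp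
    ring
  · simp only [RingHom.comp_apply, ← hC0, ← hC1, ← hC2]
    ext
    · simp [pow_two]; field_simp
    · simp [pow_two]; field_simp
  · intro e
    exact ⟨e.re, e.im, by rw [hco]⟩
end PT

/-! ### Helper material, part G1 -/

namespace QL
section
open NumberField
variable {F : Type} [Field F] [NumberField F] {V : Type} [AddCommGroup V] [Module F V]

instance OF_noeth : IsNoetherianRing (OF F) :=
  inferInstanceAs (IsNoetherianRing (𝓞 F))

lemma nat_OF (k : ℕ) : (k : F) ∈ OF F := natCast_mem _ k

lemma den_F (c : F) : ∃ k : ℕ, k ≠ 0 ∧ (k : F) * c ∈ OF F := by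
  obtain ⟨y, hy, h⟩ := ((IsFractionRing.isAlgebraic_iff ℤ ℚ F).2 (Algebra.IsAlgebraic.isAlgebraic c)).exists_integral_multiple
  refine ⟨y.natAbs, by simpa using hy, ?_⟩
  have h1 : (y : F) * c ∈ OF F := by
    rw [Algebra.smul_def] at h; exact h
  obtain ⟨k, hk⟩ : ∃ k : ℕ, k = y.natAbs := ⟨_, rfl⟩
  rw [← hk]
  rcases Int.natAbs_eq y with e | e
  · rw [e, ← hk, Int.cast_natCast] at h1; exact h1
  · rw [e, ← hk, Int.cast_neg, Int.cast_natCast] at h1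
    have := (OF F).neg_mem h1
    rwa [neg_mul, neg_neg] at this

lemma den_V {M : Submodule (OF F) V} (hsp : Submodule.span F (M : Set V) = ⊤) (x : V) :
    ∃ k : ℕ, k ≠ 0 ∧ (k : F) • x ∈ M := by
  have hx : x ∈ Submodule.span F (M : Set V) := hsp ▸ Submodule.mem_top
  induction hx using Submodule.span_induction with
  | mem x hx => exact ⟨1, one_ne_zero, by simpa using hx⟩
  | zero => exact ⟨1, one_ne_zero, by simp⟩
  | add x y _ _ hx hy =>
    obtain ⟨k, h1, h2⟩ := hx
    obtain ⟨l, h3, h4⟩ := hy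
    refine ⟨k * l, mul_ne_zero h1 h3, ?_⟩
    have e : ((k * l : ℕ) : F) • (x + y) = (l : F) • ((k : F) • x) + (k : F) • ((l : F) • y) := by
      push_cast; module
    rw [e]
    exact M.add_mem (smul_memK M (nat_OF l) h2) (smul_memK M (nat_OF k) h4)
  | smul c x _ hx =>
    obtain ⟨k, h1, h2⟩ := hx
    obtain ⟨l, h3, h4⟩ := den_F c
    refine ⟨k * l, mul_ne_zero h1 h3, ?_⟩
    have e : ((k * l : ℕ) : F) • (c • x) = ((l : F) * c) • ((k : F) • x) := by
      push_cast; module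
    rw [e]
    exact smul_memK M h4 h2

lemma den_fg {M D : Submodule (OF F) V} (hsp : Submodule.span F (M : Set V) = ⊤) (hD : D.FG) :
    ∃ k : ℕ, k ≠ 0 ∧ ∀ x ∈ D, (k : F) • x ∈ M := by
  obtain ⟨t, rfl⟩ := hD
  have h : ∀ s : Finset V, ∃ k : ℕ, k ≠ 0 ∧ ∀ x ∈ s, (k : F) • x ∈ M := by
    classical
    intro s
    induction s using Finset.induction_on with
    | empty => exact ⟨1, one_ne_zero, by simp⟩
    | insert a s _ ih =>
      obtain ⟨k, h1, h2⟩ := ih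
      obtain ⟨l, h3, h4⟩ := den_V hsp a
      refine ⟨k * l, mul_ne_zero h1 h3, fun x hx => ?_⟩
      rcases Finset.mem_insert.1 hx with rfl | hx
      · rw [Nat.cast_mul, mul_smul]; exact smul_memK M (nat_OF k) h4
      · rw [Nat.cast_mul, mul_comm, mul_smul]; exact smul_memK M (nat_OF l) (h2 x hx)
  obtain ⟨k, h1, h2⟩ := h t
  refine ⟨k, h1, fun x hx => ?_⟩
  induction hx using Submodule.span_induction with
  | mem x hx => exact h2 x hx
  | zero => simp
  | add x y _ _ hx hy => rw [smul_add]; exact M.add_mem hx hy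
  | smul c x _ hx => rw [smul_comm]; exact M.smul_mem c hx

/-- dual lattice -/
def dl (Q : QuadraticForm F V) (M : Submodule (OF F) V) : Submodule (OF F) V where
  carrier := {x | ∀ m ∈ M, P Q x m ∈ OF F}
  add_mem' := fun ha hb m hm => by rw [P_add_left]; exact (OF F).add_mem (ha m hm) (hb m hm)
  zero_mem' := fun m _ => by rw [P_zero_left]; exact (OF F).zero_mem
  smul_mem' := fun c x hx m hm => by
    have : P Q ((c : F) • x) m ∈ OF F := by rw [P_smul_left]; exact (OF F).mul_mem c.2 (hx m hm)
    exact this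
lemma mem_dl {Q : QuadraticForm F V} {M : Submodule (OF F) V} {x : V} : x ∈ dl Q M ↔ ∀ m ∈ M, P Q x m ∈ OF F := Iff.rfl

lemma dl_noeth {Q : QuadraticForm F V} (hQ : Nondeg Q) {M : Submodule (OF F) V} (hfg : M.FG)
    (hsp : Submodule.span F (M : Set V) = ⊤) : IsNoetherian (OF F) (dl Q M) := by
  obtain ⟨t, rfl⟩ := hfg
  let f : dl Q (Submodule.span (OF F) (t : Set V)) →ₗ[OF F] (t → OF F) :=
    { toFun := fun x i => ⟨P Q x i, x.2 i (Submodule.subset_span i.2)⟩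
      map_add' := fun x y => by ext i; exact P_add_left Q _ _ _
      map_smul' := fun c x => by ext i; exact P_smul_left Q (c : F) _ _ }
  refine isNoetherian_of_injective f fun x y hxy => ?_
  ext
  refine sub_eq_zero.1 (hQ _ fun w => ?_)
  have hw : w ∈ Submodule.span F (t : Set V) := by
    have e : Submodule.span F (Submodule.span (OF F) (t : Set V) : Set V) ≤ Submodule.span F (t : Set V) := by
      rw [Submodule.span_le]
      intro a ha
      exact Submodule.span_subset_span (OF F) F _ ha
    exact e (hsp ▸ Submodule.mem_top)
  change P Q _ _ = 0
  induction hw using Submodule.span_induction with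
  | mem w hw =>
    have := congrArg Subtype.val (congrFun hxy ⟨w, hw⟩)
    rw [P_sub_left, sub_eq_zero]; exact this
  | zero => exact P_zero_right _ _
  | add a b _ _ ha hb => rw [P_add_right, ha, hb, add_zero]
  | smul c a _ ha => rw [P_smul_right, ha, mul_zero]

lemma le_dl {Q : QuadraticForm F V} {M N : Submodule (OF F) V} (h : ∀ x ∈ N, Q x ∈ OF F) (hle : M ≤ N) : N ≤ dl Q M :=
  fun _ hx _ hm => P_mem h hx (hle hm)

lemma adj_int {O : Subring F} {Q : QuadraticForm F V} {M : Submodule O V} (h : ∀ x ∈ M, Q x ∈ O) {x : V} (hx : Q x ∈ O)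
    (hP : ∀ m ∈ M, P Q x m ∈ O) : ∀ y ∈ M ⊔ Submodule.span O {x}, Q y ∈ O := by
  intro y hy
  obtain ⟨m, hm, w, hw, rfl⟩ := Submodule.mem_sup.1 hy
  obtain ⟨c, rfl⟩ := Submodule.mem_span_singleton.1 hw
  change Q (m + (c : F) • x) ∈ O
  rw [Q_add, Q_smul, P_smul_right, P_comm]
  exact O.add_mem (O.add_mem (h m hm) (O.mul_mem (O.mul_mem c.2 c.2) hx)) (O.mul_mem c.2 (hP m hm))

/-- maximal overlattice -/
theorem exMx {Q : QuadraticForm F V} (hQ : Nondeg Q) {M : Submodule (OF F) V} (hfg : M.FG)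
    (hsp : Submodule.span F (M : Set V) = ⊤) (hintg : ∀ x ∈ M, Q x ∈ OF F) :
    ∃ N : Submodule (OF F) V, M ≤ N ∧ N.FG ∧ Submodule.span F (N : Set V) = ⊤ ∧ Mx (OF F) Q N := by
  have hn := dl_noeth hQ hfg hsp
  let S : Set (Submodule (OF F) (dl Q M)) := {N | M ≤ N.map (dl Q M).subtype ∧ ∀ x ∈ N.map (dl Q M).subtype, Q x ∈ OF F}
  have key : ∀ N : Submodule (OF F) V, M ≤ N → (∀ x ∈ N, Q x ∈ OF F) → (N.comap (dl Q M).subtype).map (dl Q M).subtype = N := by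
    intro N h1 h2
    rw [Submodule.map_comap_subtype, inf_eq_right]
    exact le_dl h2 h1
  obtain ⟨N, hN, hmax⟩ := set_has_maximal_iff_noetherian.2 hn S ⟨M.comap (dl Q M).subtype, by
    change _ ≤ _ ∧ _
    rw [key M le_rfl hintg]; exact ⟨le_rfl, hintg⟩⟩
  refine ⟨N.map (dl Q M).subtype, hN.1, (IsNoetherian.noetherian N).map _, ?_, hN.2, fun x hx hP => ?_⟩
  · exact top_le_iff.1 (hsp ▸ Submodule.span_mono hN.1)
  · by_contra hc
    have h1 := adj_int hN.2 hx hP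
    have h2 : M ≤ N.map (dl Q M).subtype ⊔ Submodule.span (OF F) {x} := hN.1.trans le_sup_left
    refine hmax ((N.map (dl Q M).subtype ⊔ Submodule.span (OF F) {x}).comap (dl Q M).subtype) ?_ ?_
    · change _ ≤ _ ∧ _
      rw [key _ h2 h1]; exact ⟨h2, h1⟩
    · refine lt_of_le_of_ne (Submodule.map_le_iff_le_comap.1 le_sup_left) fun e => hc ?_
      have e2 := congrArg (Submodule.map (dl Q M).subtype) e
      rw [key _ h2 h1] at e2
      rw [e2]
      exact Submodule.mem_sup_right (Submodule.mem_span_singleton_self x)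

lemma isMaximal_iff {Q : QuadraticForm F V} {M : Submodule (OF F) V} (hfg : M.FG)
    (hsp : Submodule.span F (M : Set V) = ⊤) : IsMaximal (OF F) Q (M : Set V) ↔ Mx (OF F) Q M := by
  constructor
  · rintro ⟨h1, h2⟩
    refine ⟨h1, fun x hx hP => ?_⟩
    obtain ⟨t, ht⟩ := hfg.sup (Submodule.fg_span_singleton (R := OF F) x)
    have := h2 (M ⊔ Submodule.span (OF F) {x} : Submodule (OF F) V) ⟨t, by rw [ospan_eq, ht]⟩
      (by rw [hsp]; exact top_le_iff.1 (hsp ▸ Submodule.span_mono (SetLike.coe_subset_coe.2 le_sup_left)))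
      (SetLike.coe_subset_coe.2 le_sup_left) (adj_int h1 hx hP)
    change x ∈ (M : Set V)
    rw [← this]
    exact Submodule.mem_sup_right (Submodule.mem_span_singleton_self x)
  · intro h
    refine ⟨h.1, ?_⟩
    rintro L' ⟨t, rfl⟩ _ h3 h4
    rw [ospan_eq] at *
    rw [h.eq_of_le h4 h3]

/-- reflection -/
lemma refl_ex {K : Type} [Field K] {V : Type} [AddCommGroup V] [Module K V] (Q : QuadraticForm K V) {d : V} (hd : Q d ≠ 0) :
    ∃ τ : V →ₗ[K] V, (∀ x, τ x = x - (P Q x d * (Q d)⁻¹) • d) ∧ ∀ x, Q (τ x) = Q x := by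
  refine ⟨LinearMap.id - ((Q d)⁻¹ • PL Q d).smulRight d, fun x => ?_, fun x => ?_⟩
  · simp only [LinearMap.sub_apply, LinearMap.id_apply, LinearMap.smulRight_apply, LinearMap.smul_apply, PL_apply, smul_eq_mul]
    rw [P_comm Q x d, mul_comm]
  · simp only [LinearMap.sub_apply, LinearMap.id_apply, LinearMap.smulRight_apply, LinearMap.smul_apply, PL_apply, smul_eq_mul]
    rw [Q_sub, Q_smul, P_smul_right, P_comm Q d x]
    field_simp
    ring

/-- Witt extension for anisotropic spaces -/
lemma witt {K : Type} [Field K] {V : Type} [AddCommGroup V] [Module K V] [FiniteDimensional K V] {Q : QuadraticForm K V}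
    (ha : ∀ x, Q x = 0 → x = 0) (W : Submodule K V) (σ : W →ₗ[K] V) (hσ : ∀ x, Q (σ x) = Q x) :
    ∃ ρ : V →ₗ[K] V, (∀ x, Q (ρ x) = Q x) ∧ ∀ w : W, ρ w = σ w := by
  have hP : ∀ x y : W, P Q (σ x) (σ y) = P Q (x : V) (y : V) := fun x y =>
    isom_P (Q := Q.comp W.subtype) (Q' := Q) σ hσ x y
  have key : ∀ l : Finset W, ∃ ρ : V →ₗ[K] V, (∀ x, Q (ρ x) = Q x) ∧ ∀ w ∈ l, ρ w = σ w := by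
    classical
    intro l
    induction l using Finset.induction_on with
    | empty => exact ⟨LinearMap.id, fun _ => rfl, by simp⟩
    | insert w l _ ih =>
      obtain ⟨ρ, h1, h2⟩ := ih
      by_cases hd : ρ w = σ w
      · refine ⟨ρ, h1, fun u hu => ?_⟩
        rcases Finset.mem_insert.1 hu with rfl | hu
        · exact hd
        · exact h2 u hu
      have hd0 : Q (ρ w - σ w) ≠ 0 := fun h => hd (sub_eq_zero.1 (ha _ h))
      obtain ⟨τ, h3, h4⟩ := refl_ex Q hd0
      refine ⟨τ ∘ₗ ρ, fun x => by rw [LinearMap.comp_apply, h4, h1], fun u hu => ?_⟩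
      rw [LinearMap.comp_apply, h3]
      rcases Finset.mem_insert.1 hu with rfl | hu
      · have e : P Q (ρ u) (ρ u - σ u) = Q (ρ u - σ u) := by
          rw [Q_sub, P_sub_right, P_self, h1, hσ]; ring
        rw [e, mul_inv_cancel₀ hd0, one_smul, sub_sub_cancel]
      · have e : P Q (ρ u) (ρ w - σ w) = 0 := by
          rw [P_sub_right, isom_P ρ h1, h2 u hu, hP, sub_self]
        rw [e, zero_mul, zero_smul, sub_zero, h2 u hu]
  obtain ⟨s, hs⟩ : (⊤ : Submodule K W).FG := Module.Finite.fg_top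
  obtain ⟨ρ, h1, h2⟩ := key s
  refine ⟨ρ, h1, fun w => ?_⟩
  have hw : w ∈ Submodule.span K (s : Set W) := hs ▸ Submodule.mem_top
  have : Set.EqOn (ρ ∘ₗ W.subtype) σ (s : Set W) := fun u hu => h2 u hu
  exact LinearMap.eqOn_span this hw

lemma pos_aniso (hF : TotallyReal F) {Q : QuadraticForm F V} (hQ : PosDef F Q) : ∃ _ : F →+* ℝ, ∀ x, Q x = 0 → x = 0 := by
  obtain ⟨w⟩ : Nonempty (InfinitePlace F) := inferInstance
  let φ := InfinitePlace.embedding_of_isReal (hF w)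
  refine ⟨φ, fun x hx => ?_⟩
  by_contra hc
  have := hQ φ x hc
  rw [hx, map_zero] at this
  exact lt_irrefl _ this

theorem ADC' (hF : TotallyReal F) {Q : QuadraticForm F V} (hQ : Nondeg Q) (hpos : PosDef F Q) {n : ℕ} (hrank : Module.finrank F V = n + 1)
    {L : Set V} (hA : IsGlobADC F Q L n) {M : Submodule (OF F) V} (hfg : M.FG) (hsp : Submodule.span F (M : Set V) = ⊤)
    (hintg : ∀ x ∈ M, Q x ∈ OF F) {z : V} (hz : z ≠ 0) :
    ∃ ρ : V →ₗ[F] V, (∀ x, Q (ρ x) = Q x) ∧ ∀ x ∈ M, P Q z x = 0 → ρ x ∈ L := by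
  have hfd : FiniteDimensional F V := FiniteDimensional.of_finrank_pos (by omega)
  obtain ⟨φ, han⟩ := pos_aniso hF hpos
  let W : Submodule F V := LinearMap.ker (PL Q z)
  have hpz : PL Q z ≠ 0 := fun h => hz (hQ z fun y => LinearMap.congr_fun h y)
  have hW : Module.finrank F W = n := by
    have h1 := LinearMap.finrank_range_add_finrank_ker (PL Q z)
    have h2 : LinearMap.range (PL Q z) = ⊤ := LinearMap.range_eq_top.2 (LinearMap.surjective hpz)
    rw [h2, finrank_top, Module.finrank_self, hrank] at h1
    change Module.finrank F (LinearMap.ker (PL Q z)) = n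
    omega
  let Q' : QuadraticForm F W := Q.comp W.subtype
  have hpos' : PosDef F Q' := fun φ x hx => hpos φ x fun h => hx (Subtype.ext h)
  have hQ' : Nondeg Q' := fun x hx => by
    have h1 : P Q' x x = 0 := hx x
    rw [P_self] at h1
    have h2 : Q (x : V) = 0 := by
      have : Q' x = 0 := by simpa using h1
      exact this
    exact Subtype.ext (han _ h2)
  let N : Submodule (OF F) W := M.comap (W.subtype.restrictScalars (OF F))
  have hNfg : N.FG := by
    have : IsNoetherian (OF F) M := isNoetherian_of_fg_of_noetherian M hfg
    let f : N →ₗ[OF F] M := ((W.subtype.restrictScalars (OF F)).restrict (p := N) (q := M) fun x hx => hx)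
    have hf : Function.Injective f := fun a b h => Subtype.ext (Subtype.ext (congrArg (fun m : M => (m : V)) h))
    have := isNoetherian_of_injective f hf
    exact (Submodule.fg_top N).1 Module.Finite.fg_top
  have hNsp : Submodule.span F (N : Set W) = ⊤ := by
    refine top_le_iff.1 fun x _ => ?_
    obtain ⟨k, h1, h2⟩ := den_V hsp (x : V)
    have h3 : (k : F) • x ∈ N := h2
    have h4 := Submodule.smul_mem _ ((k : F)⁻¹) (Submodule.subset_span (R := F) h3)
    rwa [inv_smul_smul₀ (by exact_mod_cast h1)] at h4
  obtain ⟨t, ht⟩ := hNfg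
  obtain ⟨σ, -, h2, h3⟩ := hA W Q' hQ' hpos' hW (N : Set W) ⟨⟨t, by rw [ospan_eq, ht]⟩, hNsp⟩ (fun x hx => hintg _ hx)
    ⟨W.subtype, W.injective_subtype, fun _ => rfl⟩
  obtain ⟨ρ, h4, h5⟩ := witt han W σ h2
  refine ⟨ρ, h4, fun x hx hzx => ?_⟩
  have := h5 ⟨x, hzx⟩
  rw [show ρ x = σ ⟨x, hzx⟩ from this]
  exact h3 ⟨⟨x, hzx⟩, hx, rfl⟩
end
end QL

/-! ### Helper material, part G2 -/

namespace QL
section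
open NumberField
variable {F : Type} [Field F] [NumberField F] {V : Type} [AddCommGroup V] [Module F V]

theorem step1 (hF : TotallyReal F) {Q : QuadraticForm F V} (hQ : Nondeg Q) (hpos : PosDef F Q) {n : ℕ} (hn : 2 ≤ n)
    (hrank : Module.finrank F V = n + 1) {L : Submodule (OF F) V} (hfg : L.FG) (hsp : Submodule.span F (L : Set V) = ⊤)
    (hintg : ∀ x ∈ L, Q x ∈ OF F) (hA : IsGlobADC F Q (L : Set V) n) : Mx (OF F) Q L := by
  have hfd : FiniteDimensional F V := FiniteDimensional.of_finrank_pos (by omega)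
  obtain ⟨M, hLM, hMfg, hMsp, hM⟩ := exMx hQ hfg hsp hintg
  by_cases hML : M ≤ L
  · rwa [le_antisymm hML hLM] at hM
  exfalso
  obtain ⟨x, hx, hxL⟩ := Set.not_subset.1 hML
  obtain ⟨v, hv⟩ : ∃ v, x ∉ lc v L := by
    by_contra hc
    push Not at hc
    exact hxL (of_lc hc)
  obtain ⟨p, hp, hd⟩ := OL_DV v
  obtain ⟨k, _, _, rs, hr⟩ := OL_Res v hp
  obtain ⟨d, b, hb⟩ := lc_exBM v hMfg hMsp
  obtain ⟨d', b', hb'⟩ := lc_exBM v hfg hsp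
  have h3 : 3 ≤ Fintype.card (Fin d) := by
    have := Module.finrank_eq_card_basis b
    omega
  obtain ⟨z, hz, h⟩ := S1 hQ hd hr hb h3 (lc_Mx v hMfg hM) (lc_mono v hLM) (fun h => hv (h (le_lc v hx))) (hb'.lt hd).full
  obtain ⟨ρ, h1, h2⟩ := ADC' hF hQ hpos hrank hA hMfg hMsp hM.1 hz
  refine h ρ h1 fun y hy hzy => ?_
  obtain ⟨s, s1, s2, s3⟩ := hy
  refine ⟨s, s1, s2, ?_⟩
  rw [← map_smul]
  exact h2 _ s3 (by rw [P_smul_right, hzy, mul_zero])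

theorem step3 {Q : QuadraticForm F V} 
    {L : Submodule (OF F) V} (hfg : L.FG) (hsp : Submodule.span F (L : Set V) = ⊤) [FiniteDimensional F V] (hQ : Nondeg Q)
    (hL : Mx (OF F) Q L)
    (h2 : ∀ M : Submodule (OF F) V, M.FG → Submodule.span F (M : Set V) = ⊤ → Mx (OF F) Q M →
      ∃ ρ : V →ₗ[F] V, (∀ x, Q (ρ x) = Q x) ∧ ∀ x, ρ x ∈ L ↔ x ∈ M) :
    ClassNumberOne F Q (L : Set V) := by
  rintro W _ _ Q' hQ' N ⟨⟨t, rfl⟩, hNsp⟩ ⟨σ, hσ⟩ hv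
  rw [ospan_eq] at *
  obtain ⟨N, hN⟩ : ∃ N, N = Submodule.span (OF F) (t : Set W) := ⟨_, rfl⟩
  have hNfg : N.FG := ⟨t, hN.symm⟩
  simp only [← hN] at *
  have hNM : Mx (OF F) Q' N := by
    refine Mx_of_LS (fun v => lc_exBM v hNfg hNsp) fun v => ?_
    obtain ⟨φ, h3, h4, h5⟩ := hv v
    rw [Lv_eq, Lv_eq] at h5
    obtain ⟨d, b, hb⟩ := lc_exBM v hfg hsp
    have hLS := LS_Mx hb hfg hL
    have hφ : ∀ y, φ y ∈ LS v L ↔ y ∈ LS v N := by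
      intro y
      change φ y ∈ (LS v L : Set _) ↔ _
      rw [← h5]
      exact h3.mem_set_image
    refine ⟨fun x hx => ?_, fun x hx hP => ?_⟩
    · rw [← h4]; exact hLS.1 _ ((hφ x).2 hx)
    · refine (hφ x).1 (hLS.2 _ (by rw [h4]; exact hx) fun m hm => ?_)
      change m ∈ (LS v L : Set _) at hm
      rw [← h5] at hm
      obtain ⟨m', hm', rfl⟩ := hm
      rw [isom_P φ h4]
      exact hP m' hm'
  have hσP : ∀ x y, P Q (σ x) (σ y) = P Q' x y := isom_P (σ : W →ₗ[F] V) hσ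
  let N' : Submodule (OF F) V := N.map ((σ : W →ₗ[F] V).restrictScalars (OF F))
  have hN' : ∀ x, σ x ∈ N' ↔ x ∈ N := fun x => σ.injective.mem_set_image
  obtain ⟨ρ, h3, h4⟩ := h2 N' (hNfg.map _) (by
      refine top_le_iff.1 fun x _ => ?_
      obtain ⟨k, h1, h2⟩ := den_V hNsp (σ.symm x)
      have h3 : (k : F) • x ∈ N' := by
        rw [← hN', map_smul, σ.apply_symm_apply] at h2; exact h2
      have h4 := Submodule.smul_mem _ ((k : F)⁻¹) (Submodule.subset_span (R := F) h3)
      rwa [inv_smul_smul₀ (by exact_mod_cast h1)] at h4) (by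
      refine ⟨?_, fun x hx hP => ?_⟩
      · rintro _ ⟨x, hx, rfl⟩
        change Q (σ x) ∈ _
        rw [hσ]; exact hNM.1 x hx
      · obtain ⟨x, rfl⟩ := σ.surjective x
        rw [hN']
        refine hNM.2 x (by rwa [hσ] at hx) fun m hm => ?_
        rw [← hσP]
        exact hP _ ((hN' m).2 hm))
  have hρ := isom_inj hQ ρ h3
  refine ⟨ρ ∘ₗ (σ : W →ₗ[F] V), hρ.comp σ.injective, fun x => by rw [LinearMap.comp_apply, h3]; exact hσ x, ?_⟩
  ext y
  constructor
  · rintro ⟨x, hx, rfl⟩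
    exact (h4 _).2 ((hN' x).2 hx)
  · intro hy
    obtain ⟨x, rfl⟩ := (LinearMap.injective_iff_surjective.1 hρ) y
    obtain ⟨w, rfl⟩ := σ.surjective x
    exact ⟨w, (hN' w).1 ((h4 _).1 hy), rfl⟩

theorem back {Q : QuadraticForm F V} [FiniteDimensional F V] (hQ : Nondeg Q) {n : ℕ}
    {L : Submodule (OF F) V} (hfg : L.FG) (hsp : Submodule.span F (L : Set V) = ⊤) 
    (hL : Mx (OF F) Q L) (hC : ClassNumberOne F Q (L : Set V)) : IsGlobADC F Q (L : Set V) n := by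
  rintro W _ _ Q' hQ' _ _ N ⟨⟨t, rfl⟩, hNsp⟩ hNint ⟨σ, hσi, hσ⟩
  rw [ospan_eq] at *
  obtain ⟨N, hN⟩ : ∃ N, N = Submodule.span (OF F) (t : Set W) := ⟨_, rfl⟩
  have hNfg : N.FG := ⟨t, hN.symm⟩
  simp only [← hN] at *
  let N1 : Submodule (OF F) V := N.map (σ.restrictScalars (OF F))
  have hN1 : ∀ x ∈ N1, Q x ∈ OF F := by
    rintro _ ⟨x, hx, rfl⟩
    change Q (σ x) ∈ _
    rw [hσ]; exact hNint x hx
  have hN1fg : N1.FG := hNfg.map _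
  obtain ⟨k, hk, hkN⟩ := den_fg hsp hN1fg
  have hk0 : (k : F) ≠ 0 := by exact_mod_cast hk
  let kL : Submodule (OF F) V := L.map (((k : F) • (LinearMap.id : V →ₗ[F] V)).restrictScalars (OF F))
  have hkL : ∀ x ∈ L, (k : F) • x ∈ kL := fun x hx => ⟨x, hx, rfl⟩
  have hintg : ∀ x ∈ N1 ⊔ kL, Q x ∈ OF F := by
    intro x hx
    obtain ⟨a, ha, _, ⟨l, hl, rfl⟩, rfl⟩ := Submodule.mem_sup.1 hx
    change Q (a + (k : F) • l) ∈ _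
    rw [Q_add, P_smul_right, ← P_smul_left, Q_smul]
    exact (OF F).add_mem ((OF F).add_mem (hN1 a ha) ((OF F).mul_mem ((OF F).mul_mem (nat_OF k) (nat_OF k)) (hL.1 l hl)))
      (P_mem hL.1 (hkN a ha) hl)
  obtain ⟨M, h1, h2, h3, h4⟩ := exMx hQ (hN1fg.sup (hfg.map _ : kL.FG)) (by
    refine top_le_iff.1 fun x _ => ?_
    obtain ⟨j, h1, h2⟩ := den_V hsp x
    have h0 : (k : F) • (j : F) • x ∈ ((N1 ⊔ kL : Submodule (OF F) V) : Set V) := Submodule.mem_sup_right (hkL _ h2)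
    have h3 := Submodule.smul_mem _ (((k : F) * (j : F))⁻¹) (Submodule.subset_span (R := F) h0)
    rwa [smul_smul (k : F), inv_smul_smul₀ (mul_ne_zero hk0 (by exact_mod_cast h1))] at h3) hintg
  obtain ⟨s, hs⟩ := id h2
  obtain ⟨τ, h5, h6, h7⟩ := hC V Q hQ (M : Set V) ⟨⟨s, by rw [ospan_eq, hs]⟩, h3⟩ ⟨LinearEquiv.refl F V, fun _ => rfl⟩
    fun v => loc_isom v hQ h2 h3 hfg hsp h4 hL
  refine ⟨τ ∘ₗ σ, h5.comp hσi, fun x => by rw [LinearMap.comp_apply, h6, hσ], ?_⟩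
  rintro _ ⟨x, hx, rfl⟩
  rw [← h7]
  exact ⟨σ x, h1 (Submodule.mem_sup_left ⟨x, hx, rfl⟩), rfl⟩
end
end QL

/-! ### Helper material, part G3 -/

namespace QL
lemma goodV {K : Type} [Field K] {V : Type} [AddCommGroup V] [Module K V] {O : Subring K} {p : K} {Q : QuadraticForm K V}
    (h : DV O p) {M M' : Submodule O V} (hintg : ∀ x ∈ M, Q x ∈ O) (hdual : ∀ x, (∀ m ∈ M, P Q x m ∈ O) → x ∈ M)
    {z : V} (hz : z ∈ M) (hz0 : Q z ≠ 0) (hzp : p * (Q z)⁻¹ ∈ O) (hintg' : ∀ x ∈ M', Q x ∈ O)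
    (hN : ∀ x ∈ M, P Q z x = 0 → x ∈ M') {x : V} (hx : x ∈ M') :
    x ∈ M ∨ ((Q z)⁻¹ ∉ O ∧ x - (P Q x z * (Q z)⁻¹) • z ∈ M) := by
  have hp := h.ne
  obtain ⟨m, hm, hmz⟩ : ∃ m ∈ M, p⁻¹ * P Q m z ∉ O := by
    by_contra hc
    push Not at hc
    have h1 : p⁻¹ • z ∈ M := hdual _ fun m hm => by
      rw [P_smul_left, P_comm]; exact hc m hm
    have h2 := hintg _ h1
    rw [Q_smul] at h2
    have h3 := O.mul_mem h2 hzp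
    rw [show p⁻¹ * p⁻¹ * Q z * (p * (Q z)⁻¹) = p⁻¹ by field_simp] at h3
    exact h.inv h3
  obtain ⟨u1, u0⟩ := h.unit (P_mem hintg hm hz) hmz
  have hm' := smul_memK M u1 hm
  obtain ⟨w, hw⟩ : ∃ w, w = (P Q m z)⁻¹ • m := ⟨_, rfl⟩
  rw [← hw] at hm'
  have hwz : P Q w z = 1 := by rw [hw, P_smul_left, inv_mul_cancel₀ u0]
  obtain ⟨t, ht⟩ : ∃ t, t = P Q x w := ⟨_, rfl⟩
  have h1 : x - t • z ∈ M := hdual _ fun y hy => by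
    have h2 : y - (P Q y z) • w ∈ M' := hN _ (M.sub_mem hy (smul_memK M (P_mem hintg hy hz) hm')) (by
      rw [P_sub_right, P_smul_right, P_comm Q z w, hwz, P_comm Q z y]; ring)
    have h3 := P_mem hintg' hx h2
    rw [P_sub_right, P_smul_right, ← ht] at h3
    rw [P_sub_left, P_smul_left, P_comm Q z y, mul_comm]
    exact h3
  by_cases hto : t ∈ O
  · left
    have := M.add_mem h1 (smul_memK M hto hz)
    rwa [sub_add_cancel] at this
  obtain ⟨t0, t1⟩ := h.nmem hto
  obtain ⟨y, hy⟩ : ∃ y, y = x - t • z := ⟨_, rfl⟩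
  rw [← hy] at h1
  have hxy : x = y + t • z := by rw [hy, sub_add_cancel]
  have hb := P_mem hintg h1 hz
  have h2 : t * (P Q y z + t * Q z) ∈ O := by
    have h3 := O.sub_mem (hintg' x hx) (hintg y h1)
    rw [hxy, Q_add, Q_smul, P_smul_right] at h3
    convert h3 using 1; ring
  have h3 : p⁻¹ * (P Q y z + t * Q z) ∈ O := by
    have := O.mul_mem t1 h2
    rwa [show p⁻¹ * t⁻¹ * (t * (P Q y z + t * Q z)) = p⁻¹ * (P Q y z + t * Q z) by field_simp] at this
  right
  refine ⟨fun hu => hto ?_, ?_⟩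
  · have h4 := O.mul_mem (O.sub_mem (h.of_p h3) hb) hu
    rwa [show (P Q y z + t * Q z - P Q y z) * (Q z)⁻¹ = t by field_simp; ring] at h4
  · have e : x - (P Q x z * (Q z)⁻¹) • z = y - ((p * (Q z)⁻¹) * (p⁻¹ * (P Q y z + t * Q z))) • z := by
      have e1 : P Q x z = P Q y z + t * (2 * Q z) := by rw [hxy, P_add_left, P_smul_left, P_self]
      have e2 : (p * (Q z)⁻¹) * (p⁻¹ * (P Q y z + t * Q z)) = P Q x z * (Q z)⁻¹ - t := by
        rw [e1]; field_simp; ring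
      rw [e2, hxy]; module
    rw [e]
    exact M.sub_mem h1 (smul_memK M (O.mul_mem hzp h3) hz)

section
open NumberField
variable {F : Type} [Field F] [NumberField F] {V : Type} [AddCommGroup V] [Module F V]

/-- prime-type vectors -/
structure PTy (Q : QuadraticForm F V) (M : Submodule (OF F) V) (z : V) (Bad : HeightOneSpectrum (𝓞 F) → Prop) : Prop where
  mem : z ∈ M
  ne : z ≠ 0
  bad : ∀ v, Bad v → ∃ p g, DV (OL v) p ∧ TA (OL v) p Q (lc v M) g ∧ ∀ x, g x = 0 → P Q z x = 0
  good : ∀ v, ¬ Bad v → (∀ x, (∀ m ∈ lc v M, P Q x m ∈ OL v) → x ∈ lc v M) ∧ ∃ p, DV (OL v) p ∧ p * (Q z)⁻¹ ∈ OL v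
  uniq : ∀ v w, ¬ Bad v → ¬ Bad w → (Q z)⁻¹ ∉ OL v → (Q z)⁻¹ ∉ OL w → v = w

lemma lc_perp {v : HeightOneSpectrum (𝓞 F)} {Q : QuadraticForm F V} {M M' : Submodule (OF F) V} {z : V}
    (hN : ∀ x ∈ M, P Q z x = 0 → x ∈ M') : ∀ x ∈ lc v M, P Q z x = 0 → x ∈ lc v M' := by
  rintro x ⟨s, h1, h2, h3⟩ hx
  exact ⟨s, h1, h2, hN _ h3 (by rw [P_smul_right, hx, mul_zero])⟩

lemma PTy.loc {Q : QuadraticForm F V} (han : ∀ x, Q x = 0 → x = 0) {M M' : Submodule (OF F) V} {z : V} {Bad : HeightOneSpectrum (𝓞 F) → Prop}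
    (hz : PTy Q M z Bad) (hfg : M.FG) (hsp : Submodule.span F (M : Set V) = ⊤) (hM : Mx (OF F) Q M) (hfg' : M'.FG)
    (hM' : Mx (OF F) Q M') (hN : ∀ x ∈ M, P Q z x = 0 → x ∈ M') {x : V} (hx : x ∈ M') (v : HeightOneSpectrum (𝓞 F)) :
    x ∈ lc v M ∨ (¬ Bad v ∧ (Q z)⁻¹ ∉ OL v ∧ x - (P Q x z * (Q z)⁻¹) • z ∈ lc v M) := by
  by_cases hv : Bad v
  · left
    obtain ⟨p, g, h1, h2, h3⟩ := hz.bad v hv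
    obtain ⟨d, b, hb⟩ := lc_exBM v hfg hsp
    exact badV h1 (lc_Mx v hfg hM) (lc_Mx v hfg' hM') (hb.lt h1).full h2
      (fun y hy hgy => lc_perp hN y hy (h3 y hgy)) (le_lc v hx)
  · obtain ⟨h1, p, h2, h3⟩ := hz.good v hv
    rcases goodV h2 (lc_int hM.1) h1 (le_lc v hz.mem) (fun h => hz.ne (han _ h)) h3 (lc_int hM'.1) (lc_perp hN) (le_lc v hx) with h | h
    · exact Or.inl h
    · exact Or.inr ⟨hv, h⟩

/-- transport of maximal lattices under an isometry -/
lemma Mx.map {O : Subring F} {Q : QuadraticForm F V} {M : Submodule O V} (h : Mx O Q M) (e : V ≃ₗ[F] V) (he : ∀ x, Q (e x) = Q x)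
    {M' : Submodule O V} (hM' : ∀ x, e x ∈ M ↔ x ∈ M') : Mx O Q M' := by
  refine ⟨fun x hx => ?_, fun x hx hP => ?_⟩
  · rw [← he]; exact h.1 _ ((hM' x).2 hx)
  · rw [← hM']
    refine h.2 _ (by rwa [he]) fun m hm => ?_
    obtain ⟨m, rfl⟩ := e.surjective m
    have := isom_P (e : V →ₗ[F] V) he x m
    have e2 : P Q (e x) (e m) = P Q x m := this
    rw [e2]
    exact hP m ((hM' m).1 hm)

theorem step2 [FiniteDimensional F V] {Q : QuadraticForm F V} (hQ : Nondeg Q) (han : ∀ x, Q x = 0 → x = 0) {L M : Submodule (OF F) V}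
    (hLfg : L.FG) (hL : Mx (OF F) Q L)
    (hfg : M.FG) (hsp : Submodule.span F (M : Set V) = ⊤) (hM : Mx (OF F) Q M) {z : V} {Bad : HeightOneSpectrum (𝓞 F) → Prop}
    (hz : PTy Q M z Bad) (hA : ∃ ρ : V →ₗ[F] V, (∀ x, Q (ρ x) = Q x) ∧ ∀ x ∈ M, P Q z x = 0 → ρ x ∈ L) :
    ∃ ρ : V →ₗ[F] V, (∀ x, Q (ρ x) = Q x) ∧ ∀ x, ρ x ∈ L ↔ x ∈ M := by
  obtain ⟨ρ, h1, h2⟩ := hA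
  -- general construction of preimages
  have pre : ∀ ρ : V →ₗ[F] V, (∀ x, Q (ρ x) = Q x) → ∃ M' : Submodule (OF F) V, M'.FG ∧ Mx (OF F) Q M' ∧ ∀ x, ρ x ∈ L ↔ x ∈ M' := by
    intro ρ h1
    let e : V ≃ₗ[F] V := LinearEquiv.ofInjectiveEndo ρ (isom_inj hQ ρ h1)
    have he : ∀ x, e x = ρ x := fun x => rfl
    have hM' : ∀ x, e x ∈ L ↔ x ∈ L.map ((e.symm : V →ₗ[F] V).restrictScalars (OF F)) := by
      intro x
      constructor
      · intro hx; exact ⟨e x, hx, e.symm_apply_apply x⟩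
      · rintro ⟨y, hy, rfl⟩
        change e (e.symm y) ∈ L
        rwa [e.apply_symm_apply]
    exact ⟨_, hLfg.map _, hL.map e h1 hM', hM'⟩
  obtain ⟨M', h3, h4, h5⟩ := pre ρ h1
  have hN : ∀ x ∈ M, P Q z x = 0 → x ∈ M' := fun x hx hzx => (h5 x).1 (h2 x hx hzx)
  obtain ⟨τ, t1, t2⟩ := refl_ex Q (fun h => hz.ne (han _ h) : Q z ≠ 0)
  by_cases hle : M' ≤ M
  · have := h4.eq_of_le hM.1 hle
    exact ⟨ρ, h1, fun x => by rw [h5, this]⟩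
  obtain ⟨y, hy, hyM⟩ := Set.not_subset.1 hle
  obtain ⟨v, hv⟩ : ∃ v, y ∉ lc v M := by
    by_contra hc
    push Not at hc
    exact hyM (of_lc hc)
  have hQz : Q z ≠ 0 := fun h => hz.ne (han _ h)
  have tt : ∀ x, τ (τ x) = x := by
    intro x
    rw [t1 (τ x), t1 x, P_sub_left, P_smul_left, P_self]
    have : (P Q x z - P Q x z * (Q z)⁻¹ * (2 * Q z)) * (Q z)⁻¹ = - (P Q x z * (Q z)⁻¹) := by field_simp; ring
    rw [this]; module
  obtain ⟨M2, h6, h7, h8⟩ := pre (ρ ∘ₗ τ) (fun x => by rw [LinearMap.comp_apply, h1, t2])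
  have hM2 : ∀ x, x ∈ M2 ↔ τ x ∈ M' := fun x => by rw [← h8, ← h5]; rfl
  have hN2 : ∀ x ∈ M, P Q z x = 0 → x ∈ M2 := fun x hx hzx => by
    rw [hM2, t1, P_comm, hzx, zero_mul, zero_smul, sub_zero]; exact hN x hx hzx
  have A := fun x hx w => hz.loc han hfg hsp hM h3 h4 hN (x := x) hx w
  have B := fun x hx w => hz.loc han hfg hsp hM h6 h7 hN2 (x := x) hx w
  simp only [← t1] at A B
  have hyv := (A y hy v).resolve_left hv
  have key : ∀ x ∈ M', τ x ∈ lc v M := by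
    intro x hx
    rcases A x hx v with h | h
    · have h9 := (A (x + y) (M'.add_mem hx hy) v).resolve_left fun h' => hv (by
        have := (lc v M).sub_mem h' h
        rwa [add_sub_cancel_left] at this)
      have := (lc v M).sub_mem h9.2.2 hyv.2.2
      rwa [map_add, add_sub_cancel_right] at this
    · exact h.2.2
  have hle2 : M2 ≤ M := by
    intro x hx
    refine of_lc fun w => ?_
    rcases B x hx w with h | h
    · exact h
    · have := hz.uniq v w hyv.1 h.1 hyv.2.1 h.2.1
      subst this
      have := key (τ x) ((hM2 x).1 hx)
      rwa [tt] at this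
  have := h7.eq_of_le hM.1 hle2
  exact ⟨ρ ∘ₗ τ, fun x => by rw [LinearMap.comp_apply, h1, t2], fun x => by rw [h8, this]⟩
end
end QL

/-! ### Helper material, part G4 -/

namespace QL
lemma TA.congr {K : Type} [Field K] {V : Type} [AddCommGroup V] [Module K V] {O : Subring K} {p : K} {Q : QuadraticForm K V}
    {M : Submodule O V} {g g' : V →ₗ[K] K} (h : TA O p Q M g)
    (hg : ∀ x ∈ M, g' x ∈ O ∧ (p⁻¹ * g' x ∈ O ↔ p⁻¹ * g x ∈ O)) : TA O p Q M g' where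
  int := fun x hx => (hg x hx).1
  prim := by
    obtain ⟨m, hm, h1⟩ := h.prim
    exact ⟨m, hm, fun h2 => h1 ((hg m hm).2.1 h2)⟩
  ty := fun y hy h1 h2 h3 => h.ty y hy ((hg y hy).2.1 h1) h2 fun w hw hgw => h3 w hw ((hg w hw).2.2 hgw)
  zz := fun y hy h1 h2 => (hg y hy).2.2 (h.zz y hy h1 h2)

section
open NumberField
variable {F : Type} [Field F] [NumberField F] {V : Type} [AddCommGroup V] [Module F V]

lemma badz [FiniteDimensional F V] {Q : QuadraticForm F V} (hQ : Nondeg Q) (hr3 : 3 ≤ Module.finrank F V)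
    {M : Submodule (OF F) V} (hfg : M.FG) (hsp : Submodule.span F (M : Set V) = ⊤) (hM : Mx (OF F) Q M)
    (v : HeightOneSpectrum (𝓞 F)) :
    ∃ p : F, v.valuation F p = WithZero.exp (-1) ∧ DV (OL v) p ∧ ∃ y ∈ M, ∃ k : ℕ, ∀ z : V,
      (p ^ k)⁻¹ • (z - y) ∈ lc v M → ∃ g, TA (OL v) p Q (lc v M) g ∧ ∀ x, g x = 0 → P Q z x = 0 := by
  obtain ⟨p, hp, hd⟩ := OL_DV v
  obtain ⟨kk, _, _, rs, hr⟩ := OL_Res v hp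
  obtain ⟨d, b, hb⟩ := lc_exBM v hfg hsp
  have h3 : 3 ≤ Fintype.card (Fin d) := by
    have := Module.finrank_eq_card_basis b
    omega
  obtain ⟨g, hg⟩ := TAex hd hr hb h3 (lc_Mx v hfg hM)
  obtain ⟨y, hy⟩ := rep_fun hQ g
  obtain ⟨k, s, s1, s2, s3⟩ := (hb.lt hd).full y
  have hp0 := hd.ne
  have hpk : p ^ k ≠ 0 := pow_ne_zero _ hp0
  refine ⟨p, hp, hd, _, s3, k + 1, fun z hz => ⟨(p ^ k)⁻¹ • PL Q z, ?_, fun x hx => ?_⟩⟩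
  · refine hg.congr fun x hx => ?_
    obtain ⟨w, hw⟩ : ∃ w, w = (p ^ (k + 1))⁻¹ • (z - s • p ^ k • y) := ⟨_, rfl⟩
    rw [← hw] at hz
    have hzw : z = s • p ^ k • y + p ^ (k + 1) • w := by
      rw [hw, smul_inv_smul₀ (pow_ne_zero _ hp0), add_sub_cancel]
    have e : ((p ^ k)⁻¹ • PL Q z) x = s * g x + p * P Q w x := by
      rw [LinearMap.smul_apply, PL_apply, hzw, P_add_left, P_smul_left, P_smul_left, P_smul_left, hy, smul_eq_mul]
      field_simp
      ring
    have hwx := P_mem (lc_int hM.1) hz hx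
    rw [e]
    have hso := OF_le_OL v s1
    refine ⟨(OL v).add_mem ((OL v).mul_mem hso (hg.int x hx)) ((OL v).mul_mem hd.mem hwx), ?_⟩
    rw [show p⁻¹ * (s * g x + p * P Q w x) = s * (p⁻¹ * g x) + P Q w x by field_simp]
    rw [add_mem_cancel_right hwx, OL_cancel s2]
  · have : (p ^ k)⁻¹ * P Q z x = 0 := hx
    exact (mul_eq_zero.1 this).resolve_left (inv_ne_zero hpk)

lemma pk_mem {v : HeightOneSpectrum (𝓞 F)} {p : F} (hp : v.valuation F p = WithZero.exp (-1)) (k : ℕ) {r : 𝓞 F}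
    (hr : r ∈ v.asIdeal ^ k) : (p ^ k)⁻¹ * algebraMap (𝓞 F) F r ∈ OL v := by
  have h1 := v.valuation_of_algebraMap (K := F) r
  rw [← v.intValuation_le_pow_iff_mem, ← h1] at hr
  rw [mem_OL, map_mul, map_inv₀, map_pow, hp, ← WithZero.exp_nsmul, inv_mul_le_iff₀ (by simp), mul_one]
  refine hr.trans (le_of_eq ?_)
  congr 1
  simp

lemma nat_prime_in (v : HeightOneSpectrum (𝓞 F)) : ∃ r : ℕ, r.Prime ∧ (r : 𝓞 F) ∈ v.asIdeal ∧ r ∣ Ideal.absNorm v.asIdeal := by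
  have key : ∀ n : ℕ, n ≠ 0 → (n : 𝓞 F) ∈ v.asIdeal → ∃ r : ℕ, r.Prime ∧ (r : 𝓞 F) ∈ v.asIdeal ∧ r ∣ n := by
    intro n
    induction n using Nat.strong_induction_on with
    | _ n ih =>
      intro h0 hn
      by_cases h1 : n = 1
      · subst h1
        rw [Nat.cast_one] at hn
        exact absurd ((Ideal.eq_top_iff_one _).2 hn) v.isPrime.ne_top
      have hp := Nat.minFac_prime h1
      obtain ⟨m, hm⟩ := Nat.minFac_dvd n
      have hn' := hn
      rw [hm, Nat.cast_mul] at hn'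
      rcases v.isPrime.mem_or_mem hn' with h | h
      · exact ⟨_, hp, h, Nat.minFac_dvd n⟩
      · have hm0 : m ≠ 0 := by rintro rfl; exact h0 (by rw [hm, mul_zero])
        have hlt : m < n := by
          have h2 := hp.two_le
          calc m < 2 * m := by omega
            _ ≤ n.minFac * m := Nat.mul_le_mul_right _ h2
            _ = n := hm.symm
        obtain ⟨r, r1, r2, r3⟩ := ih m hlt hm0 h
        exact ⟨r, r1, r2, r3.trans ⟨_, by rw [mul_comm]; exact hm⟩⟩
  exact key _ (fun h => v.ne_bot (Ideal.absNorm_eq_zero_iff.1 h)) (Ideal.absNorm_mem _)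

lemma good_dual {Q : QuadraticForm F V} {M : Submodule (OF F) V} (hfg : M.FG) {m0 : ℕ} (hm0 : ∀ x ∈ dl Q M, (m0 : F) • x ∈ M)
    {v : HeightOneSpectrum (𝓞 F)} (hv : (m0 : 𝓞 F) ∉ v.asIdeal) (x : V) (hx : ∀ m ∈ lc v M, P Q x m ∈ OL v) : x ∈ lc v M := by
  obtain ⟨t, rfl⟩ := hfg
  obtain ⟨s, s1, s2, s3⟩ := lc_den v (fun m => P Q x m) t fun m hm => hx m (le_lc v (Submodule.subset_span hm))
  have h1 : s • x ∈ dl Q (Submodule.span (OF F) (t : Set V)) := fun m hm => by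
    exact span_ind (PL Q (s • x)) (fun m hm => by rw [PL_apply, P_smul_left]; exact s3 m hm) m hm
  have h2 := hm0 _ h1
  rw [smul_smul] at h2
  refine ⟨_, (OF F).mul_mem (nat_OF m0) s1, ?_, h2⟩
  have := (v.valuation_eq_one_iff_notMem (K := F)).2 hv
  rw [map_natCast] at this
  rw [map_mul, s2, this, one_mul]

/-- CRT for vectors -/
lemma crt (s : Finset (HeightOneSpectrum (𝓞 F))) (M : Submodule (OF F) V) (p : HeightOneSpectrum (𝓞 F) → F)
    (hp : ∀ v : HeightOneSpectrum (𝓞 F), v.valuation F (p v) = WithZero.exp (-1)) (y : HeightOneSpectrum (𝓞 F) → V) (hy : ∀ v, y v ∈ M)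
    (k : HeightOneSpectrum (𝓞 F) → ℕ) : ∃ z ∈ M, ∀ v ∈ s, (p v ^ k v)⁻¹ • (z - y v) ∈ lc v M := by
  classical
  have h : ∀ w : HeightOneSpectrum (𝓞 F), ∃ e : 𝓞 F, ∀ v ∈ s, e - (if v = w then 1 else 0) ∈ v.asIdeal ^ k v := by
    intro w
    obtain ⟨e, he⟩ := IsDedekindDomain.exists_forall_sub_mem_ideal (s := s) (fun v => v.asIdeal) k (fun v _ => v.prime)
      (fun v _ w _ hvw h => hvw (HeightOneSpectrum.ext h)) (fun v => if (v : HeightOneSpectrum (𝓞 F)) = w then 1 else 0)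
    exact ⟨e, fun v hv => he v hv⟩
  choose e he using h
  refine ⟨∑ w ∈ s, algebraMap (𝓞 F) F (e w) • y w, M.sum_mem fun w _ => smul_memK M (OF_coe _) (hy w), fun v hv => ?_⟩
  have e1 : ∑ w ∈ s, algebraMap (𝓞 F) F (e w) • y w - y v
      = ∑ w ∈ s, algebraMap (𝓞 F) F (e w - if v = w then 1 else 0) • y w := by
    simp only [map_sub, sub_smul, Finset.sum_sub_distrib]
    congr 1
    rw [Finset.sum_eq_single v]
    · simp
    · intro w _ hw
      rw [if_neg (Ne.symm hw), map_zero, zero_smul]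
    · exact fun h => absurd hv h
  rw [e1, Finset.smul_sum]
  refine (lc v M).sum_mem fun w _ => ?_
  rw [smul_smul]
  exact smul_memK (lc v M) (pk_mem (hp v) _ (he w v hv)) (le_lc v (hy w))
end
end QL

/-! ### Helper material, part G5 -/

namespace QL
section
open NumberField
variable {F : Type} [Field F] [NumberField F] {V : Type} [AddCommGroup V] [Module F V]

theorem prime_type [FiniteDimensional F V] {Q : QuadraticForm F V} (hQ : Nondeg Q) (φ : F →+* ℝ) (hpos : PosDef F Q)
    (hr3 : 3 ≤ Module.finrank F V)
    {M : Submodule (OF F) V} (hfg : M.FG) (hsp : Submodule.span F (M : Set V) = ⊤) (hM : Mx (OF F) Q M) :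
    ∃ z Bad, PTy Q M z Bad := by
  have han : ∀ x, Q x = 0 → x = 0 := fun x hx => by
    by_contra hc
    have := hpos φ x hc
    rw [hx, map_zero] at this
    exact lt_irrefl _ this
  -- the discriminant bound
  have hno := dl_noeth hQ hfg hsp
  obtain ⟨m0, hm00, hm0⟩ := den_fg hsp ((Submodule.fg_top (dl Q M)).1 Module.Finite.fg_top)
  -- a nonzero vector
  have : Nontrivial V := Module.nontrivial_of_finrank_pos (R := F) (by omega)
  obtain ⟨x0, hx0⟩ := exists_ne (0 : V)
  obtain ⟨k0, hk0, hz0⟩ := den_V hsp x0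
  obtain ⟨z0, rfl⟩ : ∃ z0, z0 = (k0 : F) • x0 := ⟨_, rfl⟩
  have hk0' : (k0 : F) ≠ 0 := by exact_mod_cast hk0
  have hz00 : (k0 : F) • x0 ≠ 0 := smul_ne_zero hk0' hx0
  obtain ⟨z0, hzz⟩ : ∃ z0, z0 = (k0 : F) • x0 := ⟨_, rfl⟩
  rw [← hzz] at hz0 hz00
  clear hzz
  obtain ⟨c0, hc0⟩ := mem_OF.1 (hM.1 _ hz0)
  have hc00 : c0 ≠ 0 := fun h => hz00 (han _ (by rw [← hc0, h, map_zero]))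
  have hq0 : Ideal.absNorm (Ideal.span {c0}) ≠ 0 := fun h => hc00 (by simpa using Ideal.absNorm_eq_zero_iff.1 h)
  obtain ⟨m, hm⟩ : ∃ m, m = m0 * Ideal.absNorm (Ideal.span {c0}) := ⟨_, rfl⟩
  have hmne : m ≠ 0 := by rw [hm]; exact mul_ne_zero hm00 hq0
  -- bad places
  have hfin : {v : HeightOneSpectrum (𝓞 F) | v.asIdeal ∣ Ideal.span {(m : 𝓞 F)}}.Finite :=
    Ideal.finite_factors (by
      rw [Ne, Ideal.zero_eq_bot, Ideal.span_singleton_eq_bot]; exact_mod_cast hmne)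
  obtain ⟨s, hs⟩ : ∃ s : Finset (HeightOneSpectrum (𝓞 F)), ∀ v, v ∈ s ↔ (m : 𝓞 F) ∈ v.asIdeal :=
    ⟨hfin.toFinset, fun v => by
      rw [Set.Finite.mem_toFinset]
      change v.asIdeal ∣ _ ↔ _
      rw [Ideal.dvd_iff_le, Ideal.span_singleton_le_iff_mem]⟩
  choose p hp hd y hy k hk using fun v => badz hQ hr3 hfg hsp hM v
  obtain ⟨z1, hz1, hcl⟩ := crt s M p hp y hy k
  obtain ⟨J, hJ⟩ : ∃ J, ∀ v ∈ s, k v ≤ J := ⟨s.sup k, fun v hv => Finset.le_sup hv⟩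
  have hmJ : ∀ v ∈ s, ∀ r : 𝓞 F, ∀ w ∈ M, (p v ^ k v)⁻¹ • (algebraMap (𝓞 F) F ((m : 𝓞 F) ^ J * r) • w) ∈ lc v M := by
    intro v hv r w hw
    rw [smul_smul]
    refine smul_memK (lc v M) (pk_mem (hp v) _ ?_) (le_lc v hw)
    exact Ideal.mul_mem_right _ _ (Ideal.pow_le_pow_right (hJ v hv) (Ideal.pow_mem_pow ((hs v).1 hv) J))
  -- independence
  obtain ⟨z1, hz1, hcl, hind⟩ : ∃ z1 ∈ M, (∀ v ∈ s, (p v ^ k v)⁻¹ • (z1 - y v) ∈ lc v M) ∧ ∀ c : F, z1 ≠ c • z0 := by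
    by_cases hi : ∀ c : F, z1 ≠ c • z0
    · exact ⟨z1, hz1, hcl, hi⟩
    push Not at hi
    obtain ⟨c, hc⟩ := hi
    obtain ⟨w, hw⟩ : ∃ w, w ∉ Submodule.span F {z0} := by
      by_contra hcon
      push Not at hcon
      have h1 := finrank_span_singleton (K := F) hz00
      rw [(Submodule.eq_top_iff'.2 hcon), finrank_top] at h1
      omega
    obtain ⟨j, hj, hjw⟩ := den_V hsp w
    have hj' : (j : F) ≠ 0 := by exact_mod_cast hj
    refine ⟨z1 + algebraMap (𝓞 F) F ((m : 𝓞 F) ^ J * 1) • ((j : F) • w),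
      M.add_mem hz1 (smul_memK M (OF_coe _) hjw), fun v hv => ?_, fun c' hc' => hw ?_⟩
    · rw [add_sub_right_comm, smul_add]
      exact (lc v M).add_mem (hcl v hv) (hmJ v hv 1 _ hjw)
    · have hne : algebraMap (𝓞 F) F ((m : 𝓞 F) ^ J * 1) * (j : F) ≠ 0 := by
        refine mul_ne_zero ?_ hj'
        rw [mul_one, map_pow, map_natCast]
        exact pow_ne_zero _ (by exact_mod_cast hmne)
      rw [hc, smul_smul] at hc'
      have e : w = ((algebraMap (𝓞 F) F ((m : 𝓞 F) ^ J * 1) * (j : F))⁻¹ * (c' - c)) • z0 := by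
        rw [mul_smul, sub_smul, ← hc', add_sub_cancel_left, inv_smul_smul₀ hne]
      rw [e]
      exact Submodule.smul_mem _ _ (Submodule.mem_span_singleton_self _)
  obtain ⟨c1, hc1⟩ := mem_OF.1 (hM.1 _ hz1)
  obtain ⟨c2, hc2⟩ := mem_OF.1 (P_mem hM.1 hz0 hz1)
  have hQ0 : Q z0 ≠ 0 := fun h => hz00 (han _ h)
  have hsq : ∀ x : F, x ^ 2 ≠ algebraMap (𝓞 F) F (c2 ^ 2 - 4 * c0 * c1) := by
    intro x hx
    have hx' : x ^ 2 = P Q z0 z1 ^ 2 - 4 * Q z0 * Q z1 := by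
      rw [hx, map_sub, map_mul, map_mul, map_pow, hc0, hc1, hc2, show algebraMap (𝓞 F) F 4 = 4 from map_ofNat _ 4]
    have hne : (P Q z0 z1) • z0 - (2 * Q z0) • z1 ≠ 0 := by
      intro h
      refine hind ((2 * Q z0)⁻¹ * P Q z0 z1) ?_
      rw [mul_smul, sub_eq_zero.1 h, inv_smul_smul₀ (mul_ne_zero two_ne_zero hQ0)]
    have h1 := hpos φ _ hne
    have e : Q ((P Q z0 z1) • z0 - (2 * Q z0) • z1) = - (Q z0 * x ^ 2) := by
      rw [Q_sub, Q_smul, Q_smul, P_smul_left, P_smul_right, hx']; ring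
    rw [e, map_neg, map_mul, map_pow] at h1
    have h2 := hpos φ _ hz00
    nlinarith [sq_nonneg (φ x), mul_nonneg h2.le (sq_nonneg (φ x))]
  obtain ⟨a, b, ha, hb, l, hl⟩ := PT.binary hc00 hsq m hmne (by rw [hm]; exact Dvd.intro_left _ rfl) J
  obtain ⟨q, hq⟩ : ∃ q, q = c0 * a ^ 2 + c2 * a * b + c1 * b ^ 2 := ⟨_, rfl⟩
  rw [← hq] at hl
  obtain ⟨z, hz⟩ : ∃ z, z = algebraMap (𝓞 F) F a • z0 + algebraMap (𝓞 F) F b • z1 := ⟨_, rfl⟩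
  have hzM : z ∈ M := by
    rw [hz]; exact M.add_mem (smul_memK M (OF_coe _) hz0) (smul_memK M (OF_coe _) hz1)
  have hQz : Q z = algebraMap (𝓞 F) F q := by
    rw [hz, hq, Q_add, Q_smul, Q_smul, P_smul_left, P_smul_right, ← hc0, ← hc1, ← hc2]
    simp only [map_add, map_mul, map_pow]
    ring
  have hq00 : q ≠ 0 := by
    intro h0
    obtain ⟨r, hr1, hr2⟩ := Nat.exists_infinite_primes (m + 1)
    have h1 := hl r hr2 (fun h => by have := Nat.le_of_dvd (Nat.pos_of_ne_zero hmne) h; omega)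
    have h2 : Ideal.absNorm (Ideal.span {q}) = 0 := by rw [h0]; simp
    rw [h2] at h1
    exact (h1 (dvd_zero _)).2 (dvd_zero _)
  have hQz0 : Q z ≠ 0 := by
    rw [hQz]; exact fun h => hq00 ((map_eq_zero_iff _ (FaithfulSMul.algebraMap_injective (𝓞 F) F)).1 h)
  -- valuation at a good place
  have hgood : ∀ v : HeightOneSpectrum (𝓞 F), v ∉ s → q ∈ v.asIdeal →
      l ∣ Ideal.absNorm v.asIdeal ∧ ¬ l ^ 2 ∣ Ideal.absNorm (Ideal.span {q}) := by
    intro v hv hqv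
    obtain ⟨r, r1, r2, r3⟩ := nat_prime_in v
    have h1 : ¬ r ∣ m := by
      rintro ⟨t, ht⟩
      refine hv ((hs v).2 ?_)
      rw [ht, Nat.cast_mul]
      exact Ideal.mul_mem_right _ _ r2
    have h2 := hl r r1 h1 (r3.trans (Ideal.absNorm_dvd_absNorm_of_le ((Ideal.span_singleton_le_iff_mem _).2 hqv)))
    rw [← h2.1]
    exact ⟨r3, h2.2⟩
  have hinv : ∀ v : HeightOneSpectrum (𝓞 F), (Q z)⁻¹ ∉ OL v → q ∈ v.asIdeal := by
    intro v hv
    by_contra hc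
    have h1 := (v.valuation_eq_one_iff_notMem (K := F)).2 hc
    apply hv
    rw [hQz, mem_OL, map_inv₀, h1, inv_one]
  refine ⟨z, fun v => v ∈ s, hzM, fun h => hQz0 (by rw [h, map_zero]), fun v hv => ?_, fun v hv => ⟨?_, p v, hd v, ?_⟩, ?_⟩
  · obtain ⟨a', ha'⟩ := ha
    obtain ⟨b', hb'⟩ := hb
    have e : z - y v = (z1 - y v) + (algebraMap (𝓞 F) F ((m : 𝓞 F) ^ J * a') • z0 + algebraMap (𝓞 F) F ((m : 𝓞 F) ^ J * b') • z1) := by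
      rw [← ha', ← hb', hz, map_sub, map_one]; module
    obtain ⟨g, g1, g2⟩ := hk v z (by
      rw [e, smul_add, smul_add]
      exact (lc v M).add_mem (hcl v hv) ((lc v M).add_mem (hmJ v hv _ _ hz0) (hmJ v hv _ _ hz1)))
    exact ⟨p v, g, hd v, g1, g2⟩
  · refine good_dual hfg hm0 fun h => hv ((hs v).2 ?_)
    rw [hm, Nat.cast_mul]
    exact Ideal.mul_mem_right _ _ h
  · by_cases hi : (Q z)⁻¹ ∈ OL v
    · exact (OL v).mul_mem (hd v).mem hi
    have hqv := hinv v hi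
    obtain ⟨h1, h2⟩ := hgood v hv hqv
    have h3 : q ∉ v.asIdeal ^ 2 := by
      intro h
      refine h2 ((pow_dvd_pow_of_dvd h1 2).trans ?_)
      rw [← map_pow]
      exact Ideal.absNorm_dvd_absNorm_of_le ((Ideal.span_singleton_le_iff_mem _).2 h)
    -- use the uniformizer trichotomy
    by_contra hcon
    obtain ⟨h4, h5⟩ := (hd v).nmem hcon
    apply h3
    have hp0 := (hd v).ne
    rw [← v.intValuation_le_pow_iff_mem, ← v.valuation_of_algebraMap (K := F)]
    change v.valuation F (algebraMap (𝓞 F) F q) ≤ _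
    rw [← hQz]
    have h6 : ((p v) ^ 2)⁻¹ * Q z ∈ OL v := by
      convert h5 using 1
      field_simp
    rw [mem_OL, map_mul, map_inv₀, map_pow, hp v, ← WithZero.exp_nsmul, inv_mul_le_iff₀ (by simp), mul_one] at h6
    refine h6.trans (le_of_eq ?_)
    congr 1
  · intro v w hv hw hiv hiw
    by_contra hvw
    obtain ⟨h1, h2⟩ := hgood v hv (hinv v hiv)
    obtain ⟨h3, -⟩ := hgood w hw (hinv w hiw)
    apply h2
    rw [pow_two]
    refine (mul_dvd_mul h1 h3).trans ?_
    rw [← map_mul]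
    refine Ideal.absNorm_dvd_absNorm_of_le ?_
    have hco : IsCoprime v.asIdeal w.asIdeal := by
      have hv1 := v.isMaximal
      have hw1 := w.isMaximal
      rw [Ideal.isCoprime_iff_sup_eq]
      exact Ideal.IsMaximal.coprime_of_ne hv1 hw1 fun h => hvw (HeightOneSpectrum.ext h)
    rw [← Ideal.inf_eq_mul_of_isCoprime hco, Ideal.span_singleton_le_iff_mem]
    exact ⟨hinv v hiv, hinv w hiw⟩

theorem final (hF : TotallyReal F)
    (Q : QuadraticForm F V) (hQ : Nondeg Q) (hQpos : PosDef F Q)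
    (n : ℕ) (hn : 2 ≤ n) (hrank : Module.finrank F V = n + 1)
    (L : Set V) (hL : IsLatticeOn (OF F) L) (hLint : QLat.IsIntegral (OF F) Q L) :
    IsGlobADC F Q L n ↔ (IsMaximal (OF F) Q L ∧ ClassNumberOne F Q L) := by
  have hfd : FiniteDimensional F V := FiniteDimensional.of_finrank_pos (by omega)
  obtain ⟨φ, han⟩ := pos_aniso hF hQpos
  obtain ⟨⟨t, rfl⟩, hsp⟩ := hL
  rw [ospan_eq] at *
  obtain ⟨L, hL⟩ : ∃ L, L = Submodule.span (OF F) (t : Set V) := ⟨_, rfl⟩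
  have hfg : L.FG := ⟨t, hL.symm⟩
  simp only [← hL] at *
  rw [isMaximal_iff hfg hsp]
  constructor
  · intro hA
    have hLM := step1 hF hQ hQpos hn hrank hfg hsp hLint hA
    refine ⟨hLM, step3 hfg hsp hQ hLM fun M h1 h2 h3 => ?_⟩
    obtain ⟨z, Bad, hz⟩ := prime_type hQ φ hQpos (by omega) h1 h2 h3
    exact step2 hQ han hfg hLM h1 h2 h3 hz (ADC' hF hQ hQpos hrank hA h1 h2 h3.1 hz.ne)
  · rintro ⟨h1, h2⟩
    exact back hQ hfg hsp h1 h2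
end
end QL

/-- Let `F` be a totally real number field, `n ≥ 2` an integer, and `L`
a positive definite integral `O_F`-lattice of rank `n+1`.  Then `L` is globally `n`-ADC
if and only if `L` is `O_F`-maximal and has class number one. -/
theorem globADC_iff_maximal_and_classNumberOne
    (F : Type) [Field F] [NumberField F] (hF : TotallyReal F)
    {V : Type} [AddCommGroup V] [Module F V]
    (Q : QuadraticForm F V) (hQ : Nondeg Q) (hQpos : PosDef F Q)
    (n : ℕ) (hn : 2 ≤ n) (hrank : Module.finrank F V = n + 1)
    (L : Set V) (hL : IsLatticeOn (OF F) L) (hLint : IsIntegral (OF F) Q L) :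
    IsGlobADC F Q L n ↔ (IsMaximal (OF F) Q L ∧ ClassNumberOne F Q L) := by
  exact QL.final hF Q hQ hQpos n hn hrank L hL hLint
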